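/- There exists a constant C > 0 such that, as T → ∞, J_+(T) = (C + o(1)) T^{5/4} and −J_−(T) = (C + o(1)) T^{5/4}. -/

import Mathlib

open MeasureTheory

/-- Euler's constant `C₀ = -Γ′(1)`. -/
noncomputable def C0 : ℝ := -(deriv Real.Gamma 1)

/-- `E(T) = ∫_0^T |ζ(1/2+it)|² dt - T log(T/(2π)) - (2C₀-1)T`. -/
noncomputable def Efun (T : ℝ) : ℝ :=
  (∫ t in (0 : ℝ)..T, ‖riemannZeta (1 / 2 + Complex.I * (t : ℂ))‖ ^ 2) -
    T * Real.log (T / (2 * Real.pi)) - (2 * C0 - 1) * T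

/-- `J₊(T) = ∫_{t ∈ (T,2T], E(t)>π} (E(t)-π) dt`. -/
noncomputable def Jplus (T : ℝ) : ℝ :=
  ∫ t in {t : ℝ | t ∈ Set.Ioc T (2 * T) ∧ Real.pi < Efun t}, (Efun t - Real.pi)

/-- `J₋(T) = ∫_{t ∈ (T,2T], E(t)<π} (E(t)-π) dt`. -/
noncomputable def Jminus (T : ℝ) : ℝ :=
  ∫ t in {t : ℝ | t ∈ Set.Ioc T (2 * T) ∧ Efun t < Real.pi}, (Efun t - Real.pi)

namespace JAsymp

section
open Set Filter Topology

lemma integrableOn_rpow_mul_exp {x c : ℝ} (hx : 0 < x) (hc : 0 < c) :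
    IntegrableOn (fun t : ℝ => t ^ (x - 1) * Real.exp (-(c * t))) (Ioi 0) := by
  have := integrableOn_rpow_mul_exp_neg_mul_rpow (s := x - 1) (p := 1) (by linarith) one_pos hc
  simpa using this

lemma norm_gammaKernel {a r : ℂ} {t : ℝ} (ht : t ∈ Ioi (0 : ℝ)) :
    ‖(t : ℂ) ^ (a - 1) * Complex.exp (-(r * t))‖ =
      t ^ (a.re - 1) * Real.exp (-(r.re * t)) := by
  rw [norm_mul, Complex.norm_cpow_eq_rpow_re_of_pos ht, Complex.norm_exp]
  simp

lemma continuousOn_gammaKernel (a r : ℂ) :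
    ContinuousOn (fun t : ℝ => (t : ℂ) ^ (a - 1) * Complex.exp (-(r * t))) (Ioi 0) := by
  intro t ht
  apply ContinuousAt.continuousWithinAt
  apply ContinuousAt.mul
  · exact Complex.continuousAt_ofReal_cpow_const _ _ (Or.inr (ne_of_gt ht))
  · fun_prop

lemma integrableOn_gammaKernel {a r : ℂ} (ha : 0 < a.re) (hr : 0 < r.re) :
    IntegrableOn (fun t : ℝ => (t : ℂ) ^ (a - 1) * Complex.exp (-(r * t))) (Ioi 0) := by
  refine (integrableOn_rpow_mul_exp ha hr).mono'
    ((continuousOn_gammaKernel a r).aestronglyMeasurable measurableSet_Ioi) ?_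
  filter_upwards [ae_restrict_mem measurableSet_Ioi] with t ht
  exact (norm_gammaKernel ht).le

lemma differentiableOn_gammaIntegral {a : ℂ} (ha : 0 < a.re) :
    DifferentiableOn ℂ
      (fun r : ℂ => ∫ t : ℝ in Ioi 0, (t : ℂ) ^ (a - 1) * Complex.exp (-(r * t)))
      {r : ℂ | 0 < r.re} := by
  intro r hr
  have hr' : 0 < r.re := hr
  apply DifferentiableAt.differentiableWithinAt
  have hs : {z : ℂ | r.re / 2 < z.re} ∈ 𝓝 r :=
    (isOpen_lt continuous_const Complex.continuous_re).mem_nhds (by simp; linarith)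
  refine (hasDerivAt_integral_of_dominated_loc_of_deriv_le
    (F := fun (r : ℂ) (t : ℝ) => (t : ℂ) ^ (a - 1) * Complex.exp (-(r * t)))
    (F' := fun (r : ℂ) (t : ℝ) => (t : ℂ) ^ (a - 1) * (Complex.exp (-(r * t)) * (-t)))
    (bound := fun t => t ^ ((a.re + 1) - 1) * Real.exp (-((r.re / 2) * t)))
    hs ?_ (integrableOn_gammaKernel ha hr') ?_ ?_
    (integrableOn_rpow_mul_exp (by linarith) (by linarith)) ?_).2.differentiableAt
  · exact Eventually.of_forall fun z =>
      (continuousOn_gammaKernel a z).aestronglyMeasurable measurableSet_Ioi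
  · refine ContinuousOn.aestronglyMeasurable ?_ measurableSet_Ioi
    have := (continuousOn_gammaKernel a r).mul
      (f := _) (g := fun t : ℝ => -(t : ℂ)) (by fun_prop)
    refine this.congr fun t _ => ?_
    simp only [Pi.mul_apply]; ring
  · filter_upwards [ae_restrict_mem measurableSet_Ioi] with t ht z hz
    have ht' : (0:ℝ) < t := ht
    have : (t : ℂ) ^ (a - 1) * (Complex.exp (-(z * t)) * (-t)) =
      ((t : ℂ) ^ (a - 1) * Complex.exp (-(z * t))) * (-t) := by ring
    rw [this, norm_mul, norm_gammaKernel ht, norm_neg, Complex.norm_real, Real.norm_eq_abs,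
      abs_of_pos ht']
    have h2 : t ^ ((a.re + 1) - 1) = t ^ (a.re - 1) * t := by
      rw [← Real.rpow_add_one ht'.ne']; ring_nf
    rw [h2]
    have hz' : r.re / 2 < z.re := hz
    have : Real.exp (-(z.re * t)) ≤ Real.exp (-((r.re / 2) * t)) := by
      apply Real.exp_le_exp.mpr; nlinarith
    have h3 : 0 ≤ t ^ (a.re - 1) := by positivity
    calc _ = t ^ (a.re - 1) * t * Real.exp (-(z.re * t)) := by ring
      _ ≤ _ := by gcongr
  · refine Eventually.of_forall fun t z _ => ?_
    refine HasDerivAt.const_mul _ ?_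
    have h1 : HasDerivAt (fun z : ℂ => -(z * t)) (-(t : ℂ)) z := by
      simpa using ((hasDerivAt_id z).mul_const (t : ℂ)).fun_neg
    exact h1.cexp

lemma integral_gammaKernel {a r : ℂ} (ha : 0 < a.re) (hr : 0 < r.re) :
    ∫ t : ℝ in Ioi 0, (t : ℂ) ^ (a - 1) * Complex.exp (-(r * t)) =
      r ^ (-a) * Complex.Gamma a := by
  have hopen : IsOpen {r : ℂ | 0 < r.re} := isOpen_lt continuous_const Complex.continuous_re
  have hA := (differentiableOn_gammaIntegral ha).analyticOnNhd hopen
  have hB : AnalyticOnNhd ℂ (fun r : ℂ => r ^ (-a) * Complex.Gamma a) {r : ℂ | 0 < r.re} := by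
    apply DifferentiableOn.analyticOnNhd _ hopen
    intro z hz
    apply DifferentiableAt.differentiableWithinAt
    exact ((differentiableAt_id).cpow_const (Or.inl hz)).mul_const _
  have hconn : IsPreconnected {r : ℂ | 0 < r.re} :=
    (convex_halfSpace_re_gt 0).isPreconnected
  refine hA.eqOn_of_preconnected_of_frequently_eq hB hconn (z₀ := 1) (by simp) ?_ hr
  have hseq : Tendsto (fun n : ℕ => ((1 + 1 / ((n : ℝ) + 1) : ℝ) : ℂ)) atTop (𝓝[≠] 1) := by
    apply tendsto_nhdsWithin_iff.mpr ⟨?_, ?_⟩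
    · have h1 : Tendsto (fun n : ℕ => (1 + 1 / ((n : ℝ) + 1) : ℝ)) atTop (𝓝 (1 + 0)) :=
        tendsto_const_nhds.add tendsto_one_div_add_atTop_nhds_zero_nat
      have := (Complex.continuous_ofReal.tendsto (1 + 0 : ℝ)).comp h1
      simpa [Function.comp_def] using this
    · refine Eventually.of_forall fun n => ?_
      have : (0:ℝ) < 1 / ((n : ℝ) + 1) := by positivity
      simp only [mem_compl_iff, mem_singleton_iff]
      intro h
      have h' : (1 + 1 / ((n : ℝ) + 1) : ℝ) = 1 := by exact_mod_cast h
      linarith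
  refine hseq.frequently (Eventually.frequently (Eventually.of_forall fun n => ?_))
  have hp : (0:ℝ) < 1 + 1 / ((n : ℝ) + 1) := by positivity
  rw [Complex.integral_cpow_mul_exp_neg_mul_Ioi ha hp, one_div, Complex.inv_cpow, Complex.cpow_neg]
  rw [Complex.arg_ofReal_of_nonneg hp.le]; exact Real.pi_pos.ne

/-- Exponential decay of the Gamma function on vertical lines. -/
lemma norm_Gamma_mul_exp_le {z : ℂ} (hz : 0 < z.re) {φ : ℝ} (h1 : -(Real.pi / 2) < φ)
    (h2 : φ < Real.pi / 2) :
    ‖Complex.Gamma z‖ * Real.exp (φ * z.im) ≤ Real.Gamma z.re * (Real.cos φ) ^ (-z.re) := by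
  set r : ℂ := Complex.exp (φ * Complex.I) with hr
  have hre : r.re = Real.cos φ := by rw [hr, Complex.exp_ofReal_mul_I_re]
  have hc : 0 < Real.cos φ := Real.cos_pos_of_mem_Ioo ⟨h1, h2⟩
  have hmain := integral_gammaKernel hz (r := r) (by rw [hre]; exact hc)
  have hn : ‖r ^ (-z)‖ = Real.exp (φ * z.im) := by
    rw [Complex.norm_cpow_of_ne_zero (Complex.exp_ne_zero _)]
    have ha : r.arg = φ := by
      rw [hr, Complex.arg_exp_mul_I, toIocMod_eq_self]
      constructor <;> linarith [Real.pi_pos]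
    rw [ha, Complex.norm_exp_ofReal_mul_I]
    simp [Real.exp_neg]
  have h3 := norm_integral_le_integral_norm (μ := volume.restrict (Ioi 0))
    (fun t : ℝ => (t : ℂ) ^ (z - 1) * Complex.exp (-(r * t)))
  rw [hmain, norm_mul, hn] at h3
  have h4 : ∫ t in Ioi 0, ‖((t : ℝ) : ℂ) ^ (z - 1) * Complex.exp (-(r * t))‖ =
      ∫ t in Ioi 0, t ^ (z.re - 1) * Real.exp (-(Real.cos φ * t)) := by
    apply setIntegral_congr_fun measurableSet_Ioi
    intro t ht
    simp only
    rw [norm_gammaKernel ht, hre]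
  rw [h4, Real.integral_rpow_mul_exp_neg_mul_Ioi hz hc] at h3
  rw [Real.rpow_neg hc.le, ← Real.inv_rpow hc.le, ← one_div]
  linarith

lemma exists_norm_Gamma_le_strip {θ c : ℝ} (hθ : 0 < θ) (hc0 : 0 ≤ c)
    (hc : c < Real.pi / 2) :
    ∃ C, 0 < C ∧ ∀ z : ℂ, θ ≤ z.re → z.re ≤ 2 →
      ‖Complex.Gamma z‖ ≤ C * Real.exp (-(c * |z.im|)) := by
  have hcos : 0 < Real.cos c := Real.cos_pos_of_mem_Ioo ⟨by linarith [Real.pi_pos], hc⟩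
  have hcont : ContinuousOn (fun x : ℝ => Real.Gamma x * (Real.cos c) ^ (-x)) (Icc θ 2) := by
    intro x hx
    apply ContinuousAt.continuousWithinAt
    apply ContinuousAt.mul
    · apply (Real.differentiableAt_Gamma _).continuousAt
      intro m h
      have : (0:ℝ) ≤ m := by positivity
      linarith [hx.1]
    · exact (Real.continuousAt_const_rpow hcos.ne').comp continuousAt_neg
  obtain ⟨C, hC⟩ := isCompact_Icc.exists_bound_of_continuousOn hcont
  refine ⟨|C| + 1, by positivity, fun z h1 h2 => ?_⟩
  have hz : 0 < z.re := by linarith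
  have hb := hC z.re ⟨h1, h2⟩
  have key : ‖Complex.Gamma z‖ * Real.exp (c * |z.im|) ≤ |C| + 1 := by
    have hb' : Real.Gamma z.re * (Real.cos c) ^ (-z.re) ≤ |C| + 1 := by
      have := le_abs_self (Real.Gamma z.re * (Real.cos c) ^ (-z.re))
      rw [Real.norm_eq_abs] at hb
      linarith [le_abs_self C]
    rcases abs_cases z.im with ⟨h, _⟩ | ⟨h, _⟩
    · rw [h]; exact (norm_Gamma_mul_exp_le hz (by linarith [Real.pi_pos]) hc).trans hb'
    · rw [h]
      have := norm_Gamma_mul_exp_le hz (φ := -c) (by linarith) (by linarith [Real.pi_pos])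
      rw [Real.cos_neg] at this
      have h5 : c * -z.im = -c * z.im := by ring
      rw [h5]; exact this.trans hb'
  rw [Real.exp_neg, ← div_eq_mul_inv, le_div_iff₀ (Real.exp_pos _)]
  exact key

end

section
open Set Filter Topology

lemma integrableOn_fract_cpow {s : ℂ} (hs : 0 < s.re) :
    IntegrableOn (fun t : ℝ => ((Int.fract t : ℝ) : ℂ) * (t : ℂ) ^ (-(s + 1))) (Ioi 1) := by
  have h1 : IntegrableOn (fun t : ℝ => t ^ (-(s.re + 1))) (Ioi 1) :=
    integrableOn_Ioi_rpow_of_lt (by linarith) one_pos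
  refine h1.mono' ?_ ?_
  · refine AEStronglyMeasurable.mul ?_ ?_
    · exact (Complex.measurable_ofReal.comp measurable_fract).aestronglyMeasurable
    · refine ContinuousOn.aestronglyMeasurable ?_ measurableSet_Ioi
      intro t ht
      have ht : (1:ℝ) < t := ht
      exact (Complex.continuousAt_ofReal_cpow_const _ _
        (Or.inr (by linarith))).continuousWithinAt
  · filter_upwards [ae_restrict_mem measurableSet_Ioi] with t ht
    have ht : (1:ℝ) < t := ht
    rw [norm_mul, Complex.norm_cpow_eq_rpow_re_of_pos (by linarith), Complex.norm_real,
      Real.norm_eq_abs, abs_of_nonneg (Int.fract_nonneg _)]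
    have : (-(s + 1)).re = -(s.re + 1) := by simp
    rw [this]
    have h0 : 0 ≤ t ^ (-(s.re + 1)) := by apply Real.rpow_nonneg; linarith
    nlinarith [Int.fract_lt_one t]

lemma zeta_eq_fract {s : ℂ} (hs : 1 < s.re) :
    riemannZeta₁ s =
      s - s * (s - 1) * ∫ t in Ioi (1 : ℝ), ((Int.fract t : ℝ) : ℂ) * (t : ℂ) ^ (-(s + 1)) := by
  have hs1 : s ≠ 1 := by rintro rfl; simp at hs
  have hz := LSeries_eq_mul_integral_of_nonneg (fun _ => (1 : ℝ)) (r := 1) zero_le_one hs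
    (by simp; exact Asymptotics.isBigO_refl _ _) (fun _ => zero_le_one)
  have hL : LSeries (fun _ : ℕ => ((1 : ℝ) : ℂ)) s = riemannZeta s := by
    rw [← LSeries_one_eq_riemannZeta hs]; congr 1
  rw [hL] at hz
  have h2 : ∫ t in Ioi (1 : ℝ), (t : ℂ) * (t : ℂ) ^ (-(s + 1)) = 1 / (s - 1) := by
    have : ∀ t ∈ Ioi (1 : ℝ), (t : ℂ) * (t : ℂ) ^ (-(s + 1)) = (t : ℂ) ^ (-s) := by
      intro t ht
      have ht : (1:ℝ) < t := ht
      have h0 : (t : ℂ) ≠ 0 := by exact_mod_cast (by linarith : t ≠ 0)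
      have : -s = 1 + -(s + 1) := by ring
      rw [this, Complex.cpow_add _ _ h0, Complex.cpow_one]
    rw [setIntegral_congr_fun measurableSet_Ioi this,
      integral_Ioi_cpow_of_lt (by simpa using hs) one_pos]
    have h3 : -s + 1 ≠ 0 := by
      intro h; apply hs1; linear_combination -h
    have h4 : s - 1 ≠ 0 := sub_ne_zero.mpr hs1
    simp only [Complex.ofReal_one, Complex.one_cpow]
    field_simp
    ring
  have h3 : IntegrableOn (fun t : ℝ => (t : ℂ) * (t : ℂ) ^ (-(s + 1))) (Ioi 1) := by
    have : IntegrableOn (fun t : ℝ => (t : ℂ) ^ (-s)) (Ioi 1) :=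
      integrableOn_Ioi_cpow_of_lt (by simpa using hs) one_pos
    refine this.congr_fun (fun t ht => ?_) measurableSet_Ioi
    have ht : (1:ℝ) < t := ht
    have h0 : (t : ℂ) ≠ 0 := by exact_mod_cast (by linarith : t ≠ 0)
    have : -s = 1 + -(s + 1) := by ring
    simp only
    rw [this, Complex.cpow_add _ _ h0, Complex.cpow_one]
  have h5 : ∫ t in Ioi (1 : ℝ), (∑ k ∈ Finset.Icc 1 ⌊t⌋₊, ((1 : ℝ) : ℂ)) * (t : ℂ) ^ (-(s + 1)) =
      (∫ t in Ioi (1 : ℝ), (t : ℂ) * (t : ℂ) ^ (-(s + 1))) -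
      ∫ t in Ioi (1 : ℝ), ((Int.fract t : ℝ) : ℂ) * (t : ℂ) ^ (-(s + 1)) := by
    rw [← integral_sub h3 (integrableOn_fract_cpow (by linarith))]
    refine setIntegral_congr_fun measurableSet_Ioi fun t ht => ?_
    have ht : (1:ℝ) < t := ht
    simp only [Finset.sum_const, Nat.card_Icc, add_tsub_cancel_right, nsmul_eq_mul,
      Complex.ofReal_one, mul_one]
    rw [← sub_mul]
    congr 1
    have : ((⌊t⌋₊ : ℝ)) = t - Int.fract t := by
      rw [Int.self_sub_fract, natCast_floor_eq_intCast_floor (by linarith)]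
    rw [← Complex.ofReal_sub, ← this]; simp
  rw [h5, h2, riemannZeta_eq_inv_sub_mul hs1] at hz
  have h4 : s - 1 ≠ 0 := sub_ne_zero.mpr hs1
  field_simp at hz
  linear_combination hz

lemma differentiableOn_fractIntegral :
    DifferentiableOn ℂ (fun s : ℂ => ∫ t in Ioi (1 : ℝ), ((Int.fract t : ℝ) : ℂ) *
      (t : ℂ) ^ (-(s + 1))) {s | 0 < s.re} := by
  intro s hs
  have hs : 0 < s.re := hs
  set f : ℝ → ℂ := (Ioi (1:ℝ)).indicator fun t => ((Int.fract t : ℝ) : ℂ) with hf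
  have hb : ∀ t, ‖f t‖ ≤ 1 := by
    intro t
    rw [hf]
    by_cases h : t ∈ Ioi (1:ℝ)
    · rw [indicator_of_mem h, Complex.norm_real, Real.norm_eq_abs,
        abs_of_nonneg (Int.fract_nonneg _)]
      exact (Int.fract_lt_one t).le
    · rw [indicator_of_notMem h]; simp
  have hm : Measurable f :=
    (Complex.measurable_ofReal.comp measurable_fract).indicator measurableSet_Ioi
  have hloc : LocallyIntegrableOn f (Ioi 0) := by
    refine LocallyIntegrable.locallyIntegrableOn ?_ _
    refine (locallyIntegrable_const (1:ℝ)).mono hm.aestronglyMeasurable ?_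
    exact Eventually.of_forall fun t => by simpa using hb t
  have hd : DifferentiableAt ℂ (mellin f) (-s) := by
    refine mellin_differentiableAt_of_isBigO_rpow (a := 0) (b := -s.re - 1) hloc ?_ (by simpa) ?_
      (by simp)
    · refine Asymptotics.IsBigO.of_bound 1 (Eventually.of_forall fun t => ?_)
      simpa using hb t
    · refine Asymptotics.IsBigO.of_bound 1 ?_
      have : Iio (1:ℝ) ∈ 𝓝[>] (0:ℝ) := mem_nhdsWithin_of_mem_nhds (Iio_mem_nhds one_pos)
      filter_upwards [this] with t ht
      have ht : t < 1 := ht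
      have : f t = 0 := by rw [hf, indicator_of_notMem]; simp; exact ht.le
      rw [this]; simp
  have heq : (fun s : ℂ => ∫ t in Ioi (1 : ℝ), ((Int.fract t : ℝ) : ℂ) *
      (t : ℂ) ^ (-(s + 1))) = fun s => mellin f (-s) := by
    funext z
    unfold mellin
    have : ∀ t : ℝ, (t : ℂ) ^ (-z - 1) • f t = (Ioi (1:ℝ)).indicator
        (fun t : ℝ => ((Int.fract t : ℝ) : ℂ) * (t : ℂ) ^ (-(z + 1))) t := by
      intro t
      rw [hf]
      by_cases h : t ∈ Ioi (1:ℝ)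
      · rw [indicator_of_mem h, indicator_of_mem h, smul_eq_mul, mul_comm]; congr 2; ring
      · rw [indicator_of_notMem h, indicator_of_notMem h]; simp
    simp_rw [this]
    rw [setIntegral_indicator measurableSet_Ioi]
    congr 2
    ext x; simp
  rw [heq]
  exact (hd.comp s (differentiable_neg s)).differentiableWithinAt

lemma zeta1_eq_fract {s : ℂ} (hs : 0 < s.re) :
    riemannZeta₁ s =
      s - s * (s - 1) * ∫ t in Ioi (1 : ℝ), ((Int.fract t : ℝ) : ℂ) * (t : ℂ) ^ (-(s + 1)) := by
  have hopen : IsOpen {r : ℂ | 0 < r.re} := isOpen_lt continuous_const Complex.continuous_re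
  have hA : AnalyticOnNhd ℂ riemannZeta₁ {r : ℂ | 0 < r.re} :=
    differentiable_riemannZeta₁.differentiableOn.analyticOnNhd hopen
  have hB : AnalyticOnNhd ℂ (fun s : ℂ => s - s * (s - 1) *
      ∫ t in Ioi (1 : ℝ), ((Int.fract t : ℝ) : ℂ) * (t : ℂ) ^ (-(s + 1))) {r : ℂ | 0 < r.re} := by
    apply DifferentiableOn.analyticOnNhd _ hopen
    refine differentiableOn_id.sub (DifferentiableOn.mul ?_ differentiableOn_fractIntegral)
    fun_prop
  have hconn : IsPreconnected {r : ℂ | 0 < r.re} :=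
    (convex_halfSpace_re_gt 0).isPreconnected
  refine hA.eqOn_of_preconnected_of_eventuallyEq hB hconn (z₀ := 2) (by simp) ?_ hs
  have : {z : ℂ | 1 < z.re} ∈ 𝓝 (2:ℂ) :=
    (isOpen_lt continuous_const Complex.continuous_re).mem_nhds (by simp)
  filter_upwards [this] with z hz
  exact zeta_eq_fract hz

lemma norm_zeta1_le {s : ℂ} (hs : 0 < s.re) :
    ‖riemannZeta₁ s‖ ≤ ‖s‖ + ‖s‖ * ‖s - 1‖ / s.re := by
  have hI : ‖∫ t in Ioi (1 : ℝ), ((Int.fract t : ℝ) : ℂ) * (t : ℂ) ^ (-(s + 1))‖ ≤ 1 / s.re := by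
    have h1 : IntegrableOn (fun t : ℝ => t ^ (-(s.re + 1))) (Ioi 1) :=
      integrableOn_Ioi_rpow_of_lt (by linarith) one_pos
    have h2 : ∫ t in Ioi (1:ℝ), t ^ (-(s.re + 1)) = 1 / s.re := by
      rw [integral_Ioi_rpow_of_lt (by linarith) one_pos]
      simp
    rw [← h2]
    refine norm_integral_le_of_norm_le h1 ?_
    filter_upwards [ae_restrict_mem measurableSet_Ioi] with t ht
    have ht : (1:ℝ) < t := ht
    rw [norm_mul, Complex.norm_cpow_eq_rpow_re_of_pos (by linarith), Complex.norm_real,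
      Real.norm_eq_abs, abs_of_nonneg (Int.fract_nonneg _)]
    have : (-(s + 1)).re = -(s.re + 1) := by simp
    rw [this]
    have h0 : 0 ≤ t ^ (-(s.re + 1)) := by apply Real.rpow_nonneg; linarith
    nlinarith [Int.fract_lt_one t]
  rw [zeta1_eq_fract hs]
  refine (norm_sub_le _ _).trans ?_
  rw [norm_mul, norm_mul]
  have : 0 ≤ ‖s‖ * ‖s - 1‖ := by positivity
  have := mul_le_mul_of_nonneg_left hI this
  rw [mul_one_div] at this
  linarith

end

section
open Set Filter Topology

lemma integrable_exp_neg_mul_abs {c : ℝ} (hc : 0 < c) :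
    Integrable fun t : ℝ => Real.exp (-(c * |t|)) := by
  have h1 : IntegrableOn (fun t : ℝ => Real.exp (-(c * |t|))) (Ioi 0) := by
    have h : IntegrableOn (fun t : ℝ => Real.exp (-c * t)) (Ioi 0) := exp_neg_integrableOn_Ioi 0 hc
    refine h.congr_fun (fun t ht => ?_) measurableSet_Ioi
    simp only
    rw [abs_of_pos ht, neg_mul]
  have h2 : IntegrableOn (fun t : ℝ => Real.exp (-(c * |t|))) (Iio 0) := by
    have := (Measure.measurePreserving_neg (volume : Measure ℝ)).integrableOn_comp_preimage
      (Homeomorph.neg ℝ).measurableEmbedding (f := fun t : ℝ => Real.exp (-(c * |t|)))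
      (s := Ioi 0)
    have h3 := this.mpr h1
    simpa [Function.comp_def] using h3
  rw [← integrableOn_univ, ← Iic_union_Ioi (a := (0:ℝ))]
  exact ((integrableOn_Iic_iff_integrableOn_Iio).2 h2).union h1

lemma hasDerivAt_vertical (a y : ℝ) :
    HasDerivAt (fun y : ℝ => (a : ℂ) + y * Complex.I) Complex.I y := by
  simpa using ((Complex.ofRealCLM.hasDerivAt (x := y)).mul_const Complex.I).const_add (a : ℂ)

lemma vertical_ne_zero {a : ℝ} (ha : a ≠ 0) (y : ℝ) : (a : ℂ) + y * Complex.I ≠ 0 := by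
  intro h
  have := congrArg Complex.re h
  simp at this; exact ha this

lemma tendsto_integral_vertical_inv_sq {a : ℝ} (ha : a ≠ 0) :
    Tendsto (fun R : ℝ => ∫ y in (-R)..R, (((a : ℂ) + y * Complex.I) ^ 2)⁻¹) atTop (𝓝 0) := by
  have hd : ∀ y : ℝ, HasDerivAt (fun y : ℝ => Complex.I / ((a : ℂ) + y * Complex.I))
      ((((a : ℂ) + y * Complex.I) ^ 2)⁻¹) y := by
    intro y
    have h0 := vertical_ne_zero ha y
    have := ((hasDerivAt_vertical a y).fun_inv h0).const_mul Complex.I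
    simp only [← div_eq_mul_inv] at this
    refine this.congr_deriv ?_
    rw [← mul_div_assoc, mul_neg, Complex.I_mul_I, neg_neg, one_div]
  have hc : Continuous fun y : ℝ => (((a : ℂ) + y * Complex.I) ^ 2)⁻¹ :=
    Continuous.inv₀ (by fun_prop) fun y => pow_ne_zero 2 (vertical_ne_zero ha y)
  have he : ∀ R : ℝ, ∫ y in (-R)..R, (((a : ℂ) + y * Complex.I) ^ 2)⁻¹ =
      Complex.I / ((a : ℂ) + R * Complex.I) - Complex.I / ((a : ℂ) + ((-R : ℝ) : ℂ) * Complex.I) :=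
    fun R => intervalIntegral.integral_eq_sub_of_hasDerivAt (fun y _ => hd y)
      (hc.intervalIntegrable _ _)
  simp_rw [he]
  have h : ∀ R : ℝ, R ≠ 0 → ‖Complex.I / ((a : ℂ) + R * Complex.I)‖ ≤ |R|⁻¹ := by
    intro R hR
    rw [norm_div, Complex.norm_I, one_div]
    apply inv_anti₀ (abs_pos.mpr hR)
    simpa using Complex.abs_im_le_norm ((a : ℂ) + R * Complex.I)
  have hlim : Tendsto (fun R : ℝ => 2 * |R|⁻¹) atTop (𝓝 0) := by
    simpa using (tendsto_inv_atTop_zero.comp tendsto_abs_atTop_atTop).const_mul (2:ℝ)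
  refine squeeze_zero_norm' ?_ hlim
  filter_upwards [eventually_gt_atTop 0] with R hR
  refine (norm_sub_le _ _).trans ?_
  have h1 := h R hR.ne'
  have h2 := h (-R) (by linarith)
  rw [abs_neg] at h2
  linarith

lemma integral_vertical_inv {a : ℝ} (ha : a ≠ 0) :
    ∀ R : ℝ, ∫ y in (-R)..R, ((a : ℂ) + y * Complex.I)⁻¹ = ((2 * Real.arctan (R / a) : ℝ) : ℂ) := by
  intro R
  have hd : ∀ y : ℝ, HasDerivAt (fun y : ℝ => ((Real.arctan (y / a) : ℝ) : ℂ) -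
      Complex.I * ((Real.log (a ^ 2 + y ^ 2) / 2 : ℝ) : ℂ)) (((a : ℂ) + y * Complex.I)⁻¹) y := by
    intro y
    have hpos : 0 < a ^ 2 + y ^ 2 := by positivity
    have h1 : HasDerivAt (fun y : ℝ => Real.arctan (y / a)) (1 / (1 + (y / a) ^ 2) * (1 / a)) y :=
      ((hasDerivAt_id y).div_const a).arctan
    have h2 : HasDerivAt (fun y : ℝ => Real.log (a ^ 2 + y ^ 2) / 2)
        ((2 * y) / (a ^ 2 + y ^ 2) / 2) y := by
      have : HasDerivAt (fun y : ℝ => a ^ 2 + y ^ 2) (2 * y) y := by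
        simpa using (hasDerivAt_pow 2 y).const_add (a ^ 2)
      exact (this.log hpos.ne').div_const 2
    have h3 := h1.ofReal_comp.sub (h2.ofReal_comp.const_mul Complex.I)
    refine h3.congr_deriv ?_
    have e1 : (1 / (1 + (y / a) ^ 2) * (1 / a)) = a / (a ^ 2 + y ^ 2) := by field_simp
    have e2 : (2 * y) / (a ^ 2 + y ^ 2) / 2 = y / (a ^ 2 + y ^ 2) := by field_simp
    rw [e1, e2]
    have h0 := vertical_ne_zero ha y
    have hp : ((a : ℂ) ^ 2 + (y : ℂ) ^ 2) ≠ 0 := by exact_mod_cast hpos.ne'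
    push_cast
    field_simp
    linear_combination (-(y:ℂ)^2) * Complex.I_sq
  have hc : Continuous fun y : ℝ => ((a : ℂ) + y * Complex.I)⁻¹ :=
    Continuous.inv₀ (by fun_prop) fun y => vertical_ne_zero ha y
  rw [intervalIntegral.integral_eq_sub_of_hasDerivAt (fun y _ => hd y) (hc.intervalIntegrable _ _)]
  rw [neg_div, Real.arctan_neg]
  push_cast
  simp only [neg_sq]
  ring

lemma contour_shift {g : ℂ → ℂ} {θ C c : ℝ} (hθ : 0 < θ) (hθ1 : θ < 1) (hc : 0 < c)
    (hg : DifferentiableOn ℂ g {z | 0 < z.re})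
    (hb : ∀ z : ℂ, θ ≤ z.re → z.re ≤ 2 → ‖g z‖ ≤ C * Real.exp (-(c * |z.im|))) :
    (∫ t : ℝ, g ((2 : ℝ) + t * Complex.I) / ((2 : ℝ) + t * Complex.I - 1) ^ 2) -
      (∫ t : ℝ, g (θ + t * Complex.I) / (θ + t * Complex.I - 1) ^ 2) =
      2 * Real.pi * deriv g 1 := by
  have hopen : IsOpen {z : ℂ | 0 < z.re} := isOpen_lt continuous_const Complex.continuous_re
  have h1mem : {z : ℂ | 0 < z.re} ∈ 𝓝 (1 : ℂ) := hopen.mem_nhds (by simp)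
  set h : ℂ → ℂ := dslope (dslope g 1) 1 with hh
  have hdh : DifferentiableOn ℂ h {z | 0 < z.re} :=
    (Complex.differentiableOn_dslope h1mem).mpr ((Complex.differentiableOn_dslope h1mem).mpr hg)
  have hhe : ∀ z, z ≠ 1 → h z = g z * ((z - 1) ^ 2)⁻¹ - g 1 * ((z - 1) ^ 2)⁻¹
      - deriv g 1 * (z - 1)⁻¹ := by
    intro z hz
    have h0 : z - 1 ≠ 0 := sub_ne_zero.mpr hz
    rw [hh, dslope_of_ne _ hz, slope_def_field, dslope_of_ne _ hz, slope_def_field, dslope_same]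
    field_simp
  have hline : ∀ a : ℝ, a ≠ 1 → ∀ t : ℝ, (a : ℂ) + t * Complex.I - 1 ≠ 0 := by
    intro a ha t
    have := vertical_ne_zero (sub_ne_zero.mpr ha) t
    convert this using 1
    push_cast; ring
  have hgc : ∀ a : ℝ, 0 < a → Continuous fun t : ℝ => g (a + t * Complex.I) := by
    intro a ha
    rw [← continuousOn_univ]
    exact hg.continuousOn.comp (by fun_prop) (fun t _ => by simpa using ha)
  have hhc : ∀ a : ℝ, 0 < a → Continuous fun t : ℝ => h (a + t * Complex.I) := by
    intro a ha
    rw [← continuousOn_univ]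
    exact hdh.continuousOn.comp (by fun_prop) (fun t _ => by simpa using ha)
  have hvi : ∀ a : ℝ, θ ≤ a → a ≤ 2 → a ≠ 1 →
      Integrable fun t : ℝ => g (a + t * Complex.I) * ((a + t * Complex.I - 1) ^ 2)⁻¹ := by
    intro a h1 h2 h3
    have hI : Integrable fun t : ℝ => C * Real.exp (-(c * |t|)) * ((a - 1) ^ 2)⁻¹ :=
      ((integrable_exp_neg_mul_abs hc).const_mul C).mul_const _
    refine hI.mono' ?_ ?_
    · refine ((hgc a (by linarith)).mul (Continuous.inv₀ (by fun_prop) fun t =>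
        pow_ne_zero 2 (hline a h3 t))).aestronglyMeasurable
    · refine Eventually.of_forall fun t => ?_
      rw [norm_mul, norm_inv, norm_pow]
      have hb1 := hb (a + t * Complex.I) (by simpa using h1) (by simpa using h2)
      have e : ((a : ℂ) + t * Complex.I).im = t := by simp
      rw [e] at hb1
      have hb2 : |a - 1| ≤ ‖(a : ℂ) + t * Complex.I - 1‖ := by
        simpa using Complex.abs_re_le_norm ((a : ℂ) + t * Complex.I - 1)
      have hpos : 0 < |a - 1| := abs_pos.mpr (sub_ne_zero.mpr h3)
      have hb3 : (‖(a : ℂ) + t * Complex.I - 1‖ ^ 2)⁻¹ ≤ ((a - 1) ^ 2)⁻¹ := by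
        rw [← sq_abs (a - 1)]
        gcongr
      gcongr
      exact (norm_nonneg _).trans hb1
  have hvert : ∀ a : ℝ, θ ≤ a → a ≤ 2 → a ≠ 1 → Tendsto (fun R : ℝ =>
      (∫ y in (-R)..R, h (a + y * Complex.I)) + deriv g 1 * ((2 * Real.arctan (R / (a - 1)) : ℝ) : ℂ))
      atTop (𝓝 (∫ t : ℝ, g (a + t * Complex.I) * ((a + t * Complex.I - 1) ^ 2)⁻¹)) := by
    intro a h1 h2 h3
    have ha0 : a - 1 ≠ 0 := sub_ne_zero.mpr h3
    have t1 := intervalIntegral_tendsto_integral (hvi a h1 h2 h3) tendsto_neg_atTop_atBot tendsto_id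
    have t2 := (tendsto_integral_vertical_inv_sq ha0).const_mul (g 1)
    have t3 := t1.sub t2
    rw [mul_zero, sub_zero] at t3
    refine t3.congr fun R => ?_
    rw [← integral_vertical_inv ha0 R, ← intervalIntegral.integral_const_mul,
      ← intervalIntegral.integral_const_mul]
    simp only [id]
    have c1 : Continuous fun y : ℝ => (((a - 1 : ℝ) : ℂ) + y * Complex.I)⁻¹ :=
      Continuous.inv₀ (by fun_prop) fun y => vertical_ne_zero ha0 y
    have c2 : Continuous fun y : ℝ => ((((a - 1 : ℝ) : ℂ) + y * Complex.I) ^ 2)⁻¹ :=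
      Continuous.inv₀ (by fun_prop) fun y => pow_ne_zero 2 (vertical_ne_zero ha0 y)
    rw [← intervalIntegral.integral_sub, ← intervalIntegral.integral_add]
    · refine intervalIntegral.integral_congr fun y _ => ?_
      have hz : (a : ℂ) + y * Complex.I ≠ 1 := fun h => hline a h3 y (by rw [h]; ring)
      have e : ((a - 1 : ℝ) : ℂ) + y * Complex.I = (a : ℂ) + y * Complex.I - 1 := by
        push_cast; ring
      simp only [e]
      rw [hhe _ hz]; ring
    · exact (hhc a (by linarith)).intervalIntegrable _ _
    · exact (c1.const_mul _).intervalIntegrable _ _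
    · exact (hvi a h1 h2 h3).intervalIntegrable
    · exact (c2.const_mul _).intervalIntegrable _ _
  have hhor0 : ∀ ε : ℝ, |ε| = 1 → Tendsto (fun R : ℝ => ∫ x in θ..2,
      h (x + (ε * R : ℝ) * Complex.I)) atTop (𝓝 0) := by
    intro ε hε
    set K := |C| + ‖g 1‖ + ‖deriv g 1‖ with hK
    have hlim : Tendsto (fun R : ℝ => K * R⁻¹ * |2 - θ|) atTop (𝓝 0) := by
      simpa using (tendsto_inv_atTop_zero.const_mul K).mul_const |2 - θ|
    refine squeeze_zero_norm' ?_ hlim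
    filter_upwards [eventually_ge_atTop 1] with R hR
    refine intervalIntegral.norm_integral_le_of_norm_le_const fun x hx => ?_
    rw [uIoc_of_le (by linarith)] at hx
    set z : ℂ := x + (ε * R : ℝ) * Complex.I with hz
    have him : z.im = ε * R := by simp [hz]
    have hre : z.re = x := by simp [hz]
    have hzR : R ≤ ‖z - 1‖ := by
      have := Complex.abs_im_le_norm (z - 1)
      rw [Complex.sub_im, Complex.one_im, him, sub_zero, abs_mul, hε, one_mul,
        abs_of_pos (by linarith)] at this
      exact this
    have hz1 : z ≠ 1 := by
      intro h; rw [h, sub_self, norm_zero] at hzR; linarith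
    rw [hhe z hz1]
    have hR0 : 0 < R := by linarith
    have hi1 : ‖z - 1‖⁻¹ ≤ R⁻¹ := inv_anti₀ hR0 hzR
    have hi2 : (‖z - 1‖ ^ 2)⁻¹ ≤ R⁻¹ := by
      apply inv_anti₀ hR0; nlinarith
    have hgz : ‖g z‖ ≤ |C| := by
      refine (hb z (by rw [hre]; exact hx.1.le) (by rw [hre]; exact hx.2)).trans ?_
      have : Real.exp (-(c * |z.im|)) ≤ 1 := by
        apply Real.exp_le_one_iff.mpr; have := abs_nonneg z.im; nlinarith
      calc _ ≤ |C| * Real.exp (-(c * |z.im|)) := by gcongr; exact le_abs_self C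
        _ ≤ |C| * 1 := by gcongr
        _ = _ := mul_one _
    refine (norm_sub_le _ _).trans ((add_le_add_left (norm_sub_le _ _) _).trans ?_)
    simp only [norm_mul, norm_inv, norm_pow]
    have e : K * R⁻¹ = |C| * R⁻¹ + ‖g 1‖ * R⁻¹ + ‖deriv g 1‖ * R⁻¹ := by rw [hK]; ring
    rw [e]
    gcongr
  have hhor : Tendsto (fun R : ℝ => (∫ x in θ..2, h (x + (-R : ℝ) * Complex.I)) -
      ∫ x in θ..2, h (x + R * Complex.I)) atTop (𝓝 0) := by
    have := (hhor0 (-1) (by simp)).sub (hhor0 1 (by simp))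
    simpa using this
  have hcauchy : ∀ R : ℝ, (∫ x in θ..2, h (x + (-R : ℝ) * Complex.I)) -
      (∫ x in θ..2, h (x + R * Complex.I)) + Complex.I * (∫ y in (-R)..R, h ((2:ℝ) + y * Complex.I))
      - Complex.I * (∫ y in (-R)..R, h (θ + y * Complex.I)) = 0 := by
    intro R
    have := Complex.integral_boundary_rect_eq_zero_of_differentiableOn h
      ⟨θ, -R⟩ ⟨2, R⟩ (hdh.mono ?_)
    · simpa using this
    · intro z hz
      have := hz.1
      simp only [mem_preimage, uIcc_of_le (by linarith : θ ≤ 2), mem_Icc] at this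
      show 0 < z.re
      linarith
  have ht2 : Tendsto (fun R : ℝ => ((2 * Real.arctan (R / ((2:ℝ) - 1)) : ℝ) : ℂ)) atTop
      (𝓝 ((2 * (Real.pi / 2) : ℝ) : ℂ)) := by
    refine (Complex.continuous_ofReal.tendsto _).comp (Tendsto.const_mul _ ?_)
    refine (Real.tendsto_arctan_atTop.mono_right nhdsWithin_le_nhds).comp ?_
    exact tendsto_id.atTop_div_const (by norm_num)
  have htθ : Tendsto (fun R : ℝ => ((2 * Real.arctan (R / (θ - 1)) : ℝ) : ℂ)) atTop
      (𝓝 ((2 * (-(Real.pi / 2)) : ℝ) : ℂ)) := by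
    refine (Complex.continuous_ofReal.tendsto _).comp (Tendsto.const_mul _ ?_)
    refine (Real.tendsto_arctan_atBot.mono_right nhdsWithin_le_nhds).comp ?_
    exact tendsto_id.atTop_div_const_of_neg (by linarith)
  have hl := ((((hvert 2 (by linarith) le_rfl (by norm_num)).sub (ht2.const_mul (deriv g 1))).sub
    ((hvert θ le_rfl (by linarith) hθ1.ne).sub (htθ.const_mul (deriv g 1)))).const_mul
    Complex.I).add hhor
  have hl0 := hl.congr (f₂ := fun _ => (0:ℂ)) (fun R => by
    rw [← hcauchy R]; ring)
  have := tendsto_nhds_unique hl0 tendsto_const_nhds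
  simp only [div_eq_mul_inv]
  push_cast at this ⊢
  rw [add_zero] at this
  have h2 := (mul_eq_zero.mp this).resolve_left Complex.I_ne_zero
  linear_combination h2

end

section
open Set Filter Topology

/-- The number of divisors, as a real number. -/
noncomputable def dd (n : ℕ) : ℝ := (n.divisors.card : ℝ)

/-- The divisor generating function `∑ d(n) e^{-2πnw}`. -/
noncomputable def Dser (w : ℂ) : ℂ := ∑' n : ℕ, (dd n : ℂ) * Complex.exp (-(2 * Real.pi * n * w))

/-- The polar part of `Dser`. -/
noncomputable def Mfun (w : ℂ) : ℂ :=
  ((Real.eulerMascheroniConstant : ℂ) - Real.log (2 * Real.pi) - Complex.log w) /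
    (2 * Real.pi * w)

noncomputable def Xi (z : ℂ) : ℂ :=
  Complex.Gamma z * riemannZeta z ^ 2 * ((2 * Real.pi : ℝ) : ℂ) ^ (-z)

lemma dd_nonneg (n : ℕ) : 0 ≤ dd n := by unfold dd; positivity

lemma dd_zero : dd 0 = 0 := by simp [dd]

lemma dd_mul_le (m n : ℕ) : dd (m * n) ≤ dd m * dd n := by
  unfold dd
  rw [Nat.divisors_mul]
  exact_mod_cast Finset.card_mul_le

/-- The divisor function as a complex arithmetic function. -/
noncomputable def dA : ArithmeticFunction ℂ :=
  ((ArithmeticFunction.zeta : ArithmeticFunction ℕ) : ArithmeticFunction ℂ) *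
    ((ArithmeticFunction.zeta : ArithmeticFunction ℕ) : ArithmeticFunction ℂ)

lemma dA_apply (n : ℕ) : dA n = dd n := by
  unfold dA
  rw [ArithmeticFunction.coe_zeta_mul_apply]
  unfold dd
  have : ∀ i ∈ n.divisors, ((ArithmeticFunction.zeta : ArithmeticFunction ℕ) :
      ArithmeticFunction ℂ) i = 1 := by
    intro i hi
    have : i ≠ 0 := (Nat.pos_of_mem_divisors hi).ne'
    simp [this]
  rw [Finset.sum_congr rfl this]
  simp

lemma zeta_summable {s : ℂ} (hs : 1 < s.re) : LSeriesSummable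
    (fun n => ((ArithmeticFunction.zeta : ArithmeticFunction ℕ) : ArithmeticFunction ℂ) n) s := by
  simpa using ArithmeticFunction.LSeriesSummable_zeta_iff.mpr hs

lemma dA_summable {s : ℂ} (hs : 1 < s.re) : LSeriesSummable (fun n => dA n) s :=
  ArithmeticFunction.LSeriesSummable_mul (zeta_summable hs) (zeta_summable hs)

lemma dA_term (s : ℂ) (n : ℕ) :
    LSeries.term (fun n => dA n) s n = (dd n : ℂ) * (n : ℂ) ^ (-s) := by
  rw [LSeries.term_def₀ (by simp), dA_apply]

lemma hasSum_dd_cpow {s : ℂ} (hs : 1 < s.re) :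
    HasSum (fun n : ℕ => (dd n : ℂ) * (n : ℂ) ^ (-s)) (riemannZeta s ^ 2) := by
  have h := ArithmeticFunction.LSeriesHasSum_mul (zeta_summable hs).LSeriesHasSum
    (zeta_summable hs).LSeriesHasSum
  have hz : LSeries (fun n => ((ArithmeticFunction.zeta : ArithmeticFunction ℕ) :
      ArithmeticFunction ℂ) n) s = riemannZeta s := by
    rw [← ArithmeticFunction.LSeries_zeta_eq_riemannZeta hs]; simp
  rw [hz] at h
  unfold LSeriesHasSum at h
  have e : (fun n => LSeries.term (fun n => dA n) s n) =
    fun n : ℕ => (dd n : ℂ) * (n : ℂ) ^ (-s) := funext (dA_term s)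
  rw [← e, sq]; exact h

lemma norm_natCast_cpow_neg {n : ℕ} (hn : n ≠ 0) (x : ℝ) :
    ‖(n : ℂ) ^ (-(x : ℂ))‖ = (n : ℝ) ^ (-x) := by
  rw [Complex.norm_natCast_cpow_of_pos (Nat.pos_of_ne_zero hn)]; simp

lemma summable_dd_rpow {x : ℝ} (hx : 1 < x) : Summable fun n : ℕ => dd n * (n : ℝ) ^ (-x) := by
  have h := (hasSum_dd_cpow (s := x) (by simpa using hx)).summable.norm
  refine h.congr fun n => ?_
  rcases eq_or_ne n 0 with rfl | hn
  · simp [dd_zero]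
  · rw [norm_mul, norm_natCast_cpow_neg hn, Complex.norm_real, Real.norm_of_nonneg (dd_nonneg n)]

lemma dd_sq_le (n : ℕ) : dd n ^ 2 ≤ ‖(dA * dA) n‖ := by
  have h : (dA * dA) n = ((∑ p ∈ n.divisorsAntidiagonal, dd p.1 * dd p.2 : ℝ) : ℂ) := by
    rw [ArithmeticFunction.mul_apply]; push_cast
    simp_rw [dA_apply]
  rw [h, Complex.norm_real, Real.norm_of_nonneg
    (Finset.sum_nonneg fun p _ => mul_nonneg (dd_nonneg _) (dd_nonneg _))]
  have h2 : ∑ p ∈ n.divisorsAntidiagonal, dd n ≤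
      ∑ p ∈ n.divisorsAntidiagonal, dd p.1 * dd p.2 := by
    refine Finset.sum_le_sum fun p hp => ?_
    rw [← (Nat.mem_divisorsAntidiagonal.mp hp).1]
    exact dd_mul_le _ _
  refine le_trans (le_of_eq ?_) h2
  rw [Finset.sum_const, ← Nat.map_div_right_divisors]
  simp [dd, sq]

lemma summable_dd_sq_rpow {x : ℝ} (hx : 1 < x) :
    Summable fun n : ℕ => dd n ^ 2 * (n : ℝ) ^ (-x) := by
  have hs : 1 < (x : ℂ).re := by simpa using hx
  have h : Summable fun n => LSeries.term (fun n => (dA * dA) n) (x : ℂ) n :=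
    ArithmeticFunction.LSeriesSummable_mul (dA_summable hs) (dA_summable hs)
  refine Summable.of_nonneg_of_le (fun n => by positivity) (fun n => ?_) h.norm
  rcases eq_or_ne n 0 with rfl | hn
  · simp [dd_zero]
  rw [LSeries.term_def₀ (by simp), norm_mul, norm_natCast_cpow_neg hn]
  exact mul_le_mul_of_nonneg_right (dd_sq_le n) (by positivity)

lemma dd_le_self (n : ℕ) : dd n ≤ n := by
  unfold dd; exact_mod_cast Nat.card_divisors_le_self n

/-- Mellin inversion for the exponential. -/
lemma exp_eq_vertical_integral {w : ℂ} (hw : 0 < w.re)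
    (hintg : Integrable fun t : ℝ => w ^ (-((2 : ℝ) + t * Complex.I)) *
      Complex.Gamma ((2 : ℝ) + t * Complex.I)) {x : ℝ} (hx : 0 < x) :
    Complex.exp (-(w * x)) = (1 / (2 * Real.pi) : ℝ) • ∫ t : ℝ,
      (x : ℂ) ^ (-((2 : ℝ) + t * Complex.I)) • (w ^ (-((2 : ℝ) + t * Complex.I)) *
      Complex.Gamma ((2 : ℝ) + t * Complex.I)) := by
  have hm : ∀ s : ℂ, 0 < s.re → mellin (fun t : ℝ => Complex.exp (-(w * t))) s =
      w ^ (-s) * Complex.Gamma s := by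
    intro s hs
    rw [← integral_gammaKernel hs hw]; rfl
  have hp : ∀ t : ℝ, mellin (fun t : ℝ => Complex.exp (-(w * t))) ((2 : ℝ) + t * Complex.I) =
      w ^ (-((2 : ℝ) + t * Complex.I)) * Complex.Gamma ((2 : ℝ) + t * Complex.I) :=
    fun t => hm _ (by simp)
  have := mellinInv_mellin_eq 2 (fun t : ℝ => Complex.exp (-(w * t))) hx
    (by exact integrableOn_gammaKernel (by simp) hw)
    (by unfold Complex.VerticalIntegrable; simp_rw [hp]; exact hintg) (by fun_prop)
  rw [← this]
  unfold mellinInv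
  simp_rw [hp]

end

section
open Set Filter Topology

lemma norm_cpow_vertical {w : ℂ} (hw : w ≠ 0) (z : ℂ) :
    ‖w ^ (-z)‖ = ‖w‖ ^ (-z.re) * Real.exp (w.arg * z.im) := by
  rw [Complex.norm_cpow_of_ne_zero hw, div_eq_mul_inv, ← Real.exp_neg]
  simp

lemma continuous_cpow_vertical {w : ℂ} (hw : w ≠ 0) (a : ℝ) :
    Continuous fun t : ℝ => w ^ (-((a : ℂ) + t * Complex.I)) := by
  have : Continuous fun z : ℂ => w ^ z := by
    rw [continuous_iff_continuousAt]; exact fun z => continuousAt_const_cpow hw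
  exact this.comp (by fun_prop)

lemma continuous_Gamma_vertical {a : ℝ} (ha : 0 < a) :
    Continuous fun t : ℝ => Complex.Gamma (a + t * Complex.I) := by
  rw [continuous_iff_continuousAt]
  intro t
  refine ContinuousAt.comp (f := fun t : ℝ => (a : ℂ) + t * Complex.I) ?_ (by fun_prop)
  refine (Complex.differentiableAt_Gamma _ fun m h => ?_).continuousAt
  have := congrArg Complex.re h
  simp at this
  have : (0:ℝ) ≤ m := by positivity
  linarith

lemma exists_zeta1_sq_le {θ δ : ℝ} (hθ : 0 < θ) (hδ : 0 < δ) :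
    ∃ C, 0 < C ∧ ∀ z : ℂ, θ ≤ z.re → z.re ≤ 2 →
      ‖riemannZeta₁ z ^ 2‖ ≤ C * Real.exp (δ * |z.im|) := by
  refine ⟨(1 + 1 / θ) ^ 2 * (24 * (δ⁻¹) ^ 4 * Real.exp (δ * 2)), by positivity,
    fun z h1 h2 => ?_⟩
  have hz : 0 < z.re := by linarith
  set x := |z.im| with hx
  have hx0 : 0 ≤ x := abs_nonneg _
  have n1 : ‖z‖ ≤ 2 + x := by
    refine (Complex.norm_le_abs_re_add_abs_im z).trans ?_
    rw [abs_of_pos hz]; linarith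
  have n2 : ‖z - 1‖ ≤ 2 + x := by
    refine (Complex.norm_le_abs_re_add_abs_im _).trans ?_
    have : |(z - 1).re| ≤ 2 := by
      rw [abs_le]; simp; constructor <;> linarith
    have h3 : (z - 1).im = z.im := by simp
    rw [h3]; linarith
  have n3 : ‖riemannZeta₁ z‖ ≤ (1 + 1 / θ) * (2 + x) ^ 2 := by
    refine (norm_zeta1_le hz).trans ?_
    have e1 : ‖z‖ * ‖z - 1‖ / z.re ≤ (2 + x) * (2 + x) / θ := by gcongr
    have e2 : ‖z‖ ≤ (2 + x) ^ 2 := by nlinarith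
    have e3 : (1 + 1 / θ) * (2 + x) ^ 2 = (2 + x) ^ 2 + (2 + x) * (2 + x) / θ := by ring
    linarith
  have n4 : (2 + x) ^ 4 ≤ 24 * (δ⁻¹) ^ 4 * Real.exp (δ * 2) * Real.exp (δ * x) := by
    have := Real.pow_div_factorial_le_exp (x := δ * (2 + x)) (by positivity) 4
    rw [mul_add, Real.exp_add] at this
    have h24 : ((Nat.factorial 4 : ℕ) : ℝ) = 24 := by norm_num [Nat.factorial]
    rw [h24, div_le_iff₀ (by norm_num)] at this
    have h5 : (2 + x) ^ 4 = (δ⁻¹) ^ 4 * (δ * 2 + δ * x) ^ 4 := by field_simp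
    rw [h5]
    calc _ ≤ (δ⁻¹) ^ 4 * (Real.exp (δ * 2) * Real.exp (δ * x) * 24) := by gcongr
      _ = _ := by ring
  rw [norm_pow]
  calc _ ≤ ((1 + 1 / θ) * (2 + x) ^ 2) ^ 2 := by gcongr
    _ = (1 + 1 / θ) ^ 2 * (2 + x) ^ 4 := by ring
    _ ≤ (1 + 1 / θ) ^ 2 * (24 * (δ⁻¹) ^ 4 * Real.exp (δ * 2) * Real.exp (δ * x)) := by gcongr
    _ = _ := by ring

/-- The regularised kernel `(z-1)² Γ(z) ζ(z)²`. -/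
noncomputable def gker (z : ℂ) : ℂ := riemannZeta₁ z ^ 2 * Complex.Gamma z

lemma exists_gker_le {θ c : ℝ} (hθ : 0 < θ) (hc0 : 0 ≤ c) (hc : c < Real.pi / 2) :
    ∃ C, 0 < C ∧ ∀ z : ℂ, θ ≤ z.re → z.re ≤ 2 → ‖gker z‖ ≤ C * Real.exp (-(c * |z.im|)) := by
  obtain ⟨C1, hC1, h1⟩ := exists_norm_Gamma_le_strip (c := (c + Real.pi / 2) / 2) hθ
    (by linarith [Real.pi_pos]) (by linarith)
  obtain ⟨C2, hC2, h2⟩ := exists_zeta1_sq_le (δ := (Real.pi / 2 - c) / 2) hθ (by linarith)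
  refine ⟨C2 * C1, by positivity, fun z hz1 hz2 => ?_⟩
  unfold gker
  rw [norm_mul]
  calc _ ≤ (C2 * Real.exp ((Real.pi / 2 - c) / 2 * |z.im|)) *
        (C1 * Real.exp (-((c + Real.pi / 2) / 2 * |z.im|))) := by
        gcongr
        · exact h2 z hz1 hz2
        · exact h1 z hz1 hz2
    _ = C2 * C1 * (Real.exp ((Real.pi / 2 - c) / 2 * |z.im|) *
        Real.exp (-((c + Real.pi / 2) / 2 * |z.im|))) := by ring
    _ = _ := by rw [← Real.exp_add]; congr 2; ring

lemma differentiableOn_gker : DifferentiableOn ℂ gker {z | 0 < z.re} := by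
  intro z hz
  apply DifferentiableAt.differentiableWithinAt
  refine ((differentiable_riemannZeta₁ z).pow 2).mul (Complex.differentiableAt_Gamma _ fun m h => ?_)
  have hz : 0 < z.re := hz
  rw [h] at hz
  simp at hz
  have : (0:ℝ) ≤ m := by positivity
  linarith

lemma gker_eq {z : ℂ} (hz : z ≠ 1) :
    gker z / (z - 1) ^ 2 = Complex.Gamma z * riemannZeta z ^ 2 := by
  rw [gker, riemannZeta_eq_inv_sub_mul hz]
  have := sub_ne_zero.mpr hz
  field_simp

lemma abs_arg_lt {w : ℂ} (hw : 0 < w.re) : |w.arg| < Real.pi / 2 :=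
  Complex.abs_arg_lt_pi_div_two_iff.mpr (Or.inl hw)

lemma ne_zero_of_re_pos {w : ℂ} (hw : 0 < w.re) : w ≠ 0 := by rintro rfl; simp at hw

lemma integrable_Gamma_cpow {w : ℂ} (hw : 0 < w.re) :
    Integrable fun t : ℝ => w ^ (-((2 : ℝ) + t * Complex.I)) *
      Complex.Gamma ((2 : ℝ) + t * Complex.I) := by
  have ha := abs_arg_lt hw
  have hw0 := ne_zero_of_re_pos hw
  set c := (|w.arg| + Real.pi / 2) / 2 with hc
  obtain ⟨C, hC, h⟩ := exists_norm_Gamma_le_strip (θ := 2) (c := c) two_pos (by positivity)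
    (by linarith)
  have hi := (integrable_exp_neg_mul_abs (c := c - |w.arg|) (by linarith)).const_mul
    (‖w‖ ^ (-2:ℝ) * C)
  refine hi.mono' ((continuous_cpow_vertical hw0 2).mul
    (continuous_Gamma_vertical two_pos)).aestronglyMeasurable (Eventually.of_forall fun t => ?_)
  rw [norm_mul, norm_cpow_vertical hw0]
  have hG := h ((2:ℝ) + t * Complex.I) (by simp) (by simp)
  have him : (((2:ℝ):ℂ) + t * Complex.I).im = t := by simp
  have hre : (((2:ℝ):ℂ) + t * Complex.I).re = 2 := by simp
  rw [him] at hG ⊢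
  rw [hre]
  have hle : w.arg * t ≤ |w.arg| * |t| := by rw [← abs_mul]; exact le_abs_self _
  calc _ ≤ ‖w‖ ^ (-2:ℝ) * Real.exp (|w.arg| * |t|) * (C * Real.exp (-(c * |t|))) := by gcongr
    _ = ‖w‖ ^ (-2:ℝ) * C * (Real.exp (|w.arg| * |t|) * Real.exp (-(c * |t|))) := by ring
    _ = _ := by rw [← Real.exp_add]; congr 2; ring

lemma Dser_eq_integral_two {w : ℂ} (hw : 0 < w.re) :
    Dser w = (1 / (2 * Real.pi) : ℝ) • ∫ t : ℝ, Xi ((2 : ℝ) + t * Complex.I) *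
      w ^ (-((2 : ℝ) + t * Complex.I)) := by
  have hG := integrable_Gamma_cpow hw
  set G : ℝ → ℂ := fun t => w ^ (-((2 : ℝ) + t * Complex.I)) *
      Complex.Gamma ((2 : ℝ) + t * Complex.I) with hGdef
  set F : ℕ → ℝ → ℂ := fun n t => ((dd n : ℂ) * (n : ℂ) ^ (-((2 : ℝ) + t * Complex.I))) *
    (((2 * Real.pi : ℝ) : ℂ) ^ (-((2 : ℝ) + t * Complex.I)) * G t) with hF
  have h2pi : (0:ℝ) < 2 * Real.pi := by positivity
  have hn : ∀ n : ℕ, ∀ t : ℝ, ‖F n t‖ = dd n * (n:ℝ) ^ (-2:ℝ) * (2 * Real.pi) ^ (-2:ℝ) * ‖G t‖ := by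
    intro n t
    rcases eq_or_ne n 0 with rfl | hn
    · simp [hF, dd_zero]
    · simp only [hF, norm_mul]
      rw [Complex.norm_natCast_cpow_of_pos (Nat.pos_of_ne_zero hn),
        Complex.norm_cpow_eq_rpow_re_of_pos h2pi, Complex.norm_real,
        Real.norm_of_nonneg (dd_nonneg n)]
      simp
      ring
  have hFi : ∀ n, Integrable (F n) := by
    intro n
    rcases eq_or_ne n 0 with rfl | hn0
    · simp [hF, dd_zero]
    refine (hG.norm.const_mul (dd n * (n:ℝ) ^ (-2:ℝ) * (2 * Real.pi) ^ (-2:ℝ))).mono' ?_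
      (Eventually.of_forall fun t => (hn n t).le)
    refine AEStronglyMeasurable.mul ?_ (AEStronglyMeasurable.mul ?_ hG.aestronglyMeasurable)
    · exact (continuous_const.mul
        (continuous_cpow_vertical (Nat.cast_ne_zero.mpr hn0) 2)).aestronglyMeasurable
    · exact (continuous_cpow_vertical (by exact_mod_cast h2pi.ne') 2).aestronglyMeasurable
  have hsum : Summable fun n => ∫ t, ‖F n t‖ := by
    simp_rw [hn, integral_const_mul]
    exact ((summable_dd_rpow (x := 2) one_lt_two).mul_right _).mul_right _
  have hmain := hasSum_integral_of_summable_integral_norm hFi hsum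
  have hterm : ∀ n : ℕ, (dd n : ℂ) * Complex.exp (-(2 * Real.pi * n * w)) =
      (1 / (2 * Real.pi) : ℝ) • ∫ t, F n t := by
    intro n
    rcases eq_or_ne n 0 with rfl | hn0
    · simp [hF, dd_zero]
    have hx : (0:ℝ) < 2 * Real.pi * n := by
      have : (0:ℝ) < n := by exact_mod_cast Nat.pos_of_ne_zero hn0
      positivity
    have := exp_eq_vertical_integral hw hG hx
    have e : -(w * ((2 * Real.pi * n : ℝ) : ℂ)) = -(2 * Real.pi * n * w) := by push_cast; ring
    rw [e] at this
    rw [this, mul_smul_comm, ← integral_const_mul]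
    congr 2
    funext t
    simp only [hF, smul_eq_mul]
    have e2 : ((2 * Real.pi * n : ℝ) : ℂ) = ((n : ℝ) : ℂ) * ((2 * Real.pi : ℝ) : ℂ) := by
      push_cast; ring
    rw [e2, Complex.mul_cpow_ofReal_nonneg (by positivity) h2pi.le]
    simp only [Complex.ofReal_natCast, hGdef]
    ring
  unfold Dser
  simp_rw [hterm]
  rw [tsum_const_smul'', hmain.tsum_eq]
  congr 2
  funext t
  have h1 := (hasSum_dd_cpow (s := (2 : ℝ) + t * Complex.I) (by simp)).mul_right
    (((2 * Real.pi : ℝ) : ℂ) ^ (-((2 : ℝ) + t * Complex.I)) * G t)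
  rw [h1.tsum_eq, hGdef, Xi]
  ring

lemma Dser_sub_Mfun {w : ℂ} (hw : 0 < w.re) {θ : ℝ} (hθ : 0 < θ) (hθ1 : θ < 1) :
    Dser w - Mfun w = (1 / (2 * Real.pi) : ℝ) • ∫ t : ℝ, Xi (θ + t * Complex.I) *
      w ^ (-(θ + t * Complex.I)) := by
  have hw0 := ne_zero_of_re_pos hw
  have ha := abs_arg_lt hw
  set c := (|w.arg| + Real.pi / 2) / 2 with hc
  have h2pi : (0:ℝ) < 2 * Real.pi := by positivity
  have h2piC : ((2 * Real.pi : ℝ) : ℂ) ≠ 0 := by exact_mod_cast h2pi.ne'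
  obtain ⟨C, hC, hCb⟩ := exists_gker_le (θ := θ) (c := c) hθ (by positivity) (by linarith)
  set g : ℂ → ℂ := fun z => gker z * (((2 * Real.pi : ℝ) : ℂ) ^ (-z) * w ^ (-z)) with hg
  have hdiff : DifferentiableOn ℂ g {z | 0 < z.re} := by
    refine differentiableOn_gker.mul (DifferentiableOn.mul ?_ ?_)
    · exact (differentiable_neg.differentiableOn).const_cpow (Or.inl h2piC)
    · exact (differentiable_neg.differentiableOn).const_cpow (Or.inl hw0)
  obtain ⟨B, hB⟩ : ∃ B, ∀ x ∈ Icc θ 2, ‖(2 * Real.pi) ^ (-x) * ‖w‖ ^ (-x)‖ ≤ B := by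
    refine isCompact_Icc.exists_bound_of_continuousOn (Continuous.continuousOn ?_)
    refine Continuous.mul ?_ ?_
    · exact (Real.continuous_const_rpow h2pi.ne').comp continuous_neg
    · exact (Real.continuous_const_rpow (norm_ne_zero_iff.mpr hw0)).comp continuous_neg
  have hbound : ∀ z : ℂ, θ ≤ z.re → z.re ≤ 2 →
      ‖g z‖ ≤ C * B * Real.exp (-((c - |w.arg|) * |z.im|)) := by
    intro z h1 h2
    have hb := hB z.re ⟨h1, h2⟩
    rw [Real.norm_of_nonneg (by positivity)] at hb
    have hle : w.arg * z.im ≤ |w.arg| * |z.im| := by rw [← abs_mul]; exact le_abs_self _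
    simp only [hg, norm_mul]
    rw [norm_cpow_vertical hw0, Complex.norm_cpow_eq_rpow_re_of_pos h2pi, Complex.neg_re]
    calc _ ≤ (C * Real.exp (-(c * |z.im|))) * ((2 * Real.pi) ^ (-z.re) * (‖w‖ ^ (-z.re) *
          Real.exp (|w.arg| * |z.im|))) := by
          gcongr
          exact hCb z h1 h2
      _ = C * ((2 * Real.pi) ^ (-z.re) * ‖w‖ ^ (-z.re)) *
          (Real.exp (-(c * |z.im|)) * Real.exp (|w.arg| * |z.im|)) := by ring
      _ ≤ C * B * (Real.exp (-(c * |z.im|)) * Real.exp (|w.arg| * |z.im|)) := by gcongr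
      _ = _ := by rw [← Real.exp_add]; congr 2; ring
  have hshift := contour_shift hθ hθ1 (by linarith : 0 < c - |w.arg|) hdiff hbound
  have hge : ∀ z : ℂ, z ≠ 1 → g z / (z - 1) ^ 2 = Xi z * w ^ (-z) := by
    intro z hz
    rw [Xi, ← gker_eq hz, hg]; ring
  have hne : ∀ a : ℝ, a ≠ 1 → ∀ t : ℝ, (a : ℂ) + t * Complex.I ≠ 1 := by
    intro a ha t h
    have := congrArg Complex.re h
    simp at this; exact ha this
  have e1 : (∫ t : ℝ, g ((2 : ℝ) + t * Complex.I) / ((2 : ℝ) + t * Complex.I - 1) ^ 2) =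
      ∫ t : ℝ, Xi ((2 : ℝ) + t * Complex.I) * w ^ (-((2 : ℝ) + t * Complex.I)) :=
    integral_congr_ae (Eventually.of_forall fun t => hge _ (hne 2 (by norm_num) t))
  have e2 : (∫ t : ℝ, g (θ + t * Complex.I) / (θ + t * Complex.I - 1) ^ 2) =
      ∫ t : ℝ, Xi (θ + t * Complex.I) * w ^ (-(θ + t * Complex.I)) :=
    integral_congr_ae (Eventually.of_forall fun t => hge _ (hne θ hθ1.ne t))
  have hderiv : deriv g 1 = Mfun w := by
    have hz1 : HasDerivAt riemannZeta₁ (Real.eulerMascheroniConstant : ℂ) 1 := by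
      rw [← deriv_riemannZeta₁_one]; exact (differentiable_riemannZeta₁ 1).hasDerivAt
    have d1 := ((hz1.fun_pow 2).mul Complex.hasDerivAt_Gamma_one)
    have d2 := ((hasDerivAt_neg (1:ℂ)).const_cpow (c := ((2 * Real.pi : ℝ) : ℂ)) (Or.inl h2piC))
    have d3 := ((hasDerivAt_neg (1:ℂ)).const_cpow (c := w) (Or.inl hw0))
    have d4 := (d1.mul (d2.mul d3)).deriv
    have : deriv g 1 = _ := d4
    rw [this]
    simp only [Pi.mul_apply, riemannZeta₁_one, Complex.Gamma_one, Complex.cpow_neg_one]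
    rw [← Complex.ofReal_log h2pi.le]
    unfold Mfun
    push_cast at h2piC ⊢
    have hp : (Real.pi : ℂ) ≠ 0 := by exact_mod_cast Real.pi_pos.ne'
    field_simp
    ring
  rw [e1, e2, hderiv] at hshift
  rw [Dser_eq_integral_two hw, sub_eq_iff_eq_add, ← sub_eq_iff_eq_add', ← smul_sub, hshift]
  rw [Complex.real_smul]
  push_cast
  have hp : (Real.pi : ℂ) ≠ 0 := by exact_mod_cast Real.pi_pos.ne'
  field_simp

/-- Exponential decay of `Ξ` on vertical lines in the critical strip. -/
lemma exists_Xi_le {θ c : ℝ} (hθ : 0 < θ) (hθ1 : θ < 1) (hc0 : 0 ≤ c) (hc : c < Real.pi / 2) :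
    ∃ C, 0 < C ∧ ∀ t : ℝ, ‖Xi (θ + t * Complex.I)‖ ≤ C * Real.exp (-(c * |t|)) := by
  obtain ⟨C, hC, h⟩ := exists_gker_le hθ hc0 hc
  have h1 : 0 < (1 - θ) ^ 2 := by have := sub_pos.mpr hθ1; positivity
  refine ⟨C * ((1 - θ) ^ 2)⁻¹ * (2 * Real.pi) ^ (-θ), by positivity, fun t => ?_⟩
  have hne : (θ : ℂ) + t * Complex.I ≠ 1 := by
    intro h
    have := congrArg Complex.re h
    simp at this; linarith
  have hb := h (θ + t * Complex.I) (by simp) (by simp; linarith)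
  have him : ((θ : ℂ) + t * Complex.I).im = t := by simp
  rw [him] at hb
  rw [Xi, ← gker_eq hne, norm_mul, norm_div, norm_pow,
    Complex.norm_cpow_eq_rpow_re_of_pos (by positivity)]
  have hre : (-((θ : ℂ) + t * Complex.I)).re = -θ := by simp
  rw [hre, div_eq_mul_inv]
  have hb2 : 1 - θ ≤ ‖(θ : ℂ) + t * Complex.I - 1‖ := by
    have := Complex.abs_re_le_norm ((θ : ℂ) + t * Complex.I - 1)
    simp at this
    rw [abs_of_neg (by linarith)] at this; linarith
  have : (‖(θ : ℂ) + t * Complex.I - 1‖ ^ 2)⁻¹ ≤ ((1 - θ) ^ 2)⁻¹ := by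
    have := sub_pos.mpr hθ1
    gcongr
  calc _ ≤ C * Real.exp (-(c * |t|)) * ((1 - θ) ^ 2)⁻¹ * (2 * Real.pi) ^ (-θ) := by gcongr
    _ = _ := by ring

lemma continuous_Xi_vertical {θ : ℝ} (hθ : 0 < θ) (hθ1 : θ < 1) :
    Continuous fun t : ℝ => Xi (θ + t * Complex.I) := by
  have hne : ∀ t : ℝ, (θ : ℂ) + t * Complex.I ≠ 1 := by
    intro t h
    have := congrArg Complex.re h
    simp at this; linarith
  unfold Xi
  refine ((continuous_Gamma_vertical hθ).mul (Continuous.pow ?_ 2)).mul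
    (continuous_cpow_vertical ?_ θ)
  · rw [continuous_iff_continuousAt]
    intro t
    exact ContinuousAt.comp (f := fun t : ℝ => (θ : ℂ) + t * Complex.I)
      (differentiableAt_riemannZeta (hne t)).continuousAt (by fun_prop)
  · exact_mod_cast (by positivity : (2 * Real.pi) ≠ 0)

end

section
open Set Filter Topology

/-- `|ζ(1/2+it)|²`. -/
noncomputable def Zsq (t : ℝ) : ℝ := ‖riemannZeta (1 / 2 + Complex.I * (t : ℂ))‖ ^ 2

lemma Zsq_nonneg (t : ℝ) : 0 ≤ Zsq t := by unfold Zsq; positivity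

lemma half_line (t : ℝ) : ((1 / 2 : ℝ) : ℂ) + t * Complex.I = 1 / 2 + Complex.I * (t : ℂ) := by
  push_cast; ring

lemma half_line_ne_one (t : ℝ) : (1 / 2 + Complex.I * (t : ℂ)) ≠ 1 := by
  intro h
  have := congrArg Complex.re h
  norm_num at this

lemma continuous_Zsq : Continuous Zsq := by
  unfold Zsq
  refine (Continuous.norm ?_).pow 2
  rw [continuous_iff_continuousAt]
  intro t
  exact ContinuousAt.comp (f := fun t : ℝ => 1 / 2 + Complex.I * (t : ℂ))
      (differentiableAt_riemannZeta (half_line_ne_one t)).continuousAt (by fun_prop)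

lemma exists_Zsq_le {δ : ℝ} (hδ : 0 < δ) : ∃ C, 0 < C ∧ ∀ t, Zsq t ≤ C * Real.exp (δ * |t|) := by
  obtain ⟨C, hC, h⟩ := exists_zeta1_sq_le (θ := 1 / 2) (by norm_num) hδ
  refine ⟨C * 4, by positivity, fun t => ?_⟩
  have hb := h (1 / 2 + Complex.I * (t : ℂ)) (by simp) (by norm_num)
  have him : (1 / 2 + Complex.I * (t : ℂ)).im = t := by simp
  rw [him] at hb
  unfold Zsq
  rw [riemannZeta_eq_inv_sub_mul (half_line_ne_one t), norm_mul, mul_pow, ← norm_pow _ 2, ← norm_pow _ 2]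
  have h4 : ‖((1 / 2 + Complex.I * (t : ℂ)) - 1)⁻¹ ^ 2‖ ≤ 4 := by
    rw [norm_pow, norm_inv]
    have h5 : 1 / 2 ≤ ‖(1 / 2 + Complex.I * (t : ℂ)) - 1‖ := by
      have := Complex.abs_re_le_norm ((1 / 2 + Complex.I * (t : ℂ)) - 1)
      norm_num at this ⊢
      linarith
    have h6 : ‖(1 / 2 + Complex.I * (t : ℂ)) - 1‖⁻¹ ≤ 2 := by
      rw [inv_le_comm₀ (by linarith) (by norm_num)]; linarith
    nlinarith [inv_nonneg.mpr (norm_nonneg ((1 / 2 + Complex.I * (t : ℂ)) - 1))]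
  calc _ ≤ 4 * (C * Real.exp (δ * |t|)) := by gcongr
    _ = _ := by ring

lemma Xi_mul_cos {z : ℂ} (hz : 0 < z.re) (hz1 : z ≠ 1) :
    Xi z * (2 * Complex.cos (Real.pi * z / 2)) = riemannZeta z * riemannZeta (1 - z) := by
  rw [riemannZeta_one_sub (fun n h => ?_) hz1, Xi]
  · push_cast; ring
  · rw [h] at hz
    simp at hz
    have : (0:ℝ) ≤ n := by positivity
    linarith

lemma Xi_half_mul_cos (t : ℝ) : Xi ((1 / 2 : ℝ) + t * Complex.I) *
    (2 * Complex.cos (Real.pi * ((1 / 2 : ℝ) + t * Complex.I) / 2)) = Zsq t := by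
  rw [Xi_mul_cos (by simp) (by rw [half_line]; exact half_line_ne_one t), half_line]
  have : 1 - (1 / 2 + Complex.I * (t : ℂ)) = (starRingEnd ℂ) (1 / 2 + Complex.I * (t : ℂ)) := by
    rw [map_add, map_mul, map_div₀, map_one, map_ofNat, Complex.conj_I, Complex.conj_ofReal]; ring
  rw [this, riemannZeta_conj, Complex.mul_conj, Zsq, Complex.normSq_eq_norm_sq]

/-- The Laplace transform of `|ζ(1/2+it)|²`. -/
noncomputable def Lap (s : ℂ) : ℂ := ∫ t in Ioi (0:ℝ), (Zsq t : ℂ) * Complex.exp (-(s * t))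

lemma norm_one_add_I_exp (x : ℝ) : 1 ≤ ‖1 + Complex.I * (Real.exp x : ℂ)‖ ∧
    Real.exp x ≤ ‖1 + Complex.I * (Real.exp x : ℂ)‖ := by
  constructor
  · have := Complex.abs_re_le_norm (1 + Complex.I * (Real.exp x : ℂ))
    rw [Complex.add_re, Complex.re_mul_ofReal] at this
    simpa using this
  · have := Complex.abs_im_le_norm (1 + Complex.I * (Real.exp x : ℂ))
    rw [Complex.add_im, Complex.im_mul_ofReal] at this
    simpa using this

/-- The point `i e^{-is}`. -/
noncomputable def wpt (s : ℂ) : ℂ := Complex.exp ((Real.pi / 2 - s) * Complex.I)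

lemma log_wpt {s : ℂ} (h0 : 0 < s.re) (h1 : s.re < Real.pi) :
    Complex.log (wpt s) = (Real.pi / 2 - s) * Complex.I := by
  have him : ((Real.pi / 2 - s) * Complex.I).im = Real.pi / 2 - s.re := by
    have : (Real.pi / 2 : ℂ) = ((Real.pi / 2 : ℝ) : ℂ) := by push_cast; ring
    rw [Complex.mul_I_im, this, Complex.sub_re, Complex.ofReal_re]
  unfold wpt
  rw [Complex.log_exp]
  · rw [him]; linarith [Real.pi_pos]
  · rw [him]; linarith [Real.pi_pos]

lemma wpt_eq (s : ℂ) : wpt s = Complex.I * Complex.exp (-(s * Complex.I)) := by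
  unfold wpt
  rw [sub_mul, sub_eq_add_neg, Complex.exp_add, Complex.exp_pi_div_two_mul_I]

lemma wpt_re (s : ℂ) : (wpt s).re = Real.exp s.im * Real.sin s.re := by
  rw [wpt_eq, Complex.I_mul_re, Complex.exp_im]
  simp

lemma wpt_im (s : ℂ) : (wpt s).im = Real.exp s.im * Real.cos s.re := by
  rw [wpt_eq, Complex.I_mul_im, Complex.exp_re]
  simp

lemma norm_wpt (s : ℂ) : ‖wpt s‖ = Real.exp s.im := by
  rw [wpt_eq, norm_mul, Complex.norm_I, one_mul, Complex.norm_exp]; simp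

lemma wpt_re_pos {s : ℂ} (h0 : 0 < s.re) (h1 : s.re < Real.pi) : 0 < (wpt s).re := by
  rw [wpt_re]
  have := Real.sin_pos_of_pos_of_lt_pi h0 h1
  positivity

lemma integrable_Zsq_mul_exp {σ : ℝ} (hσ : 0 < σ) :
    IntegrableOn (fun t => Zsq t * Real.exp (-(σ * t))) (Ioi 0) := by
  obtain ⟨C, hC, hZ⟩ := exists_Zsq_le (δ := σ / 2) (by linarith)
  have hi := ((integrable_exp_neg_mul_abs (c := σ / 2) (by linarith)).const_mul C).integrableOn
    (s := Ioi 0)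
  refine hi.mono' (by have := continuous_Zsq; fun_prop) ?_
  filter_upwards [ae_restrict_mem measurableSet_Ioi] with t ht
  have ht : 0 < t := ht
  rw [Real.norm_of_nonneg (mul_nonneg (Zsq_nonneg t) (Real.exp_pos _).le), abs_of_pos ht]
  have := hZ t
  rw [abs_of_pos ht] at this
  calc _ ≤ C * Real.exp (σ / 2 * t) * Real.exp (-(σ * t)) := by gcongr
    _ = _ := by rw [mul_assoc, ← Real.exp_add]; ring_nf

lemma Lap_approx : ∃ C, 0 < C ∧ ∀ s : ℂ, 0 < s.re → s.re ≤ 1 →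
    ‖Lap s - 2 * Real.pi * Complex.exp (-(s * Complex.I / 2)) *
      (Dser (wpt s) - Mfun (wpt s))‖ ≤ C := by
  obtain ⟨C, hC, hZ⟩ := exists_Zsq_le (δ := 1) one_pos
  refine ⟨C * ∫ t : ℝ, Real.exp (-(1 * |t|)), ?_, fun s h0 h1 => ?_⟩
  · refine mul_pos hC ?_
    exact integral_exp_pos (integrable_exp_neg_mul_abs one_pos)
  have hpi := Real.pi_gt_three
  have hlt : s.re < Real.pi := by linarith
  have hw := wpt_re_pos h0 hlt
  have hw0 := ne_zero_of_re_pos hw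
  -- the full integrand
  set F : ℝ → ℂ := fun t => (Zsq t : ℂ) * Complex.exp (-(s * t)) /
    (1 + Complex.I * (Real.exp (-(Real.pi * t)) : ℂ)) with hF
  have hden : ∀ t : ℝ, (1 + Complex.I * (Real.exp (-(Real.pi * t)) : ℂ)) ≠ 0 := by
    intro t h
    have := (norm_one_add_I_exp (-(Real.pi * t))).1
    rw [h, norm_zero] at this; linarith
  have hXi : ∀ t : ℝ, Xi ((1 / 2 : ℝ) + t * Complex.I) * wpt s ^ (-(((1 / 2 : ℝ) : ℂ) + t * Complex.I)) =
      Complex.exp (s * Complex.I / 2) * F t := by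
    intro t
    have hx := Xi_half_mul_cos t
    set z : ℂ := ((1 / 2 : ℝ) : ℂ) + t * Complex.I with hz
    rw [Complex.cpow_def_of_ne_zero hw0, log_wpt h0 hlt]
    simp only [hF]
    rw [← hx, eq_comm, ← mul_div_assoc, div_eq_iff (hden t)]
    have e1 : 2 * Complex.cos (Real.pi * z / 2) = Complex.exp (-(Real.pi * z / 2 * Complex.I)) *
        (1 + Complex.I * (Real.exp (-(Real.pi * t)) : ℂ)) := by
      have h1 : Complex.I * (Real.exp (-(Real.pi * t)) : ℂ) =
          Complex.exp (Real.pi / 2 * Complex.I + ((-(Real.pi * t) : ℝ) : ℂ)) := by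
        rw [Complex.exp_add, Complex.exp_pi_div_two_mul_I, Complex.ofReal_exp]
      have h2 : Real.pi * z / 2 * Complex.I = -(Real.pi * z / 2 * Complex.I) +
          (Real.pi / 2 * Complex.I + ((-(Real.pi * t) : ℝ) : ℂ)) := by
        rw [hz]; push_cast
        linear_combination ((Real.pi:ℂ) * t) * Complex.I_sq
      rw [Complex.cos, mul_div_cancel₀ _ two_ne_zero, h1, mul_one_add, ← Complex.exp_add, ← h2,
        neg_mul, add_comm]
    rw [e1]
    have e2 : Complex.exp ((Real.pi / 2 - s) * Complex.I * -z) =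
        Complex.exp (s * Complex.I / 2) * Complex.exp (-(s * t)) *
          Complex.exp (-(Real.pi * z / 2 * Complex.I)) := by
      rw [← Complex.exp_add, ← Complex.exp_add]
      congr 1
      rw [hz]; push_cast
      linear_combination (s * t) * Complex.I_sq
    rw [e2]; ring
  have hmain := Dser_sub_Mfun hw (θ := 1 / 2) (by norm_num) (by norm_num)
  have hcongr : (∫ t : ℝ, Xi ((1 / 2 : ℝ) + t * Complex.I) *
      wpt s ^ (-(((1 / 2 : ℝ) : ℂ) + t * Complex.I))) = Complex.exp (s * Complex.I / 2) * ∫ t, F t := by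
    rw [← integral_const_mul]; congr 1; funext t; exact hXi t
  rw [hcongr] at hmain
  have hexp : Complex.exp (-(s * Complex.I / 2)) * Complex.exp (s * Complex.I / 2) = 1 := by
    rw [← Complex.exp_add]; simp
  have hval : 2 * Real.pi * Complex.exp (-(s * Complex.I / 2)) *
      (Dser (wpt s) - Mfun (wpt s)) = ∫ t, F t := by
    rw [hmain, Complex.real_smul]; push_cast
    have hp : (Real.pi : ℂ) ≠ 0 := by exact_mod_cast Real.pi_pos.ne'
    field_simp
    linear_combination (∫ t, F t) * hexp
  rw [hval]
  set G : ℝ → ℂ := (Ioi (0:ℝ)).indicator (fun t => (Zsq t : ℂ) * Complex.exp (-(s * t))) with hG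
  have hne : ∀ t : ℝ, ‖Complex.exp (-(s * t))‖ = Real.exp (-(s.re * t)) := by
    intro t; rw [Complex.norm_exp]; simp
  have hGi : Integrable G := by
    rw [hG, integrable_indicator_iff measurableSet_Ioi]
    refine (integrable_Zsq_mul_exp h0).mono' (by have := continuous_Zsq; fun_prop)
      (Eventually.of_forall fun t => ?_)
    rw [norm_mul, hne, Complex.norm_real, Real.norm_of_nonneg (Zsq_nonneg t)]
  have hdiff : ∀ t, ‖G t - F t‖ ≤ C * Real.exp (-(1 * |t|)) := by
    intro t
    have hZt := hZ t
    obtain ⟨b1, b2⟩ := norm_one_add_I_exp (-(Real.pi * t))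
    set den := 1 + Complex.I * (Real.exp (-(Real.pi * t)) : ℂ) with hdenn
    have hdp : 0 < ‖den‖ := by linarith
    rcases lt_or_ge 0 t with ht | ht
    · have : G t - F t = (Zsq t : ℂ) * Complex.exp (-(s * t)) *
          ((Complex.I * (Real.exp (-(Real.pi * t)) : ℂ)) / den) := by
        rw [hG, indicator_of_mem (show t ∈ Ioi (0:ℝ) from ht)]
        simp only [hF]
        have := hden t
        rw [← hdenn] at this ⊢
        field_simp
        rw [hdenn]; ring
      rw [this, norm_mul, norm_mul, hne, Complex.norm_real, Real.norm_of_nonneg (Zsq_nonneg t),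
        norm_div, norm_mul, Complex.norm_I, one_mul, Complex.norm_real, Real.norm_of_nonneg (Real.exp_pos _).le]
      rw [abs_of_pos ht] at hZt ⊢
      have k1 : Real.exp (-(Real.pi * t)) / ‖den‖ ≤ Real.exp (-(Real.pi * t)) :=
        div_le_self (Real.exp_pos _).le b1
      calc _ ≤ C * Real.exp (1 * t) * Real.exp (-(s.re * t)) * Real.exp (-(Real.pi * t)) := by gcongr
        _ = C * Real.exp (1 * t + -(s.re * t) + -(Real.pi * t)) := by
          rw [Real.exp_add, Real.exp_add]; ring
        _ ≤ _ := by gcongr; nlinarith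
    · have : G t - F t = -F t := by
        rw [hG, indicator_of_notMem (by simpa using ht)]; simp
      rw [this, norm_neg]
      simp only [hF]
      rw [norm_div, norm_mul, hne, Complex.norm_real, Real.norm_of_nonneg (Zsq_nonneg t)]
      rw [← hdenn, div_le_iff₀ hdp]
      rw [abs_of_nonpos ht] at hZt ⊢
      calc _ ≤ C * Real.exp (1 * -t) * Real.exp (-(s.re * t)) := by gcongr
        _ = C * Real.exp (1 * -t + -(s.re * t)) := by rw [Real.exp_add]; ring
        _ ≤ C * Real.exp (-(1 * -t) + -(Real.pi * t)) := by gcongr C * Real.exp ?_; nlinarith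
        _ = C * Real.exp (-(1 * -t)) * Real.exp (-(Real.pi * t)) := by rw [Real.exp_add]; ring
        _ ≤ _ := by gcongr
  have hbi := (integrable_exp_neg_mul_abs (c := 1) one_pos).const_mul C
  have hFm : AEStronglyMeasurable F := by
    refine Continuous.aestronglyMeasurable ?_
    have := continuous_Zsq
    exact Continuous.div (by fun_prop) (by fun_prop) hden
  have hdi : Integrable fun t => G t - F t :=
    hbi.mono' (hGi.aestronglyMeasurable.sub hFm) (Eventually.of_forall hdiff)
  have hFi : Integrable F := by
    have := hGi.sub hdi
    refine this.congr (Eventually.of_forall fun t => ?_)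
    simp
  have hL : Lap s = ∫ t, G t := by
    rw [hG, integral_indicator measurableSet_Ioi]; rfl
  rw [hL, ← integral_sub hGi hFi, ← integral_const_mul]
  exact norm_integral_le_of_norm_le hbi (Eventually.of_forall hdiff)

end

section
open Set Filter Topology

lemma integrable_Xi_cpow {w : ℂ} (hw : 0 < w.re) {θ : ℝ} (hθ : 0 < θ) (hθ1 : θ < 1) :
    Integrable fun t : ℝ => Xi (θ + t * Complex.I) * w ^ (-((θ : ℂ) + t * Complex.I)) := by
  have ha := abs_arg_lt hw
  have hw0 := ne_zero_of_re_pos hw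
  set c := (|w.arg| + Real.pi / 2) / 2 with hc
  obtain ⟨C, hC, h⟩ := exists_Xi_le hθ hθ1 (c := c) (by positivity) (by linarith)
  have hi := (integrable_exp_neg_mul_abs (c := c - |w.arg|) (by linarith)).const_mul (C * ‖w‖ ^ (-θ))
  refine hi.mono' ((continuous_Xi_vertical hθ hθ1).mul
    (continuous_cpow_vertical hw0 θ)).aestronglyMeasurable (Eventually.of_forall fun t => ?_)
  have hle : w.arg * t ≤ |w.arg| * |t| := by rw [← abs_mul]; exact le_abs_self _
  rw [norm_mul, norm_cpow_vertical hw0]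
  have e1 : ((θ : ℂ) + t * Complex.I).re = θ := by simp
  have e2 : ((θ : ℂ) + t * Complex.I).im = t := by simp
  rw [e1, e2]
  calc _ ≤ (C * Real.exp (-(c * |t|))) * (‖w‖ ^ (-θ) * Real.exp (|w.arg| * |t|)) := by
        gcongr
        exact h t
    _ = C * ‖w‖ ^ (-θ) * (Real.exp (-(c * |t|)) * Real.exp (|w.arg| * |t|)) := by ring
    _ = _ := by rw [← Real.exp_add]; congr 2; ring

lemma Xi_reflect {z : ℂ} (hz : 0 < z.re) (hz1 : z.re < 1) :
    (Xi z - Complex.I * Xi (1 - z)) * (1 + Complex.exp (-(Real.pi * z * Complex.I))) =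
      -2 * Complex.I * Xi (1 - z) := by
  have hne : z ≠ 1 := by rintro rfl; simp at hz1
  have hne' : 1 - z ≠ 1 := by
    intro h
    have : z = 0 := by linear_combination -h
    rw [this] at hz; simp at hz
  have h1 := Xi_mul_cos hz hne
  have h2 := Xi_mul_cos (z := 1 - z) (by simpa using hz1) hne'
  rw [sub_sub_cancel] at h2
  have h3 : Complex.cos (Real.pi * (1 - z) / 2) = Complex.sin (Real.pi * z / 2) := by
    rw [← Complex.cos_pi_div_two_sub]; congr 1; ring
  rw [h3] at h2
  have h4 : Xi z * (2 * Complex.cos (Real.pi * z / 2)) =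
      Xi (1 - z) * (2 * Complex.sin (Real.pi * z / 2)) := by rw [h1, h2]; ring
  set u := Complex.exp (Real.pi * z / 2 * Complex.I) with hu
  set v := Complex.exp (-(Real.pi * z / 2) * Complex.I) with hv
  have huv : u * v = 1 := by rw [hu, hv, ← Complex.exp_add]; simp
  have hvv : Complex.exp (-(Real.pi * z * Complex.I)) = v * v := by
    rw [hv, ← Complex.exp_add]; congr 1; ring
  rw [Complex.cos, Complex.sin, ← hu, ← hv] at h4
  rw [hvv]
  linear_combination v * h4 - (Xi (1 - z) * Complex.I + Xi z) * huv

lemma norm_one_add_mul_ge (t : ℝ) (z : ℂ) (hz : z = ((1 / 8 : ℝ) : ℂ) + t * Complex.I) :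
    1 ≤ ‖1 + Complex.exp (-(Real.pi * z * Complex.I))‖ ∧
    Real.exp (Real.pi * t) ≤ ‖1 + Complex.exp (-(Real.pi * z * Complex.I))‖ := by
  have h : -(Real.pi * z * Complex.I) = ((Real.pi * t : ℝ) : ℂ) +
      ((-(Real.pi / 8) : ℝ) : ℂ) * Complex.I := by
    rw [hz]; push_cast; linear_combination (-(Real.pi:ℂ) * t) * Complex.I_sq
  have hcos : 0 < Real.cos (-(Real.pi / 8)) := by
    apply Real.cos_pos_of_mem_Ioo; constructor <;> linarith [Real.pi_pos]
  set r := Real.exp (Real.pi * t) with hr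
  have hr0 : 0 < r := Real.exp_pos _
  have hre : (1 + Complex.exp (-(Real.pi * z * Complex.I))).re = 1 + r * Real.cos (-(Real.pi / 8)) := by
    rw [h, Complex.exp_add, ← Complex.ofReal_exp, ← hr, Complex.add_re, Complex.re_ofReal_mul,
      Complex.exp_ofReal_mul_I_re]; simp
  have him : (1 + Complex.exp (-(Real.pi * z * Complex.I))).im = r * Real.sin (-(Real.pi / 8)) := by
    rw [h, Complex.exp_add, ← Complex.ofReal_exp, ← hr, Complex.add_im, Complex.im_ofReal_mul,
      Complex.exp_ofReal_mul_I_im]; simp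
  have hsq : ‖1 + Complex.exp (-(Real.pi * z * Complex.I))‖ ^ 2 =
      1 + 2 * r * Real.cos (-(Real.pi / 8)) + r ^ 2 := by
    rw [← Complex.normSq_eq_norm_sq, Complex.normSq_apply, hre, him]
    linear_combination r ^ 2 * Real.sin_sq_add_cos_sq (-(Real.pi / 8))
  have hp : 0 < r * Real.cos (-(Real.pi / 8)) := by positivity
  constructor
  · apply le_of_sq_le_sq _ (norm_nonneg _)
    rw [hsq]; nlinarith
  · apply le_of_sq_le_sq _ (norm_nonneg _)
    rw [hsq]; nlinarith

lemma modular_bound : ∃ C, 0 < C ∧ ∀ w : ℂ, 0 < w.re → -w.re ≤ w.im →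
    ‖Dser w - Mfun w - Complex.I / w * (Dser w⁻¹ - Mfun w⁻¹)‖ ≤ C * ‖w‖ ^ (-(1 / 8 : ℝ)) := by
  have hpi := Real.pi_pos
  obtain ⟨C, hC, hX⟩ := exists_Xi_le (θ := 7 / 8) (c := 3 * Real.pi / 8) (by norm_num) (by norm_num)
    (by positivity) (by linarith)
  have hintg := integrable_exp_neg_mul_abs (c := Real.pi / 8) (by positivity)
  refine ⟨1 / (2 * Real.pi) * (2 * C * ∫ t : ℝ, Real.exp (-(Real.pi / 8 * |t|))), ?_,
    fun w hw hwi => ?_⟩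
  · have := integral_exp_pos hintg
    positivity
  have hw0 := ne_zero_of_re_pos hw
  have hwn : 0 < ‖w‖ := norm_pos_iff.mpr hw0
  have hwi' : 0 < (w⁻¹).re := by
    rw [Complex.inv_re]; have := Complex.normSq_pos.mpr hw0; positivity
  have harg := abs_arg_lt hw
  have harg4 : -(Real.pi / 4) ≤ w.arg := by
    have h1 : w.arg = Real.arctan (w.im / w.re) := by
      rw [← Complex.tan_arg, Real.arctan_tan] <;> linarith [abs_lt.mp harg]
    rw [h1, ← Real.arctan_one, ← Real.arctan_neg]
    apply Real.arctan_strictMono.monotone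
    rw [le_div_iff₀ hw]; linarith
  have h1 := Dser_sub_Mfun hw (θ := 1 / 8) (by norm_num) (by norm_num)
  have h2 := Dser_sub_Mfun hwi' (θ := 7 / 8) (by norm_num) (by norm_num)
  have hi1 := integrable_Xi_cpow hw (θ := 1 / 8) (by norm_num) (by norm_num)
  have hi2 := integrable_Xi_cpow hwi' (θ := 7 / 8) (by norm_num) (by norm_num)
  rw [← integral_neg_eq_self] at h2
  have hi2 := hi2.comp_neg
  have hz : ∀ t : ℝ, ((7 / 8 : ℝ) : ℂ) + ((-t : ℝ) : ℂ) * Complex.I =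
      1 - (((1 / 8 : ℝ) : ℂ) + t * Complex.I) := by intro t; push_cast; ring
  have hcp : ∀ t : ℝ, Complex.I / w * (Xi (((7 / 8 : ℝ) : ℂ) + ((-t : ℝ) : ℂ) * Complex.I) *
      w⁻¹ ^ (-(((7 / 8 : ℝ) : ℂ) + ((-t : ℝ) : ℂ) * Complex.I))) =
      Complex.I * Xi (1 - (((1 / 8 : ℝ) : ℂ) + t * Complex.I)) *
        w ^ (-(((1 / 8 : ℝ) : ℂ) + t * Complex.I)) := by
    intro t
    rw [hz]
    set z := ((1 / 8 : ℝ) : ℂ) + t * Complex.I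
    rw [Complex.inv_cpow _ _ (by linarith [abs_lt.mp harg]), ← Complex.cpow_neg, neg_neg,
      sub_eq_add_neg, Complex.cpow_add _ _ hw0, Complex.cpow_one]
    field_simp
  have key : Dser w - Mfun w - Complex.I / w * (Dser w⁻¹ - Mfun w⁻¹) =
      (1 / (2 * Real.pi) : ℝ) • ∫ t : ℝ, (Xi (((1 / 8 : ℝ) : ℂ) + t * Complex.I) -
        Complex.I * Xi (1 - (((1 / 8 : ℝ) : ℂ) + t * Complex.I))) *
        w ^ (-(((1 / 8 : ℝ) : ℂ) + t * Complex.I)) := by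
    rw [h1, h2, mul_smul_comm, ← integral_const_mul, ← smul_sub, ← integral_sub hi1
      (hi2.const_mul _)]
    congr 2; funext t
    rw [hcp]; ring
  rw [key, norm_smul, Real.norm_of_nonneg (by positivity), mul_assoc]
  gcongr
  calc _ ≤ ∫ t : ℝ, (2 * C * ‖w‖ ^ (-(1 / 8 : ℝ))) * Real.exp (-(Real.pi / 8 * |t|)) := by
        refine norm_integral_le_of_norm_le (hintg.const_mul _) (Eventually.of_forall fun t => ?_)
        set z := ((1 / 8 : ℝ) : ℂ) + t * Complex.I with hzdef
        have hzre : z.re = 1 / 8 := by simp [hzdef]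
        have hzim : z.im = t := by simp [hzdef]
        have hr := Xi_reflect (z := z) (by rw [hzre]; norm_num) (by rw [hzre]; norm_num)
        obtain ⟨b1, b2⟩ := norm_one_add_mul_ge t z hzdef
        set den := 1 + Complex.exp (-(Real.pi * z * Complex.I)) with hden
        have hx := hX (-t)
        rw [hz, ← hzdef, abs_neg] at hx
        have hd : ‖Xi z - Complex.I * Xi (1 - z)‖ * ‖den‖ = 2 * ‖Xi (1 - z)‖ := by
          rw [← norm_mul, hr]; simp
        rw [norm_mul, norm_cpow_vertical hw0, hzre, hzim]
        have e1 : Real.exp (w.arg * t) ≤ ‖den‖ * Real.exp (Real.pi / 4 * |t|) := by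
          rcases le_or_gt 0 t with ht | ht
          · rw [abs_of_nonneg ht]
            calc _ ≤ Real.exp (Real.pi * t) * Real.exp (Real.pi / 4 * t) := by
                  rw [← Real.exp_add]; apply Real.exp_le_exp.mpr
                  nlinarith [abs_lt.mp harg, mul_nonneg hpi.le ht]
              _ ≤ _ := by gcongr
          · rw [abs_of_neg ht]
            calc _ ≤ 1 * Real.exp (Real.pi / 4 * -t) := by
                  rw [one_mul]; apply Real.exp_le_exp.mpr; nlinarith
              _ ≤ _ := by gcongr
        have hdd : 0 ≤ ‖Xi z - Complex.I * Xi (1 - z)‖ := norm_nonneg _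
        calc _ ≤ ‖Xi z - Complex.I * Xi (1 - z)‖ * (‖w‖ ^ (-(1 / 8 : ℝ)) *
              (‖den‖ * Real.exp (Real.pi / 4 * |t|))) := by gcongr
          _ = (‖Xi z - Complex.I * Xi (1 - z)‖ * ‖den‖) * ‖w‖ ^ (-(1 / 8 : ℝ)) *
              Real.exp (Real.pi / 4 * |t|) := by ring
          _ = 2 * ‖Xi (1 - z)‖ * ‖w‖ ^ (-(1 / 8 : ℝ)) * Real.exp (Real.pi / 4 * |t|) := by rw [hd]
          _ ≤ 2 * (C * Real.exp (-(3 * Real.pi / 8 * |t|))) * ‖w‖ ^ (-(1 / 8 : ℝ)) *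
              Real.exp (Real.pi / 4 * |t|) := by gcongr
          _ = (2 * C * ‖w‖ ^ (-(1 / 8 : ℝ))) * (Real.exp (-(3 * Real.pi / 8 * |t|)) *
              Real.exp (Real.pi / 4 * |t|)) := by ring
          _ = _ := by rw [← Real.exp_add]; congr 2; ring
    _ = _ := by rw [integral_const_mul]; ring

end

section
open Set Filter Topology

/-- The point `i (e^{-is} - 1)`, close to `s` for small `s`. -/
noncomputable def wsm (s : ℂ) : ℂ := Complex.I * (Complex.exp (-(s * Complex.I)) - 1)

/-- The point `i/2 + cot(s/2)/2`, which is the inverse of `wsm s`. -/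
noncomputable def wct (s : ℂ) : ℂ := Complex.cos (s / 2) / (2 * Complex.sin (s / 2)) + Complex.I / 2

lemma Dser_wpt (s : ℂ) : Dser (wpt s) = Dser (wsm s) := by
  unfold Dser
  congr 1; funext n
  congr 1
  have : -(2 * Real.pi * n * wpt s) = -(2 * Real.pi * n * wsm s) +
      ((-n : ℤ) : ℂ) * (2 * Real.pi * Complex.I) := by
    rw [wpt_eq, wsm]; push_cast; ring
  rw [this, Complex.exp_add, Complex.exp_int_mul_two_pi_mul_I, mul_one]

lemma wsm_eq (s : ℂ) : wsm s = 2 * Complex.exp (-(s * Complex.I / 2)) * Complex.sin (s / 2) := by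
  have h : Complex.exp (-(s * Complex.I)) =
      Complex.exp (-(s * Complex.I / 2)) * Complex.exp (-(s * Complex.I / 2)) := by
    rw [← Complex.exp_add]; congr 1; ring
  have h1 : Complex.exp (-(s * Complex.I / 2)) * Complex.exp (s / 2 * Complex.I) = 1 := by
    rw [← Complex.exp_add]; ring_nf; simp
  have h2 : Complex.exp (-(s / 2) * Complex.I) = Complex.exp (-(s * Complex.I / 2)) := by
    congr 1; ring
  rw [wsm, h, Complex.sin, h2]
  linear_combination Complex.I * h1

lemma sin_half_ne_zero {s : ℂ} (h0 : 0 < s.re) (h1 : s.re ≤ 1) : Complex.sin (s / 2) ≠ 0 := by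
  intro h
  rw [Complex.sin_eq_zero_iff] at h
  obtain ⟨k, hk⟩ := h
  have := congrArg Complex.re hk
  have h3 : (s / 2).re = s.re / 2 := by simp
  rw [h3] at this
  have h2 : ((k : ℂ) * (Real.pi : ℂ)).re = k * Real.pi := by simp
  rw [h2] at this
  have hpi := Real.pi_gt_three
  have hk0 : 0 < (k : ℝ) := by by_contra hc; push Not at hc; nlinarith
  have hk1 : (1 : ℝ) ≤ k := by exact_mod_cast (by exact_mod_cast hk0 : 0 < k)
  nlinarith

lemma wsm_inv {s : ℂ} (h0 : 0 < s.re) (h1 : s.re ≤ 1) : (wsm s)⁻¹ = wct s := by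
  have hs := sin_half_ne_zero h0 h1
  have hee : Complex.exp (-(s * Complex.I / 2)) * Complex.exp (s / 2 * Complex.I) = 1 := by
    rw [← Complex.exp_add]; ring_nf; simp
  rw [Complex.exp_mul_I] at hee
  refine inv_eq_of_mul_eq_one_right ?_
  rw [wsm_eq, wct, ← hee]
  field_simp

lemma wsm_re (s : ℂ) : (wsm s).re = Real.exp s.im * Real.sin s.re := by
  rw [wsm, mul_sub, ← wpt_eq]; simp [wpt_re]

lemma wsm_im (s : ℂ) : (wsm s).im = Real.exp s.im * Real.cos s.re - 1 := by
  rw [wsm, mul_sub, ← wpt_eq]; simp [wpt_im]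

lemma norm_wsm_sub_le {s : ℂ} (hs : ‖s‖ ≤ 1) : ‖wsm s - s‖ ≤ ‖s‖ ^ 2 := by
  have h : wsm s - s = Complex.I * (Complex.exp (-(s * Complex.I)) - 1 - (-(s * Complex.I))) := by
    rw [wsm]; linear_combination (-s) * Complex.I_sq
  have h2 : ‖-(s * Complex.I)‖ = ‖s‖ := by simp
  rw [h, norm_mul, Complex.norm_I, one_mul, ← h2]
  exact Complex.norm_exp_sub_one_sub_id_le (by rw [h2]; exact hs)

lemma neg_log_le_rpow {x : ℝ} (hx : 0 < x) : -Real.log x ≤ 8 * x ^ (-(1 / 8 : ℝ)) := by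
  have := Real.log_le_self (Real.rpow_nonneg hx.le (-(1 / 8 : ℝ)))
  rw [Real.log_rpow hx] at this
  linarith

lemma norm_log_le {w : ℂ} (hw : 0 < w.re) (hw1 : ‖w‖ ≤ 1) :
    ‖Complex.log w‖ ≤ 10 * ‖w‖ ^ (-(1 / 8 : ℝ)) := by
  have hw0 := norm_pos_iff.mpr (ne_zero_of_re_pos hw)
  have h1 := Complex.norm_le_abs_re_add_abs_im (Complex.log w)
  rw [Complex.log_re, Complex.log_im, abs_of_nonpos (Real.log_nonpos hw0.le hw1)] at h1
  have h2 := abs_arg_lt hw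
  have h3 := neg_log_le_rpow hw0
  have h4 : 1 ≤ ‖w‖ ^ (-(1 / 8 : ℝ)) := Real.one_le_rpow_of_pos_of_le_one_of_nonpos hw0 hw1 (by norm_num)
  linarith [Real.pi_lt_four]

set_option maxHeartbeats 1000000 in
/-- The Laplace transform of `|ζ(1/2+it)|²` near the origin. -/
lemma Lap_modular : ∃ C, 0 < C ∧ ∀ s : ℂ, 0 < s.re → s.re ≤ 1 / 4 → 0 < s.im → s.im ≤ 1 / 4 →
    ‖Lap s - 2 * Real.pi * Mfun s - Real.pi * Complex.I / Complex.sin (s / 2) * Dser (wct s)‖ ≤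
      C * ‖s‖ ^ (-(1 / 8 : ℝ)) := by
  obtain ⟨C1, hC1, hL⟩ := Lap_approx
  obtain ⟨C2, hC2, hM⟩ := modular_bound
  set K : ℝ := |Real.eulerMascheroniConstant - Real.log (2 * Real.pi)| with hK
  have hKc : ‖((Real.eulerMascheroniConstant : ℂ) - (Real.log (2 * Real.pi) : ℂ))‖ = K := by
    rw [← Complex.ofReal_sub, Complex.norm_real]; rfl
  have hK0 : 0 ≤ K := abs_nonneg _
  refine ⟨C1 + 20 * Real.pi * C2 + 100 * (K + 100), by positivity, fun s h0 h1 h2 h3 => ?_⟩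
  have hpi := Real.pi_gt_three
  have hsn : ‖s‖ ≤ 1 / 2 := by
    have := Complex.norm_le_abs_re_add_abs_im s
    rw [abs_of_pos h0, abs_of_pos h2] at this; linarith
  have hs0 := ne_zero_of_re_pos h0
  have hsp : 0 < ‖s‖ := norm_pos_iff.mpr hs0
  have hsin : 0 < Real.sin s.re := Real.sin_pos_of_pos_of_lt_pi h0 (by linarith)
  have hcos : 0 < Real.cos s.re := Real.cos_pos_of_mem_Ioo ⟨by linarith, by linarith⟩
  have hwre : 0 < (wsm s).re := by rw [wsm_re]; positivity
  have hwim : -(wsm s).re ≤ (wsm s).im := by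
    rw [wsm_re, wsm_im]
    have e1 := Real.one_le_exp h2.le
    have e2 : 1 ≤ Real.sin s.re + Real.cos s.re := by
      nlinarith [Real.sin_sq_add_cos_sq s.re]
    nlinarith
  have hm := hM _ hwre hwim
  have hl := hL s h0 (by linarith)
  rw [Dser_wpt] at hl
  have hws := norm_wsm_sub_le (s := s) (by linarith)
  have hwsm := wsm_eq s
  have hwi := wsm_inv h0 (by linarith)
  have hsne := sin_half_ne_zero h0 (by linarith)
  rw [hwi] at hm
  set w := wsm s with hw
  have hw0 := ne_zero_of_re_pos hwre
  have hwp : 0 < ‖w‖ := norm_pos_iff.mpr hw0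
  have hw1 : ‖s‖ / 2 ≤ ‖w‖ := by
    have := norm_sub_norm_le s w
    rw [norm_sub_rev] at this; nlinarith
  have hw2 : ‖w‖ ≤ 1 := by
    have := norm_sub_norm_le w s
    nlinarith
  have hX : 1 ≤ ‖s‖ ^ (-(1 / 8 : ℝ)) :=
    Real.one_le_rpow_of_pos_of_le_one_of_nonpos hsp (by linarith) (by norm_num)
  have hwX : ‖w‖ ^ (-(1 / 8 : ℝ)) ≤ 2 * ‖s‖ ^ (-(1 / 8 : ℝ)) := by
    calc _ ≤ (‖s‖ / 2) ^ (-(1 / 8 : ℝ)) :=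
          Real.rpow_le_rpow_of_nonpos (by positivity) hw1 (by norm_num)
      _ = ‖s‖ ^ (-(1 / 8 : ℝ)) * 2 ^ (1 / 8 : ℝ) := by
          rw [Real.div_rpow hsp.le (by norm_num), Real.rpow_neg (by norm_num : (0:ℝ) ≤ 2)]
          field_simp
      _ ≤ ‖s‖ ^ (-(1 / 8 : ℝ)) * 2 ^ (1 : ℝ) := by
          gcongr <;> norm_num
      _ = _ := by rw [Real.rpow_one]; ring
  have hlw := norm_log_le hwre hw2
  set X := ‖s‖ ^ (-(1 / 8 : ℝ)) with hXdef
  set E := Complex.exp (-(s * Complex.I / 2)) with hE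
  have hEn : ‖E‖ ≤ 3 := by
    rw [hE, Complex.norm_exp]
    have : (-(s * Complex.I / 2)).re ≤ 1 := by simp; linarith
    linarith [Real.exp_le_exp.mpr this, Real.exp_one_lt_three]
  have hE1 : ‖E - 1‖ ≤ ‖s‖ := by
    have h : ‖-(s * Complex.I / 2)‖ = ‖s‖ / 2 := by simp
    have := Complex.norm_exp_sub_one_le (x := -(s * Complex.I / 2)) (by rw [h]; linarith)
    rw [h] at this; rw [hE]; linarith
  -- the quotient `w / s`
  have hlog : ‖Complex.log w - Complex.log s‖ ≤ 3 / 2 * ‖s‖ := by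
    have hq : ‖w / s - 1‖ ≤ ‖s‖ := by
      have : w / s - 1 = (w - s) / s := by field_simp
      rw [this, norm_div, div_le_iff₀ hsp]; nlinarith
    have hqre : 0 < (w / s).re := by
      have := Complex.abs_re_le_norm (w / s - 1)
      rw [Complex.sub_re, Complex.one_re] at this
      linarith [abs_le.mp (this.trans hq)]
    have ha1 := abs_lt.mp (abs_arg_lt hqre)
    have ha2 := abs_lt.mp (abs_arg_lt h0)
    have h5 := (Complex.log_mul_eq_add_log_iff (ne_zero_of_re_pos hqre) hs0).mpr
      ⟨by linarith, by linarith⟩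
    rw [div_mul_cancel₀ _ hs0] at h5
    have h6 := Complex.norm_log_one_add_half_le_self (z := w / s - 1) (hq.trans hsn)
    rw [add_sub_cancel] at h6
    rw [h5, add_sub_cancel_right]
    linarith
  have hEw : E / w = 1 / (2 * Complex.sin (s / 2)) := by
    rw [hwsm, div_eq_div_iff]
    · ring
    · rw [← hwsm]; exact hw0
    · exact mul_ne_zero two_ne_zero hsne
  have hdiff : ‖E / w - 1 / s‖ ≤ 4 := by
    have h7 : E / w - 1 / s = ((E - 1) * s - (w - s)) / (w * s) := by field_simp; ring
    rw [h7, norm_div, norm_mul, div_le_iff₀ (by positivity)]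
    calc _ ≤ ‖(E - 1) * s‖ + ‖w - s‖ := norm_sub_le _ _
      _ ≤ ‖s‖ * ‖s‖ + ‖s‖ ^ 2 := by rw [norm_mul]; gcongr
      _ ≤ _ := by nlinarith
  set κ : ℂ := (Real.eulerMascheroniConstant : ℂ) - (Real.log (2 * Real.pi) : ℂ) with hκ
  have hpc : (Real.pi : ℂ) ≠ 0 := by exact_mod_cast Real.pi_pos.ne'
  -- the five pieces
  have t1 : ‖2 * Real.pi * E * Mfun w - 2 * Real.pi * Mfun s‖ ≤ 4 * (K + 20 * X) + 2 := by
    have h8 : 2 * Real.pi * E * Mfun w - 2 * Real.pi * Mfun s =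
        (E / w - 1 / s) * (κ - Complex.log w) - (Complex.log w - Complex.log s) / s := by
      unfold Mfun; rw [← hκ]; field_simp; ring
    rw [h8]
    calc _ ≤ ‖(E / w - 1 / s) * (κ - Complex.log w)‖ + ‖(Complex.log w - Complex.log s) / s‖ :=
          norm_sub_le _ _
      _ ≤ 4 * (K + 20 * X) + 2 := by
          rw [norm_mul, norm_div]
          have : ‖κ - Complex.log w‖ ≤ K + 20 * X := (norm_sub_le _ _).trans (by linarith)
          gcongr
          rw [div_le_iff₀ hsp]; linarith
  have t2 : ‖2 * Real.pi * E * (Complex.I / w * Mfun (wct s))‖ ≤ 3 * (K + 20 * X) := by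
    have hne : w.arg ≠ Real.pi := by
      have := (abs_lt.mp (abs_arg_lt hwre)).2; intro h; linarith
    have h9 : 2 * Real.pi * E * (Complex.I / w * Mfun (wct s)) =
        E * Complex.I * (κ + Complex.log w) := by
      rw [← hwi]; unfold Mfun; rw [← hκ, Complex.log_inv _ hne]; field_simp; ring
    rw [h9, norm_mul, norm_mul, Complex.norm_I, mul_one]
    have : ‖κ + Complex.log w‖ ≤ K + 20 * X := (norm_add_le _ _).trans (by linarith)
    gcongr
  have t3 : ‖2 * Real.pi * E * Mfun (wpt s)‖ ≤ 3 * (K + 3) := by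
    have hn := norm_wpt s
    have hge : 1 ≤ ‖wpt s‖ := by rw [hn]; exact Real.one_le_exp h2.le
    have hne : wpt s ≠ 0 := by rw [← norm_pos_iff]; linarith
    have h9 : 2 * Real.pi * E * Mfun (wpt s) = E * (κ - Complex.log (wpt s)) / wpt s := by
      unfold Mfun; rw [← hκ]; field_simp
    have hlg : ‖Complex.log (wpt s)‖ ≤ 3 := by
      rw [log_wpt h0 (by linarith), norm_mul, Complex.norm_I, mul_one]
      refine (norm_sub_le _ _).trans ?_
      have : ‖(Real.pi / 2 : ℂ)‖ = Real.pi / 2 := by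
        rw [norm_div, Complex.norm_real, Real.norm_of_nonneg Real.pi_pos.le]; norm_num
      rw [this]; linarith [Real.pi_lt_four]
    rw [h9, norm_div, norm_mul]
    refine (div_le_self (by positivity) hge).trans ?_
    have : ‖κ - Complex.log (wpt s)‖ ≤ K + 3 := (norm_sub_le _ _).trans (by linarith)
    gcongr
  have t4 : ‖2 * Real.pi * E * (Dser w - Mfun w - Complex.I / w * (Dser (wct s) - Mfun (wct s)))‖ ≤
      6 * Real.pi * (C2 * (2 * X)) := by
    rw [norm_mul, norm_mul, norm_mul, Complex.norm_real, Real.norm_of_nonneg Real.pi_pos.le]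
    have : ‖(2:ℂ)‖ = 2 := by norm_num
    rw [this]
    calc _ ≤ 2 * Real.pi * 3 * (C2 * (2 * X)) := by
          gcongr
          exact hm.trans (by gcongr)
      _ = _ := by ring
  have hdec : Lap s - 2 * Real.pi * Mfun s - Real.pi * Complex.I / Complex.sin (s / 2) * Dser (wct s)
      = (Lap s - 2 * Real.pi * E * (Dser w - Mfun (wpt s))) +
        2 * Real.pi * E * (Dser w - Mfun w - Complex.I / w * (Dser (wct s) - Mfun (wct s))) +
        (2 * Real.pi * E * Mfun w - 2 * Real.pi * Mfun s) -
        2 * Real.pi * E * (Complex.I / w * Mfun (wct s)) - 2 * Real.pi * E * Mfun (wpt s) := by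
    have : Real.pi * Complex.I / Complex.sin (s / 2) = 2 * Real.pi * Complex.I * (E / w) := by
      rw [hEw]; field_simp
    rw [this]; ring
  rw [hdec]
  refine (norm_sub_le _ _).trans ?_
  refine (add_le_add_left (norm_sub_le _ _) _).trans ?_
  refine (add_le_add_left (add_le_add_left (norm_add_le _ _) _) _).trans ?_
  refine (add_le_add_left (add_le_add_left (add_le_add_left (norm_add_le _ _) _) _) _).trans ?_
  have : 0 ≤ Real.pi * C2 * X := by positivity
  have : K ≤ K * X := by nlinarith
  nlinarith

end

section
open Set Filter Topology

open FourierTransform in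
/-- Plancherel's theorem for functions in `L¹ ∩ L²`. -/
lemma plancherel_L1_L2 {f : ℝ → ℂ} (h1 : Integrable f) (h2 : MemLp f 2) :
    MemLp (𝓕 f) 2 ∧ ∫ x, ‖𝓕 f x‖ ^ 2 = ∫ x, ‖f x‖ ^ 2 := by
  set T := h2.toLp f with hT
  have hcont : Continuous (𝓕 f) :=
    VectorFourier.fourierIntegral_continuous Real.continuous_fourierChar
      (L := innerₗ ℝ) continuous_inner h1
  have hae : ∀ᵐ x, (𝓕 T : Lp ℂ 2 (volume : Measure ℝ)) x = 𝓕 f x := by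
    refine ae_eq_of_integral_contDiff_smul_eq ((Lp.memLp _).locallyIntegrable one_le_two)
      hcont.locallyIntegrable fun g g_smooth g_cpt => ?_
    have hg₁ : HasCompactSupport (Complex.ofRealCLM ∘ g) := g_cpt.comp_left rfl
    have hg₂ : ContDiff ℝ ((⊤ : ℕ∞) : WithTop ℕ∞) (Complex.ofRealCLM ∘ g) := by
      exact Complex.ofRealCLM.contDiff.comp g_smooth
    set G := hg₁.toSchwartzMap hg₂ with hG
    have e1 : (∫ x, g x • (𝓕 T : Lp ℂ 2 (volume : Measure ℝ)) x) =
        Lp.toTemperedDistribution (𝓕 T) G := by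
      rw [Lp.toTemperedDistribution_apply]
      rfl
    rw [e1, ← Lp.fourier_toTemperedDistribution_eq, TemperedDistribution.fourier_apply,
      Lp.toTemperedDistribution_apply]
    have e2 : (∫ x, (𝓕 G) x • T x) = ∫ x, (𝓕 (G : ℝ → ℂ)) x • f x := by
      refine integral_congr_ae ?_
      filter_upwards [h2.coeFn_toLp] with x hx
      rw [hx]; rfl
    rw [e2]
    have e3 := VectorFourier.integral_bilin_fourierIntegral_eq_flip
      (ContinuousLinearMap.lsmul ℂ ℂ : ℂ →L[ℂ] ℂ →L[ℂ] ℂ) (L := innerₗ ℝ) (μ := volume) (ν := volume)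
      Real.continuous_fourierChar continuous_inner G.integrable h1
    rw [flip_innerₗ] at e3
    exact e3
  have hm : MemLp (𝓕 f) 2 := (Lp.memLp (𝓕 T)).ae_eq hae
  refine ⟨hm, ?_⟩
  have hn : ‖(𝓕 T : Lp ℂ 2 (volume : Measure ℝ))‖ = ‖T‖ := Lp.norm_fourier_eq T
  have key : ∀ u : Lp ℂ 2 (volume : Measure ℝ), ‖u‖ ^ 2 = ∫ x, ‖u x‖ ^ 2 := by
    intro u
    have := L2.inner_def (𝕜 := ℂ) u u
    rw [inner_self_eq_norm_sq_to_K] at this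
    simp_rw [inner_self_eq_norm_sq_to_K] at this
    have h' : ((‖u‖ ^ 2 : ℝ) : ℂ) = ((∫ x, ‖u x‖ ^ 2 : ℝ) : ℂ) := by
      rw [← integral_complex_ofReal]
      push_cast
      exact this
    exact_mod_cast h'
  have k1 := key (𝓕 T)
  have k2 := key T
  rw [hn, k2] at k1
  have i1 : (∫ x, ‖(𝓕 T : Lp ℂ 2 (volume : Measure ℝ)) x‖ ^ 2) = ∫ x, ‖𝓕 f x‖ ^ 2 :=
    integral_congr_ae (by filter_upwards [hae] with x hx; rw [hx])
  have i2 : (∫ x, ‖T x‖ ^ 2) = ∫ x, ‖f x‖ ^ 2 :=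
    integral_congr_ae (by filter_upwards [h2.coeFn_toLp] with x hx; rw [hx])
  rw [← i1, ← i2, ← k1]

/-- The Laplace transform. -/
noncomputable def lapl (f : ℝ → ℂ) (s : ℂ) : ℂ := ∫ t in Ioi (0:ℝ), f t * Complex.exp (-(s * t))

lemma norm_exp_neg_mul_ofReal (s : ℂ) (t : ℝ) :
    ‖Complex.exp (-(s * t))‖ = Real.exp (-(s.re * t)) := by
  rw [Complex.norm_exp]; simp

open FourierTransform in
lemma plancherel_lapl {f : ℝ → ℂ} {σ : ℝ} (hf : AEStronglyMeasurable f (volume.restrict (Ioi 0)))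
    (h1 : IntegrableOn (fun t => ‖f t‖ * Real.exp (-(σ * t))) (Ioi 0))
    (h2 : IntegrableOn (fun t => ‖f t‖ ^ 2 * Real.exp (-(2 * σ * t))) (Ioi 0)) :
    Integrable (fun τ : ℝ => ‖lapl f (σ + τ * Complex.I)‖ ^ 2) ∧
    ∫ τ : ℝ, ‖lapl f (σ + τ * Complex.I)‖ ^ 2 =
      2 * Real.pi * ∫ t in Ioi (0:ℝ), ‖f t‖ ^ 2 * Real.exp (-(2 * σ * t)) := by
  have hpi := Real.pi_pos
  set g : ℝ → ℂ := fun t => f t * Complex.exp (-((σ : ℂ) * t)) with hg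
  have hgn : ∀ t, ‖g t‖ = ‖f t‖ * Real.exp (-(σ * t)) := by
    intro t; rw [hg]; simp only; rw [norm_mul, norm_exp_neg_mul_ofReal, Complex.ofReal_re]
  have hgn2 : ∀ t, ‖g t‖ ^ 2 = ‖f t‖ ^ 2 * Real.exp (-(2 * σ * t)) := by
    intro t; rw [hgn, mul_pow, ← Real.exp_nat_mul]; congr 2; push_cast; ring
  have hgm : AEStronglyMeasurable g (volume.restrict (Ioi 0)) :=
    hf.mul (by fun_prop : Continuous fun t : ℝ => Complex.exp (-((σ : ℂ) * t))).aestronglyMeasurable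
  set G : ℝ → ℂ := (Ioi (0:ℝ)).indicator g with hG
  have hGm : AEStronglyMeasurable G := (aestronglyMeasurable_indicator_iff measurableSet_Ioi).mpr hgm
  have hG1 : Integrable G := by
    rw [hG, integrable_indicator_iff measurableSet_Ioi]
    exact h1.mono' hgm (Eventually.of_forall fun t => (hgn t).le)
  have hGsq : (fun t => ‖G t‖ ^ 2) = (Ioi (0:ℝ)).indicator
      (fun t => ‖f t‖ ^ 2 * Real.exp (-(2 * σ * t))) := by
    funext t
    by_cases ht : t ∈ Ioi (0:ℝ)
    · rw [hG, indicator_of_mem ht, indicator_of_mem ht, hgn2]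
    · rw [hG, indicator_of_notMem ht, indicator_of_notMem ht]; simp
  have hG2 : MemLp G 2 := by
    rw [memLp_two_iff_integrable_sq_norm hGm, hGsq, integrable_indicator_iff measurableSet_Ioi]
    exact h2
  obtain ⟨m, e⟩ := plancherel_L1_L2 hG1 hG2
  have hF : ∀ x : ℝ, 𝓕 G x = lapl f (σ + ((2 * Real.pi * x : ℝ) : ℂ) * Complex.I) := by
    intro x
    rw [Real.fourier_real_eq_integral_exp_smul, lapl, ← integral_indicator measurableSet_Ioi]
    congr 1; funext t
    by_cases ht : t ∈ Ioi (0:ℝ)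
    · rw [hG, indicator_of_mem ht, indicator_of_mem ht, smul_eq_mul, hg]
      simp only
      rw [mul_left_comm, ← Complex.exp_add]
      congr 2; push_cast; ring
    · rw [hG, indicator_of_notMem ht, indicator_of_notMem ht, smul_zero]
  have hmi := (memLp_two_iff_integrable_sq_norm m.1).mp m
  simp_rw [hF] at hmi e
  have hne : (2 * Real.pi) ≠ 0 := by positivity
  set L : ℝ → ℝ := fun τ => ‖lapl f (σ + τ * Complex.I)‖ ^ 2 with hL
  have hLi : Integrable L := (integrable_comp_mul_left_iff L hne).mp hmi
  refine ⟨hLi, ?_⟩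
  have h3 := Measure.integral_comp_mul_left L (2 * Real.pi)
  rw [hGsq, integral_indicator measurableSet_Ioi] at e
  rw [← e]
  have h4 : (∫ x : ℝ, ‖lapl f (σ + ((2 * Real.pi * x : ℝ) : ℂ) * Complex.I)‖ ^ 2) =
      ∫ x, L (2 * Real.pi * x) := rfl
  rw [h4, h3, smul_eq_mul, abs_of_pos (by positivity)]
  field_simp

end

section
open Set Filter Topology

lemma C0_eq : C0 = Real.eulerMascheroniConstant := Real.eulerMascheroniConstant_eq_neg_deriv.symm

lemma Laplace_log {s : ℂ} (hs : 0 < s.re) :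
    IntegrableOn (fun t : ℝ => (Real.log t : ℂ) * Complex.exp (-(s * t))) (Ioi 0) ∧
    ∫ t in Ioi (0:ℝ), (Real.log t : ℂ) * Complex.exp (-(s * t)) =
      -((Real.eulerMascheroniConstant : ℂ) + Complex.log s) / s := by
  have hs0 := ne_zero_of_re_pos hs
  set f : ℝ → ℂ := fun t => Complex.exp (-(s * t)) with hf
  have hfc : Continuous f := by fun_prop
  have hO1 : f =O[atTop] (fun t : ℝ => t ^ (-(2:ℝ))) := by
    have := (isLittleO_exp_neg_mul_rpow_atTop hs (-2)).isBigO
    refine Asymptotics.IsBigO.trans (Asymptotics.IsBigO.of_bound 1 (Eventually.of_forall fun t => ?_)) this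
    rw [hf]; simp only; rw [norm_exp_neg_mul_ofReal, Real.norm_of_nonneg (Real.exp_pos _).le, one_mul,
      neg_mul]
  have hO2 : f =O[𝓝[>] 0] (fun t : ℝ => t ^ (-(0:ℝ))) := by
    simp only [neg_zero, Real.rpow_zero]
    exact (hfc.continuousAt.tendsto.mono_left nhdsWithin_le_nhds).isBigO_one ℝ
  have hd := mellin_hasDerivAt_of_isBigO_rpow (s := 1) (a := 2) (b := 0) (f := f)
    (hfc.locallyIntegrable.locallyIntegrableOn _) hO1 (by norm_num) hO2 (by norm_num)
  have e1 : ∀ᶠ a : ℂ in 𝓝 1, mellin f a = s ^ (-a) * Complex.Gamma a := by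
    have : {a : ℂ | 0 < a.re} ∈ 𝓝 (1:ℂ) :=
      (isOpen_lt continuous_const Complex.continuous_re).mem_nhds (by simp)
    filter_upwards [this] with a ha
    exact integral_gammaKernel ha hs
  have d2 := (((hasDerivAt_neg (1:ℂ)).const_cpow (c := s) (Or.inl hs0)).mul
    Complex.hasDerivAt_Gamma_one)
  have d3 := (hd.2.congr_of_eventuallyEq (Filter.EventuallyEq.symm e1)).unique d2
  have hco : EqOn (fun t : ℝ => (t:ℂ) ^ ((1:ℂ) - 1) • (Real.log t • f t))
      (fun t => (Real.log t : ℂ) * Complex.exp (-(s * t))) (Ioi 0) := by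
    intro t _
    simp [hf]
  constructor
  · exact hd.1.congr_fun hco measurableSet_Ioi
  · rw [← setIntegral_congr_fun measurableSet_Ioi hco]
    refine d3.trans ?_
    rw [Complex.Gamma_one, Complex.cpow_neg_one]
    field_simp
    ring

/-- The derivative of `Efun`. -/
noncomputable def edot (t : ℝ) : ℝ := Zsq t - Real.log (t / (2 * Real.pi)) - 2 * C0

lemma Efun_eq (T : ℝ) : Efun T = (∫ t in (0:ℝ)..T, Zsq t) -
    T * Real.log (T / (2 * Real.pi)) - (2 * C0 - 1) * T := rfl

lemma hasDerivAt_Efun {t : ℝ} (ht : 0 < t) : HasDerivAt Efun (edot t) t := by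
  have hpi := Real.pi_pos
  have h1 : HasDerivAt (fun T : ℝ => ∫ t in (0:ℝ)..T, Zsq t) (Zsq t) t :=
    continuous_Zsq.integral_hasStrictDerivAt 0 t |>.hasDerivAt
  have h2 : HasDerivAt (fun T : ℝ => T * Real.log (T / (2 * Real.pi)))
      (Real.log (t / (2 * Real.pi)) + 1) t := by
    have := (hasDerivAt_id t).fun_mul (((hasDerivAt_id t).div_const (2 * Real.pi)).log
      (by simp only [id]; positivity))
    refine this.congr_deriv ?_
    simp only [id]; field_simp
  have h3 := ((h1.sub h2).sub ((hasDerivAt_id t).const_mul (2 * C0 - 1)))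
  refine (h3.congr_deriv ?_).congr_of_eventuallyEq (Eventually.of_forall fun T => ?_)
  · unfold edot; ring
  · simp [Efun_eq]

lemma continuous_Efun : Continuous Efun := by
  have h : ∀ T : ℝ, Efun T = (∫ t in (0:ℝ)..T, Zsq t) -
    (2 * Real.pi) * ((T / (2 * Real.pi)) * Real.log (T / (2 * Real.pi))) - (2 * C0 - 1) * T := by
    intro T
    have hpi := Real.pi_pos
    rw [Efun_eq]; congr 2; field_simp
  rw [funext h]
  have h1 : Continuous (fun T : ℝ => ∫ t in (0:ℝ)..T, Zsq t) :=
    intervalIntegral.continuous_primitive (fun a b => continuous_Zsq.intervalIntegrable a b) 0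
  have h2 : Continuous (fun T : ℝ => (T / (2 * Real.pi)) * Real.log (T / (2 * Real.pi))) :=
    Real.continuous_mul_log.comp (by fun_prop : Continuous fun T : ℝ => T / (2 * Real.pi))
  fun_prop

lemma Efun_zero : Efun 0 = 0 := by simp [Efun_eq]

lemma exists_Efun_le {δ : ℝ} (hδ : 0 < δ) : ∃ C, 0 < C ∧ ∀ t, 0 ≤ t →
    |Efun t| ≤ C * Real.exp (δ * t) := by
  obtain ⟨C, hC, hZ⟩ := exists_Zsq_le hδ
  have hpi := Real.pi_gt_three
  refine ⟨C / δ + (2 * Real.pi + 2 / δ ^ 2) + |2 * C0 - 1| / δ, by positivity, fun t ht => ?_⟩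
  have he1 : δ * t ≤ Real.exp (δ * t) := by linarith [Real.add_one_le_exp (δ * t)]
  have he0 : 1 ≤ Real.exp (δ * t) := Real.one_le_exp (by positivity)
  have he2 : (δ * t) ^ 2 / 2 ≤ Real.exp (δ * t) := by
    linarith [Real.quadratic_le_exp_of_nonneg (by positivity : 0 ≤ δ * t), mul_nonneg hδ.le ht]
  have hA : |∫ u in (0:ℝ)..t, Zsq u| ≤ C / δ * Real.exp (δ * t) := by
    rw [abs_of_nonneg (intervalIntegral.integral_nonneg ht fun u _ => Zsq_nonneg u)]
    calc _ ≤ ∫ u in (0:ℝ)..t, C * Real.exp (δ * u) := by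
          refine intervalIntegral.integral_mono_on ht (continuous_Zsq.intervalIntegrable _ _)
            ((by fun_prop : Continuous fun u : ℝ => C * Real.exp (δ * u)).intervalIntegrable _ _)
            fun u hu => ?_
          have := hZ u
          rwa [abs_of_nonneg hu.1] at this
      _ = C / δ * (Real.exp (δ * t) - 1) := by
          rw [intervalIntegral.integral_const_mul, intervalIntegral.integral_comp_mul_left _ hδ.ne', integral_exp]
          simp; field_simp
      _ ≤ _ := by gcongr; linarith
  have hB : |t * Real.log (t / (2 * Real.pi))| ≤ (2 * Real.pi + 2 / δ ^ 2) * Real.exp (δ * t) := by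
    have hle : |t * Real.log (t / (2 * Real.pi))| ≤ 2 * Real.pi + t ^ 2 := by
      rcases ht.eq_or_lt with rfl | ht
      · simp; positivity
      have hx : 0 < t / (2 * Real.pi) := by positivity
      have hl1 := Real.log_le_self hx.le
      have hl2 := Real.one_sub_inv_le_log_of_pos hx
      have ht2 : t / (2 * Real.pi) ≤ t := div_le_self ht.le (by linarith)
      rw [abs_le]; constructor
      · have : t * (1 - (t / (2 * Real.pi))⁻¹) = t - 2 * Real.pi := by field_simp
        nlinarith
      · nlinarith
    refine hle.trans ?_
    rw [add_mul]
    have : t ^ 2 ≤ 2 / δ ^ 2 * Real.exp (δ * t) := by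
      rw [div_mul_eq_mul_div, le_div_iff₀ (by positivity)]; nlinarith
    nlinarith
  have hD : |(2 * C0 - 1) * t| ≤ |2 * C0 - 1| / δ * Real.exp (δ * t) := by
    rw [abs_mul, abs_of_nonneg ht, div_mul_eq_mul_div, le_div_iff₀ hδ, mul_assoc]
    gcongr; linarith
  rw [Efun_eq]
  calc _ ≤ |(∫ u in (0:ℝ)..t, Zsq u) - t * Real.log (t / (2 * Real.pi))| + |(2 * C0 - 1) * t| :=
        abs_sub _ _
    _ ≤ _ := by
      have := abs_sub (∫ u in (0:ℝ)..t, Zsq u) (t * Real.log (t / (2 * Real.pi)))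
      linarith

lemma integrable_Efun_mul_exp {σ : ℝ} (hσ : 0 < σ) :
    IntegrableOn (fun t => |Efun t| * Real.exp (-(σ * t))) (Ioi 0) := by
  obtain ⟨C, hC, h⟩ := exists_Efun_le (δ := σ / 2) (by positivity)
  have hi : IntegrableOn (fun t => C * Real.exp (-(σ / 2) * t)) (Ioi 0) :=
    (exp_neg_integrableOn_Ioi 0 (by linarith : 0 < σ / 2)).const_mul C
  refine hi.mono' (by have := continuous_Efun; fun_prop) ?_
  filter_upwards [ae_restrict_mem measurableSet_Ioi] with t ht
  rw [Real.norm_of_nonneg (by positivity)]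
  calc _ ≤ C * Real.exp (σ / 2 * t) * Real.exp (-(σ * t)) := by gcongr; exact h t (le_of_lt ht)
    _ = _ := by rw [mul_assoc, ← Real.exp_add]; congr 2; ring

lemma integrable_Efun_sq_mul_exp {σ : ℝ} (hσ : 0 < σ) :
    IntegrableOn (fun t => |Efun t| ^ 2 * Real.exp (-(σ * t))) (Ioi 0) := by
  obtain ⟨C, hC, h⟩ := exists_Efun_le (δ := σ / 4) (by positivity)
  have hi : IntegrableOn (fun t => C ^ 2 * Real.exp (-(σ / 2) * t)) (Ioi 0) :=
    (exp_neg_integrableOn_Ioi 0 (by linarith : 0 < σ / 2)).const_mul _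
  refine hi.mono' (by have := continuous_Efun; fun_prop) ?_
  filter_upwards [ae_restrict_mem measurableSet_Ioi] with t ht
  rw [Real.norm_of_nonneg (by positivity)]
  calc _ ≤ (C * Real.exp (σ / 4 * t)) ^ 2 * Real.exp (-(σ * t)) := by gcongr; exact h t (le_of_lt ht)
    _ = _ := by rw [mul_pow, mul_assoc, ← Real.exp_nat_mul, ← Real.exp_add]; congr 2; push_cast; ring

lemma lapl_Efun {s : ℂ} (hs : 0 < s.re) :
    s * lapl (fun t => (Efun t : ℂ)) s = Lap s - 2 * Real.pi * Mfun s := by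
  have hs0 := ne_zero_of_re_pos hs
  have hpi := Real.pi_pos
  have hEc := continuous_Efun
  have hi1 : IntegrableOn (fun t : ℝ => (Efun t : ℂ) * Complex.exp (-(s * t))) (Ioi 0) := by
    refine (integrable_Efun_mul_exp hs).mono' (by fun_prop) (Eventually.of_forall fun t => ?_)
    rw [norm_mul, norm_exp_neg_mul_ofReal, Complex.norm_real, Real.norm_eq_abs]
  have hi2 : IntegrableOn (fun t : ℝ => (Zsq t : ℂ) * Complex.exp (-(s * t))) (Ioi 0) := by
    refine (integrable_Zsq_mul_exp hs).mono' (by have := continuous_Zsq; fun_prop)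
      (Eventually.of_forall fun t => ?_)
    rw [norm_mul, norm_exp_neg_mul_ofReal, Complex.norm_real, Real.norm_of_nonneg (Zsq_nonneg t)]
  obtain ⟨hi3, hlog⟩ := Laplace_log hs
  have hi4 : IntegrableOn (fun t : ℝ => Complex.exp (-(s * t))) (Ioi 0) := by
    have : IntegrableOn (fun t => Real.exp (-s.re * t)) (Ioi 0) :=
      exp_neg_integrableOn_Ioi 0 hs
    refine this.mono' (by fun_prop) (Eventually.of_forall fun t => ?_)
    rw [norm_exp_neg_mul_ofReal, neg_mul]
  have hexp : ∫ t in Ioi (0:ℝ), Complex.exp (-(s * t)) = 1 / s := by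
    have := integral_gammaKernel (a := 1) (by simp) hs
    simpa [Complex.cpow_neg_one] using this
  set κ : ℂ := (2 * Real.eulerMascheroniConstant - Real.log (2 * Real.pi) : ℂ) with hκ
  have hed : EqOn (fun t : ℝ => (edot t : ℂ) * Complex.exp (-(s * t)))
      (fun t => ((Zsq t : ℂ) * Complex.exp (-(s * t)) - (Real.log t : ℂ) * Complex.exp (-(s * t))) -
        κ * Complex.exp (-(s * t))) (Ioi 0) := by
    intro t ht
    simp only [edot]
    rw [Real.log_div (ne_of_gt ht) (by positivity), C0_eq, hκ]
    push_cast; ring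
  have hi5 : IntegrableOn (fun t : ℝ => (edot t : ℂ) * Complex.exp (-(s * t))) (Ioi 0) := by
    rw [integrableOn_congr_fun hed measurableSet_Ioi]
    exact (hi2.sub hi3).sub (hi4.const_mul κ)
  have hval : ∫ t in Ioi (0:ℝ), (edot t : ℂ) * Complex.exp (-(s * t)) =
      Lap s - 2 * Real.pi * Mfun s := by
    rw [setIntegral_congr_fun measurableSet_Ioi hed, integral_sub (f := fun t : ℝ => (Zsq t : ℂ) * Complex.exp (-(s * t)) -
        (Real.log t : ℂ) * Complex.exp (-(s * t))) (hi2.sub hi3) (hi4.const_mul κ),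
      integral_sub hi2 hi3, integral_const_mul, hexp, hlog, hκ]
    unfold Lap Mfun
    have hp : (Real.pi : ℂ) ≠ 0 := by exact_mod_cast Real.pi_pos.ne'
    field_simp
    ring
  have hF : ∀ t ∈ Ioi (0:ℝ), HasDerivAt (fun t : ℝ => (Efun t : ℂ) * Complex.exp (-(s * t)))
      ((edot t : ℂ) * Complex.exp (-(s * t)) - s * ((Efun t : ℂ) * Complex.exp (-(s * t)))) t := by
    intro t ht
    have h1 := (hasDerivAt_Efun ht).ofReal_comp
    have h2 : HasDerivAt (fun t : ℝ => Complex.exp (-(s * t))) (Complex.exp (-(s * t)) * (-s)) t := by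
      have : HasDerivAt (fun t : ℝ => -(s * (t:ℂ))) (-s) t := by
        have := ((hasDerivAt_id t).ofReal_comp.const_mul s).fun_neg
        simpa using this
      exact this.cexp
    refine (h1.fun_mul h2).congr_deriv ?_
    ring
  have hlim : Tendsto (fun t : ℝ => (Efun t : ℂ) * Complex.exp (-(s * t))) atTop (𝓝 0) := by
    obtain ⟨C, hC, h⟩ := exists_Efun_le (δ := s.re / 2) (by positivity)
    have hz : Tendsto (fun t : ℝ => C * Real.exp (-(s.re / 2 * t))) atTop (𝓝 0) := by
      rw [← mul_zero C]
      refine Tendsto.const_mul C (Real.tendsto_exp_neg_atTop_nhds_zero.comp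
        (tendsto_id.const_mul_atTop (by positivity)))
    refine squeeze_zero_norm' ?_ hz
    filter_upwards [eventually_ge_atTop 0] with t ht
    rw [norm_mul, norm_exp_neg_mul_ofReal, Complex.norm_real, Real.norm_eq_abs]
    calc _ ≤ C * Real.exp (s.re / 2 * t) * Real.exp (-(s.re * t)) := by gcongr; exact h t ht
      _ = _ := by rw [mul_assoc, ← Real.exp_add]; congr 2; ring
  have := integral_Ioi_of_hasDerivAt_of_tendsto (a := 0) (by fun_prop) hF
    (hi5.sub (hi1.const_mul s)) hlim
  rw [integral_sub hi5 (hi1.const_mul s), integral_const_mul, hval, Efun_zero] at this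
  unfold lapl
  simp only [Complex.ofReal_zero, zero_mul, sub_zero] at this
  linear_combination -this

end

section
open Set Filter Topology

lemma sq_integral_le {h : ℝ → ℝ} (hh : Continuous h) {a b : ℝ} (hab : a ≤ b) :
    (∫ v in a..b, h v) ^ 2 ≤ (b - a) * ∫ v in a..b, h v ^ 2 := by
  rcases hab.eq_or_lt with rfl | hlt
  · simp
  set A := ∫ v in a..b, h v with hA
  have hi : IntervalIntegrable h volume a b := hh.intervalIntegrable _ _
  have hi2 : IntervalIntegrable (fun v => h v ^ 2) volume a b := (hh.pow 2).intervalIntegrable _ _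
  have h0 : 0 ≤ ∫ v in a..b, ((b - a) * h v - A) ^ 2 :=
    intervalIntegral.integral_nonneg hab fun v _ => sq_nonneg _
  have h1 : ∫ v in a..b, ((b - a) * h v - A) ^ 2 =
      (b - a) ^ 2 * (∫ v in a..b, h v ^ 2) - 2 * (b - a) * A * A + A ^ 2 * (b - a) := by
    have : (fun v => ((b - a) * h v - A) ^ 2) =
        fun v => ((b - a) ^ 2 * h v ^ 2 - 2 * (b - a) * A * h v) + A ^ 2 := by
      ext v; ring
    rw [this, intervalIntegral.integral_add ((hi2.const_mul _).sub (hi.const_mul _)) (by simp),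
      intervalIntegral.integral_sub (hi2.const_mul _) (hi.const_mul _),
      intervalIntegral.integral_const_mul, intervalIntegral.integral_const_mul,
      intervalIntegral.integral_const, ← hA, smul_eq_mul]
    ring
  rw [h1] at h0
  have hL : 0 < b - a := sub_pos.2 hlt
  have : 0 ≤ (b - a) * ((b - a) * (∫ v in a..b, h v ^ 2) - A ^ 2) := by nlinarith
  have := nonneg_of_mul_nonneg_right this hL
  linarith

lemma norm_sq_le_sobolev {g g' : ℝ → ℂ} (hg : ∀ v, HasDerivAt g (g' v) v) (hg' : Continuous g')
    {y1 y y2 : ℝ} (h1 : y1 ≤ y) (h2 : y ≤ y2) :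
    ‖g y‖ ^ 2 ≤ 2 * ‖g y2‖ ^ 2 + 2 * (y2 - y1) * ∫ v in y1..y2, ‖g' v‖ ^ 2 := by
  have e : g y = g y2 - ∫ v in y..y2, g' v := by
    rw [intervalIntegral.integral_eq_sub_of_hasDerivAt (fun v _ => hg v)
      (hg'.intervalIntegrable _ _)]
    ring
  have hb : ‖∫ v in y..y2, g' v‖ ≤ ∫ v in y1..y2, ‖g' v‖ :=
    (intervalIntegral.norm_integral_le_integral_norm h2).trans
      (intervalIntegral.integral_mono_interval h1 h2 le_rfl
        (Eventually.of_forall fun v => norm_nonneg _) (hg'.norm.intervalIntegrable _ _))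
  have hc := sq_integral_le hg'.norm (h1.trans h2)
  have hn : ‖g y‖ ≤ ‖g y2‖ + ∫ v in y1..y2, ‖g' v‖ := by
    rw [e]; exact (norm_sub_le _ _).trans (by linarith)
  have := pow_le_pow_left₀ (norm_nonneg _) hn 2
  nlinarith [sq_nonneg (‖g y2‖ - ∫ v in y1..y2, ‖g' v‖)]

/-- A finite Dirichlet-type exponential sum. -/
noncomputable def psum (S : Finset ℕ) (a : ℕ → ℝ) (w : ℂ) : ℂ :=
  ∑ n ∈ S, (a n : ℂ) * Complex.exp (-(2 * Real.pi * n * w))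

lemma integral_exp_period (k : ℤ) (b : ℝ) (K : ℕ) :
    ∫ x in b..(b + K), Complex.exp ((2 * Real.pi * k * Complex.I) * (x : ℂ)) =
      if k = 0 then (K : ℂ) else 0 := by
  split_ifs with hk
  · subst hk; simp
  · have hne : (2 * Real.pi * k * Complex.I : ℂ) ≠ 0 := by
      simp [Real.pi_ne_zero, hk]
    rw [integral_exp_mul_complex hne]
    have : Complex.exp (2 * Real.pi * k * Complex.I * ((b + K : ℝ) : ℂ)) =
        Complex.exp (2 * Real.pi * k * Complex.I * (b : ℂ)) := by
      rw [Complex.exp_eq_exp_iff_exists_int]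
      exact ⟨k * K, by push_cast; ring⟩
    rw [this, sub_self, zero_div]

lemma parseval_psum (S : Finset ℕ) (a : ℕ → ℝ) (y b : ℝ) (K : ℕ) :
    ∫ x in b..(b + K), ‖psum S a (y + x * Complex.I)‖ ^ 2 =
      K * ∑ n ∈ S, a n ^ 2 * Real.exp (-(4 * Real.pi * n * y)) := by
  have hpt : ∀ x : ℝ, ((‖psum S a (y + x * Complex.I)‖ ^ 2 : ℝ) : ℂ) =
      ∑ m ∈ S, ∑ n ∈ S, ((a m * a n * Real.exp (-(2 * Real.pi * (m + n) * y)) : ℝ) : ℂ) *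
        Complex.exp ((2 * Real.pi * ((n - m : ℤ) : ℂ) * Complex.I) * (x : ℂ)) := by
    intro x
    rw [Complex.ofReal_pow, ← Complex.mul_conj', psum, map_sum, Finset.sum_mul_sum]
    refine Finset.sum_congr rfl fun m _ => Finset.sum_congr rfl fun n _ => ?_
    rw [map_mul, Complex.conj_ofReal, ← Complex.exp_conj]
    push_cast
    rw [show (a m : ℂ) * Complex.exp (-(2 * Real.pi * m * (y + x * Complex.I))) *
      (a n * Complex.exp ((starRingEnd ℂ) (-(2 * Real.pi * n * (y + x * Complex.I))))) =
      a m * a n * (Complex.exp (-(2 * Real.pi * m * (y + x * Complex.I))) *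
        Complex.exp ((starRingEnd ℂ) (-(2 * Real.pi * n * (y + x * Complex.I))))) by ring,
      ← Complex.exp_add, mul_assoc _ (Complex.exp _), ← Complex.exp_add]
    congr 2
    simp [Complex.conj_ofNat]
    ring
  have hc : ((∫ x in b..(b + K), ‖psum S a (y + x * Complex.I)‖ ^ 2 : ℝ) : ℂ) =
      ((K * ∑ n ∈ S, a n ^ 2 * Real.exp (-(4 * Real.pi * n * y)) : ℝ) : ℂ) := by
    rw [← intervalIntegral.integral_ofReal, intervalIntegral.integral_congr fun x _ => hpt x,
      intervalIntegral.integral_finsetSum fun m _ => Continuous.intervalIntegrable (by fun_prop) _ _]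
    rw [Finset.mul_sum, Complex.ofReal_sum]
    refine Finset.sum_congr rfl fun m hm => ?_
    rw [intervalIntegral.integral_finsetSum
      fun m _ => Continuous.intervalIntegrable (by fun_prop) _ _]
    rw [Finset.sum_eq_single m]
    · rw [intervalIntegral.integral_const_mul, integral_exp_period]
      simp only [sub_self, if_true]
      rw [show -(2 * Real.pi * ((m : ℝ) + m) * y) = -(4 * Real.pi * m * y) by ring]
      push_cast; ring
    · intro n _ hne
      rw [intervalIntegral.integral_const_mul, integral_exp_period, if_neg, mul_zero]
      intro h; apply hne; omega
    · exact fun h => absurd hm h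
  exact_mod_cast hc

lemma hasDerivAt_psum (S : Finset ℕ) (a : ℕ → ℝ) (x v : ℝ) :
    HasDerivAt (fun v : ℝ => psum S a (v + x * Complex.I))
      (psum S (fun n => -(2 * Real.pi * n * a n)) (v + x * Complex.I)) v := by
  unfold psum
  refine HasDerivAt.fun_sum fun n _ => ?_
  have h1 : HasDerivAt (fun v : ℝ => -(2 * Real.pi * n * ((v : ℂ) + x * Complex.I)))
      (-(2 * Real.pi * n)) v := by
    have := (((hasDerivAt_id v).ofReal_comp.add_const (x * Complex.I : ℂ)).const_mul
      (2 * Real.pi * n : ℂ)).fun_neg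
    simpa using this
  refine (h1.cexp.const_mul (a n : ℂ)).congr_deriv ?_
  push_cast; ring

@[fun_prop]
lemma continuous_psum (S : Finset ℕ) (a : ℕ → ℝ) : Continuous (psum S a) := by
  unfold psum; fun_prop

lemma sq_mul_exp_le {z : ℝ} (hz : 0 ≤ z) : z ^ 2 * Real.exp (-(2 * z)) ≤ Real.exp (-z) := by
  have h := Real.quadratic_le_exp_of_nonneg hz
  have h3 : z ^ 2 ≤ Real.exp z := by
    have h2 := Real.sum_le_exp_of_nonneg hz 4
    simp [Finset.sum_range_succ, Nat.factorial] at h2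
    nlinarith [sq_nonneg (z - 3), sq_nonneg z, mul_nonneg hz (sq_nonneg (z-3/2)), mul_nonneg hz (sq_nonneg (z-2))]
  calc z ^ 2 * Real.exp (-(2 * z)) ≤ Real.exp z * Real.exp (-(2 * z)) := by gcongr
    _ = Real.exp (-z) := by rw [← Real.exp_add]; ring_nf

lemma curve_bound (S : Finset ℕ) (a : ℕ → ℝ) {y x x' : ℝ → ℝ} {τ1 τ2 y1 κ : ℝ} {K : ℕ}
    (hτ : τ1 ≤ τ2) (hy1 : 0 < y1) (hκ : 1 ≤ κ) (hy : ContinuousOn y (Icc τ1 τ2))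
    (hyl : ∀ τ ∈ Icc τ1 τ2, y1 ≤ y τ) (hyu : ∀ τ ∈ Icc τ1 τ2, y τ ≤ κ * y1)
    (hx : ∀ τ ∈ Icc τ1 τ2, HasDerivAt x (x' τ) τ) (hx' : ContinuousOn x' (Icc τ1 τ2))
    (hx0 : ∀ τ ∈ Icc τ1 τ2, 0 ≤ x' τ) (hK : x τ2 - x τ1 ≤ K) :
    ∫ τ in τ1..τ2, ‖psum S a (y τ + x τ * Complex.I)‖ ^ 2 * x' τ ≤
      2 * K * (1 + (κ - 1) ^ 2) * ∑ n ∈ S, a n ^ 2 * Real.exp (-(2 * Real.pi * n * y1)) := by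
  have hu : uIcc τ1 τ2 = Icc τ1 τ2 := uIcc_of_le hτ
  have hxc : ContinuousOn x (Icc τ1 τ2) := fun τ h => (hx τ h).continuousAt.continuousWithinAt
  set b := fun n : ℕ => -(2 * Real.pi * n * a n) with hb
  have hy12 : y1 ≤ κ * y1 := by nlinarith
  have hxm : x τ1 ≤ x τ2 := by
    have := intervalIntegral.integral_eq_sub_of_hasDerivAt (f := x) (f' := x') (a := τ1) (b := τ2)
      (by rwa [hu]) (ContinuousOn.intervalIntegrable (by rwa [hu]))
    have h0 := intervalIntegral.integral_nonneg (μ := volume) hτ hx0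
    linarith
  have key : ∀ (c : ℕ → ℝ) (v : ℝ), ∫ τ in τ1..τ2, ‖psum S c (v + x τ * Complex.I)‖ ^ 2 * x' τ ≤
      K * ∑ n ∈ S, c n ^ 2 * Real.exp (-(4 * Real.pi * n * v)) := by
    intro c v
    have hs := intervalIntegral.integral_comp_mul_deriv (a := τ1) (b := τ2) (f := x) (f' := x')
      (g := fun x : ℝ => ‖psum S c (v + x * Complex.I)‖ ^ 2) (by rwa [hu]) (by rwa [hu])
      (by fun_prop)
    simp only [Function.comp_def] at hs
    rw [hs, ← parseval_psum S c v (x τ1) K]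
    exact intervalIntegral.integral_mono_interval le_rfl hxm (by linarith)
      (Eventually.of_forall fun v => by positivity)
      (Continuous.intervalIntegrable (by fun_prop) _ _)
  have hcon : ContinuousOn (fun p : ℝ × ℝ => ‖psum S b (p.2 + x p.1 * Complex.I)‖ ^ 2 * x' p.1)
      (Icc τ1 τ2 ×ˢ Icc y1 (κ * y1)) := by
    have h1 : ContinuousOn (fun p : ℝ × ℝ => x p.1) (Icc τ1 τ2 ×ˢ Icc y1 (κ * y1)) :=
      hxc.comp continuousOn_fst fun p hp => hp.1
    have h2 : ContinuousOn (fun p : ℝ × ℝ => x' p.1) (Icc τ1 τ2 ×ˢ Icc y1 (κ * y1)) :=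
      hx'.comp continuousOn_fst fun p hp => hp.1
    refine ContinuousOn.mul (((continuous_psum S b).comp_continuousOn ?_).norm.pow 2) h2
    exact (Complex.continuous_ofReal.comp_continuousOn continuousOn_snd).add
      ((Complex.continuous_ofReal.comp_continuousOn h1).mul continuousOn_const)
  have hintg : IntegrableOn (fun p : ℝ × ℝ => ‖psum S b (p.2 + x p.1 * Complex.I)‖ ^ 2 * x' p.1)
      (Icc τ1 τ2 ×ˢ Icc y1 (κ * y1)) (volume.prod volume) :=
    hcon.integrableOn_compact (isCompact_Icc.prod isCompact_Icc)
  have hswap := intervalIntegral_intervalIntegral_swap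
    (F := fun τ v : ℝ => ‖psum S b (v + x τ * Complex.I)‖ ^ 2 * x' τ) (a := τ1) (b := τ2)
    (c := y1) (d := κ * y1) (by
      rw [uIoc_of_le hτ, uIoc_of_le hy12]
      exact hintg.mono_set (prod_mono Ioc_subset_Icc_self Ioc_subset_Icc_self))
  have hxcc : ContinuousOn (fun τ => (x τ : ℂ)) (Icc τ1 τ2) :=
    Complex.continuous_ofReal.comp_continuousOn hxc
  have hyc : ContinuousOn (fun τ => (y τ : ℂ)) (Icc τ1 τ2) :=
    Complex.continuous_ofReal.comp_continuousOn hy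
  have hI0 : IntervalIntegrable (fun τ => ‖psum S a (y τ + x τ * Complex.I)‖ ^ 2 * x' τ)
      volume τ1 τ2 := by
    refine ContinuousOn.intervalIntegrable ?_
    rw [hu]
    exact (((continuous_psum S a).comp_continuousOn
      (hyc.add (hxcc.mul continuousOn_const))).norm.pow 2).mul hx'
  have hI1 : IntervalIntegrable (fun τ => ‖psum S a ((κ * y1 : ℝ) + x τ * Complex.I)‖ ^ 2 * x' τ)
      volume τ1 τ2 := by
    refine ContinuousOn.intervalIntegrable ?_
    rw [hu]
    exact (((continuous_psum S a).comp_continuousOn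
      (continuousOn_const.add (hxcc.mul continuousOn_const))).norm.pow 2).mul hx'
  have hI2 : IntervalIntegrable (fun τ => ∫ v in y1..(κ * y1),
      ‖psum S b (v + x τ * Complex.I)‖ ^ 2 * x' τ) volume τ1 τ2 := by
    rw [intervalIntegrable_iff_integrableOn_Ioc_of_le hτ]
    have h := (hintg.mono_set (prod_mono Ioc_subset_Icc_self Ioc_subset_Icc_self :
      Ioc τ1 τ2 ×ˢ Ioc y1 (κ * y1) ⊆ _))
    rw [IntegrableOn, ← Measure.prod_restrict] at h
    simpa only [intervalIntegral.integral_of_le hy12, IntegrableOn] using h.integral_prod_left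
  have hE : ∀ v ≥ y1, ∑ n ∈ S, b n ^ 2 * Real.exp (-(4 * Real.pi * n * v)) ≤
      (1 / y1 ^ 2) * ∑ n ∈ S, a n ^ 2 * Real.exp (-(2 * Real.pi * n * y1)) := by
    intro v hv
    rw [Finset.mul_sum]
    refine Finset.sum_le_sum fun n _ => ?_
    have hz : (0:ℝ) ≤ 2 * Real.pi * n * y1 := by positivity
    have h1 := sq_mul_exp_le hz
    have h2 : Real.exp (-(4 * Real.pi * n * v)) ≤ Real.exp (-(2 * (2 * Real.pi * n * y1))) := by
      apply Real.exp_le_exp.2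
      have : (4 * Real.pi * n) * y1 ≤ 4 * Real.pi * n * v := by gcongr
      linarith
    calc b n ^ 2 * Real.exp (-(4 * Real.pi * n * v))
        ≤ b n ^ 2 * Real.exp (-(2 * (2 * Real.pi * n * y1))) := by gcongr
      _ = a n ^ 2 / y1 ^ 2 * ((2 * Real.pi * n * y1) ^ 2 * Real.exp (-(2 * (2 * Real.pi * n * y1)))) := by
        simp only [hb]; field_simp
      _ ≤ a n ^ 2 / y1 ^ 2 * Real.exp (-(2 * Real.pi * n * y1)) := by gcongr
      _ = _ := by ring
  set A := ∑ n ∈ S, a n ^ 2 * Real.exp (-(2 * Real.pi * n * y1)) with hA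
  have hA0 : 0 ≤ A := by positivity
  have hE0 : ∑ n ∈ S, a n ^ 2 * Real.exp (-(4 * Real.pi * n * (κ * y1))) ≤ A := by
    refine Finset.sum_le_sum fun n _ => ?_
    gcongr
    have : (2 * Real.pi * n) * y1 ≤ 2 * Real.pi * n * (κ * y1) := by gcongr
    have : (0:ℝ) ≤ 2 * Real.pi * n * (κ * y1) := by positivity
    linarith
  calc ∫ τ in τ1..τ2, ‖psum S a (y τ + x τ * Complex.I)‖ ^ 2 * x' τ
      ≤ ∫ τ in τ1..τ2, (2 * (‖psum S a ((κ * y1 : ℝ) + x τ * Complex.I)‖ ^ 2 * x' τ) +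
        2 * (κ * y1 - y1) * ∫ v in y1..(κ * y1), ‖psum S b (v + x τ * Complex.I)‖ ^ 2 * x' τ) := by
        refine intervalIntegral.integral_mono_on hτ hI0 ((hI1.const_mul 2).add (hI2.const_mul _))
          fun τ h => ?_
        have hs := norm_sq_le_sobolev (hasDerivAt_psum S a (x τ)) (by fun_prop) (hyl τ h) (hyu τ h)
        have := mul_le_mul_of_nonneg_right hs (hx0 τ h)
        rw [intervalIntegral.integral_mul_const]
        refine this.trans (le_of_eq ?_)
        ring
    _ = 2 * (∫ τ in τ1..τ2, ‖psum S a ((κ * y1 : ℝ) + x τ * Complex.I)‖ ^ 2 * x' τ) +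
        2 * (κ * y1 - y1) * ∫ v in y1..(κ * y1), ∫ τ in τ1..τ2,
          ‖psum S b (v + x τ * Complex.I)‖ ^ 2 * x' τ := by
        rw [intervalIntegral.integral_add (hI1.const_mul 2) (hI2.const_mul _),
          intervalIntegral.integral_const_mul, intervalIntegral.integral_const_mul, hswap]
    _ ≤ 2 * (K * A) + 2 * (κ * y1 - y1) * (K * (1 / y1 ^ 2 * A) * (κ * y1 - y1)) := by
        have hk1 := (key a (κ * y1)).trans (mul_le_mul_of_nonneg_left hE0 (Nat.cast_nonneg K))
        have hk2 : ∫ v in y1..(κ * y1), ∫ τ in τ1..τ2,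
            ‖psum S b (v + x τ * Complex.I)‖ ^ 2 * x' τ ≤
            ∫ v in y1..(κ * y1), (K * (1 / y1 ^ 2 * A)) := by
          have hii : IntervalIntegrable (fun v => ∫ τ in τ1..τ2,
              ‖psum S b (v + x τ * Complex.I)‖ ^ 2 * x' τ) volume y1 (κ * y1) := by
            rw [intervalIntegrable_iff_integrableOn_Ioc_of_le hy12]
            have h := (hintg.mono_set (prod_mono Ioc_subset_Icc_self Ioc_subset_Icc_self :
              Ioc τ1 τ2 ×ˢ Ioc y1 (κ * y1) ⊆ _))
            rw [IntegrableOn, ← Measure.prod_restrict] at h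
            simpa only [intervalIntegral.integral_of_le hτ, IntegrableOn] using h.integral_prod_right
          refine intervalIntegral.integral_mono_on hy12 hii (by simp) fun v hv => ?_
          exact (key b v).trans (mul_le_mul_of_nonneg_left (hE v hv.1) (Nat.cast_nonneg K))
        rw [intervalIntegral.integral_const, smul_eq_mul] at hk2
        have : 0 ≤ 2 * (κ * y1 - y1) := by linarith
        have h3 := mul_le_mul_of_nonneg_left hk2 this
        linarith
    _ = 2 * K * (1 + (κ - 1) ^ 2) * A := by field_simp

end

section
open Set Filter Topology

/-- The full exponential series with coefficients `a`. -/
noncomputable def tser (a : ℕ → ℝ) (w : ℂ) : ℂ :=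
  ∑' n : ℕ, (a n : ℂ) * Complex.exp (-(2 * Real.pi * n * w))

lemma norm_tser_term (c : ℝ) (n : ℕ) (w : ℂ) :
    ‖(c : ℂ) * Complex.exp (-(2 * Real.pi * n * w))‖ = |c| * Real.exp (-(2 * Real.pi * n * w.re)) := by
  rw [norm_mul, Complex.norm_real, Real.norm_eq_abs, Complex.norm_exp]
  congr 2
  simp [Complex.mul_re]

lemma summable_abs_exp {a : ℕ → ℝ} (ha : ∀ n, |a n| ≤ dd n) {y : ℝ} (hy : 0 < y) :
    Summable fun n : ℕ => |a n| * Real.exp (-(2 * Real.pi * n * y)) := by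
  refine Summable.of_nonneg_of_le (fun n => by positivity) (fun n => ?_)
    (Real.summable_pow_mul_exp_neg_nat_mul 1 (r := 2 * Real.pi * y) (by positivity))
  rw [pow_one, show -(2 * Real.pi * n * y) = -(2 * Real.pi * y) * n by ring]
  gcongr
  exact (ha n).trans (dd_le_self n)

lemma summable_sq_exp {a : ℕ → ℝ} (ha : ∀ n, |a n| ≤ dd n) {y : ℝ} (hy : 0 < y) :
    Summable fun n : ℕ => a n ^ 2 * Real.exp (-(2 * Real.pi * n * y)) := by
  refine Summable.of_nonneg_of_le (fun n => by positivity) (fun n => ?_)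
    (Real.summable_pow_mul_exp_neg_nat_mul 2 (r := 2 * Real.pi * y) (by positivity))
  rw [show -(2 * Real.pi * n * y) = -(2 * Real.pi * y) * n by ring, ← sq_abs]
  gcongr
  exact (ha n).trans (dd_le_self n)

lemma summable_tser {a : ℕ → ℝ} (ha : ∀ n, |a n| ≤ dd n) {w : ℂ} (hw : 0 < w.re) :
    Summable fun n : ℕ => (a n : ℂ) * Complex.exp (-(2 * Real.pi * n * w)) := by
  refine Summable.of_norm ?_
  simpa only [norm_tser_term] using summable_abs_exp ha hw

lemma norm_tser_le {a : ℕ → ℝ} (ha : ∀ n, |a n| ≤ dd n) {w : ℂ} (hw : 0 < w.re) :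
    ‖tser a w‖ ≤ ∑' n : ℕ, |a n| * Real.exp (-(2 * Real.pi * n * w.re)) := by
  have h : Summable fun n : ℕ => ‖(a n : ℂ) * Complex.exp (-(2 * Real.pi * n * w))‖ := by
    simpa only [norm_tser_term] using summable_abs_exp ha hw
  refine (norm_tsum_le_tsum_norm h).trans (le_of_eq ?_)
  simp only [norm_tser_term]

lemma curve_bound_tsum {a : ℕ → ℝ} (ha : ∀ n, |a n| ≤ dd n) {y x x' : ℝ → ℝ} {τ1 τ2 y1 κ : ℝ} {K : ℕ}
    (hτ : τ1 ≤ τ2) (hy1 : 0 < y1) (hκ : 1 ≤ κ) (hy : ContinuousOn y (Icc τ1 τ2))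
    (hyl : ∀ τ ∈ Icc τ1 τ2, y1 ≤ y τ) (hyu : ∀ τ ∈ Icc τ1 τ2, y τ ≤ κ * y1)
    (hx : ∀ τ ∈ Icc τ1 τ2, HasDerivAt x (x' τ) τ) (hx' : ContinuousOn x' (Icc τ1 τ2))
    (hx0 : ∀ τ ∈ Icc τ1 τ2, 0 ≤ x' τ) (hK : x τ2 - x τ1 ≤ K) :
    ∫ τ in τ1..τ2, ‖tser a (y τ + x τ * Complex.I)‖ ^ 2 * x' τ ≤
      2 * K * (1 + (κ - 1) ^ 2) * ∑' n, a n ^ 2 * Real.exp (-(2 * Real.pi * n * y1)) := by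
  have hxc : ContinuousOn x (Icc τ1 τ2) := fun τ h => (hx τ h).continuousAt.continuousWithinAt
  have hxcc : ContinuousOn (fun τ => (x τ : ℂ)) (Icc τ1 τ2) :=
    Complex.continuous_ofReal.comp_continuousOn hxc
  have hyc : ContinuousOn (fun τ => (y τ : ℂ)) (Icc τ1 τ2) :=
    Complex.continuous_ofReal.comp_continuousOn hy
  have hre : ∀ τ, ((y τ : ℂ) + x τ * Complex.I).re = y τ := fun τ => by simp
  set B := ∑' n : ℕ, |a n| * Real.exp (-(2 * Real.pi * n * y1)) with hB
  have hlim : Tendsto (fun M => ∫ τ in τ1..τ2,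
      ‖psum (Finset.range M) a (y τ + x τ * Complex.I)‖ ^ 2 * x' τ) atTop
      (𝓝 (∫ τ in τ1..τ2, ‖tser a (y τ + x τ * Complex.I)‖ ^ 2 * x' τ)) := by
    refine intervalIntegral.tendsto_integral_filter_of_dominated_convergence
      (fun τ => B ^ 2 * x' τ) ?_ ?_ ?_ ?_
    · refine Eventually.of_forall fun M => ?_
      rw [uIoc_of_le hτ]
      refine (ContinuousOn.aestronglyMeasurable ?_ measurableSet_Icc).mono_measure
        (Measure.restrict_mono Ioc_subset_Icc_self le_rfl)
      exact (((continuous_psum _ a).comp_continuousOn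
        (hyc.add (hxcc.mul continuousOn_const))).norm.pow 2).mul hx'
    · refine Eventually.of_forall fun M => Eventually.of_forall fun τ h => ?_
      rw [uIoc_of_le hτ] at h
      have h := Ioc_subset_Icc_self h
      have h0 := hx0 τ h
      rw [norm_mul, norm_pow, norm_norm, Real.norm_of_nonneg h0]
      gcongr
      refine (norm_sum_le _ _).trans ?_
      simp only [norm_tser_term, hre]
      refine le_trans (Finset.sum_le_sum fun n _ => ?_)
        ((summable_abs_exp ha hy1).sum_le_tsum _ fun n _ => by positivity)
      gcongr
      exact hyl τ h
    · refine ContinuousOn.intervalIntegrable ?_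
      rw [uIcc_of_le hτ]
      exact continuousOn_const.mul hx'
    · refine Eventually.of_forall fun τ h => ?_
      rw [uIoc_of_le hτ] at h
      have h := Ioc_subset_Icc_self h
      have hs := (summable_tser ha (w := (y τ : ℂ) + x τ * Complex.I)
        (by rw [hre]; exact hy1.trans_le (hyl τ h))).hasSum.tendsto_sum_nat
      exact (hs.norm.pow 2).mul_const _
  refine le_of_tendsto hlim (Eventually.of_forall fun M => ?_)
  refine (curve_bound _ a hτ hy1 hκ hy hyl hyu hx hx' hx0 hK).trans ?_
  gcongr
  exact (summable_sq_exp ha hy1).sum_le_tsum _ fun n _ => by positivity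

lemma continuousOn_tser {a : ℕ → ℝ} (ha : ∀ n, |a n| ≤ dd n) :
    ContinuousOn (tser a) {w | 0 < w.re} := by
  intro w hw
  have hw : 0 < w.re := hw
  have hU : {z : ℂ | w.re / 2 < z.re} ∈ 𝓝 w :=
    (isOpen_lt continuous_const Complex.continuous_re).mem_nhds (by simp; linarith)
  refine ContinuousAt.continuousWithinAt ?_
  refine ContinuousOn.continuousAt ?_ hU
  unfold tser
  refine continuousOn_tsum (u := fun n : ℕ => |a n| * Real.exp (-(2 * Real.pi * n * (w.re / 2))))
    (fun n => by fun_prop) (summable_abs_exp ha (by positivity)) fun n z hz => ?_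
  rw [norm_tser_term]
  gcongr
  exact (le_of_lt hz)

lemma exp_neg_le_rpow {p : ℝ} (hp : 0 < p) : ∃ C, 0 < C ∧ ∀ z > 0, Real.exp (-z) ≤ C * z ^ (-p) := by
  obtain ⟨k, hk⟩ := exists_nat_gt p
  refine ⟨(k.factorial : ℝ) + 1, by positivity, fun z hz => ?_⟩
  have hzp : 0 < z ^ p := Real.rpow_pos_of_pos hz p
  rw [Real.rpow_neg hz.le, ← div_eq_mul_inv, le_div_iff₀ hzp]
  rcases le_total z 1 with h | h
  · have h1 : z ^ p ≤ 1 := Real.rpow_le_one hz.le h hp.le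
    have h2 : Real.exp (-z) ≤ 1 := Real.exp_le_one_iff.2 (by linarith)
    have : Real.exp (-z) * z ^ p ≤ 1 := mul_le_one₀ h2 hzp.le h1
    have : (0:ℝ) ≤ k.factorial := by positivity
    linarith
  · have h1 : z ^ p ≤ z ^ k := by
      rw [← Real.rpow_natCast]
      exact Real.rpow_le_rpow_of_exponent_le h hk.le
    have h2 := Real.pow_div_factorial_le_exp z hz.le k
    rw [div_le_iff₀ (by positivity)] at h2
    rw [Real.exp_neg, inv_mul_le_iff₀ (Real.exp_pos z)]
    nlinarith [Real.exp_pos z]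

lemma integral_Dser_wpt_le : ∃ C, 0 < C ∧ ∀ σ : ℝ, 0 < σ → σ ≤ 1 → ∀ m : ℕ,
    ∫ τ in (0:ℝ)..(m * Real.log 2), ‖Dser (wpt (σ + τ * Complex.I))‖ ^ 2 * Real.exp τ ≤
      C * σ ^ (-(5 / 4 : ℝ)) := by
  obtain ⟨C1, hC1, hexp⟩ := exp_neg_le_rpow (p := 5 / 4) (by norm_num)
  set Z := ∑' n : ℕ, dd n ^ 2 * (n : ℝ) ^ (-(5 / 4 : ℝ)) with hZ
  have hsum := summable_dd_sq_rpow (x := 5 / 4) (by norm_num)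
  have hZ0 : 0 ≤ Z := tsum_nonneg fun n => by positivity
  set r : ℝ := 2 ^ (-(1 / 4 : ℝ)) with hr
  have hr0 : 0 < r := by positivity
  have hr1 : r < 1 := Real.rpow_lt_one_of_one_lt_of_neg (by norm_num) (by norm_num)
  have hgeo : Summable fun k : ℕ => r ^ k := summable_geometric_of_lt_one hr0.le hr1
  refine ⟨80 * C1 * (Z + 1) * (∑' k : ℕ, r ^ k) + 1, ?_, fun σ hσ hσ1 m => ?_⟩
  · have : 0 ≤ ∑' k : ℕ, r ^ k := tsum_nonneg fun n => by positivity
    positivity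
  have hsin : σ / 2 ≤ Real.sin σ := by
    have := Real.sin_gt_sub_cube hσ
    have h3 : σ ^ 3 ≤ σ := by nlinarith [pow_le_one₀ (n := 2) hσ.le hσ1]
    linarith
  have hcos : 1 / 2 ≤ Real.cos σ := by
    have := Real.one_sub_sq_div_two_le_cos (x := σ)
    nlinarith
  have hy : ∀ τ : ℝ, wpt (σ + τ * Complex.I) =
      ((Real.exp τ * Real.sin σ : ℝ) : ℂ) + ((Real.exp τ * Real.cos σ : ℝ) : ℂ) * Complex.I := by
    intro τ
    apply Complex.ext
    · rw [wpt_re]; simp [-Complex.ofReal_mul]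
    · rw [wpt_im]; simp [-Complex.ofReal_mul]
  have hpos : ∀ τ : ℝ, 0 < (wpt (σ + τ * Complex.I)).re := fun τ =>
    wpt_re_pos (by simpa using hσ) (by simp; linarith [Real.pi_gt_three])
  have hL : 0 < Real.log 2 := Real.log_pos (by norm_num)
  have hpiece : ∀ k : ℕ, ∫ τ in (k * Real.log 2)..((k + 1 : ℕ) * Real.log 2),
      ‖Dser (wpt (σ + τ * Complex.I))‖ ^ 2 * Real.exp τ ≤ 80 * C1 * Z * r ^ k * σ ^ (-(5 / 4 : ℝ)) := by
    intro k
    have e1 : Real.exp (k * Real.log 2) = 2 ^ k := by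
      rw [mul_comm, Real.exp_mul, Real.exp_log (by norm_num), Real.rpow_natCast]
    have e2 : Real.exp ((k + 1 : ℕ) * Real.log 2) = 2 ^ (k + 1) := by
      rw [mul_comm, Real.exp_mul, Real.exp_log (by norm_num), Real.rpow_natCast]
    have hmono : k * Real.log 2 ≤ (k + 1 : ℕ) * Real.log 2 := by push_cast; nlinarith
    have hb : ∀ τ ∈ Icc (k * Real.log 2) ((k + 1 : ℕ) * Real.log 2),
        2 ^ k ≤ Real.exp τ ∧ Real.exp τ ≤ 2 ^ (k + 1) := by
      intro τ h
      rw [← e1, ← e2]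
      exact ⟨Real.exp_le_exp.2 h.1, Real.exp_le_exp.2 h.2⟩
    have hc := curve_bound_tsum (a := dd) (fun n => (abs_of_nonneg (dd_nonneg n)).le)
      (y := fun τ => Real.exp τ * Real.sin σ) (x := fun τ => Real.exp τ * Real.cos σ)
      (x' := fun τ => Real.exp τ * Real.cos σ) (κ := 4) (y1 := 2 ^ k * (σ / 2)) (K := 2 ^ (k+1))
      hmono (by positivity) (by norm_num) (by fun_prop)
      (fun τ h => by have := (hb τ h).1; gcongr)
      (fun τ h => ?_)
      (fun τ h => (Real.hasDerivAt_exp τ).mul_const _) (by fun_prop)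
      (fun τ h => by positivity) ?_
    rotate_left
    · have := (hb τ h).2
      have h3 : Real.sin σ ≤ σ := Real.sin_le hσ.le
      calc Real.exp τ * Real.sin σ ≤ 2 ^ (k + 1) * σ := by
            apply mul_le_mul this h3 (by linarith) (by positivity)
        _ = 4 * (2 ^ k * (σ / 2)) := by ring
    · simp only [e1, e2]
      have : Real.cos σ ≤ 1 := Real.cos_le_one σ
      have h2 : (0:ℝ) < 2 ^ k := by positivity
      push_cast
      rw [pow_succ]; nlinarith
    have hlow : (∫ τ in (k * Real.log 2)..((k + 1 : ℕ) * Real.log 2),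
        ‖Dser (wpt (σ + τ * Complex.I))‖ ^ 2 * Real.exp τ) ≤
        2 * ∫ τ in (k * Real.log 2)..((k + 1 : ℕ) * Real.log 2),
        ‖Dser (wpt (σ + τ * Complex.I))‖ ^ 2 * (Real.exp τ * Real.cos σ) := by
      simp only [← mul_assoc]
      rw [intervalIntegral.integral_mul_const, ← mul_assoc, mul_comm 2, mul_assoc]
      refine le_mul_of_one_le_right ?_ (by linarith)
      exact intervalIntegral.integral_nonneg hmono fun τ _ => by positivity
    have hZk : ∑' n : ℕ, dd n ^ 2 * Real.exp (-(2 * Real.pi * n * (2 ^ k * (σ / 2)))) ≤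
        C1 * ((2 ^ k * σ) ^ (-(5 / 4 : ℝ))) * Z := by
      rw [hZ, ← tsum_mul_left]
      refine Summable.tsum_le_tsum (fun n => ?_) (summable_sq_exp
        (fun n => (abs_of_nonneg (dd_nonneg n)).le) (by positivity)) (hsum.mul_left _)
      rcases Nat.eq_zero_or_pos n with rfl | hn
      · simp [dd_zero]
      have hn' : (0:ℝ) < n := by exact_mod_cast hn
      have h1 := hexp (n * (2 ^ k * σ)) (by positivity)
      rw [Real.mul_rpow hn'.le (by positivity)] at h1
      have h2 : Real.exp (-(2 * Real.pi * n * (2 ^ k * (σ / 2)))) ≤ Real.exp (-(n * (2 ^ k * σ))) := by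
        apply Real.exp_le_exp.2
        have : 1 * (n * (2 ^ k * σ)) ≤ Real.pi * (n * (2 ^ k * σ)) := by
          gcongr; linarith [Real.pi_gt_three]
        linarith
      calc dd n ^ 2 * Real.exp (-(2 * Real.pi * n * (2 ^ k * (σ / 2))))
          ≤ dd n ^ 2 * (C1 * ((n:ℝ) ^ (-(5 / 4 : ℝ)) * (2 ^ k * σ) ^ (-(5 / 4 : ℝ)))) := by
            gcongr; exact h2.trans h1
        _ = _ := by ring
    have hpw : (2 : ℝ) ^ k * (2 ^ k * σ) ^ (-(5 / 4 : ℝ)) = r ^ k * σ ^ (-(5 / 4 : ℝ)) := by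
      rw [Real.mul_rpow (by positivity) hσ.le, ← mul_assoc, hr]
      congr 1
      rw [← Real.rpow_natCast, ← Real.rpow_natCast, ← Real.rpow_mul (by norm_num),
        ← Real.rpow_mul (by norm_num), ← Real.rpow_add (by norm_num)]
      congr 1; ring
    have hid : (∫ τ in (k * Real.log 2)..((k + 1 : ℕ) * Real.log 2),
        ‖Dser (wpt (σ + τ * Complex.I))‖ ^ 2 * (Real.exp τ * Real.cos σ)) ≤
        2 * ((2 ^ (k + 1) : ℕ) : ℝ) * (1 + (4 - 1) ^ 2) *
          ∑' n : ℕ, dd n ^ 2 * Real.exp (-(2 * Real.pi * n * (2 ^ k * (σ / 2)))) := by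
      refine le_trans (le_of_eq ?_) hc
      refine intervalIntegral.integral_congr fun τ _ => ?_
      simp only [hy τ]; rfl
    calc _ ≤ _ := hlow
      _ ≤ 2 * (2 * ((2 ^ (k + 1) : ℕ) : ℝ) * (1 + (4 - 1) ^ 2) *
          (C1 * ((2 ^ k * σ) ^ (-(5 / 4 : ℝ))) * Z)) := by
          refine mul_le_mul_of_nonneg_left (hid.trans ?_) (by norm_num)
          exact mul_le_mul_of_nonneg_left hZk (by positivity)
      _ = 80 * C1 * Z * (2 ^ k * (2 ^ k * σ) ^ (-(5 / 4 : ℝ))) := by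
          push_cast; ring
      _ = _ := by rw [hpw]; ring
  have hcont : Continuous fun τ : ℝ => ‖Dser (wpt (σ + τ * Complex.I))‖ ^ 2 * Real.exp τ := by
    have h : Continuous fun τ : ℝ => Dser (wpt (σ + τ * Complex.I)) :=
      (continuousOn_tser (a := dd) fun n => (abs_of_nonneg (dd_nonneg n)).le).comp_continuous
        (by unfold wpt; fun_prop) hpos
    fun_prop
  have hadd := intervalIntegral.sum_integral_adjacent_intervals (n := m) (μ := volume)
    (a := fun k : ℕ => (k : ℝ) * Real.log 2)
    (f := fun τ : ℝ => ‖Dser (wpt (σ + τ * Complex.I))‖ ^ 2 * Real.exp τ)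
    (fun k _ => hcont.intervalIntegrable _ _)
  simp only [Nat.cast_zero, zero_mul] at hadd
  rw [← hadd]
  have hσp : 0 < σ ^ (-(5 / 4 : ℝ)) := Real.rpow_pos_of_pos hσ _
  calc _ ≤ ∑ k ∈ Finset.range m, 80 * C1 * Z * r ^ k * σ ^ (-(5 / 4 : ℝ)) :=
        Finset.sum_le_sum fun k _ => hpiece k
    _ = 80 * C1 * Z * σ ^ (-(5 / 4 : ℝ)) * ∑ k ∈ Finset.range m, r ^ k := by
        rw [Finset.mul_sum]; exact Finset.sum_congr rfl fun k _ => by ring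
    _ ≤ 80 * C1 * (Z + 1) * σ ^ (-(5 / 4 : ℝ)) * ∑' k : ℕ, r ^ k := by
        gcongr
        · linarith
        · exact hgeo.sum_le_tsum _ fun n _ => by positivity
    _ ≤ _ := by nlinarith

end

section
open Set Filter Topology

/-- `2|sin ((σ + iτ)/2)|²`. -/
noncomputable def Qf (σ τ : ℝ) : ℝ := Real.cosh τ - Real.cos σ

lemma Qf_pos {σ : ℝ} (h0 : 0 < σ) (h1 : σ ≤ 1) (τ : ℝ) : 0 < Qf σ τ := by
  have : Real.cos σ < 1 := by
    rw [← Real.cos_zero]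
    exact Real.cos_lt_cos_of_nonneg_of_le_pi_div_two le_rfl (by linarith [Real.pi_gt_three]) h0
  unfold Qf
  linarith [Real.one_le_cosh τ]

lemma sin_half_conj (σ τ : ℝ) : (starRingEnd ℂ) (Complex.sin ((σ + τ * Complex.I) / 2)) =
    Complex.sin ((σ - τ * Complex.I) / 2) := by
  rw [← Complex.sin_conj]
  congr 1
  simp [Complex.conj_ofNat, sub_eq_add_neg]

lemma two_mul_sin_mul_sin (σ τ : ℝ) : 2 * Complex.sin ((σ + τ * Complex.I) / 2) *
    Complex.sin ((σ - τ * Complex.I) / 2) = (Qf σ τ : ℂ) := by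
  have h := Complex.cos_sub_cos σ (τ * Complex.I)
  rw [Complex.cos_mul_I] at h
  unfold Qf
  push_cast
  linear_combination h

lemma norm_sin_half_sq (σ τ : ℝ) : ‖Complex.sin ((σ + τ * Complex.I) / 2)‖ ^ 2 = Qf σ τ / 2 := by
  have h : ((‖Complex.sin ((σ + τ * Complex.I) / 2)‖ ^ 2 : ℝ) : ℂ) = ((Qf σ τ / 2 : ℝ) : ℂ) := by
    rw [Complex.ofReal_pow, ← Complex.mul_conj', sin_half_conj]
    push_cast
    linear_combination (1 / 2 : ℂ) * two_mul_sin_mul_sin σ τ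
  exact_mod_cast h

lemma wct_eq {σ τ : ℝ} (h0 : 0 < σ) (h1 : σ ≤ 1) : wct (σ + τ * Complex.I) =
    ((Real.sin σ / (2 * Qf σ τ) : ℝ) : ℂ) + ((1 / 2 - Real.sinh τ / (2 * Qf σ τ) : ℝ) : ℂ) * Complex.I := by
  have hs := sin_half_ne_zero (s := σ + τ * Complex.I) (by simpa using h0) (by simpa using h1)
  have hQ : (Qf σ τ : ℂ) ≠ 0 := by exact_mod_cast (Qf_pos h0 h1 τ).ne'
  have e1 := two_mul_sin_mul_sin σ τ
  have e2 := Complex.sin_sub_sin σ (τ * Complex.I)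
  rw [Complex.sin_mul_I] at e2
  unfold wct
  push_cast
  have key : Complex.cos ((σ + τ * Complex.I) / 2) * Qf σ τ =
      Complex.sin ((σ + τ * Complex.I) / 2) * (Complex.sin σ - Complex.sinh τ * Complex.I) := by
    rw [e2, ← e1]; ring
  have h3 : Complex.cos ((σ + τ * Complex.I) / 2) / (2 * Complex.sin ((σ + τ * Complex.I) / 2)) =
      (Complex.sin σ - Complex.sinh τ * Complex.I) / (2 * Qf σ τ) := by
    rw [div_eq_div_iff (by simpa using hs) (by simpa using hQ)]
    linear_combination 2 * key
  rw [h3]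
  ring

lemma cosh_ge (τ : ℝ) : 1 + τ ^ 2 / 2 ≤ Real.cosh τ := by
  wlog h : 0 ≤ τ generalizing τ
  · simpa using this (-τ) (by linarith)
  have h1 : τ / 2 ≤ Real.sinh (τ / 2) := Real.self_le_sinh_iff.2 (by positivity)
  have h2 := Real.cosh_two_mul (τ / 2)
  have h3 := Real.cosh_sq (τ / 2)
  rw [show 2 * (τ / 2) = τ by ring] at h2
  nlinarith

lemma cosh_le {τ : ℝ} (h : |τ| ≤ 1 / 2) : Real.cosh τ ≤ 1 + 0.57 * τ ^ 2 := by
  have h0 := Real.cosh_le_exp_half_sq τ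
  have hτ : τ ^ 2 ≤ 1 / 4 := by rw [← sq_abs]; nlinarith [abs_nonneg τ]
  have h1 := Real.abs_exp_sub_one_sub_id_le (x := τ ^ 2 / 2) (by rw [abs_of_nonneg (by positivity)]; linarith)
  have h2 := (abs_le.1 h1).2
  nlinarith [sq_nonneg τ]

lemma Qf_bounds {σ τ : ℝ} (h : |τ| ≤ 1 / 2) : τ ^ 2 / 2 ≤ Qf σ τ ∧ Qf σ τ ≤ 0.57 * τ ^ 2 + σ ^ 2 / 2 := by
  have h1 := cosh_ge τ
  have h2 := cosh_le h
  have h3 := Real.one_sub_sq_div_two_le_cos (x := σ)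
  have h4 := Real.cos_le_one σ
  unfold Qf
  constructor <;> linarith

lemma Qf_ge {σ : ℝ} (h0 : 0 < σ) (h1 : σ ≤ 1) (τ : ℝ) : σ ^ 2 / 4 ≤ Qf σ τ := by
  have h2 := Real.one_le_cosh τ
  have h3 : Real.cos σ ≤ 1 - σ ^ 2 / 4 := by
    have e := Real.cos_two_mul (σ / 2)
    have e2 := Real.cos_sq' (σ / 2)
    have h3 := Real.sin_gt_sub_cube (x := σ / 2) (by positivity)
    rw [show 2 * (σ / 2) = σ by ring] at e
    have h4 : (σ / 2) ^ 3 / 6 ≤ σ / 48 := by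
      have : σ ^ 3 ≤ σ := by nlinarith [pow_le_one₀ (n := 2) h0.le h1]
      linarith
    nlinarith
  unfold Qf
  linarith

lemma sinh_le {τ : ℝ} (h0 : 0 ≤ τ) (h : τ ≤ 1 / 2) : Real.sinh τ ≤ 2 * τ := by
  have h2 := cosh_le (τ := τ) (by rwa [abs_of_nonneg h0])
  have h3 := Real.cosh_sq τ
  have h4 := Real.one_le_cosh τ
  refine abs_le_of_sq_le_sq' ?_ (by linarith) |>.2
  have h5 : τ ^ 2 ≤ 1 / 4 := by nlinarith
  have h6 : (Real.cosh τ - 1) * (Real.cosh τ + 1) ≤ (0.57 * τ ^ 2) * (2 + 0.57 * τ ^ 2) := by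
    apply mul_le_mul <;> nlinarith
  nlinarith [sq_nonneg τ]

lemma continuous_Qf (σ : ℝ) : Continuous (Qf σ) := by unfold Qf; fun_prop

lemma hasDerivAt_xct {σ τ : ℝ} (h0 : 0 < σ) (h1 : σ ≤ 1) :
    HasDerivAt (fun τ => 1 / 2 - Real.sinh τ / (2 * Qf σ τ))
      ((Real.cosh τ * Real.cos σ - 1) / (2 * Qf σ τ ^ 2)) τ := by
  have hQ := (Qf_pos h0 h1 τ).ne'
  have hd : HasDerivAt (fun τ => 2 * Qf σ τ) (2 * Real.sinh τ) τ := by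
    unfold Qf
    exact ((Real.hasDerivAt_cosh τ).sub_const _).const_mul 2
  have := ((Real.hasDerivAt_sinh τ).fun_div hd (by simpa using hQ)).const_sub (1 / 2)
  refine this.congr_deriv ?_
  have h3 := Real.cosh_sq τ
  field_simp
  have e : Qf σ τ = Real.cosh τ - Real.cos σ := rfl
  rw [e]
  linear_combination (-1 : ℝ) * h3

lemma wct_re_pos {σ τ : ℝ} (h0 : 0 < σ) (h1 : σ ≤ 1) : 0 < (wct (σ + τ * Complex.I)).re := by
  have := Qf_pos h0 h1 τ
  have : 0 < Real.sin σ := Real.sin_pos_of_pos_of_lt_pi h0 (by linarith [Real.pi_gt_three])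
  rw [wct_eq h0 h1]
  simp [-Complex.ofReal_div, -Complex.ofReal_sub]
  positivity

lemma continuous_wct {σ : ℝ} (h0 : 0 < σ) (h1 : σ ≤ 1) :
    Continuous fun τ : ℝ => wct (σ + τ * Complex.I) := by
  have hQ : ∀ τ, 2 * Qf σ τ ≠ 0 := fun τ => by have := Qf_pos h0 h1 τ; positivity
  have := continuous_Qf σ
  simp only [wct_eq h0 h1]
  refine (Complex.continuous_ofReal.comp ?_).add ((Complex.continuous_ofReal.comp ?_).mul
    continuous_const)
  · exact continuous_const.div (continuous_const.mul this) hQ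
  · exact continuous_const.sub (Real.continuous_sinh.div (continuous_const.mul this) hQ)

/-- The squared weighted series along the vertical line. -/
noncomputable def Ttail (a : ℕ → ℝ) (σ τ : ℝ) : ℝ :=
  ‖tser a (wct (σ + τ * Complex.I))‖ ^ 2 * (2 / ((σ ^ 2 + τ ^ 2) * Qf σ τ))

lemma continuous_Ttail {a : ℕ → ℝ} (ha : ∀ n, |a n| ≤ dd n) {σ : ℝ} (h0 : 0 < σ) (h1 : σ ≤ 1) :
    Continuous (Ttail a σ) := by
  have hT : Continuous fun τ : ℝ => tser a (wct (σ + τ * Complex.I)) :=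
    (continuousOn_tser ha).comp_continuous (continuous_wct h0 h1) fun τ => wct_re_pos h0 h1
  have := continuous_Qf σ
  have hQ : ∀ τ, (σ ^ 2 + τ ^ 2) * Qf σ τ ≠ 0 := fun τ => by
    have := Qf_pos h0 h1 τ
    positivity
  unfold Ttail
  exact (hT.norm.pow 2).mul (continuous_const.div (by fun_prop) hQ)

lemma Ttail_nonneg (a : ℕ → ℝ) {σ : ℝ} (h0 : 0 < σ) (h1 : σ ≤ 1) (τ : ℝ) : 0 ≤ Ttail a σ τ := by
  have := Qf_pos h0 h1 τ
  unfold Ttail; positivity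

set_option maxHeartbeats 1000000 in
lemma integral_Ttail_dyadic {a : ℕ → ℝ} (ha : ∀ n, |a n| ≤ dd n) {σ U : ℝ} (h0 : 0 < σ)
    (hU : 8 * σ ≤ U) (hU1 : U ≤ 1 / 4) :
    ∫ τ in U..(2 * U), Ttail a σ τ ≤
      21696 * (U⁻¹ ^ 3 * ∑' n : ℕ, a n ^ 2 * Real.exp (-(n * σ / 4 / U ^ 2))) := by
  have h1 : σ ≤ 1 := by linarith
  have hU0 : 0 < U := by linarith
  have hsin : σ / 2 ≤ Real.sin σ := by
    have := Real.sin_gt_sub_cube h0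
    have h3 : σ ^ 3 ≤ σ := by nlinarith [pow_le_one₀ (n := 2) h0.le h1]
    linarith
  have hmono : U ≤ 2 * U := by linarith
  have hQp := Qf_pos h0 h1
  have hQu : ∀ τ ∈ Icc U (2 * U), τ ^ 2 / 2 ≤ Qf σ τ ∧ Qf σ τ ≤ 0.6 * τ ^ 2 := by
    intro τ h
    have hb := Qf_bounds (σ := σ) (τ := τ) (abs_le.2 ⟨by linarith [h.1], by linarith [h.2]⟩)
    refine ⟨hb.1, hb.2.trans ?_⟩
    have : (8 * σ) ^ 2 ≤ τ ^ 2 := by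
      have := h.1; gcongr; linarith
    nlinarith
  set x := fun τ => 1 / 2 - Real.sinh τ / (2 * Qf σ τ) with hx
  set x' := fun τ => (Real.cosh τ * Real.cos σ - 1) / (2 * Qf σ τ ^ 2) with hx'
  have hx'low : ∀ τ ∈ Icc U (2 * U), 1 / (4 * τ ^ 2) ≤ x' τ := by
    intro τ h
    have hτ0 : 0 < τ := hU0.trans_le h.1
    have hσ2 : (8 * σ) ^ 2 ≤ τ ^ 2 := by
      have := h.1; gcongr; linarith
    have hc : 1 - σ ^ 2 / 2 ≤ Real.cos σ := Real.one_sub_sq_div_two_le_cos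
    have hch := cosh_ge τ
    have hnum : τ ^ 2 / 4 ≤ Real.cosh τ * Real.cos σ - 1 := by
      have hcp : 0 ≤ 1 - σ ^ 2 / 2 := by nlinarith
      have : (1 + τ ^ 2 / 2) * (1 - σ ^ 2 / 2) ≤ Real.cosh τ * Real.cos σ := by
        apply mul_le_mul hch hc hcp; linarith [Real.one_le_cosh τ]
      have : τ ^ 2 * σ ^ 2 ≤ τ ^ 2 * (1 / 64) := by gcongr; nlinarith
      nlinarith
    have hQ2 := (hQu τ h).2
    have hQq : 2 * Qf σ τ ^ 2 ≤ τ ^ 4 := by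
      have : Qf σ τ ^ 2 ≤ (0.6 * τ ^ 2) ^ 2 := by gcongr; exact (hQp τ).le
      nlinarith [pow_pos hτ0 4]
    have hQ0 := hQp τ
    calc 1 / (4 * τ ^ 2) = (τ ^ 2 / 4) / τ ^ 4 := by field_simp
      _ ≤ (Real.cosh τ * Real.cos σ - 1) / (2 * Qf σ τ ^ 2) := by gcongr; linarith [sq_nonneg τ]
  have hK := curve_bound_tsum ha (y := fun τ => Real.sin σ / (2 * Qf σ τ)) (x := x) (x' := x')
    (κ := 16) (y1 := σ / (16 * U ^ 2)) (K := ⌈2 / U⌉₊) hmono (by positivity) (by norm_num)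
    (Continuous.continuousOn (continuous_const.div (continuous_const.mul (continuous_Qf σ))
      fun τ => by have := hQp τ; positivity))
    (fun τ h => ?_) (fun τ h => ?_) (fun τ h => hasDerivAt_xct h0 h1)
    (Continuous.continuousOn (Continuous.div (by fun_prop)
      (continuous_const.mul ((continuous_Qf σ).pow 2)) fun τ => by have := hQp τ; positivity))
    (fun τ h => le_trans (by positivity) (hx'low τ h)) ?_
  rotate_left
  · have hQ2 := (hQu τ h).2
    have hQ0 := hQp τ
    have hτU : τ ^ 2 ≤ (2 * U) ^ 2 := by have := h.1; have := h.2; gcongr; linarith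
    calc σ / (16 * U ^ 2) = (σ / 2) / (8 * U ^ 2) := by field_simp; norm_num
      _ ≤ (σ / 2) / (2 * Qf σ τ) := by
          refine div_le_div_of_nonneg_left (by positivity) (by positivity) (by nlinarith)
      _ ≤ _ := by gcongr
  · have hQ2 := (hQu τ h).1
    have hQ0 := hQp τ
    have hτU : U ^ 2 ≤ τ ^ 2 := by have := h.1; gcongr
    have : Real.sin σ ≤ σ := Real.sin_le h0.le
    calc Real.sin σ / (2 * Qf σ τ) ≤ σ / U ^ 2 := by gcongr; linarith
      _ = _ := by field_simp
  · refine le_trans ?_ (Nat.le_ceil _)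
    have hQ2 := (hQu U ⟨le_rfl, hmono⟩).1
    have hs := sinh_le hU0.le (by linarith)
    have hQ0 := hQp U
    have hQ1 := hQp (2 * U)
    have hpos : 0 ≤ Real.sinh (2 * U) / (2 * Qf σ (2 * U)) := by
      have : 0 ≤ Real.sinh (2 * U) := Real.sinh_nonneg_iff.2 (by linarith)
      positivity
    have : Real.sinh U / (2 * Qf σ U) ≤ (2 * U) / U ^ 2 := by gcongr; linarith
    have e : (2 * U) / U ^ 2 = 2 / U := by field_simp
    simp only [hx]
    linarith
  have hceil : (⌈2 / U⌉₊ : ℝ) ≤ 3 / U := by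
    have h2 := (Nat.ceil_lt_add_one (a := 2 / U) (by positivity)).le
    have h3 : 1 ≤ 1 / U := by rw [le_div_iff₀ hU0]; linarith
    have : 3 / U = 2 / U + 1 / U := by ring
    linarith
  have hcI : Continuous fun τ : ℝ => ‖tser a (wct (σ + τ * Complex.I))‖ ^ 2 * x' τ := by
    have hT : Continuous fun τ : ℝ => tser a (wct (σ + τ * Complex.I)) :=
      (continuousOn_tser ha).comp_continuous (continuous_wct h0 h1) fun τ => wct_re_pos h0 h1
    refine (hT.norm.pow 2).mul (Continuous.div (by fun_prop)
      (continuous_const.mul ((continuous_Qf σ).pow 2)) fun τ => by have := hQp τ; positivity)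
  calc ∫ τ in U..(2 * U), Ttail a σ τ
      ≤ ∫ τ in U..(2 * U), 16 * U⁻¹ ^ 2 * (‖tser a (wct (σ + τ * Complex.I))‖ ^ 2 * x' τ) := by
        refine intervalIntegral.integral_mono_on hmono
          ((continuous_Ttail ha h0 h1).intervalIntegrable _ _)
          ((hcI.const_mul _).intervalIntegrable _ _) fun τ h => ?_
        have hτ0 : 0 < τ := hU0.trans_le h.1
        have hw : 2 / ((σ ^ 2 + τ ^ 2) * Qf σ τ) ≤ 16 * U⁻¹ ^ 2 * x' τ := by
          have hτU : U ^ 2 ≤ τ ^ 2 := by have := h.1; gcongr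
          calc 2 / ((σ ^ 2 + τ ^ 2) * Qf σ τ) ≤ 2 / (U ^ 2 * (τ ^ 2 / 2)) := by
                gcongr
                · nlinarith
                · exact (hQu τ h).1
            _ = 16 * U⁻¹ ^ 2 * (1 / (4 * τ ^ 2)) := by field_simp; norm_num
            _ ≤ _ := by gcongr; exact hx'low τ h
        unfold Ttail
        calc _ ≤ ‖tser a (wct (σ + τ * Complex.I))‖ ^ 2 * (16 * U⁻¹ ^ 2 * x' τ) := by gcongr
          _ = _ := by ring
    _ = 16 * U⁻¹ ^ 2 * ∫ τ in U..(2 * U), ‖tser a (wct (σ + τ * Complex.I))‖ ^ 2 * x' τ :=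
        intervalIntegral.integral_const_mul _ _
    _ ≤ 16 * U⁻¹ ^ 2 * (2 * (3 / U) * (1 + (16 - 1) ^ 2) *
        ∑' n : ℕ, a n ^ 2 * Real.exp (-(n * σ / 4 / U ^ 2))) := by
        refine mul_le_mul_of_nonneg_left ?_ (by positivity)
        have e : ∀ τ : ℝ, wct (σ + τ * Complex.I) =
            ((Real.sin σ / (2 * Qf σ τ) : ℝ) : ℂ) + (x τ : ℂ) * Complex.I := fun τ => wct_eq h0 h1
        simp only [e]
        refine hK.trans ?_
        have hle : ∀ n : ℕ, Real.exp (-(2 * Real.pi * n * (σ / (16 * U ^ 2)))) ≤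
            Real.exp (-(n * σ / 4 / U ^ 2)) := by
          intro n
          apply Real.exp_le_exp.2
          have : 3 * (n * (σ / (16 * U ^ 2))) ≤ Real.pi * (n * (σ / (16 * U ^ 2))) := by
            gcongr; exact Real.pi_gt_three.le
          have e2 : n * σ / 4 / U ^ 2 = 4 * (n * (σ / (16 * U ^ 2))) := by field_simp; norm_num
          nlinarith [show 0 ≤ n * (σ / (16 * U ^ 2)) by positivity]
        have hs := summable_sq_exp ha (y := σ / 4 / U ^ 2 / (2 * Real.pi)) (by positivity)
        have hs' : Summable fun n : ℕ => a n ^ 2 * Real.exp (-(n * σ / 4 / U ^ 2)) := by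
          refine hs.congr fun n => ?_
          congr 3; field_simp
        have : ∑' n : ℕ, a n ^ 2 * Real.exp (-(2 * Real.pi * n * (σ / (16 * U ^ 2)))) ≤
            ∑' n : ℕ, a n ^ 2 * Real.exp (-(n * σ / 4 / U ^ 2)) :=
          Summable.tsum_le_tsum (fun n => mul_le_mul_of_nonneg_left (hle n) (sq_nonneg _))
            (summable_sq_exp ha (by positivity)) hs'
        gcongr
    _ = _ := by
        generalize ∑' n : ℕ, a n ^ 2 * Real.exp (-(n * σ / 4 / U ^ 2)) = Z
        ring

end

section
open Set Filter Topology

lemma cube_mul_exp_le {z : ℝ} (hz : 0 < z) :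
    z ^ 3 * Real.exp (-z ^ 2) ≤ 8 * (z / (1 + z) - (z / 2) / (1 + z / 2)) := by
  have h1 := Real.quadratic_le_exp_of_nonneg (sq_nonneg z)
  have e : z / (1 + z) - (z / 2) / (1 + z / 2) = z / ((1 + z) * (2 + z)) := by
    field_simp; ring
  rw [e, Real.exp_neg, ← div_eq_mul_inv, ← mul_div_assoc, div_le_div_iff₀ (Real.exp_pos _) (by positivity)]
  have h2 : (1 + z) * (2 + z) ≤ 4 * (1 + z ^ 2) := by nlinarith [sq_nonneg (z - 1 / 2)]
  calc z ^ 3 * ((1 + z) * (2 + z)) ≤ z ^ 3 * (4 * (1 + z ^ 2)) := by gcongr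
    _ = 8 * z * ((z ^ 2 + (z ^ 2) ^ 2) / 2) := by ring
    _ ≤ 8 * z * Real.exp (z ^ 2) := by gcongr; nlinarith [sq_nonneg z]

lemma sum_dyadic_le {c U : ℝ} (hc : 0 < c) (hU : 0 < U) (m : ℕ) :
    ∑ k ∈ Finset.range m, (U * 2 ^ k)⁻¹ ^ 3 * Real.exp (-(c / (U * 2 ^ k) ^ 2)) ≤
      8 * c ^ (-(3 / 2 : ℝ)) := by
  set z : ℕ → ℝ := fun k => Real.sqrt c / (U * 2 ^ k) with hz
  have hz0 : ∀ k, 0 < z k := fun k => by have := Real.sqrt_pos.2 hc; simp only [hz]; positivity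
  have hcc : Real.sqrt c ^ 2 = c := Real.sq_sqrt hc.le
  have hc3 : c ^ (-(3 / 2 : ℝ)) = (Real.sqrt c ^ 3)⁻¹ := by
    rw [Real.sqrt_eq_rpow, ← Real.rpow_natCast, ← Real.rpow_mul hc.le, ← Real.rpow_neg hc.le]
    norm_num
  have hs := Real.sqrt_pos.2 hc
  have hterm : ∀ k, (U * 2 ^ k)⁻¹ ^ 3 * Real.exp (-(c / (U * 2 ^ k) ^ 2)) ≤
      8 * c ^ (-(3 / 2 : ℝ)) * (z k / (1 + z k) - z (k + 1) / (1 + z (k + 1))) := by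
    intro k
    have h := cube_mul_exp_le (hz0 k)
    have e1 : z k / 2 = z (k + 1) := by simp only [hz, pow_succ]; field_simp
    rw [e1] at h
    have e2 : z k ^ 2 = c / (U * 2 ^ k) ^ 2 := by simp only [hz, div_pow, hcc]
    rw [e2] at h
    calc _ = c ^ (-(3 / 2 : ℝ)) * (z k ^ 3 * Real.exp (-(c / (U * 2 ^ k) ^ 2))) := by
          rw [hc3]; simp only [hz]; field_simp
      _ ≤ c ^ (-(3 / 2 : ℝ)) * (8 * (z k / (1 + z k) - z (k + 1) / (1 + z (k + 1)))) := by gcongr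
      _ = _ := by ring
  refine (Finset.sum_le_sum fun k _ => hterm k).trans ?_
  rw [← Finset.mul_sum, Finset.sum_range_sub']
  have h1 : z 0 / (1 + z 0) ≤ 1 := by
    have := hz0 0
    rw [div_le_one (by positivity)]; linarith
  have h2 : 0 ≤ z m / (1 + z m) := by have := hz0 m; positivity
  refine mul_le_of_le_one_right (by positivity) (by linarith)

lemma integral_Ttail_small : ∃ C, 0 < C ∧ ∀ (a : ℕ → ℝ), (∀ n, |a n| ≤ dd n) → ∀ σ : ℝ, 0 < σ →
    σ ≤ 1 / 32 → ∫ τ in (0:ℝ)..(8 * σ), Ttail a σ τ ≤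
      C * σ ^ (-(3 / 2 : ℝ)) * ∑' n : ℕ, a n ^ 2 * (n : ℝ) ^ (-(3 / 2 : ℝ)) := by
  obtain ⟨C1, hC1, hexp⟩ := exp_neg_le_rpow (p := 2) (by norm_num)
  set Y := ∑' n : ℕ, (n : ℝ) ^ (-(5 / 4 : ℝ)) with hY
  have hYs : Summable fun n : ℕ => (n : ℝ) ^ (-(5 / 4 : ℝ)) :=
    Real.summable_nat_rpow.2 (by norm_num)
  have hY0 : 0 ≤ Y := tsum_nonneg fun n => by positivity
  refine ⟨64 * (C1 * Y * 2500) ^ 2 + 1, by positivity, fun a ha σ h0 hσ => ?_⟩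
  have h1 : σ ≤ 1 := by linarith
  set A := ∑' n : ℕ, a n ^ 2 * (n : ℝ) ^ (-(3 / 2 : ℝ)) with hA
  have hA0 : 0 ≤ A := tsum_nonneg fun n => by positivity
  have hAs : Summable fun n : ℕ => a n ^ 2 * (n : ℝ) ^ (-(3 / 2 : ℝ)) := by
    refine Summable.of_nonneg_of_le (fun n => by positivity) (fun n => ?_)
      (summable_dd_sq_rpow (x := 3 / 2) (by norm_num))
    rw [← sq_abs]
    gcongr
    exact ha n
  have hale : ∀ n : ℕ, 0 < n → |a n| ≤ Real.sqrt A * (n : ℝ) ^ (3 / 4 : ℝ) := by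
    intro n hn
    have hn' : (0:ℝ) < n := by exact_mod_cast hn
    have h := hAs.le_tsum n fun m _ => by positivity
    refine abs_le_of_sq_le_sq ?_ (by positivity)
    rw [mul_pow, Real.sq_sqrt hA0, ← Real.rpow_natCast, ← Real.rpow_natCast,
      ← Real.rpow_mul hn'.le]
    rw [Real.rpow_neg hn'.le, ← div_eq_mul_inv, div_le_iff₀ (by positivity)] at h
    convert h using 2 <;> norm_num
  have hsin : σ / 2 ≤ Real.sin σ := by
    have := Real.sin_gt_sub_cube h0
    have h3 : σ ^ 3 ≤ σ := by nlinarith [pow_le_one₀ (n := 2) h0.le h1]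
    linarith
  have hQp := Qf_pos h0 h1
  have hT : ∀ τ ∈ Icc 0 (8 * σ), ‖tser a (wct (σ + τ * Complex.I))‖ ≤
      Real.sqrt A * (C1 * Y * 2500) * σ ^ 2 := by
    intro τ h
    refine (norm_tser_le ha (wct_re_pos h0 h1)).trans ?_
    have hQ := (Qf_bounds (σ := σ) (τ := τ) (abs_le.2 ⟨by linarith [h.1], by linarith [h.2]⟩)).2
    have hQ2 : Qf σ τ ≤ 40 * σ ^ 2 := by
      have : τ ^ 2 ≤ (8 * σ) ^ 2 := by have := h.1; have := h.2; gcongr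
      nlinarith
    have hre : (1 / (200 * σ)) ≤ (wct (σ + τ * Complex.I)).re := by
      rw [wct_eq h0 h1]
      simp only [Complex.add_re, Complex.ofReal_re, Complex.re_ofReal_mul, Complex.I_re, mul_zero,
        add_zero]
      calc 1 / (200 * σ) ≤ (σ / 2) / (2 * (40 * σ ^ 2)) := by
            rw [div_le_div_iff₀ (by positivity) (by positivity)]; nlinarith
        _ ≤ Real.sin σ / (2 * Qf σ τ) := by
            have := hQp τ
            have : 0 ≤ Real.sin σ := by linarith
            gcongr
    have hle : ∀ n : ℕ, |a n| * Real.exp (-(2 * Real.pi * n * (wct (σ + τ * Complex.I)).re)) ≤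
        Real.sqrt A * (C1 * 2500) * σ ^ 2 * (n : ℝ) ^ (-(5 / 4 : ℝ)) := by
      intro n
      rcases Nat.eq_zero_or_pos n with rfl | hn
      · have : a 0 = 0 := abs_nonpos_iff.1 ((ha 0).trans dd_zero.le)
        rw [this]; simp
      have hn' : (0:ℝ) < n := by exact_mod_cast hn
      have h5 : Real.exp (-(2 * Real.pi * n * (wct (σ + τ * Complex.I)).re)) ≤
          Real.exp (-(n / (50 * σ))) := by
        apply Real.exp_le_exp.2
        have : n / (50 * σ) = 4 * n * (1 / (200 * σ)) := by field_simp; norm_num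
        rw [this]
        have : 4 * n * (1 / (200 * σ)) ≤ 2 * Real.pi * n * (wct (σ + τ * Complex.I)).re := by
          gcongr; linarith [Real.pi_gt_three]
        linarith
      have h6 := hexp (n / (50 * σ)) (by positivity)
      calc |a n| * Real.exp (-(2 * Real.pi * n * (wct (σ + τ * Complex.I)).re))
          ≤ (Real.sqrt A * (n : ℝ) ^ (3 / 4 : ℝ)) * (C1 * (n / (50 * σ)) ^ (-(2:ℝ))) := by
            gcongr
            · exact hale n hn
            · exact h5.trans h6
        _ = Real.sqrt A * (C1 * 2500) * σ ^ 2 * ((n : ℝ) ^ (3 / 4 : ℝ) * (n : ℝ) ^ (-2 : ℝ)) := by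
            rw [Real.div_rpow hn'.le (by positivity), Real.rpow_neg (x := 50 * σ) (by positivity)]
            norm_cast
            field_simp
            ring
        _ = _ := by rw [← Real.rpow_add hn']; norm_num
    refine (Summable.tsum_le_tsum hle (summable_abs_exp ha (wct_re_pos h0 h1))
      (hYs.mul_left _)).trans (le_of_eq ?_)
    rw [tsum_mul_left, ← hY]; ring
  have hTt : ∀ τ ∈ Icc 0 (8 * σ), Ttail a σ τ ≤ 8 * (A * (C1 * Y * 2500) ^ 2) := by
    intro τ h
    have hQ := Qf_ge h0 h1 τ
    have h7 : 2 / ((σ ^ 2 + τ ^ 2) * Qf σ τ) ≤ 8 / σ ^ 4 := by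
      calc 2 / ((σ ^ 2 + τ ^ 2) * Qf σ τ) ≤ 2 / (σ ^ 2 * (σ ^ 2 / 4)) := by
            gcongr; nlinarith
        _ = 8 / σ ^ 4 := by field_simp; norm_num
    unfold Ttail
    calc _ ≤ (Real.sqrt A * (C1 * Y * 2500) * σ ^ 2) ^ 2 * (8 / σ ^ 4) := by
          have := hQp τ
          gcongr; exact hT τ h
      _ = Real.sqrt A ^ 2 * ((C1 * Y * 2500) ^ 2 * 8) := by field_simp
      _ = _ := by rw [Real.sq_sqrt hA0]; ring
  calc _ ≤ ∫ τ in (0:ℝ)..(8 * σ), 8 * (A * (C1 * Y * 2500) ^ 2) :=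
        intervalIntegral.integral_mono_on (by positivity)
          ((continuous_Ttail ha h0 h1).intervalIntegrable _ _) (by simp) hTt
    _ = 64 * (C1 * Y * 2500) ^ 2 * σ * A := by
        rw [intervalIntegral.integral_const, smul_eq_mul]; ring
    _ ≤ _ := by
        have : σ ≤ σ ^ (-(3 / 2 : ℝ)) := by
          refine h1.trans ?_
          exact Real.one_le_rpow_of_pos_of_le_one_of_nonpos h0 h1 (by norm_num)
        have hB : 0 ≤ 64 * (C1 * Y * 2500) ^ 2 := by positivity
        calc 64 * (C1 * Y * 2500) ^ 2 * σ * A ≤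
            (64 * (C1 * Y * 2500) ^ 2 + 1) * σ ^ (-(3 / 2 : ℝ)) * A := by
              gcongr; linarith
          _ = _ := rfl

lemma integral_Ttail_le : ∃ C, 0 < C ∧ ∀ (a : ℕ → ℝ), (∀ n, |a n| ≤ dd n) → ∀ σ : ℝ, 0 < σ →
    σ ≤ 1 / 32 → ∫ τ in (0:ℝ)..(1 / 4), Ttail a σ τ ≤
      C * σ ^ (-(3 / 2 : ℝ)) * ∑' n : ℕ, a n ^ 2 * (n : ℝ) ^ (-(3 / 2 : ℝ)) := by
  obtain ⟨C1, hC1, hsmall⟩ := integral_Ttail_small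
  refine ⟨C1 + 21696 * 64, by positivity, fun a ha σ h0 hσ => ?_⟩
  have h1 : σ ≤ 1 := by linarith
  have hcont := continuous_Ttail ha h0 h1
  have hs := hsmall a ha σ h0 hσ
  set A := ∑' n : ℕ, a n ^ 2 * (n : ℝ) ^ (-(3 / 2 : ℝ)) with hA
  have hA0 : 0 ≤ A := tsum_nonneg fun n => by positivity
  have hAs : Summable fun n : ℕ => a n ^ 2 * (n : ℝ) ^ (-(3 / 2 : ℝ)) := by
    refine Summable.of_nonneg_of_le (fun n => by positivity) (fun n => ?_)
      (summable_dd_sq_rpow (x := 3 / 2) (by norm_num))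
    rw [← sq_abs]
    gcongr
    exact ha n
  obtain ⟨n, hn1, hn2⟩ := exists_nat_pow_near (x := 1 / (32 * σ)) (y := 2)
    (by rw [le_div_iff₀ (by positivity)]; linarith) (by norm_num)
  rw [le_div_iff₀ (by positivity)] at hn1
  rw [div_lt_iff₀ (by positivity)] at hn2
  set U : ℕ → ℝ := fun k => 8 * σ * 2 ^ k with hU
  have hadd := intervalIntegral.sum_integral_adjacent_intervals (n := n + 1) (μ := volume)
    (a := U) (f := Ttail a σ) (fun k _ => hcont.intervalIntegrable _ _)
  have hU0 : U 0 = 8 * σ := by simp [hU]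
  have hUs : ∀ k, U (k + 1) = 2 * U k := fun k => by simp only [hU, pow_succ]; ring
  have hpiece : ∀ k ∈ Finset.range (n + 1), ∫ τ in (U k)..(U (k + 1)), Ttail a σ τ ≤
      21696 * ((U k)⁻¹ ^ 3 * ∑' n : ℕ, a n ^ 2 * Real.exp (-(n * σ / 4 / U k ^ 2))) := by
    intro k hk
    rw [hUs]
    refine integral_Ttail_dyadic ha h0 ?_ ?_
    · have : (1:ℝ) ≤ 2 ^ k := one_le_pow₀ (by norm_num)
      simp only [hU]; nlinarith
    · have : (2:ℝ) ^ k ≤ 2 ^ n := pow_le_pow_right₀ (by norm_num) (by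
        have := Finset.mem_range.1 hk; omega)
      simp only [hU]; nlinarith
  have hUpos : ∀ k, 0 < U k := fun k => by simp only [hU]; positivity
  have hsk : ∀ k, Summable fun n : ℕ => (U k)⁻¹ ^ 3 * (a n ^ 2 * Real.exp (-(n * σ / 4 / U k ^ 2))) := by
    intro k
    have := hUpos k
    have hs := summable_sq_exp ha (y := σ / 4 / U k ^ 2 / (2 * Real.pi)) (by positivity)
    refine (hs.congr fun n => ?_).mul_left _
    congr 3; field_simp
  have hsum : ∑ k ∈ Finset.range (n + 1),
      ((U k)⁻¹ ^ 3 * ∑' n : ℕ, a n ^ 2 * Real.exp (-(n * σ / 4 / U k ^ 2))) ≤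
      64 * σ ^ (-(3 / 2 : ℝ)) * A := by
    simp only [← tsum_mul_left]
    rw [← Summable.tsum_finsetSum fun k _ => hsk k, hA, ← tsum_mul_left]
    refine Summable.tsum_le_tsum (fun j => ?_) (summable_sum fun k _ => hsk k) (hAs.mul_left _)
    rcases Nat.eq_zero_or_pos j with rfl | hj
    · have : a 0 = 0 := abs_nonpos_iff.1 ((ha 0).trans dd_zero.le)
      simp [this]
    have hj' : (0:ℝ) < j := by exact_mod_cast hj
    have h := sum_dyadic_le (c := j * σ / 4) (U := 8 * σ) (by positivity) (by positivity) (n + 1)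
    calc ∑ k ∈ Finset.range (n + 1), (U k)⁻¹ ^ 3 * (a j ^ 2 * Real.exp (-(j * σ / 4 / U k ^ 2)))
        = a j ^ 2 * ∑ k ∈ Finset.range (n + 1), (U k)⁻¹ ^ 3 * Real.exp (-(j * σ / 4 / U k ^ 2)) := by
          rw [Finset.mul_sum]; exact Finset.sum_congr rfl fun k _ => by ring
      _ ≤ a j ^ 2 * (8 * (j * σ / 4) ^ (-(3 / 2 : ℝ))) := by gcongr
      _ = _ := by
          rw [Real.div_rpow (by positivity) (by norm_num), Real.mul_rpow hj'.le h0.le,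
            show (4:ℝ) ^ (-(3 / 2 : ℝ)) = 1 / 8 by
              rw [show (4:ℝ) = 2 ^ (2:ℝ) by norm_num, ← Real.rpow_mul (by norm_num)]
              norm_num
              ]
          ring
  have hsplit : ∫ τ in (0:ℝ)..(U (n + 1)), Ttail a σ τ =
      (∫ τ in (0:ℝ)..(8 * σ), Ttail a σ τ) + ∫ τ in (U 0)..(U (n + 1)), Ttail a σ τ := by
    rw [hU0, intervalIntegral.integral_add_adjacent_intervals] <;>
      exact hcont.intervalIntegrable _ _
  have hmono : ∫ τ in (0:ℝ)..(1 / 4), Ttail a σ τ ≤ ∫ τ in (0:ℝ)..(U (n + 1)), Ttail a σ τ := by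
    refine intervalIntegral.integral_mono_interval le_rfl (by norm_num) ?_
      (Eventually.of_forall fun τ => Ttail_nonneg a h0 h1 τ) (hcont.intervalIntegrable _ _)
    simp only [hU]; linarith
  have hfin : ∫ τ in (U 0)..(U (n + 1)), Ttail a σ τ ≤ 21696 * (64 * σ ^ (-(3 / 2 : ℝ)) * A) := by
    rw [← hadd]
    refine (Finset.sum_le_sum hpiece).trans ?_
    rw [← Finset.mul_sum]
    gcongr
  calc _ ≤ _ := hmono
    _ ≤ C1 * σ ^ (-(3 / 2 : ℝ)) * A + 21696 * (64 * σ ^ (-(3 / 2 : ℝ)) * A) := by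
        rw [hsplit]; linarith
    _ = _ := by ring

end

section
open Set Filter Topology

/-- A Scheffé-type criterion for `L²` convergence. -/
lemma scheffe_sq {ι α : Type*} [MeasurableSpace α] {μ : Measure α} {l : Filter ι}
    [l.IsCountablyGenerated] {f q : ι → α → ℂ} {g : α → ℂ} {B : α → ℝ} {M : ℝ}
    (hfm : ∀ᶠ i in l, AEStronglyMeasurable (f i) μ) (hqm : ∀ᶠ i in l, AEStronglyMeasurable (q i) μ)
    (hgm : AEStronglyMeasurable g μ)
    (hfi : ∀ᶠ i in l, Integrable (fun x => ‖f i x‖ ^ 2) μ)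
    (hg : Integrable (fun x => ‖g x‖ ^ 2) μ) (hM : ∫ x, ‖g x‖ ^ 2 ∂μ = M)
    (hfM : ∀ᶠ i in l, ∫ x, ‖f i x‖ ^ 2 ∂μ ≤ M)
    (hB : Integrable B μ) (hqB : ∀ᶠ i in l, ∀ᵐ x ∂μ, ‖q i x‖ ^ 2 ≤ B x)
    (hfl : ∀ᵐ x ∂μ, Tendsto (fun i => f i x) l (𝓝 (g x)))
    (hql : ∀ᵐ x ∂μ, Tendsto (fun i => q i x) l (𝓝 (g x))) :
    Tendsto (fun i => ∫ x, ‖f i x - q i x‖ ^ 2 ∂μ) l (𝓝 0) ∧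
    Tendsto (fun i => ∫ x, ‖f i x‖ ^ 2 ∂μ) l (𝓝 M) := by
  have hqi : ∀ᶠ i in l, Integrable (fun x => ‖q i x‖ ^ 2) μ := by
    filter_upwards [hqm, hqB] with i h1 h2
    refine hB.mono (h1.norm.pow 2) ?_
    filter_upwards [h2] with x hx
    rw [Real.norm_of_nonneg (by positivity)]
    exact hx.trans (le_abs_self _)
  have hq : Tendsto (fun i => ∫ x, ‖q i x‖ ^ 2 ∂μ) l (𝓝 M) := by
    rw [← hM]
    refine tendsto_integral_filter_of_dominated_convergence B ?_ ?_ hB ?_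
    · filter_upwards [hqm] with i h using h.norm.pow 2
    · filter_upwards [hqB] with i h
      filter_upwards [h] with x hx
      rwa [Real.norm_of_nonneg (by positivity)]
    · filter_upwards [hql] with x hx using hx.norm.pow 2
  have hmin : ∀ (F : ι → α → ℂ) (G : α → ℂ), (∀ᶠ i in l, AEStronglyMeasurable (F i) μ) →
      AEStronglyMeasurable G μ → Integrable (fun x => ‖G x‖ ^ 2) μ →
      (∀ᵐ x ∂μ, Tendsto (fun i => F i x) l (𝓝 (G x))) →
      Tendsto (fun i => ∫ x, min (‖F i x‖ ^ 2) (‖G x‖ ^ 2) ∂μ) l (𝓝 (∫ x, ‖G x‖ ^ 2 ∂μ)) := by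
    intro F G hF hG hGi hl
    refine tendsto_integral_filter_of_dominated_convergence (fun x => ‖G x‖ ^ 2) ?_ ?_ hGi ?_
    · filter_upwards [hF] with i h
      exact (h.norm.pow 2).inf (hG.norm.pow 2)
    · refine Eventually.of_forall fun i => ae_of_all _ fun x => ?_
      rw [Real.norm_of_nonneg (le_min (by positivity) (by positivity))]
      exact min_le_right _ _
    · filter_upwards [hl] with x hx
      have := (hx.norm.pow 2).min (tendsto_const_nhds (x := ‖G x‖ ^ 2))
      rwa [min_self] at this
  have hmini : ∀ (F G : α → ℂ), Integrable (fun x => ‖F x‖ ^ 2) μ →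
      Integrable (fun x => ‖G x‖ ^ 2) μ →
      ∫ x, min (‖F x‖ ^ 2) (‖G x‖ ^ 2) ∂μ ≤ ∫ x, ‖F x‖ ^ 2 ∂μ := by
    intro F G hF hG
    exact integral_mono (hF.inf hG) hF fun x => min_le_left _ _
  have hf : Tendsto (fun i => ∫ x, ‖f i x‖ ^ 2 ∂μ) l (𝓝 M) := by
    have h := hmin f g hfm hgm hg hfl
    rw [hM] at h
    refine tendsto_of_tendsto_of_tendsto_of_le_of_le' h tendsto_const_nhds ?_ hfM
    filter_upwards [hfi] with i hi using hmini _ _ hi hg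
  refine ⟨?_, hf⟩
  have hG2 : Integrable (fun x => ‖2 * g x‖ ^ 2) μ := by
    simp only [norm_mul, mul_pow]
    exact hg.const_mul _
  have h2 := hmin (fun i x => f i x + q i x) (fun x => 2 * g x)
    (by filter_upwards [hfm, hqm] with i a b using a.add b) (hgm.const_mul 2) hG2
    (by filter_upwards [hfl, hql] with x a b; rw [two_mul]; exact a.add b)
  have e4 : ∫ x, ‖2 * g x‖ ^ 2 ∂μ = 4 * M := by
    simp only [norm_mul, mul_pow]
    rw [integral_const_mul, hM]; norm_num
  rw [e4] at h2
  have h3 : Tendsto (fun i => 2 * (∫ x, ‖f i x‖ ^ 2 ∂μ) + 2 * (∫ x, ‖q i x‖ ^ 2 ∂μ) -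
      ∫ x, min (‖f i x + q i x‖ ^ 2) (‖2 * g x‖ ^ 2) ∂μ) l (𝓝 0) := by
    have := ((hf.const_mul 2).add (hq.const_mul 2)).sub h2
    convert this using 2; ring
  refine squeeze_zero' (Eventually.of_forall fun i => integral_nonneg fun x => by positivity) ?_ h3
  filter_upwards [hfi, hqi, hfm, hqm] with i hi hi' hm hm'
  have par : ∀ x, ‖f i x - q i x‖ ^ 2 = 2 * ‖f i x‖ ^ 2 + 2 * ‖q i x‖ ^ 2 - ‖f i x + q i x‖ ^ 2 := by
    intro x
    have := parallelogram_law_with_norm ℝ (f i x) (q i x)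
    nlinarith
  have hs : Integrable (fun x => ‖f i x + q i x‖ ^ 2) μ := by
    refine ((hi.const_mul 2).add (hi'.const_mul 2)).mono ((hm.add hm').norm.pow 2) ?_
    refine ae_of_all _ fun x => ?_
    rw [Real.norm_of_nonneg (by positivity)]
    refine le_trans ?_ (le_abs_self _)
    have := par x
    simp only [Pi.add_apply]
    nlinarith [sq_nonneg ‖f i x - q i x‖]
  have e : ∫ x, ‖f i x - q i x‖ ^ 2 ∂μ = 2 * (∫ x, ‖f i x‖ ^ 2 ∂μ) + 2 * (∫ x, ‖q i x‖ ^ 2 ∂μ) -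
      ∫ x, ‖f i x + q i x‖ ^ 2 ∂μ := by
    simp_rw [par]
    rw [integral_sub (f := fun x => 2 * ‖f i x‖ ^ 2 + 2 * ‖q i x‖ ^ 2)
      ((hi.const_mul 2).add (hi'.const_mul 2)) hs, integral_add (hi.const_mul 2) (hi'.const_mul 2),
      integral_const_mul, integral_const_mul]
  rw [e]
  linarith [hmini (fun x => f i x + q i x) _ hs hG2]

lemma norm_exp_neg_mul_sq_le {z : ℂ} (hz : 0 ≤ z.re) (x : ℝ) : ‖Complex.exp (-(z * x ^ 2))‖ ≤ 1 := by
  rw [Complex.norm_exp, Real.exp_le_one_iff, ← Complex.ofReal_pow, Complex.neg_re,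
    Complex.re_mul_ofReal]
  have := mul_nonneg hz (sq_nonneg x)
  linarith

lemma norm_integral_exp_neg_mul_sq_le {z : ℂ} (hz : 0 ≤ z.re) (hz0 : z ≠ 0) {R R' : ℝ} (hR : 0 < R)
    (hRR : R ≤ R') : ‖∫ x in R..R', Complex.exp (-(z * x ^ 2))‖ ≤ 1 / (‖z‖ * R) := by
  have hR' : 0 < R' := hR.trans_le hRR
  have hn : 0 < ‖z‖ := norm_pos_iff.2 hz0
  have hpos : ∀ x ∈ uIcc R R', 0 < x := fun x hx => by
    rw [uIcc_of_le hRR] at hx; exact hR.trans_le hx.1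
  have hd : ∀ x ∈ uIcc R R', HasDerivAt (fun x : ℝ => -(Complex.exp (-(z * x ^ 2)) / (2 * z * x)))
      (Complex.exp (-(z * x ^ 2)) + Complex.exp (-(z * x ^ 2)) / (2 * z * x ^ 2)) x := by
    intro x hx
    have hx0 : (x : ℂ) ≠ 0 := Complex.ofReal_ne_zero.2 (hpos x hx).ne'
    have h1 : HasDerivAt (fun x : ℝ => (x : ℂ)) 1 x := Complex.ofRealCLM.hasDerivAt
    have h2 : HasDerivAt (fun x : ℝ => Complex.exp (-(z * x ^ 2))) _ x :=
      (((h1.fun_pow 2).const_mul z).fun_neg).cexp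
    have h3 := (h2.fun_div (h1.const_mul (2 * z)) (mul_ne_zero (mul_ne_zero two_ne_zero hz0) hx0)).fun_neg
    refine h3.congr_deriv ?_
    field_simp
    push_cast
    ring
  have c1 : Continuous fun x : ℝ => Complex.exp (-(z * x ^ 2)) := by fun_prop
  have c2 : ContinuousOn (fun x : ℝ => Complex.exp (-(z * x ^ 2)) / (2 * z * x ^ 2)) (uIcc R R') := by
    refine c1.continuousOn.div (by fun_prop) fun x hx => ?_
    exact mul_ne_zero (mul_ne_zero two_ne_zero hz0) (pow_ne_zero 2 (Complex.ofReal_ne_zero.2 (hpos x hx).ne'))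
  have ftc := intervalIntegral.integral_eq_sub_of_hasDerivAt hd
    (c1.continuousOn.add c2).intervalIntegrable
  rw [intervalIntegral.integral_add (c1.intervalIntegrable _ _) c2.intervalIntegrable] at ftc
  have hb : ∀ x : ℝ, 0 < x → ‖Complex.exp (-(z * x ^ 2)) / (2 * z * x)‖ ≤ 1 / (2 * ‖z‖ * x) := by
    intro x hx
    rw [norm_div]
    simp only [norm_mul, Complex.norm_ofNat, Complex.norm_real, Real.norm_of_nonneg hx.le]
    gcongr
    exact norm_exp_neg_mul_sq_le hz x
  have hi : ‖∫ x in R..R', Complex.exp (-(z * x ^ 2)) / (2 * z * x ^ 2)‖ ≤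
      1 / (2 * ‖z‖) * (1 / R - 1 / R') := by
    have hI : ∫ x in R..R', 1 / (2 * ‖z‖) * (x ^ 2)⁻¹ = 1 / (2 * ‖z‖) * (1 / R - 1 / R') := by
      rw [intervalIntegral.integral_const_mul]
      congr 1
      have hd' : ∀ x ∈ uIcc R R', HasDerivAt (fun x : ℝ => -(x⁻¹)) ((x ^ 2)⁻¹) x := fun x hx => by
        simpa using (hasDerivAt_inv (hpos x hx).ne').fun_neg
      rw [intervalIntegral.integral_eq_sub_of_hasDerivAt hd']
      · simp; ring
      · refine ContinuousOn.intervalIntegrable ?_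
        exact ContinuousOn.inv₀ (by fun_prop) fun x hx => by have := hpos x hx; positivity
    rw [← hI]
    refine intervalIntegral.norm_integral_le_of_norm_le hRR ?_ ?_
    · refine ae_of_all _ fun x hx => ?_
      have hx0 : 0 < x := hR.trans hx.1
      rw [norm_div]
      simp only [norm_mul, Complex.norm_ofNat, Complex.norm_real, norm_pow, Real.norm_of_nonneg hx0.le]
      rw [← one_div, ← one_div_mul_one_div, one_div_mul_one_div, div_mul_div_comm]
      simp only [mul_one]
      gcongr
      exact norm_exp_neg_mul_sq_le hz x
    · refine ContinuousOn.intervalIntegrable ?_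
      exact continuousOn_const.mul (ContinuousOn.inv₀ (by fun_prop) fun x hx => by have := hpos x hx; positivity)
  have h1 := hb R hR
  have h2 := hb R' hR'
  have e : ∫ x in R..R', Complex.exp (-(z * x ^ 2)) =
      -(Complex.exp (-(z * R' ^ 2)) / (2 * z * R')) + Complex.exp (-(z * R ^ 2)) / (2 * z * R) -
      ∫ x in R..R', Complex.exp (-(z * x ^ 2)) / (2 * z * x ^ 2) := by
    linear_combination ftc
  rw [e]
  refine (norm_sub_le _ _).trans ((add_le_add (norm_add_le _ _) hi).trans ?_)
  rw [norm_neg]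
  refine (add_le_add_left (add_le_add h2 h1) _).trans (le_of_eq ?_)
  field_simp
  ring

/-- Fresnel integrals. -/
noncomputable def Fres (y u : ℝ) : ℂ := ∫ x in (0:ℝ)..u, Complex.exp (-((y * Complex.I) * x ^ 2))

noncomputable def FresL (y : ℝ) : ℂ := ((Real.pi : ℂ) / (y * Complex.I)) ^ (1 / 2 : ℂ) / 2

lemma norm_Fres_sub_le {y R : ℝ} (hy : 0 < y) (hR : 0 < R) : ‖Fres y R - FresL y‖ ≤ 1 / (y * R) := by
  have key : ∀ δ : ℝ, 0 < δ → ‖(∫ x in (0:ℝ)..R, Complex.exp (-((δ + y * Complex.I) * x ^ 2))) -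
      ((Real.pi : ℂ) / (δ + y * Complex.I)) ^ (1 / 2 : ℂ) / 2‖ ≤ 1 / (y * R) := by
    intro δ hδ
    have hre : ((δ : ℂ) + y * Complex.I).re = δ := by simp
    have him : ((δ : ℂ) + y * Complex.I).im = y := by simp
    have hn : y ≤ ‖(δ : ℂ) + y * Complex.I‖ := by
      have := Complex.abs_im_le_norm ((δ : ℂ) + y * Complex.I)
      rw [him, abs_of_pos hy] at this; exact this
    have h0 : (δ : ℂ) + y * Complex.I ≠ 0 := norm_pos_iff.1 (hy.trans_le hn)
    have g := integral_gaussian_complex_Ioi (b := (δ : ℂ) + y * Complex.I) (by rw [hre]; exact hδ)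
    have gi := (integrable_cexp_neg_mul_sq (b := (δ : ℂ) + y * Complex.I) (by rw [hre]; exact hδ))
    rw [← g]
    have lim := intervalIntegral_tendsto_integral_Ioi R
      (f := fun x : ℝ => Complex.exp (-((δ : ℂ) + y * Complex.I) * x ^ 2)) gi.integrableOn tendsto_id
    have e : (∫ x in (0:ℝ)..R, Complex.exp (-((δ + y * Complex.I) * x ^ 2))) -
        ∫ x in Ioi (0:ℝ), Complex.exp (-((δ : ℂ) + y * Complex.I) * x ^ 2) =
        - ∫ x in Ioi R, Complex.exp (-((δ : ℂ) + y * Complex.I) * x ^ 2) := by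
      rw [← intervalIntegral.integral_interval_add_Ioi (a := 0) (b := R) gi.integrableOn gi.integrableOn]
      simp only [neg_mul]
      ring
    rw [e, norm_neg]
    refine le_of_tendsto lim.norm ?_
    filter_upwards [eventually_ge_atTop R] with R' hR'
    have := norm_integral_exp_neg_mul_sq_le (z := (δ : ℂ) + y * Complex.I) (by rw [hre]; exact hδ.le) h0 hR hR'
    simp only [neg_mul, id]
    refine this.trans ?_
    gcongr
  have c1 : Continuous fun δ : ℝ => ∫ x in (0:ℝ)..R, Complex.exp (-((δ + y * Complex.I) * x ^ 2)) := by
    refine intervalIntegral.continuous_parametric_intervalIntegral_of_continuous' ?_ _ _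
    fun_prop
  have c2 : ContinuousAt (fun δ : ℝ => ((Real.pi : ℂ) / (δ + y * Complex.I)) ^ (1 / 2 : ℂ) / 2) 0 := by
    have hne : ((0 : ℝ) : ℂ) + y * Complex.I ≠ 0 := by simp [hy.ne']
    have : ContinuousAt (fun δ : ℝ => (Real.pi : ℂ) / (δ + y * Complex.I)) 0 :=
      ContinuousAt.div (by fun_prop) (by fun_prop) hne
    refine (ContinuousAt.comp' (g := fun z : ℂ => z ^ (1 / 2 : ℂ)) (continuousAt_cpow_const ?_) this).div_const _
    right
    have : (Real.pi : ℂ) / (((0:ℝ) : ℂ) + y * Complex.I) = ((-(Real.pi / y) : ℝ) : ℂ) * Complex.I := by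
      have : (y : ℂ) ≠ 0 := by exact_mod_cast hy.ne'
      push_cast
      rw [zero_add]
      field_simp
      simp
    rw [this, Complex.im_ofReal_mul, Complex.I_im]
    have := Real.pi_pos
    have : 0 < Real.pi / y := by positivity
    linarith
  have lim : Tendsto (fun δ : ℝ => ‖(∫ x in (0:ℝ)..R, Complex.exp (-((δ + y * Complex.I) * x ^ 2))) -
      ((Real.pi : ℂ) / (δ + y * Complex.I)) ^ (1 / 2 : ℂ) / 2‖) (𝓝[>] 0) (𝓝 ‖Fres y R - FresL y‖) := by
    have := ((c1.continuousAt.sub c2).norm).tendsto.mono_left (nhdsWithin_le_nhds (s := Ioi (0:ℝ)))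
    simpa [Fres, FresL] using this
  refine le_of_tendsto lim ?_
  filter_upwards [self_mem_nhdsWithin] with δ hδ using key δ hδ

lemma Fres_neg (y u : ℝ) : Fres y (-u) = -Fres y u := by
  have := intervalIntegral.integral_comp_neg (a := 0) (b := u)
    (f := fun x : ℝ => Complex.exp (-((y * Complex.I) * (x:ℂ) ^ 2)))
  simp only [Complex.ofReal_neg, neg_sq, neg_zero] at this
  unfold Fres
  rw [this, intervalIntegral.integral_symm]

lemma hasDerivAt_Fres (y u : ℝ) : HasDerivAt (Fres y) (Complex.exp (-((y * Complex.I) * u ^ 2))) u := by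
  have hc : Continuous fun x : ℝ => Complex.exp (-((y * Complex.I) * x ^ 2)) := by fun_prop
  exact hc.integral_hasStrictDerivAt 0 u |>.hasDerivAt

lemma tendsto_Fres_atTop {y : ℝ} (hy : 0 < y) : Tendsto (Fres y) atTop (𝓝 (FresL y)) := by
  rw [tendsto_iff_norm_sub_tendsto_zero]
  have h : Tendsto (fun R : ℝ => 1 / y * R⁻¹) atTop (𝓝 0) := by
    simpa using tendsto_inv_atTop_zero.const_mul (1 / y)
  refine squeeze_zero' (Eventually.of_forall fun _ => norm_nonneg _) ?_ h
  filter_upwards [eventually_gt_atTop 0] with R hR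
  refine (norm_Fres_sub_le hy hR).trans (le_of_eq ?_)
  field_simp

lemma exists_norm_Fres_le {y : ℝ} (hy : 0 < y) : ∃ C, ∀ u, ‖Fres y u‖ ≤ C := by
  have hpos : ∀ u, 0 ≤ u → ‖Fres y u‖ ≤ 1 + (‖FresL y‖ + 1 / y) := by
    intro u hu
    rcases le_total u 1 with h | h
    · have : ‖Fres y u‖ ≤ 1 * |u - 0| := by
        refine intervalIntegral.norm_integral_le_of_norm_le_const fun x _ => ?_
        exact norm_exp_neg_mul_sq_le (by simp) x
      rw [sub_zero, abs_of_nonneg hu] at this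
      have : 0 ≤ ‖FresL y‖ + 1 / y := by positivity
      linarith
    · have h1 := norm_Fres_sub_le hy (by linarith : 0 < u)
      have h2 : 1 / (y * u) ≤ 1 / y := by
        gcongr; nlinarith
      have h3 := norm_sub_norm_le (Fres y u) (FresL y)
      linarith
  refine ⟨1 + (‖FresL y‖ + 1 / y), fun u => ?_⟩
  rcases le_total 0 u with h | h
  · exact hpos u h
  · have := hpos (-u) (by linarith)
    rwa [Fres_neg, norm_neg] at this

end

section
open Set Filter Topology

lemma tendsto_stationary {φ φ' : ℝ → ℂ} {y c : ℝ} (hy : 0 < y) (hc : 0 < c)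
    (hd : ∀ v ∈ Ici (0:ℝ), HasDerivAt φ (φ' v) v) (hi : IntegrableOn φ (Ioi 0))
    (hi' : IntegrableOn φ' (Ioi 0)) (h0 : φ 0 = 0) (hinf : Tendsto φ atTop (𝓝 0)) :
    Tendsto (fun r : ℝ => (r : ℂ) * ∫ v in Ioi (0:ℝ), φ v *
      Complex.exp (-((y * Complex.I) * (r * (v - c)) ^ 2))) atTop (𝓝 (2 * FresL y * φ c)) := by
  obtain ⟨C, hC⟩ := exists_norm_Fres_le hy
  have hcF : Continuous (Fres y) :=
    continuous_iff_continuousAt.2 fun u => (hasDerivAt_Fres y u).continuousAt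
  have ibp : ∀ r : ℝ, (r : ℂ) * ∫ v in Ioi (0:ℝ), φ v *
      Complex.exp (-((y * Complex.I) * (r * (v - c)) ^ 2)) =
      - ∫ v in Ioi (0:ℝ), φ' v * Fres y (r * (v - c)) := by
    intro r
    have hv : ∀ v ∈ Ioi (0:ℝ), HasDerivAt (fun v : ℝ => Fres y (r * (v - c)))
        (r * Complex.exp (-((y * Complex.I) * (r * (v - c)) ^ 2))) v := by
      intro v _
      have h1 : HasDerivAt (fun v : ℝ => r * (v - c)) (r * 1) v :=
        ((hasDerivAt_id v).sub_const c).const_mul r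
      have h2 := (hasDerivAt_Fres y (r * (v - c))).scomp v h1
      refine h2.congr_deriv ?_
      simp
    have b1 : IntegrableOn (φ * fun v : ℝ => (r:ℂ) *
        Complex.exp (-((y * Complex.I) * (r * (v - c)) ^ 2))) (Ioi 0) := by
      refine Integrable.mul_bdd (c := |r|) hi ?_ ?_
      · exact Continuous.aestronglyMeasurable (by fun_prop)
      · refine ae_of_all _ fun v => ?_
        rw [norm_mul, Complex.norm_real, Real.norm_eq_abs]
        refine mul_le_of_le_one_right (abs_nonneg r) ?_
        have := norm_exp_neg_mul_sq_le (z := y * Complex.I) (by simp) (r * (v - c))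
        simpa using this
    have b2 : IntegrableOn (φ' * fun v : ℝ => Fres y (r * (v - c))) (Ioi 0) := by
      refine Integrable.mul_bdd (c := C) hi' ?_ ?_
      · exact Continuous.aestronglyMeasurable (by fun_prop)
      · exact ae_of_all _ fun v => hC _
    have bd : ∀ᶠ v in (⊤ : Filter ℝ), ‖Fres y (r * (v - c))‖ ≤ C := Eventually.of_forall fun v => hC _
    have t0 : Tendsto (φ * fun v : ℝ => Fres y (r * (v - c))) (𝓝[>] 0) (𝓝 0) := by
      have h1 : Tendsto φ (𝓝[>] 0) (𝓝 0) := by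
        have := (hd 0 self_mem_Ici).continuousAt.tendsto
        rw [h0] at this
        exact this.mono_left nhdsWithin_le_nhds
      exact h1.zero_mul_isBoundedUnder_le (isBoundedUnder_of ⟨C, fun v => hC _⟩)
    have t1 : Tendsto (φ * fun v : ℝ => Fres y (r * (v - c))) atTop (𝓝 0) :=
      hinf.zero_mul_isBoundedUnder_le (isBoundedUnder_of ⟨C, fun v => hC _⟩)
    have := integral_Ioi_mul_deriv_eq_deriv_mul (fun v hv => hd v (mem_Ioi.1 hv).le) hv b1 b2 t0 t1
    rw [sub_zero, zero_sub] at this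
    rw [← this, ← integral_const_mul]
    congr 1; ext v; ring
  simp_rw [ibp]
  have lim : Tendsto (fun r : ℝ => ∫ v in Ioi (0:ℝ), φ' v * Fres y (r * (v - c))) atTop
      (𝓝 (∫ v in Ioi (0:ℝ), (2 * FresL y) * (Ioi c).indicator φ' v - FresL y * φ' v)) := by
    refine tendsto_integral_filter_of_dominated_convergence (fun v => C * ‖φ' v‖) ?_ ?_
      (hi'.norm.const_mul C) ?_
    · exact Eventually.of_forall fun r => hi'.aestronglyMeasurable.mul
        (Continuous.aestronglyMeasurable (by fun_prop))
    · refine Eventually.of_forall fun r => ae_of_all _ fun v => ?_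
      rw [norm_mul, mul_comm]
      exact mul_le_mul_of_nonneg_right (hC _) (norm_nonneg _)
    · have hne : ∀ᵐ v ∂(volume.restrict (Ioi (0:ℝ))), v ≠ c :=
        ae_restrict_of_ae (Measure.ae_ne volume c)
      filter_upwards [hne] with v hv
      rcases lt_or_gt_of_ne hv with h | h
      · rw [indicator_of_notMem (by simpa using h.le)]
        have h1 : Tendsto (fun r : ℝ => Fres y (r * (c - v))) atTop (𝓝 (FresL y)) :=
          (tendsto_Fres_atTop hy).comp (tendsto_id.atTop_mul_const (sub_pos.2 h))
        have h2 := (h1.neg).const_mul (φ' v)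
        convert h2 using 2 with r
        · rw [← Fres_neg]; congr 2; ring
        · ring
      · rw [indicator_of_mem (mem_Ioi.2 h)]
        have h1 : Tendsto (fun r : ℝ => Fres y (r * (v - c))) atTop (𝓝 (FresL y)) :=
          (tendsto_Fres_atTop hy).comp (tendsto_id.atTop_mul_const (sub_pos.2 h))
        have h2 := h1.const_mul (φ' v)
        convert h2 using 2
        ring
  have hsub : Ioi c ⊆ Ioi (0:ℝ) := Ioi_subset_Ioi hc.le
  have e1 : ∫ v in Ioi (0:ℝ), φ' v = 0 := by
    rw [integral_Ioi_of_hasDerivAt_of_tendsto' hd hi' hinf, h0, sub_zero]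
  have e2 : ∫ v in Ioi (0:ℝ), (Ioi c).indicator φ' v = - φ c := by
    rw [setIntegral_indicator measurableSet_Ioi, inter_eq_right.2 hsub,
      integral_Ioi_of_hasDerivAt_of_tendsto' (fun x hx => hd x (hc.le.trans hx)) (hi'.mono_set hsub) hinf,
      zero_sub]
  rw [integral_sub ((hi'.indicator measurableSet_Ioi).const_mul _) (hi'.const_mul _),
    integral_const_mul, integral_const_mul, e1, e2] at lim
  convert lim.neg using 2
  ring

/-- The amplitude `v ^ (3/2) * exp (-v ^ 2)`. -/
noncomputable def ampl (v : ℝ) : ℂ := ((v ^ (3 / 2 : ℝ) * Real.exp (-v ^ 2) : ℝ) : ℂ)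

lemma tendsto_ampl {y c : ℝ} (hy : 0 < y) (hc : 0 < c) :
    Tendsto (fun r : ℝ => (r : ℂ) * ∫ v in Ioi (0:ℝ), ampl v *
      Complex.exp (-((y * Complex.I) * (r * (v - c)) ^ 2))) atTop (𝓝 (2 * FresL y * ampl c)) := by
  have hd : ∀ v : ℝ, HasDerivAt (fun v : ℝ => v ^ (3 / 2 : ℝ) * Real.exp (-v ^ 2))
      (3 / 2 * v ^ (1 / 2 : ℝ) * Real.exp (-v ^ 2) + v ^ (3 / 2 : ℝ) * (Real.exp (-v ^ 2) * (-(2 * v)))) v := by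
    intro v
    have h1 := Real.hasDerivAt_rpow_const (x := v) (p := 3 / 2) (Or.inr (by norm_num))
    have h2 : HasDerivAt (fun v : ℝ => Real.exp (-v ^ 2)) _ v := ((hasDerivAt_pow 2 v).fun_neg).exp
    refine (h1.fun_mul h2).congr_deriv ?_
    norm_num
  have hintg : ∀ s : ℝ, -1 < s → IntegrableOn (fun v : ℝ => v ^ s * Real.exp (-v ^ 2)) (Ioi 0) := by
    intro s hs
    simpa using integrableOn_rpow_mul_exp_neg_mul_sq one_pos hs
  refine tendsto_stationary (φ' := fun v => ((3 / 2 * v ^ (1 / 2 : ℝ) * Real.exp (-v ^ 2) +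
    v ^ (3 / 2 : ℝ) * (Real.exp (-v ^ 2) * (-(2 * v))) : ℝ) : ℂ)) hy hc ?_ ?_ ?_ ?_ ?_
  · exact fun v _ => (hd v).ofReal_comp
  · exact Integrable.ofReal (hintg (3 / 2) (by norm_num))
  · refine Integrable.ofReal (𝕜 := ℂ) ?_
    have h1 := ((hintg (1 / 2) (by norm_num)).const_mul (3 / 2)).sub ((hintg (5 / 2) (by norm_num)).const_mul 2)
    refine (integrableOn_congr_fun (fun v hv => ?_) measurableSet_Ioi).1 h1
    have : v ^ (5 / 2 : ℝ) = v ^ (3 / 2 : ℝ) * v := by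
      rw [← Real.rpow_add_one (ne_of_gt hv)]; norm_num
    change 3 / 2 * (v ^ (1 / 2 : ℝ) * Real.exp (-v ^ 2)) - 2 * (v ^ (5 / 2 : ℝ) * Real.exp (-v ^ 2)) =
      3 / 2 * v ^ (1 / 2 : ℝ) * Real.exp (-v ^ 2) + v ^ (3 / 2 : ℝ) * (Real.exp (-v ^ 2) * (-(2 * v)))
    rw [this]; ring
  · simp [ampl]
  · have h1 : Tendsto (fun v : ℝ => v ^ (3 / 2 : ℝ) * Real.exp (-v ^ 2)) atTop (𝓝 0) := by
      have h2 := tendsto_rpow_mul_exp_neg_mul_atTop_nhds_zero (3 / 2) 1 one_pos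
      refine squeeze_zero' ?_ ?_ h2
      · filter_upwards [eventually_ge_atTop 0] with v hv using by positivity
      · filter_upwards [eventually_ge_atTop 1] with v hv
        gcongr
        nlinarith
    have := (Complex.continuous_ofReal.tendsto 0).comp h1
    exact this

/-- The oscillating function `t ^ (1/4) * exp (2 i b √t)`. -/
noncomputable def osc (b t : ℝ) : ℂ :=
  ((t ^ (1 / 4 : ℝ) : ℝ) : ℂ) * Complex.exp ((2 * b * Real.sqrt t : ℝ) * Complex.I)

lemma lapl_osc {b r y : ℝ} (hr : 0 < r) (hy : 0 < y) :
    (((r ^ 4)⁻¹ : ℝ) : ℂ) * lapl (osc b) (((r ^ 4)⁻¹ : ℝ) + ((y / r ^ 2 : ℝ) : ℂ) * Complex.I) =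
    Complex.exp ((r ^ 2 * b ^ 2 / y : ℝ) * Complex.I) * (2 * ((r : ℂ) * ∫ v in Ioi (0:ℝ), ampl v *
      Complex.exp (-((y * Complex.I) * (r * (v - (b / y : ℝ))) ^ 2)))) := by
  set s : ℂ := ((r ^ 4)⁻¹ : ℝ) + ((y / r ^ 2 : ℝ) : ℂ) * Complex.I with hs
  have cv : ∀ g : ℝ → ℂ, ∫ t in Ioi (0:ℝ), g t =
      ∫ v in Ioi (0:ℝ), (2 * r ^ 4 * v : ℝ) • g (r ^ 4 * v ^ 2) := by
    intro g
    have h1 := integral_comp_mul_left_Ioi' g 0 (b := r ^ 4) (by positivity)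
    rw [mul_zero] at h1
    rw [← h1, ← integral_smul]
    rw [← integral_comp_rpow_Ioi_of_pos (g := fun x => r ^ 4 • g (r ^ 4 * x)) two_pos]
    refine setIntegral_congr_fun measurableSet_Ioi fun v hv => ?_
    simp only [smul_smul]
    rw [Real.rpow_two, show (2:ℝ) - 1 = 1 by norm_num, Real.rpow_one]
    congr 1
    ring
  rw [lapl, cv, ← integral_const_mul, ← mul_assoc, ← mul_assoc, ← integral_const_mul]
  refine setIntegral_congr_fun measurableSet_Ioi fun v hv => ?_
  have hv0 : 0 < v := hv
  have hr0 : (r : ℂ) ≠ 0 := by exact_mod_cast hr.ne'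
  have hy0 : (y : ℂ) ≠ 0 := by exact_mod_cast hy.ne'
  simp only [osc, ampl]
  have sq : Real.sqrt (r ^ 4 * v ^ 2) = r ^ 2 * v := by
    rw [show r ^ 4 * v ^ 2 = (r ^ 2 * v) ^ 2 by ring, Real.sqrt_sq (by positivity)]
  have qr : (r ^ 4 * v ^ 2) ^ (1 / 4 : ℝ) = r * v ^ (1 / 2 : ℝ) := by
    rw [Real.mul_rpow (by positivity) (by positivity), ← Real.rpow_natCast, ← Real.rpow_natCast,
      ← Real.rpow_mul hr.le, ← Real.rpow_mul hv0.le]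
    norm_num
  have p32 : v ^ (3 / 2 : ℝ) = v * v ^ (1 / 2 : ℝ) := by
    rw [mul_comm, ← Real.rpow_add_one hv0.ne']; norm_num
  rw [sq, qr, p32]
  have ex : Complex.exp ((2 * b * (r ^ 2 * v) : ℝ) * Complex.I) * Complex.exp (-(s * (r ^ 4 * v ^ 2 : ℝ))) =
      Complex.exp ((r ^ 2 * b ^ 2 / y : ℝ) * Complex.I) * ((Real.exp (-v ^ 2) : ℝ) : ℂ) *
      Complex.exp (-((y * Complex.I) * (r * (v - (b / y : ℝ))) ^ 2)) := by
    rw [Complex.ofReal_exp, ← Complex.exp_add, ← Complex.exp_add, ← Complex.exp_add]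
    congr 1
    rw [hs]
    push_cast
    field_simp
    ring
  rw [Complex.real_smul]
  push_cast at ex ⊢
  have hinv : (r : ℂ)⁻¹ ^ 4 * r ^ 4 = 1 := by field_simp
  linear_combination (2 * (r:ℂ) * v * ((v ^ (1 / 2 : ℝ) : ℝ) : ℂ)) * ex +
    2 * (r:ℂ) * v * ((v ^ (1 / 2 : ℝ) : ℝ) : ℂ) *
    (Complex.exp (2 * b * (r ^ 2 * v) * Complex.I) * Complex.exp (-(s * (r ^ 4 * v ^ 2)))) * hinv

end

section
open Set Filter Topology

lemma tendsto_sin_div : Tendsto (fun z : ℂ => Complex.sin z / z) (𝓝[≠] 0) (𝓝 1) := by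
  have h := (Complex.hasDerivAt_sin 0).tendsto_slope_zero
  simp only [zero_add, Complex.sin_zero, sub_zero, Complex.cos_zero, smul_eq_mul] at h
  refine h.congr fun z => ?_
  rw [div_eq_inv_mul]

lemma tendsto_cot_sub : Tendsto (fun z : ℂ => Complex.cos z / Complex.sin z - 1 / z) (𝓝[≠] 0) (𝓝 0) := by
  have h1 : Tendsto (fun z : ℂ => (z * Complex.cos z - Complex.sin z) / z ^ 2) (𝓝[≠] 0) (𝓝 0) := by
    rw [Metric.tendsto_nhds]
    intro ε hε
    have hs : ∀ᶠ z : ℂ in 𝓝 0, ‖Complex.sin z‖ < ε / 2 := by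
      have := Complex.continuous_sin.norm.tendsto 0
      simp only [Complex.sin_zero, norm_zero] at this
      exact this.eventually_lt_const (by positivity)
    obtain ⟨δ, hδ, hb⟩ := Metric.eventually_nhds_iff_ball.1 hs
    rw [eventually_nhdsWithin_iff]
    filter_upwards [Metric.ball_mem_nhds (0:ℂ) hδ] with z hz hz0
    have hz0 : z ≠ 0 := hz0
    have hzδ : ‖z‖ < δ := by simpa using hz
    have hd : ∀ w ∈ Metric.closedBall (0:ℂ) ‖z‖, HasDerivWithinAt
        (fun z : ℂ => z * Complex.cos z - Complex.sin z) (-(w * Complex.sin w))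
        (Metric.closedBall (0:ℂ) ‖z‖) w := by
      intro w _
      refine (((hasDerivAt_id' w).fun_mul (Complex.hasDerivAt_cos w)).fun_sub
        (Complex.hasDerivAt_sin w)).hasDerivWithinAt.congr_deriv ?_
      ring
    have := Convex.norm_image_sub_le_of_norm_hasDerivWithin_le (C := ‖z‖ * (ε / 2)) hd ?_
      (convex_closedBall _ _) (x := 0) (y := z) (by simp) (by simp)
    · simp only [zero_mul, Complex.sin_zero, sub_zero] at this
      rw [dist_zero_right, norm_div, norm_pow, div_lt_iff₀ (by positivity)]
      have : 0 < ‖z‖ := norm_pos_iff.2 hz0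
      nlinarith [mul_pos hε (pow_pos this 2)]
    · intro w hw
      have hw' : ‖w‖ ≤ ‖z‖ := by simpa using hw
      rw [norm_neg, norm_mul]
      refine mul_le_mul hw' (hb w ?_).le (norm_nonneg _) (norm_nonneg _)
      simpa using hw'.trans_lt hzδ
  have h2 := h1.div tendsto_sin_div one_ne_zero
  rw [zero_div] at h2
  refine h2.congr' ?_
  have hs : ∀ᶠ z : ℂ in 𝓝[≠] 0, Complex.sin z / z ≠ 0 :=
    tendsto_sin_div.eventually_ne one_ne_zero
  filter_upwards [hs, self_mem_nhdsWithin] with z h hz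
  have hz : z ≠ 0 := hz
  have hs : Complex.sin z ≠ 0 := fun h' => h (by rw [h', zero_div])
  simp only [Pi.div_apply]
  field_simp

/-- One term of the modular main part of the Laplace transform. -/
noncomputable def Qker (n : ℕ) (s : ℂ) : ℂ :=
  Real.pi * Complex.I / (s * Complex.sin (s / 2)) * Complex.exp (-(2 * Real.pi * n * wct s))

/-- The point `r⁻⁴ + i y r⁻²`. -/
noncomputable def spt (r y : ℝ) : ℂ := (((r ^ 4)⁻¹ : ℝ) : ℂ) + ((y / r ^ 2 : ℝ) : ℂ) * Complex.I

lemma spt_re (r y : ℝ) : (spt r y).re = (r ^ 4)⁻¹ := by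
  unfold spt
  rw [Complex.add_re, Complex.ofReal_re, Complex.re_ofReal_mul, Complex.I_re, mul_zero, add_zero]

lemma tendsto_spt (y : ℝ) : Tendsto (fun r : ℝ => (r : ℂ) ^ 2 * spt r y) atTop (𝓝 (y * Complex.I)) := by
  have h : Tendsto (fun r : ℝ => (((r ^ 2)⁻¹ : ℝ) : ℂ) + y * Complex.I) atTop (𝓝 (y * Complex.I)) := by
    have h1 : Tendsto (fun r : ℝ => (r ^ 2)⁻¹) atTop (𝓝 0) :=
      (tendsto_pow_atTop two_ne_zero).inv_tendsto_atTop
    have h2 := (Complex.continuous_ofReal.tendsto 0).comp h1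
    simpa using h2.add_const ((y : ℂ) * Complex.I)
  refine h.congr' ?_
  filter_upwards [eventually_gt_atTop 0] with r hr
  have : (r : ℂ) ≠ 0 := by exact_mod_cast hr.ne'
  unfold spt
  push_cast
  field_simp

lemma tendsto_spt_half (y : ℝ) : Tendsto (fun r : ℝ => spt r y / 2) atTop (𝓝[≠] 0) := by
  rw [tendsto_nhdsWithin_iff]
  constructor
  · have h1 : Tendsto (fun r : ℝ => (r ^ 2)⁻¹) atTop (𝓝 0) :=
      (tendsto_pow_atTop two_ne_zero).inv_tendsto_atTop
    have h2 := ((Complex.continuous_ofReal.tendsto 0).comp h1).mul ((tendsto_spt y).div_const 2)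
    rw [Complex.ofReal_zero, zero_mul] at h2
    refine h2.congr' ?_
    filter_upwards [eventually_gt_atTop 0] with r hr
    have : (r : ℂ) ≠ 0 := by exact_mod_cast hr.ne'
    simp only [Function.comp]
    push_cast
    field_simp
  · filter_upwards [eventually_gt_atTop 0] with r hr
    intro h
    have h1 := spt_re r y
    have h2 : spt r y = 0 := by simpa using h
    rw [h2, Complex.zero_re] at h1
    have : 0 < (r ^ 4)⁻¹ := by positivity
    linarith

lemma tendsto_wct_spt {y : ℝ} (hy : 0 < y) :
    Tendsto (fun r : ℝ => wct (spt r y) + ((r ^ 2 / y : ℝ) : ℂ) * Complex.I) atTop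
      (𝓝 (((1 / y ^ 2 : ℝ) : ℂ) + Complex.I / 2)) := by
  have hy0 : (y : ℂ) ≠ 0 := by exact_mod_cast hy.ne'
  have hyI : (y : ℂ) * Complex.I ≠ 0 := mul_ne_zero hy0 Complex.I_ne_zero
  have h1 := (tendsto_cot_sub.comp (tendsto_spt_half y)).div_const 2
  have h2 : Tendsto (fun r : ℝ => -1 / (((r : ℂ) ^ 2 * spt r y) * (y * Complex.I))) atTop
      (𝓝 (-1 / ((y * Complex.I) * (y * Complex.I)))) :=
    tendsto_const_nhds.div ((tendsto_spt y).mul_const _) (mul_ne_zero hyI hyI)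
  have h3 := (h1.add h2).add_const (Complex.I / 2)
  have e : (0 : ℂ) / 2 + -1 / ((y * Complex.I) * (y * Complex.I)) + Complex.I / 2 =
      ((1 / y ^ 2 : ℝ) : ℂ) + Complex.I / 2 := by
    push_cast
    rw [show (y : ℂ) * Complex.I * (y * Complex.I) = -(y ^ 2) by
      linear_combination (y:ℂ) ^ 2 * Complex.I_sq]
    field_simp
    ring
  rw [e] at h3
  refine h3.congr' ?_
  have hne := (tendsto_nhdsWithin_iff.1 (tendsto_spt_half y)).2
  filter_upwards [eventually_gt_atTop 0, hne] with r hr hs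
  have hr0 : (r : ℂ) ≠ 0 := by exact_mod_cast hr.ne'
  have hs0 : spt r y ≠ 0 := fun h => hs (by simp [h])
  simp only [Function.comp, wct]
  have key : -(1 / (spt r y / 2)) / 2 + -1 / ((r : ℂ) ^ 2 * spt r y * (y * Complex.I)) =
      ((r ^ 2 / y : ℝ) : ℂ) * Complex.I := by
    have e1 : spt r y * (r ^ 4) = 1 + y * r ^ 2 * Complex.I := by
      unfold spt
      push_cast
      field_simp
    push_cast
    have hI := Complex.I_ne_zero
    field_simp
    linear_combination e1 - (r:ℂ) ^ 4 * spt r y * Complex.I_sq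
  rw [← key]
  have : Complex.cos (spt r y / 2) / (2 * Complex.sin (spt r y / 2)) =
      Complex.cos (spt r y / 2) / Complex.sin (spt r y / 2) / 2 := by
    rw [div_div, mul_comm]
  rw [this]
  ring

/-- The pointwise limit of the rescaled kernels. -/
noncomputable def glim (n : ℕ) (y : ℝ) : ℂ :=
  -(2 * Real.pi * Complex.I) * (-1) ^ n * (((y ^ 2)⁻¹ * Real.exp (-(2 * Real.pi * n / y ^ 2)) : ℝ) : ℂ)

lemma tendsto_Qker (n : ℕ) {y : ℝ} (hy : 0 < y) :
    Tendsto (fun r : ℝ => (((r ^ 4)⁻¹ : ℝ) : ℂ) * Qker n (spt r y) *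
      Complex.exp (-((r ^ 2 * (2 * Real.pi * n) / y : ℝ) * Complex.I))) atTop (𝓝 (glim n y)) := by
  have hy0 : (y : ℂ) ≠ 0 := by exact_mod_cast hy.ne'
  have hyI : (y : ℂ) * Complex.I ≠ 0 := mul_ne_zero hy0 Complex.I_ne_zero
  have h1 := (tendsto_spt y)
  have h2 : Tendsto (fun r : ℝ => (r : ℂ) ^ 2 * Complex.sin (spt r y / 2)) atTop
      (𝓝 (1 * ((y * Complex.I) / 2))) := by
    refine ((tendsto_sin_div.comp (tendsto_spt_half y)).mul (h1.div_const 2)).congr' ?_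
    have hne := (tendsto_nhdsWithin_iff.1 (tendsto_spt_half y)).2
    filter_upwards [hne] with r hs
    have hs0 : spt r y ≠ 0 := fun h => hs (by simp [h])
    simp only [Function.comp]
    field_simp
  have h3 : Tendsto (fun r : ℝ => Real.pi * Complex.I / (((r : ℂ) ^ 2 * spt r y) *
      ((r : ℂ) ^ 2 * Complex.sin (spt r y / 2)))) atTop
      (𝓝 (Real.pi * Complex.I / ((y * Complex.I) * (1 * ((y * Complex.I) / 2))))) :=
    tendsto_const_nhds.div (h1.mul h2) (mul_ne_zero hyI (by simpa using hy0))
  have h4 := ((tendsto_wct_spt hy).const_mul (-(2 * Real.pi * n : ℂ))).cexp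
  have h5 := h3.mul h4
  have e : Real.pi * Complex.I / ((y * Complex.I) * (1 * ((y * Complex.I) / 2))) *
      Complex.exp (-(2 * Real.pi * n : ℂ) * (((1 / y ^ 2 : ℝ) : ℂ) + Complex.I / 2)) = glim n y := by
    have e1 : Complex.exp (-(2 * Real.pi * n : ℂ) * (((1 / y ^ 2 : ℝ) : ℂ) + Complex.I / 2)) =
        (-1) ^ n * ((Real.exp (-(2 * Real.pi * n / y ^ 2)) : ℝ) : ℂ) := by
      have e2 : Complex.exp (-(Real.pi * Complex.I)) = -1 := by
        rw [Complex.exp_neg, Complex.exp_pi_mul_I]; norm_num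
      rw [← e2, ← Complex.exp_nat_mul, Complex.ofReal_exp, ← Complex.exp_add]
      congr 1
      push_cast
      ring
    rw [e1, glim]
    have hI := Complex.I_ne_zero
    push_cast
    field_simp
    rw [Complex.I_sq]; ring
  rw [e] at h5
  refine h5.congr' ?_
  filter_upwards [eventually_gt_atTop 0] with r hr
  have hr0 : (r : ℂ) ≠ 0 := by exact_mod_cast hr.ne'
  have e3 : Complex.exp (-(2 * Real.pi * n : ℂ) * (wct (spt r y) + ((r ^ 2 / y : ℝ) : ℂ) * Complex.I)) =
      Complex.exp (-(2 * Real.pi * n * wct (spt r y))) *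
      Complex.exp (-((r ^ 2 * (2 * Real.pi * n) / y : ℝ) * Complex.I)) := by
    rw [← Complex.exp_add]
    congr 1
    push_cast
    ring
  rw [e3, Qker]
  push_cast
  rw [show ((r:ℂ) ^ 2 * spt r y) * ((r : ℂ) ^ 2 * Complex.sin (spt r y / 2)) =
    (r:ℂ) ^ 4 * (spt r y * Complex.sin (spt r y / 2)) by ring, div_mul_eq_div_div_swap]
  ring

/-- The Fourier coefficient of the limiting almost periodic function. -/
noncomputable def kap (n : ℕ) : ℂ :=
  -Complex.I * (-1) ^ n * ((Real.sqrt Real.pi / (Real.sqrt (2 * Real.pi * n)) ^ (3 / 2 : ℝ) : ℝ) : ℂ) *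
    Complex.exp ((Real.pi / 4 : ℝ) * Complex.I)

lemma FresL_eq {y : ℝ} (hy : 0 < y) : FresL y =
    ((Real.sqrt (Real.pi / y) / 2 : ℝ) : ℂ) * Complex.exp (-((Real.pi / 4 : ℝ) * Complex.I)) := by
  have hp : 0 < Real.pi / y := div_pos Real.pi_pos hy
  have hy0 : (y : ℂ) ≠ 0 := by exact_mod_cast hy.ne'
  have e : (Real.pi : ℂ) / (y * Complex.I) = ((Real.pi / y : ℝ) : ℂ) * (-Complex.I) := by
    push_cast
    field_simp
    simp
  unfold FresL
  have hne : ((Real.pi / y : ℝ) : ℂ) * (-Complex.I) ≠ 0 :=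
    mul_ne_zero (by exact_mod_cast hp.ne') (neg_ne_zero.2 Complex.I_ne_zero)
  rw [e, Complex.cpow_def_of_ne_zero hne, Complex.log_ofReal_mul hp (neg_ne_zero.2 Complex.I_ne_zero),
    Complex.log_neg_I]
  have e2 : Real.sqrt (Real.pi / y) = Real.exp (Real.log (Real.pi / y) * (1 / 2)) := by
    rw [Real.sqrt_eq_rpow, Real.rpow_def_of_pos hp]
  rw [e2]
  push_cast
  rw [add_mul, Complex.exp_add]
  rw [show -((Real.pi : ℂ) / 2) * Complex.I * (1 / 2) = -(Real.pi / 4 * Complex.I) by ring]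
  ring

lemma kap_mul_limit {n : ℕ} (hn : 1 ≤ n) {y : ℝ} (hy : 0 < y) :
    kap n * (2 * (2 * FresL y * ampl (Real.sqrt (2 * Real.pi * n) / y))) = glim n y := by
  have hn0 : (0:ℝ) < n := by exact_mod_cast hn
  have hp : 0 < 2 * Real.pi * n := by positivity
  set b := Real.sqrt (2 * Real.pi * n) with hb
  have hb0 : 0 < b := Real.sqrt_pos.2 hp
  have hb2 : b ^ 2 = 2 * Real.pi * n := Real.sq_sqrt hp.le
  rw [FresL_eq hy, kap, ← hb, ampl, glim]
  have e1 : Complex.exp ((Real.pi / 4 : ℝ) * Complex.I) * Complex.exp (-((Real.pi / 4 : ℝ) * Complex.I)) = 1 := by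
    rw [← Complex.exp_add]; simp
  have e2 : Real.sqrt Real.pi / b ^ (3 / 2 : ℝ) * (2 * (2 * (Real.sqrt (Real.pi / y) / 2) *
      ((b / y) ^ (3 / 2 : ℝ) * Real.exp (-(b / y) ^ 2)))) =
      2 * Real.pi * ((y ^ 2)⁻¹ * Real.exp (-(2 * Real.pi * n / y ^ 2))) := by
    rw [Real.div_rpow hb0.le hy.le, Real.sqrt_div Real.pi_pos.le, div_pow, hb2]
    have h1 : y ^ (3 / 2 : ℝ) * Real.sqrt y = y ^ 2 := by
      rw [Real.sqrt_eq_rpow, ← Real.rpow_add hy]; norm_num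
    have h3 : 0 < b ^ (3 / 2 : ℝ) := by positivity
    have h4 : 0 < y ^ (3 / 2 : ℝ) := by positivity
    have h5 : 0 < Real.sqrt y := Real.sqrt_pos.2 hy
    rw [← h1]
    field_simp
    exact Real.sq_sqrt Real.pi_pos.le
  have e2' := congrArg (fun x : ℝ => (x : ℂ)) e2
  push_cast at e1 e2' ⊢
  linear_combination (-Complex.I * (-1) ^ n * (Complex.exp (Real.pi / 4 * Complex.I) * Complex.exp (-(Real.pi / 4 * Complex.I)))) * e2' - 
    Complex.I * (-1) ^ n * (2 * Real.pi * (((y:ℂ) ^ 2)⁻¹ * Complex.exp (-(2 * Real.pi * n / y ^ 2)))) * e1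

end

section
open Set Filter Topology

lemma continuous_lapl {f : ℝ → ℂ} {σ : ℝ} (hf : AEStronglyMeasurable f (volume.restrict (Ioi 0)))
    (h1 : IntegrableOn (fun t => ‖f t‖ * Real.exp (-(σ * t))) (Ioi 0)) :
    Continuous fun τ : ℝ => lapl f (σ + τ * Complex.I) := by
  unfold lapl
  refine continuous_of_dominated (bound := fun t => ‖f t‖ * Real.exp (-(σ * t))) ?_ ?_ h1 ?_
  · exact fun τ => hf.mul (Continuous.aestronglyMeasurable (by fun_prop))
  · refine fun τ => ae_of_all _ fun t => ?_
    rw [norm_mul, norm_exp_neg_mul_ofReal]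
    simp
  · exact ae_of_all _ fun t => by fun_prop

lemma norm_osc (b : ℝ) {t : ℝ} (ht : 0 ≤ t) : ‖osc b t‖ = t ^ (1 / 4 : ℝ) := by
  rw [osc, norm_mul, Complex.norm_exp_ofReal_mul_I, mul_one, Complex.norm_real,
    Real.norm_of_nonneg (by positivity)]

lemma measurable_osc (b : ℝ) : Measurable (osc b) := by
  unfold osc
  have : Continuous fun t : ℝ => t ^ (1 / 4 : ℝ) := Real.continuous_rpow_const (by norm_num)
  exact Continuous.measurable (by fun_prop)

lemma integrable_osc (b : ℝ) {σ : ℝ} (hσ : 0 < σ) :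
    IntegrableOn (fun t => ‖osc b t‖ * Real.exp (-(σ * t))) (Ioi 0) := by
  have := integrableOn_rpow_mul_exp (x := 5 / 4) (by norm_num) hσ
  refine (integrableOn_congr_fun (fun t ht => ?_) measurableSet_Ioi).1 this
  rw [norm_osc b (mem_Ioi.1 ht).le]; norm_num

lemma norm_osc_sq (b : ℝ) {t : ℝ} (ht : 0 < t) : ‖osc b t‖ ^ 2 = t ^ ((3 / 2 : ℝ) - 1) := by
  rw [norm_osc b ht.le, ← Real.rpow_natCast, ← Real.rpow_mul ht.le]; norm_num

lemma integrable_osc_sq (b : ℝ) {σ : ℝ} (hσ : 0 < σ) :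
    IntegrableOn (fun t => ‖osc b t‖ ^ 2 * Real.exp (-(σ * t))) (Ioi 0) := by
  have := integrableOn_rpow_mul_exp (x := 3 / 2) (by norm_num) hσ
  refine (integrableOn_congr_fun (fun t ht => ?_) measurableSet_Ioi).1 this
  rw [norm_osc_sq b (mem_Ioi.1 ht)]

/-- The normalised square norm of the Laplace transform of `osc b` on a vertical line. -/
noncomputable def oscA : ℝ := 2 * Real.pi * ((1 / 2) ^ (3 / 2 : ℝ) * Real.Gamma (3 / 2))

lemma plancherel_osc (b : ℝ) {r : ℝ} (hr : 0 < r) :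
    Integrable (fun τ : ℝ => ‖lapl (osc b) ((((r ^ 4)⁻¹ : ℝ) : ℂ) + τ * Complex.I)‖ ^ 2) ∧
    (r ^ 6)⁻¹ * ∫ τ : ℝ, ‖lapl (osc b) ((((r ^ 4)⁻¹ : ℝ) : ℂ) + τ * Complex.I)‖ ^ 2 = oscA := by
  have hσ : 0 < (r ^ 4)⁻¹ := by positivity
  obtain ⟨h1, h2⟩ := plancherel_lapl (σ := (r ^ 4)⁻¹) (measurable_osc b).aestronglyMeasurable
    (integrable_osc b hσ) (integrable_osc_sq b (by positivity))
  refine ⟨h1, ?_⟩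
  rw [h2]
  have : ∫ t in Ioi (0:ℝ), ‖osc b t‖ ^ 2 * Real.exp (-(2 * (r ^ 4)⁻¹ * t)) =
      r ^ 6 * ((1 / 2) ^ (3 / 2 : ℝ) * Real.Gamma (3 / 2)) := by
    have h3 := Real.integral_rpow_mul_exp_neg_mul_Ioi (a := 3 / 2) (r := 2 * (r ^ 4)⁻¹) (by norm_num)
      (by positivity)
    have e : (1 / (2 * (r ^ 4)⁻¹)) ^ (3 / 2 : ℝ) = r ^ 6 * (1 / 2) ^ (3 / 2 : ℝ) := by
      rw [show 1 / (2 * (r ^ 4)⁻¹) = r ^ 4 * (1 / 2) by field_simp,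
        Real.mul_rpow (by positivity) (by norm_num), ← Real.rpow_natCast, ← Real.rpow_mul hr.le,
        ← Real.rpow_natCast r 6]
      norm_num
    rw [e] at h3
    rw [← mul_assoc, ← h3]
    refine setIntegral_congr_fun measurableSet_Ioi fun t ht => ?_
    rw [norm_osc_sq b (mem_Ioi.1 ht)]
  rw [this, oscA]
  field_simp

lemma integral_glim_sq {n : ℕ} (hn : 1 ≤ n) : IntegrableOn (fun y => ‖glim n y‖ ^ 2) (Ioi 0) ∧
    ∫ y in Ioi (0:ℝ), ‖glim n y‖ ^ 2 = ‖kap n‖ ^ 2 * oscA := by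
  have hn0 : (0:ℝ) < n := by exact_mod_cast hn
  have hp : 0 < 4 * Real.pi * n := by have := Real.pi_pos; positivity
  have hpi := Real.pi_pos
  set g : ℝ → ℝ := fun u => 4 * Real.pi ^ 2 * (u ^ (2:ℝ) * Real.exp (-(4 * Real.pi * n) * u ^ (2:ℝ))) with hg
  have e : ∀ y ∈ Ioi (0:ℝ), ‖glim n y‖ ^ 2 = (|(-1:ℝ)| * y ^ ((-1:ℝ) - 1)) • g (y ^ (-1:ℝ)) := by
    intro y hy
    have hy0 : 0 < y := hy
    simp only [glim, norm_mul, norm_neg, norm_pow, norm_one, one_pow, mul_one, Complex.norm_ofNat,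
      Complex.norm_real, Complex.norm_I, Real.norm_of_nonneg hpi.le]
    rw [hg]
    simp only [smul_eq_mul, abs_neg, abs_one, one_mul, norm_inv, norm_pow, Real.norm_eq_abs, Real.abs_exp, abs_of_pos hy0]
    rw [show (-1:ℝ) - 1 = -2 by norm_num, Real.rpow_neg hy0.le, Real.rpow_neg_one, Real.rpow_two, Real.rpow_two,
      mul_pow, mul_pow, mul_pow, ← Real.exp_nat_mul]
    rw [show ((2:ℕ):ℝ) * -(2 * Real.pi * n / y ^ 2) = -(4 * Real.pi * n) * y⁻¹ ^ 2 by
      push_cast; field_simp; ring]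
    ring
  have hgi : IntegrableOn g (Ioi 0) := by
    refine Integrable.const_mul ?_ _
    have := integrableOn_rpow_mul_exp_neg_mul_rpow (s := 2) (p := 2) (by norm_num) (by norm_num) hp
    exact this
  have hgI : ∫ u in Ioi (0:ℝ), g u = ‖kap n‖ ^ 2 * oscA := by
    rw [hg, integral_const_mul, integral_rpow_mul_exp_neg_mul_rpow (by norm_num) (by norm_num) hp]
    have hk : ‖kap n‖ = Real.sqrt Real.pi / (Real.sqrt (2 * Real.pi * n)) ^ (3 / 2 : ℝ) := by
      have hx : ‖Complex.exp ((Real.pi / 4 : ℝ) * Complex.I)‖ = 1 := Complex.norm_exp_ofReal_mul_I _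
      rw [kap, norm_mul, hx]
      simp only [norm_mul, norm_neg, norm_pow, norm_one, one_pow, mul_one, Complex.norm_real,
        Complex.norm_I, one_mul]
      exact Real.norm_of_nonneg (by positivity)
    have h2 : 0 < 2 * Real.pi * n := by positivity
    rw [hk, div_pow, Real.sq_sqrt hpi.le, oscA, Real.sqrt_eq_rpow, ← Real.rpow_mul h2.le,
      ← Real.rpow_natCast (_ ^ _) 2, ← Real.rpow_mul h2.le,
      show 4 * Real.pi * n = (2 * Real.pi * n) * 2 by ring, Real.mul_rpow h2.le (by norm_num),
      show -((2:ℝ) + 1) / 2 = -(3 / 2) by norm_num, show ((2:ℝ) + 1) / 2 = 3 / 2 by norm_num,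
      Real.rpow_neg h2.le, Real.rpow_neg (by norm_num : (0:ℝ) ≤ 2), Real.div_rpow (by norm_num) (by norm_num),
      Real.one_rpow]
    norm_num
    ring
  constructor
  · rw [integrableOn_congr_fun e measurableSet_Ioi]
    exact (integrableOn_Ioi_comp_rpow_iff g (by norm_num : (-1:ℝ) ≠ 0)).2 hgi
  · rw [setIntegral_congr_fun measurableSet_Ioi e, integral_comp_rpow_Ioi g (by norm_num : (-1:ℝ) ≠ 0), hgI]

lemma inv_sq_mul_exp_le {u : ℝ} (hu : 0 < u) : (u ^ 2)⁻¹ * Real.exp (-(1 / u)) ≤ 2 / (1 + u) := by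
  have h1 := Real.quadratic_le_exp_of_nonneg (x := 1 / u) (by positivity)
  rw [Real.exp_neg, ← mul_inv, ← one_div, div_le_div_iff₀ (by positivity) (by positivity), one_mul]
  have h2 : u ^ 2 * (1 + 1 / u + (1 / u) ^ 2 / 2) = u ^ 2 + u + 1 / 2 := by field_simp
  have h3 : u ^ 2 * (1 + 1 / u + (1 / u) ^ 2 / 2) ≤ u ^ 2 * Real.exp (1 / u) := by gcongr
  nlinarith [sq_nonneg u]

lemma norm_Qker_sq (n : ℕ) {σ τ : ℝ} (h0 : 0 < σ) (h1 : σ ≤ 1) :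
    ‖Qker n (σ + τ * Complex.I)‖ ^ 2 = Real.pi ^ 2 * (2 / ((σ ^ 2 + τ ^ 2) * Qf σ τ)) *
      Real.exp (-(4 * Real.pi * n * (Real.sin σ / (2 * Qf σ τ)))) := by
  have hre : (wct (σ + τ * Complex.I)).re = Real.sin σ / (2 * Qf σ τ) := by
    rw [wct_eq h0 h1]
    simp [-Complex.ofReal_div, -Complex.ofReal_sub]
  have hn : ‖(σ : ℂ) + τ * Complex.I‖ ^ 2 = σ ^ 2 + τ ^ 2 := by
    rw [Complex.sq_norm, Complex.normSq_add_mul_I]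
  rw [Qker, norm_mul, norm_div, norm_mul, norm_mul, mul_pow, div_pow, mul_pow, mul_pow, hn,
    norm_sin_half_sq, Complex.norm_I, Complex.norm_real, Real.norm_of_nonneg Real.pi_pos.le,
    Complex.norm_exp, ← Real.exp_nat_mul]
  have : (-(2 * Real.pi * n * wct (σ + τ * Complex.I))).re =
      -(2 * Real.pi * n * (Real.sin σ / (2 * Qf σ τ))) := by
    rw [← hre, show (2 * Real.pi * n * wct (σ + τ * Complex.I) : ℂ) =
      ((2 * Real.pi * n : ℝ) : ℂ) * wct (σ + τ * Complex.I) by push_cast; ring, Complex.neg_re,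
      Complex.re_ofReal_mul]
  rw [this]
  congr 1
  · have := Qf_pos h0 h1 τ
    field_simp
  · congr 1; push_cast; ring

lemma norm_Qker_sq_le {n : ℕ} (hn : 1 ≤ n) {r y : ℝ} (hr : 2 ≤ r) (hy : 0 < y) (hyr : y < r ^ 2 / 4) :
    ‖(((r ^ 4)⁻¹ : ℝ) : ℂ) * Qker n (spt r y)‖ ^ 2 ≤ 24 * Real.pi ^ 2 * (1 + y ^ 2)⁻¹ := by
  have hpi := Real.pi_gt_three
  have hr0 : 0 < r := by linarith
  set σ : ℝ := (r ^ 4)⁻¹ with hσ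
  set τ : ℝ := y / r ^ 2 with hτ
  have h0 : 0 < σ := by positivity
  have h1 : σ ≤ 1 / 16 := by
    rw [hσ, inv_le_comm₀ (by positivity) (by norm_num)]
    have : (2:ℝ) ^ 4 ≤ r ^ 4 := by gcongr
    norm_num at this ⊢; linarith
  have hτ0 : 0 < τ := by positivity
  have hτ1 : τ ≤ 1 / 4 := by
    rw [hτ, div_le_iff₀ (by positivity)]; linarith
  have hb := Qf_bounds (σ := σ) (τ := τ) (by rw [abs_of_pos hτ0]; linarith)
  have hb2 := Qf_ge h0 (by linarith) τ
  have hQ := Qf_pos h0 (by linarith) τ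
  set u : ℝ := σ + y ^ 2 with hu
  have hu0 : 0 < u := by positivity
  have huσ : σ ^ 2 + τ ^ 2 = σ * u := by
    rw [hu, hτ, hσ]; field_simp
  have hsin : σ / 2 ≤ Real.sin σ := by
    have h3 := Real.sin_gt_sub_cube (x := σ) h0
    have h4 : σ ^ 3 ≤ σ := by nlinarith [pow_le_one₀ (n := 2) h0.le (by linarith : σ ≤ 1)]
    linarith
  have hQl : σ * u / 6 ≤ Qf σ τ := by rw [← huσ]; nlinarith [sq_nonneg σ, sq_nonneg τ]
  have hQu : Qf σ τ ≤ σ * u := by rw [← huσ]; nlinarith [sq_nonneg σ, sq_nonneg τ]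
  have hσu : 0 < σ * u := by positivity
  have e1 : 1 / (4 * u) ≤ Real.sin σ / (2 * Qf σ τ) := by
    rw [div_le_div_iff₀ (by positivity) (by positivity)]
    nlinarith
  have e2 : 1 / u ≤ 4 * Real.pi * n * (Real.sin σ / (2 * Qf σ τ)) := by
    have hn1 : (1:ℝ) ≤ n := by exact_mod_cast hn
    have h2 : 0 < 1 / (4 * u) := by positivity
    calc 1 / u = 4 * (1 / (4 * u)) := by field_simp
      _ ≤ 4 * Real.pi * n * (1 / (4 * u)) := by gcongr; nlinarith
      _ ≤ _ := by gcongr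
  rw [norm_mul, mul_pow, Complex.norm_real, Real.norm_of_nonneg h0.le,
    show spt r y = (σ : ℂ) + τ * Complex.I from rfl, norm_Qker_sq n h0 (by linarith), huσ]
  calc σ ^ 2 * (Real.pi ^ 2 * (2 / (σ * u * Qf σ τ)) * Real.exp (-(4 * Real.pi * n * (Real.sin σ / (2 * Qf σ τ)))))
      ≤ σ ^ 2 * (Real.pi ^ 2 * (2 / (σ * u * (σ * u / 6))) * Real.exp (-(1 / u))) := by gcongr
    _ = 12 * Real.pi ^ 2 * ((u ^ 2)⁻¹ * Real.exp (-(1 / u))) := by field_simp; ring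
    _ ≤ 12 * Real.pi ^ 2 * (2 / (1 + u)) := by gcongr; exact inv_sq_mul_exp_le hu0
    _ ≤ 12 * Real.pi ^ 2 * (2 / (1 + y ^ 2)) := by gcongr; linarith
    _ = _ := by field_simp; ring

lemma continuous_Qker (n : ℕ) {σ : ℝ} (h0 : 0 < σ) (h1 : σ ≤ 1) :
    Continuous fun τ : ℝ => Qker n (σ + τ * Complex.I) := by
  have := continuous_wct h0 h1
  unfold Qker
  refine Continuous.mul (Continuous.div (by fun_prop) (by fun_prop) fun τ => ?_) (by fun_prop)
  have hre : ((σ : ℂ) + τ * Complex.I).re = σ := by simp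
  refine mul_ne_zero (ne_zero_of_re_pos (by rw [hre]; exact h0)) (sin_half_ne_zero (by rw [hre]; exact h0) (by rw [hre]; exact h1))

end

section
open Set Filter Topology

lemma integral_comp_div_sq (F : ℝ → ℝ) {r : ℝ} (hr : 0 < r) :
    ∫ y in Ioi (0:ℝ), F (y / r ^ 2) = r ^ 2 * ∫ τ in Ioi (0:ℝ), F τ := by
  have := integral_comp_mul_right_Ioi F 0 (b := (r ^ 2)⁻¹) (by positivity)
  simpa [div_eq_mul_inv] using this

/-- The Laplace transform of `osc (√(2πn))` at `r⁻⁴ + iτ`. -/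
noncomputable def Iker (n : ℕ) (s : ℂ) : ℂ := kap n * lapl (osc (Real.sqrt (2 * Real.pi * n))) s

lemma norm_kap_pos {n : ℕ} (hn : 1 ≤ n) : 0 < ‖kap n‖ := by
  have hn0 : (0:ℝ) < n := by exact_mod_cast hn
  have h : 0 < Real.sqrt Real.pi / (Real.sqrt (2 * Real.pi * n)) ^ (3 / 2 : ℝ) := by
    have := Real.pi_pos; positivity
  rw [norm_pos_iff, kap]
  refine mul_ne_zero (mul_ne_zero (mul_ne_zero (neg_ne_zero.2 Complex.I_ne_zero) (by simp)) ?_) (Complex.exp_ne_zero _)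
  exact_mod_cast h.ne'

lemma continuous_Iker (n : ℕ) {r : ℝ} (hr : 0 < r) :
    Continuous fun τ : ℝ => Iker n ((((r ^ 4)⁻¹ : ℝ) : ℂ) + τ * Complex.I) :=
  (continuous_lapl (measurable_osc _).aestronglyMeasurable
    (integrable_osc _ (by positivity))).const_mul _

lemma integrable_Iker_sq (n : ℕ) {r : ℝ} (hr : 0 < r) :
    Integrable fun τ : ℝ => ‖Iker n ((((r ^ 4)⁻¹ : ℝ) : ℂ) + τ * Complex.I)‖ ^ 2 := by
  simp only [Iker, norm_mul, mul_pow]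
  exact (plancherel_osc _ hr).1.const_mul _

lemma integral_Iker_sq (n : ℕ) {r : ℝ} (hr : 0 < r) :
    (r ^ 6)⁻¹ * ∫ τ : ℝ, ‖Iker n ((((r ^ 4)⁻¹ : ℝ) : ℂ) + τ * Complex.I)‖ ^ 2 =
      ‖kap n‖ ^ 2 * oscA := by
  simp only [Iker, norm_mul, mul_pow]
  rw [integral_const_mul, ← (plancherel_osc (Real.sqrt (2 * Real.pi * n)) hr).2]
  ring

/-- The truncated main term on the line `Re s = r⁻⁴`. -/
noncomputable def Qcut (n : ℕ) (r τ : ℝ) : ℂ :=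
  (Iio (1 / 4 : ℝ)).indicator (fun τ : ℝ => Qker n ((((r ^ 4)⁻¹ : ℝ) : ℂ) + τ * Complex.I)) τ

lemma tendsto_Iker_aux {n : ℕ} (hn : 1 ≤ n) :
    Tendsto (fun r : ℝ => (r ^ 6)⁻¹ * ∫ τ in Ioi (0:ℝ),
      ‖Iker n ((((r ^ 4)⁻¹ : ℝ) : ℂ) + τ * Complex.I) - Qcut n r τ‖ ^ 2) atTop (𝓝 0) ∧
    Tendsto (fun r : ℝ => (r ^ 6)⁻¹ * ∫ τ in Ioi (0:ℝ),
      ‖Iker n ((((r ^ 4)⁻¹ : ℝ) : ℂ) + τ * Complex.I)‖ ^ 2) atTop (𝓝 (‖kap n‖ ^ 2 * oscA)) := by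
  have hpi := Real.pi_pos
  have hn0 : (0:ℝ) < n := by exact_mod_cast hn
  set b : ℝ := Real.sqrt (2 * Real.pi * n) with hb
  have hb2 : b ^ 2 = 2 * Real.pi * n := Real.sq_sqrt (by positivity)
  have hb0 : 0 < b := Real.sqrt_pos.2 (by positivity)
  set ph : ℝ → ℝ → ℂ := fun r y => Complex.exp (-((r ^ 2 * (2 * Real.pi * n) / y : ℝ) * Complex.I)) with hph
  have hphn : ∀ r y, ‖ph r y‖ = 1 := by
    intro r y
    rw [hph]
    simp only
    rw [← neg_mul, ← Complex.ofReal_neg, Complex.norm_exp_ofReal_mul_I]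
  set f : ℝ → ℝ → ℂ := fun r y => (((r ^ 4)⁻¹ : ℝ) : ℂ) * Iker n (spt r y) * ph r y with hf
  set q : ℝ → ℝ → ℂ := fun r y => (((r ^ 4)⁻¹ : ℝ) : ℂ) * Qcut n r (y / r ^ 2) * ph r y with hq
  have hscale : ∀ (F : ℝ → ℝ → ℂ) (r : ℝ), 0 < r →
      ∫ y in Ioi (0:ℝ), ‖(((r ^ 4)⁻¹ : ℝ) : ℂ) * F r (y / r ^ 2) * ph r y‖ ^ 2 =
      (r ^ 6)⁻¹ * ∫ τ in Ioi (0:ℝ), ‖F r τ‖ ^ 2 := by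
    intro F r hr
    simp only [norm_mul, hphn, mul_one, mul_pow]
    rw [integral_const_mul, integral_comp_div_sq (fun x => ‖F r x‖ ^ 2) hr, Complex.norm_real,
      Real.norm_of_nonneg (by positivity)]
    field_simp
  have hfs : ∀ r : ℝ, 0 < r → ∫ y in Ioi (0:ℝ), ‖f r y‖ ^ 2 =
      (r ^ 6)⁻¹ * ∫ τ in Ioi (0:ℝ), ‖Iker n ((((r ^ 4)⁻¹ : ℝ) : ℂ) + τ * Complex.I)‖ ^ 2 := fun r hr =>
    hscale (fun r τ => Iker n ((((r ^ 4)⁻¹ : ℝ) : ℂ) + τ * Complex.I)) r hr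
  have hphm : ∀ r, Measurable (ph r) := by intro r; rw [hph]; fun_prop
  have key := scheffe_sq (μ := volume.restrict (Ioi (0:ℝ))) (l := (atTop : Filter ℝ)) (f := f) (q := q)
    (g := glim n) (B := fun y => 24 * Real.pi ^ 2 * (1 + y ^ 2)⁻¹) (M := ‖kap n‖ ^ 2 * oscA)
    ?_ ?_ ?_ ?_ (integral_glim_sq hn).1 (integral_glim_sq hn).2 ?_ ?_ ?_ ?_ ?_
  · refine ⟨key.1.congr' ?_, key.2.congr' ?_⟩
    · filter_upwards [eventually_gt_atTop 0] with r hr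
      rw [← hscale (fun r τ => Iker n ((((r ^ 4)⁻¹ : ℝ) : ℂ) + τ * Complex.I) - Qcut n r τ) r hr]
      refine integral_congr_ae (ae_of_all _ fun y => ?_)
      simp only [hf, hq, spt]
      congr 2; ring
    · filter_upwards [eventually_gt_atTop 0] with r hr using hfs r hr
  · filter_upwards [eventually_gt_atTop 0] with r hr
    have h1 : Continuous fun y : ℝ => Iker n (spt r y) :=
      (continuous_Iker n hr).comp (by fun_prop : Continuous fun y : ℝ => y / r ^ 2)
    exact ((h1.measurable.const_mul _).mul (hphm r)).aestronglyMeasurable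
  · filter_upwards [eventually_ge_atTop 1] with r hr
    have hr0 : 0 < r := by linarith
    have h1 : Measurable fun τ : ℝ => Qcut n r τ := by
      unfold Qcut
      refine (continuous_Qker n (by positivity) ?_).measurable.indicator measurableSet_Iio
      exact inv_le_one_of_one_le₀ (one_le_pow₀ hr)
    have h2 : Measurable fun y : ℝ => Qcut n r (y / r ^ 2) := h1.comp (by fun_prop)
    exact ((h2.const_mul _).mul (hphm r)).aestronglyMeasurable
  · have : Measurable (glim n) := by unfold glim; fun_prop
    exact this.aestronglyMeasurable
  · filter_upwards [eventually_gt_atTop 0] with r hr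
    have h1 := (integrable_Iker_sq n hr).comp_mul_right' (R := (r ^ 2)⁻¹) (by positivity)
    simp only [hf, norm_mul, hphn, mul_one, mul_pow, Complex.norm_real]
    refine Integrable.integrableOn (Integrable.const_mul ?_ _)
    simpa [spt, div_eq_mul_inv] using h1
  · filter_upwards [eventually_gt_atTop 0] with r hr
    rw [hfs r hr, ← integral_Iker_sq n hr]
    refine mul_le_mul_of_nonneg_left ?_ (by positivity)
    exact setIntegral_le_integral (integrable_Iker_sq n hr) (ae_of_all _ fun _ => by positivity)
  · exact (integrable_inv_one_add_sq.const_mul _).integrableOn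
  · filter_upwards [eventually_ge_atTop 2] with r hr
    have hr0 : 0 < r := by linarith
    refine (ae_restrict_iff' measurableSet_Ioi).2 (ae_of_all _ fun y hy => ?_)
    simp only [hq]
    rw [norm_mul, hphn, mul_one]
    unfold Qcut indicator
    split_ifs with h
    · have h' : y / r ^ 2 < 1 / 4 := h
      rw [div_lt_iff₀ (by positivity)] at h'
      exact norm_Qker_sq_le hn hr hy (by linarith)
    · simp; positivity
  · refine (ae_restrict_iff' measurableSet_Ioi).2 (ae_of_all _ fun y hy => ?_)
    have hy : 0 < y := hy
    have h1 := (tendsto_ampl (y := y) (c := b / y) hy (by positivity)).const_mul (2 * kap n)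
    have h2 := kap_mul_limit hn hy
    rw [show 2 * kap n * (2 * FresL y * ampl (b / y)) = glim n y by rw [← h2]; ring] at h1
    refine h1.congr' ?_
    filter_upwards [eventually_gt_atTop 0] with r hr
    have h3 := lapl_osc (b := b) hr hy
    simp only [hf, hph, Iker, spt]
    rw [← hb, show ∀ a k l p : ℂ, a * (k * l) * p = k * p * (a * l) by intros; ring, h3, hb2, Complex.exp_neg]
    have := Complex.exp_ne_zero ((r ^ 2 * (2 * Real.pi * n) / y : ℝ) * Complex.I)
    field_simp
  · refine (ae_restrict_iff' measurableSet_Ioi).2 (ae_of_all _ fun y hy => ?_)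
    have hy : 0 < y := hy
    refine (tendsto_Qker n hy).congr' ?_
    filter_upwards [eventually_gt_atTop 0, eventually_gt_atTop (4 * y), eventually_gt_atTop 1] with r hr hr1 hr2
    simp only [hq, Qcut]
    rw [indicator_of_mem]
    · rfl
    · rw [mem_Iio, div_lt_iff₀ (by positivity)]; nlinarith

/-- `Iker n` is asymptotically concentrated on the upper half of the line and equal to `Qcut n`. -/
lemma tendsto_Iker_sub {n : ℕ} (hn : 1 ≤ n) :
    Tendsto (fun r : ℝ => (r ^ 6)⁻¹ * ∫ τ in Ioi (0:ℝ),
      ‖Iker n ((((r ^ 4)⁻¹ : ℝ) : ℂ) + τ * Complex.I) - Qcut n r τ‖ ^ 2) atTop (𝓝 0) :=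
  (tendsto_Iker_aux hn).1

lemma tendsto_Iker_neg {n : ℕ} (hn : 1 ≤ n) :
    Tendsto (fun r : ℝ => (r ^ 6)⁻¹ * ∫ τ in Ioi (0:ℝ),
      ‖Iker n ((((r ^ 4)⁻¹ : ℝ) : ℂ) + ((-τ : ℝ) : ℂ) * Complex.I)‖ ^ 2) atTop (𝓝 0) := by
  have h := (tendsto_const_nhds (x := ‖kap n‖ ^ 2 * oscA)).sub (tendsto_Iker_aux hn).2
  rw [sub_self] at h
  refine h.congr' ?_
  filter_upwards [eventually_gt_atTop 0] with r hr
  rw [← integral_Iker_sq n hr, ← mul_sub]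
  congr 1
  rw [← intervalIntegral.integral_Iic_add_Ioi (integrable_Iker_sq n hr).integrableOn
    (integrable_Iker_sq n hr).integrableOn (b := 0), add_sub_cancel_right]
  have := integral_comp_neg_Ioi 0 (fun τ : ℝ => ‖Iker n ((((r ^ 4)⁻¹ : ℝ) : ℂ) + (τ : ℂ) * Complex.I)‖ ^ 2)
  rw [neg_zero] at this
  exact this.symm

end

section
open Set Filter Topology

/-- The Laplace transform of `E`. -/
noncomputable def Eh (s : ℂ) : ℂ := lapl (fun t => (Efun t : ℂ)) s

lemma Eh_plancherel {σ : ℝ} (hσ : 0 < σ) : Integrable fun τ : ℝ => ‖Eh (σ + τ * Complex.I)‖ ^ 2 := by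
  refine (plancherel_lapl ?_ ?_ ?_).1
  · exact (Complex.continuous_ofReal.comp continuous_Efun).aestronglyMeasurable
  · simpa only [Complex.norm_real, Real.norm_eq_abs] using integrable_Efun_mul_exp hσ
  · simpa only [Complex.norm_real, Real.norm_eq_abs] using
      integrable_Efun_sq_mul_exp (σ := 2 * σ) (by positivity)

lemma continuous_Eh {σ : ℝ} (hσ : 0 < σ) : Continuous fun τ : ℝ => Eh (σ + τ * Complex.I) := by
  refine continuous_lapl ?_ ?_
  · exact (Complex.continuous_ofReal.comp continuous_Efun).aestronglyMeasurable
  · simpa only [Complex.norm_real, Real.norm_eq_abs] using integrable_Efun_mul_exp hσ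

lemma norm_Mfun_le : ∃ A, 0 < A ∧ ∀ w : ℂ, 0 < w.re → ‖Mfun w‖ ≤ (A + |Real.log ‖w‖|) / ‖w‖ := by
  refine ⟨|Real.eulerMascheroniConstant| + |Real.log (2 * Real.pi)| + Real.pi, by have := Real.pi_pos; positivity,
    fun w hw => ?_⟩
  have hpi := Real.pi_gt_three
  have hw0 := norm_pos_iff.mpr (ne_zero_of_re_pos hw)
  have h1 := Complex.norm_le_abs_re_add_abs_im (Complex.log w)
  rw [Complex.log_re, Complex.log_im] at h1
  have h2 := Complex.abs_arg_le_pi w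
  rw [Mfun, norm_div, norm_mul, norm_mul, Complex.norm_ofNat, Complex.norm_real,
    Real.norm_of_nonneg Real.pi_pos.le]
  have h3 : ‖(Real.eulerMascheroniConstant : ℂ) - Real.log (2 * Real.pi) - Complex.log w‖ ≤
      |Real.eulerMascheroniConstant| + |Real.log (2 * Real.pi)| + Real.pi + |Real.log ‖w‖| := by
    refine (norm_sub_le _ _).trans ?_
    refine (add_le_add_left (norm_sub_le _ _) _).trans ?_
    rw [Complex.norm_real, Complex.norm_real, Real.norm_eq_abs, Real.norm_eq_abs]
    linarith
  have h4 : ‖w‖ ≤ 2 * Real.pi * ‖w‖ := by nlinarith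
  exact div_le_div₀ (by positivity) h3 hw0 h4

lemma Eh_near : ∃ C, 0 < C ∧ ∀ s : ℂ, 0 < s.re → s.re ≤ 1 / 4 → 0 < s.im → s.im ≤ 1 / 4 →
    ‖Eh s - Real.pi * Complex.I / (s * Complex.sin (s / 2)) * Dser (wct s)‖ ≤ C * ‖s‖ ^ (-(9 / 8 : ℝ)) := by
  obtain ⟨C, hC, h⟩ := Lap_modular
  refine ⟨C, hC, fun s h1 h2 h3 h4 => ?_⟩
  have hs := ne_zero_of_re_pos h1
  have hsn := norm_pos_iff.2 hs
  have := h s h1 h2 h3 h4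
  rw [← lapl_Efun h1] at this
  have e : lapl (fun t => (Efun t : ℂ)) s = Eh s := rfl
  rw [e, show s * Eh s - Real.pi * Complex.I / Complex.sin (s / 2) * Dser (wct s) =
    s * (Eh s - Real.pi * Complex.I / (s * Complex.sin (s / 2)) * Dser (wct s)) by field_simp, norm_mul] at this
  rw [show -(9 / 8 : ℝ) = -(1 / 8) - 1 by norm_num, Real.rpow_sub_one hsn.ne', mul_div_assoc', le_div_iff₀ hsn]
  linarith

lemma Eh_far : ∃ C, 0 < C ∧ ∀ σ τ : ℝ, 0 < σ → σ ≤ 1 → 1 / 4 ≤ τ →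
    ‖Eh (σ + τ * Complex.I)‖ ^ 2 ≤ C * (τ ^ (-2 : ℝ) + ‖Dser (wpt (σ + τ * Complex.I))‖ ^ 2 * Real.exp τ) := by
  obtain ⟨C1, hC1, hL⟩ := Lap_approx
  obtain ⟨A, hA, hM⟩ := norm_Mfun_le
  set K := C1 + 2 * Real.pi * (A + 2) + 2 * Real.pi * (4 * A + 17) with hK
  have hpi := Real.pi_pos
  refine ⟨2 * K ^ 2 + 2 * (8 * Real.pi) ^ 2, by positivity, fun σ τ h0 h1 hτ => ?_⟩
  set s : ℂ := σ + τ * Complex.I with hs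
  have hre : s.re = σ := by simp [hs]
  have him : s.im = τ := by simp [hs]
  have hτ0 : 0 < τ := by linarith
  have hsτ : τ ≤ ‖s‖ := by have := Complex.abs_im_le_norm s; rw [him, abs_of_pos hτ0] at this; exact this
  have hMs : ‖Mfun s‖ ≤ 4 * A + 17 := by
    refine (hM s (by rw [hre]; exact h0)).trans ?_
    have hn : 0 < ‖s‖ := hτ0.trans_le hsτ
    have h4 : |Real.log ‖s‖| ≤ 4 + ‖s‖ := by
      rw [abs_le]
      refine ⟨?_, by linarith [Real.log_le_self hn.le]⟩
      have := Real.one_sub_inv_le_log_of_pos hn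
      have h5 : ‖s‖⁻¹ ≤ 4 := by
        rw [inv_le_comm₀ hn (by norm_num)]; norm_num; linarith
      linarith
    rw [div_le_iff₀ hn]
    nlinarith
  have hMw : Real.exp (τ / 2) * ‖Mfun (wpt s)‖ ≤ A + 2 := by
    have h5 := hM (wpt s) (wpt_re_pos (by rw [hre]; exact h0) (by rw [hre]; linarith [Real.pi_gt_three]))
    rw [norm_wpt, him, Real.log_exp, abs_of_pos hτ0] at h5
    have h6 : Real.exp τ = Real.exp (τ / 2) * Real.exp (τ / 2) := by rw [← Real.exp_add]; ring_nf
    have h7 := Real.add_one_le_exp (τ / 2)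
    calc Real.exp (τ / 2) * ‖Mfun (wpt s)‖ ≤ Real.exp (τ / 2) * ((A + τ) / Real.exp τ) := by gcongr
      _ = (A + τ) / Real.exp (τ / 2) := by rw [h6]; field_simp
      _ ≤ A + 2 := by
        rw [div_le_iff₀ (Real.exp_pos _)]
        nlinarith
  have hX : ‖Complex.exp (-(s * Complex.I / 2))‖ = Real.exp (τ / 2) := by
    rw [Complex.norm_exp]; congr 1; simp [him]; ring
  have hLs := hL s (by rw [hre]; exact h0) (by rw [hre]; exact h1)
  have key : ‖s * Eh s‖ ≤ K + 2 * Real.pi * (Real.exp (τ / 2) * ‖Dser (wpt s)‖) := by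
    have e : s * Eh s = (Lap s - 2 * Real.pi * Complex.exp (-(s * Complex.I / 2)) *
      (Dser (wpt s) - Mfun (wpt s))) + 2 * Real.pi * (Complex.exp (-(s * Complex.I / 2)) * Dser (wpt s)) -
      2 * Real.pi * (Complex.exp (-(s * Complex.I / 2)) * Mfun (wpt s)) - 2 * Real.pi * Mfun s := by
      rw [Eh, lapl_Efun (by rw [hre]; exact h0)]; ring
    have n2 : ‖(2 * Real.pi : ℂ)‖ = 2 * Real.pi := by
      rw [norm_mul, Complex.norm_ofNat, Complex.norm_real, Real.norm_of_nonneg hpi.le]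
    rw [e]
    refine (norm_sub_le _ _).trans ?_
    refine (add_le_add_left ((norm_sub_le _ _).trans (add_le_add_left (norm_add_le _ _) _)) _).trans ?_
    rw [norm_mul (2 * Real.pi : ℂ) (Mfun s), norm_mul (2 * Real.pi : ℂ) (_ * _), norm_mul (2 * Real.pi : ℂ) (_ * _),
      n2, norm_mul _ (Dser _), norm_mul _ (Mfun (wpt s)), hX, hK]
    have := mul_le_mul_of_nonneg_left hMw (by positivity : 0 ≤ 2 * Real.pi)
    have := mul_le_mul_of_nonneg_left hMs (by positivity : 0 ≤ 2 * Real.pi)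
    linarith
  rw [norm_mul] at key
  set D := Real.exp (τ / 2) * ‖Dser (wpt s)‖ with hD
  have hD0 : 0 ≤ D := by positivity
  have hE : ‖Eh s‖ ≤ K * τ⁻¹ + 8 * Real.pi * D := by
    have h8 : τ * ‖Eh s‖ ≤ K + 2 * Real.pi * D := (mul_le_mul_of_nonneg_right hsτ (norm_nonneg _)).trans key
    have h9 : ‖Eh s‖ ≤ (K + 2 * Real.pi * D) / τ := by rw [le_div_iff₀ hτ0]; linarith
    refine h9.trans ?_
    rw [div_eq_mul_inv, add_mul]
    have : τ⁻¹ ≤ 4 := by rw [inv_le_comm₀ hτ0 (by norm_num)]; norm_num; linarith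
    nlinarith [mul_nonneg hpi.le hD0]
  have hD2 : ‖Dser (wpt s)‖ ^ 2 * Real.exp τ = D ^ 2 := by
    rw [hD, mul_pow, ← Real.exp_nat_mul, mul_comm]; congr 2; push_cast; ring
  rw [hD2, Real.rpow_neg hτ0.le, Real.rpow_two, ← inv_pow]
  have h10 : ‖Eh s‖ ^ 2 ≤ (K * τ⁻¹ + 8 * Real.pi * D) ^ 2 := by gcongr
  have h11 : 0 ≤ K ^ 2 * D ^ 2 := by positivity
  have h12 : 0 ≤ (8 * Real.pi) ^ 2 * τ⁻¹ ^ 2 := by positivity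
  nlinarith [sq_nonneg (K * τ⁻¹ - 8 * Real.pi * D)]

lemma integral_Eh_far : ∃ C, 0 < C ∧ ∀ σ : ℝ, 0 < σ → σ ≤ 1 →
    ∫ τ in Ioi (1 / 4 : ℝ), ‖Eh (σ + τ * Complex.I)‖ ^ 2 ≤ C * σ ^ (-(5 / 4 : ℝ)) := by
  obtain ⟨C1, hC1, hE⟩ := Eh_far
  obtain ⟨C2, hC2, hD⟩ := integral_Dser_wpt_le
  refine ⟨C1 * (4 + C2), by positivity, fun σ h0 h1 => ?_⟩
  have hσ1 : 1 ≤ σ ^ (-(5 / 4 : ℝ)) := Real.one_le_rpow_of_pos_of_le_one_of_nonpos h0 h1 (by norm_num)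
  have hlog : 0 < Real.log 2 := Real.log_pos (by norm_num)
  have hlim : Tendsto (fun m : ℕ => (m : ℝ) * Real.log 2) atTop atTop :=
    tendsto_natCast_atTop_atTop.atTop_mul_const hlog
  have ht := intervalIntegral_tendsto_integral_Ioi (1 / 4 : ℝ) (Eh_plancherel h0).integrableOn hlim
  refine le_of_tendsto ht ?_
  filter_upwards [hlim.eventually_ge_atTop (1 / 4)] with m hm
  have hDc : ContinuousOn (fun τ : ℝ => ‖Dser (wpt (σ + τ * Complex.I))‖ ^ 2 * Real.exp τ) univ := by
    have hw : Continuous fun τ : ℝ => wpt (σ + τ * Complex.I) := by unfold wpt; fun_prop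
    have : Continuous fun τ : ℝ => tser dd (wpt (σ + τ * Complex.I)) :=
      (continuousOn_tser fun n => (abs_of_nonneg (dd_nonneg n)).le).comp_continuous hw fun τ => by
        refine wpt_re_pos (by simpa using h0) ?_
        simp; linarith [Real.pi_gt_three]
    exact ((this.norm.pow 2).mul Real.continuous_exp).continuousOn
  have hDc := continuousOn_univ.1 hDc
  have hpow : IntegrableOn (fun τ : ℝ => τ ^ (-2 : ℝ)) (Ioi (1 / 4)) :=
    integrableOn_Ioi_rpow_of_lt (by norm_num) (by norm_num)
  have hi1 : IntervalIntegrable (fun τ : ℝ => τ ^ (-2 : ℝ)) volume (1 / 4) (m * Real.log 2) := by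
    rw [intervalIntegrable_iff_integrableOn_Ioc_of_le hm]
    exact hpow.mono_set Ioc_subset_Ioi_self
  have hi2 := hDc.intervalIntegrable (μ := volume) (1 / 4) (m * Real.log 2)
  have hp : ∫ τ in (1 / 4 : ℝ)..(m * Real.log 2), τ ^ (-2 : ℝ) ≤ 4 := by
    rw [intervalIntegral.integral_of_le hm]
    refine (setIntegral_mono_set hpow ?_ Ioc_subset_Ioi_self.eventuallyLE).trans ?_
    · exact (ae_restrict_iff' measurableSet_Ioi).2 (ae_of_all _ fun x hx => Real.rpow_nonneg
        ((by norm_num : (0:ℝ) ≤ 1 / 4).trans (mem_Ioi.1 hx).le) _)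
    · rw [integral_Ioi_rpow_of_lt (by norm_num) (by norm_num)]; norm_num [Real.rpow_neg_one]
  have hq : ∫ τ in (1 / 4 : ℝ)..(m * Real.log 2), ‖Dser (wpt (σ + τ * Complex.I))‖ ^ 2 * Real.exp τ ≤
      C2 * σ ^ (-(5 / 4 : ℝ)) := by
    refine le_trans ?_ (hD σ h0 h1 m)
    have h3 := intervalIntegral.integral_add_adjacent_intervals
      (hDc.intervalIntegrable (μ := volume) 0 (1 / 4)) hi2
    rw [← h3]
    have : 0 ≤ ∫ τ in (0 : ℝ)..(1 / 4), ‖Dser (wpt (σ + τ * Complex.I))‖ ^ 2 * Real.exp τ :=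
      intervalIntegral.integral_nonneg (by norm_num) fun x _ => by positivity
    linarith
  calc ∫ τ in (1 / 4 : ℝ)..(m * Real.log 2), ‖Eh (σ + τ * Complex.I)‖ ^ 2
      ≤ ∫ τ in (1 / 4 : ℝ)..(m * Real.log 2),
        C1 * (τ ^ (-2 : ℝ) + ‖Dser (wpt (σ + τ * Complex.I))‖ ^ 2 * Real.exp τ) := by
        refine intervalIntegral.integral_mono_on hm (Eh_plancherel h0).intervalIntegrable
          ((hi1.add hi2).const_mul _) fun x hx => hE σ x h0 h1 hx.1
    _ ≤ C1 * (4 + C2 * σ ^ (-(5 / 4 : ℝ))) := by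
        rw [intervalIntegral.integral_const_mul, intervalIntegral.integral_add hi1 hi2]
        gcongr
    _ ≤ _ := by
        rw [mul_assoc]; gcongr; nlinarith

end

section
open Set Filter Topology

/-- The divisor function with its first `N` values removed. -/
noncomputable def ddTail (N n : ℕ) : ℝ := if n ≤ N then 0 else dd n

/-- The tail of the mean square series. -/
noncomputable def tailSum (N : ℕ) : ℝ := ∑' n : ℕ, ddTail N n ^ 2 * (n : ℝ) ^ (-(3 / 2 : ℝ))

lemma abs_ddTail_le (N n : ℕ) : |ddTail N n| ≤ dd n := by
  unfold ddTail
  split_ifs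
  · simpa using dd_nonneg n
  · rw [abs_of_nonneg (dd_nonneg n)]

lemma tailSum_nonneg (N : ℕ) : 0 ≤ tailSum N := tsum_nonneg fun n => by positivity

lemma tendsto_tailSum : Tendsto tailSum atTop (𝓝 0) := by
  have h := tendsto_tsum_of_dominated_convergence (β := ℕ) (𝓕 := (atTop : Filter ℕ))
    (f := fun N n => ddTail N n ^ 2 * (n : ℝ) ^ (-(3 / 2 : ℝ))) (g := fun _ => (0:ℝ))
    (bound := fun n => dd n ^ 2 * (n : ℝ) ^ (-(3 / 2 : ℝ))) (summable_dd_sq_rpow (by norm_num)) ?_ ?_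
  · rw [tsum_zero] at h; exact h
  · intro n
    refine tendsto_const_nhds.congr' ?_
    filter_upwards [eventually_ge_atTop n] with N hN
    simp [ddTail, hN]
  · refine Eventually.of_forall fun N n => ?_
    rw [Real.norm_of_nonneg (by positivity), ← sq_abs (ddTail N n)]
    gcongr
    exact abs_ddTail_le N n

lemma Dser_split (N : ℕ) {w : ℂ} (hw : 0 < w.re) : Dser w =
    ∑ n ∈ Finset.Icc 1 N, (dd n : ℂ) * Complex.exp (-(2 * Real.pi * n * w)) + tser (ddTail N) w := by
  have hb : ∀ n, |dd n - ddTail N n| ≤ dd n := fun n => by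
    unfold ddTail
    split_ifs
    · rw [sub_zero, abs_of_nonneg (dd_nonneg n)]
    · simpa using dd_nonneg n
  have h1 := summable_tser (abs_ddTail_le N) hw
  have h2 := summable_tser hb hw
  have h3 := h2.tsum_add h1
  have h4 : ∑' n : ℕ, ((dd n - ddTail N n : ℝ) : ℂ) * Complex.exp (-(2 * Real.pi * n * w)) =
      ∑ n ∈ Finset.Icc 1 N, (dd n : ℂ) * Complex.exp (-(2 * Real.pi * n * w)) := by
    rw [tsum_eq_sum (s := Finset.Icc 1 N)]
    · refine Finset.sum_congr rfl fun n hn => ?_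
      simp [ddTail, (Finset.mem_Icc.1 hn).2]
    · intro n hn
      rw [Finset.mem_Icc] at hn
      rcases Nat.eq_zero_or_pos n with rfl | h
      · simp [ddTail, dd_zero]
      · have : ¬ n ≤ N := fun h' => hn ⟨h, h'⟩
        simp [ddTail, this]
  rw [tser, ← h4, ← h3, Dser]
  refine tsum_congr fun n => ?_
  push_cast; ring

lemma norm_sum_dd_sq_le (N : ℕ) (z : ℕ → ℂ) : ‖∑ n ∈ Finset.Icc 1 N, (dd n : ℂ) * z n‖ ^ 2 ≤
    N * ∑ n ∈ Finset.Icc 1 N, dd n ^ 2 * ‖z n‖ ^ 2 := by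
  have h1 := norm_sum_le (Finset.Icc 1 N) fun n => (dd n : ℂ) * z n
  have h2 := sq_sum_le_card_mul_sum_sq (s := Finset.Icc 1 N) (f := fun n => ‖(dd n : ℂ) * z n‖)
  rw [Nat.card_Icc, Nat.add_sub_cancel] at h2
  calc _ ≤ (∑ n ∈ Finset.Icc 1 N, ‖(dd n : ℂ) * z n‖) ^ 2 := by gcongr
    _ ≤ _ := h2
    _ = _ := by
      congr 1
      refine Finset.sum_congr rfl fun n _ => ?_
      rw [norm_mul, mul_pow, Complex.norm_real, Real.norm_of_nonneg (dd_nonneg n)]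

/-- The Laplace transform of the `N`-th partial sum. -/
noncomputable def Ssum (N : ℕ) (s : ℂ) : ℂ := ∑ n ∈ Finset.Icc 1 N, (dd n : ℂ) * Iker n s

/-- The error in replacing the oscillating integrals by the kernels. -/
noncomputable def Yerr (N : ℕ) (r τ : ℝ) : ℝ := N * ∑ n ∈ Finset.Icc 1 N, dd n ^ 2 *
  ‖Iker n ((((r ^ 4)⁻¹ : ℝ) : ℂ) + τ * Complex.I) - Qcut n r τ‖ ^ 2

lemma integrable_sub_Qcut (n : ℕ) {r : ℝ} (hr : 1 ≤ r) :
    IntegrableOn (fun τ : ℝ => ‖Iker n ((((r ^ 4)⁻¹ : ℝ) : ℂ) + τ * Complex.I) - Qcut n r τ‖ ^ 2) (Ioi 0) := by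
  have hr0 : 0 < r := by linarith
  have hQ := continuous_Qker n (σ := (r ^ 4)⁻¹) (by positivity) (inv_le_one_of_one_le₀ (one_le_pow₀ hr))
  have hI := continuous_Iker n hr0
  have h1 : IntegrableOn (fun τ : ℝ => ‖Iker n ((((r ^ 4)⁻¹ : ℝ) : ℂ) + τ * Complex.I) - Qcut n r τ‖ ^ 2)
      (Ioo 0 (1 / 4)) := by
    have : IntegrableOn (fun τ : ℝ => ‖Iker n ((((r ^ 4)⁻¹ : ℝ) : ℂ) + τ * Complex.I) -
      Qker n ((((r ^ 4)⁻¹ : ℝ) : ℂ) + τ * Complex.I)‖ ^ 2) (Ioo 0 (1 / 4)) :=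
      (((hI.sub hQ).norm.pow 2).integrableOn_Icc (a := 0) (b := 1 / 4)).mono_set Ioo_subset_Icc_self
    refine (integrableOn_congr_fun (fun x hx => ?_) measurableSet_Ioo).1 this
    rw [Qcut, indicator_of_mem (show x ∈ Iio (1 / 4 : ℝ) from hx.2)]
  have h2 : IntegrableOn (fun τ : ℝ => ‖Iker n ((((r ^ 4)⁻¹ : ℝ) : ℂ) + τ * Complex.I) - Qcut n r τ‖ ^ 2)
      (Ici (1 / 4)) := by
    refine (integrableOn_congr_fun (fun x hx => ?_) measurableSet_Ici).1 (integrable_Iker_sq n hr0).integrableOn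
    rw [Qcut, indicator_of_notMem (show x ∉ Iio (1 / 4 : ℝ) from fun h : x < 1 / 4 => absurd hx (not_le.2 h)), sub_zero]
  have := h1.union h2
  rwa [Ioo_union_Ici_eq_Ioi (by norm_num)] at this

lemma integrable_Yerr (N : ℕ) {r : ℝ} (hr : 1 ≤ r) : IntegrableOn (Yerr N r) (Ioi 0) := by
  unfold Yerr
  exact (integrable_finsetSum _ fun n _ => (integrable_sub_Qcut n hr).const_mul _).const_mul _

lemma Yerr_nonneg (N : ℕ) (r τ : ℝ) : 0 ≤ Yerr N r τ := by unfold Yerr; positivity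

lemma tendsto_Yerr (N : ℕ) : Tendsto (fun r : ℝ => (r ^ 6)⁻¹ * ∫ τ in Ioi (0:ℝ), Yerr N r τ) atTop (𝓝 0) := by
  have h : Tendsto (fun r : ℝ => (N : ℝ) * ∑ n ∈ Finset.Icc 1 N, dd n ^ 2 * ((r ^ 6)⁻¹ * ∫ τ in Ioi (0:ℝ),
      ‖Iker n ((((r ^ 4)⁻¹ : ℝ) : ℂ) + τ * Complex.I) - Qcut n r τ‖ ^ 2)) atTop
      (𝓝 ((N : ℝ) * ∑ n ∈ Finset.Icc 1 N, dd n ^ 2 * 0)) :=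
    (tendsto_finsetSum _ fun n hn => (tendsto_Iker_sub (Finset.mem_Icc.1 hn).1).const_mul _).const_mul _
  simp only [mul_zero, Finset.sum_const_zero] at h
  refine h.congr' ?_
  filter_upwards [eventually_ge_atTop 1] with r hr
  unfold Yerr
  rw [integral_const_mul, integral_finsetSum _ fun n _ => (integrable_sub_Qcut n hr).const_mul _]
  simp_rw [integral_const_mul, Finset.mul_sum]
  exact Finset.sum_congr rfl fun n _ => by ring

lemma inv_pow_four_rpow {r : ℝ} (hr : 0 < r) (p : ℝ) : ((r ^ 4)⁻¹ : ℝ) ^ (-p) = r ^ (4 * p) := by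
  rw [Real.rpow_neg (by positivity), Real.inv_rpow (by positivity), inv_inv, ← Real.rpow_natCast,
    ← Real.rpow_mul hr.le]
  norm_num

lemma continuous_Ssum (N : ℕ) {r : ℝ} (hr : 0 < r) :
    Continuous fun τ : ℝ => Ssum N ((((r ^ 4)⁻¹ : ℝ) : ℂ) + τ * Complex.I) :=
  continuous_finsetSum _ fun n _ => (continuous_Iker n hr).const_mul _

lemma near_pointwise : ∃ C, 0 < C ∧ ∀ (N : ℕ) (r τ : ℝ), 3 ≤ r → 0 < τ → τ < 1 / 4 →
    ‖Eh ((((r ^ 4)⁻¹ : ℝ) : ℂ) + τ * Complex.I) - Ssum N ((((r ^ 4)⁻¹ : ℝ) : ℂ) + τ * Complex.I)‖ ^ 2 ≤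
    C * (r ^ (11 / 2 : ℝ) * τ ^ (-(7 / 8 : ℝ))) + C * Ttail (ddTail N) (r ^ 4)⁻¹ τ + 3 * Yerr N r τ := by
  obtain ⟨C1, hC1, hE⟩ := Eh_near
  refine ⟨3 * C1 ^ 2 + 3 * Real.pi ^ 2, by positivity, fun N r τ hr h0 h1 => ?_⟩
  have hr0 : 0 < r := by linarith
  set σ : ℝ := (r ^ 4)⁻¹ with hσ
  have hσ0 : 0 < σ := by positivity
  have hσ1 : σ ≤ 1 / 81 := by
    rw [hσ, inv_le_comm₀ (by positivity) (by norm_num)]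
    have : (3:ℝ) ^ 4 ≤ r ^ 4 := by gcongr
    norm_num at this ⊢; linarith
  set s : ℂ := (σ : ℂ) + τ * Complex.I with hs
  have hre : s.re = σ := by simp [hs]
  have him : s.im = τ := by simp [hs]
  have hE1 := hE s (by rw [hre]; exact hσ0) (by rw [hre]; linarith) (by rw [him]; exact h0) (by rw [him]; exact h1.le)
  set c : ℂ := Real.pi * Complex.I / (s * Complex.sin (s / 2)) with hc
  have hX : ‖Eh s - c * Dser (wct s)‖ ^ 2 ≤ C1 ^ 2 * (r ^ (11 / 2 : ℝ) * τ ^ (-(7 / 8 : ℝ))) := by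
    have hsn : 0 < ‖s‖ := norm_pos_iff.2 (ne_zero_of_re_pos (by rw [hre]; exact hσ0))
    have a1 : σ ≤ ‖s‖ := by have := Complex.abs_re_le_norm s; rwa [hre, abs_of_pos hσ0] at this
    have a2 : τ ≤ ‖s‖ := by have := Complex.abs_im_le_norm s; rwa [him, abs_of_pos h0] at this
    calc ‖Eh s - c * Dser (wct s)‖ ^ 2 ≤ (C1 * ‖s‖ ^ (-(9 / 8 : ℝ))) ^ 2 := by gcongr
      _ = C1 ^ 2 * (‖s‖ ^ (-(11 / 8 : ℝ)) * ‖s‖ ^ (-(7 / 8 : ℝ))) := by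
        rw [mul_pow, ← Real.rpow_natCast (_ ^ _) 2, ← Real.rpow_mul hsn.le, ← Real.rpow_add hsn]; norm_num
      _ ≤ C1 ^ 2 * (σ ^ (-(11 / 8 : ℝ)) * τ ^ (-(7 / 8 : ℝ))) := by
        have b1 := Real.rpow_le_rpow_of_nonpos hσ0 a1 (by norm_num : -(11 / 8 : ℝ) ≤ 0)
        have b2 := Real.rpow_le_rpow_of_nonpos h0 a2 (by norm_num : -(7 / 8 : ℝ) ≤ 0)
        gcongr
      _ = _ := by rw [hσ, inv_pow_four_rpow hr0]; norm_num
  have hT : ‖c * tser (ddTail N) (wct s)‖ ^ 2 = Real.pi ^ 2 * Ttail (ddTail N) σ τ := by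
    have hn : ‖s‖ ^ 2 = σ ^ 2 + τ ^ 2 := by rw [hs, Complex.sq_norm, Complex.normSq_add_mul_I]
    have hQ := Qf_pos hσ0 (by linarith) τ
    rw [hc, norm_mul, norm_div, norm_mul, norm_mul, mul_pow, div_pow, mul_pow, mul_pow, hn, hs,
      norm_sin_half_sq, Complex.norm_I, Complex.norm_real, Real.norm_of_nonneg Real.pi_pos.le, Ttail]
    have : 0 < σ ^ 2 + τ ^ 2 := by positivity
    field_simp
  have hY : ‖∑ n ∈ Finset.Icc 1 N, (dd n : ℂ) * (Iker n s - Qcut n r τ)‖ ^ 2 ≤ Yerr N r τ :=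
    norm_sum_dd_sq_le N fun n => Iker n s - Qcut n r τ
  have hsplit : Eh s - Ssum N s = (Eh s - c * Dser (wct s)) + c * tser (ddTail N) (wct s) -
      ∑ n ∈ Finset.Icc 1 N, (dd n : ℂ) * (Iker n s - Qcut n r τ) := by
    have hQ : ∀ n, Qcut n r τ = c * Complex.exp (-(2 * Real.pi * n * wct s)) := fun n => by
      rw [Qcut, indicator_of_mem (show τ ∈ Iio (1 / 4 : ℝ) from h1)]; rfl
    simp_rw [mul_sub, Finset.sum_sub_distrib, hQ]
    rw [Dser_split N (wct_re_pos hσ0 (by linarith)), Ssum, mul_add, Finset.mul_sum]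
    simp_rw [mul_left_comm c]
    ring
  rw [hsplit]
  have h3 := norm_sub_le ((Eh s - c * Dser (wct s)) + c * tser (ddTail N) (wct s))
    (∑ n ∈ Finset.Icc 1 N, (dd n : ℂ) * (Iker n s - Qcut n r τ))
  have h4 := norm_add_le (Eh s - c * Dser (wct s)) (c * tser (ddTail N) (wct s))
  set x := ‖Eh s - c * Dser (wct s)‖
  set y := ‖c * tser (ddTail N) (wct s)‖
  set z := ‖∑ n ∈ Finset.Icc 1 N, (dd n : ℂ) * (Iker n s - Qcut n r τ)‖
  have h5 : (x + y + z) ^ 2 ≤ 3 * (x ^ 2 + y ^ 2 + z ^ 2) := by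
    nlinarith [sq_nonneg (x - y), sq_nonneg (y - z), sq_nonneg (x - z)]
  have h6 : 0 ≤ r ^ (11 / 2 : ℝ) * τ ^ (-(7 / 8 : ℝ)) := by positivity
  have h7 := Ttail_nonneg (ddTail N) hσ0 (by linarith : σ ≤ 1) τ
  calc _ ≤ (x + y + z) ^ 2 := by gcongr; linarith
    _ ≤ 3 * (x ^ 2 + y ^ 2 + z ^ 2) := h5
    _ ≤ _ := by
      rw [hT]
      nlinarith [mul_nonneg (sq_nonneg C1) h7, mul_nonneg (sq_nonneg Real.pi) h6]

lemma far_pointwise (N : ℕ) {r τ : ℝ} (h1 : 1 / 4 ≤ τ) :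
    ‖Eh ((((r ^ 4)⁻¹ : ℝ) : ℂ) + τ * Complex.I) - Ssum N ((((r ^ 4)⁻¹ : ℝ) : ℂ) + τ * Complex.I)‖ ^ 2 ≤
    2 * ‖Eh ((((r ^ 4)⁻¹ : ℝ) : ℂ) + τ * Complex.I)‖ ^ 2 + 2 * Yerr N r τ := by
  set s : ℂ := (((r ^ 4)⁻¹ : ℝ) : ℂ) + τ * Complex.I with hs
  have hY : ‖∑ n ∈ Finset.Icc 1 N, (dd n : ℂ) * (Iker n s - Qcut n r τ)‖ ^ 2 ≤ Yerr N r τ :=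
    norm_sum_dd_sq_le N fun n => Iker n s - Qcut n r τ
  have hQ : ∀ n, Qcut n r τ = 0 := fun n => by
    rw [Qcut, indicator_of_notMem (show τ ∉ Iio (1 / 4 : ℝ) from not_lt.2 h1)]
  simp_rw [hQ, sub_zero] at hY
  have h3 := norm_sub_le (Eh s) (Ssum N s)
  have hY : ‖Ssum N s‖ ^ 2 ≤ Yerr N r τ := hY
  calc _ ≤ (‖Eh s‖ + ‖Ssum N s‖) ^ 2 := by gcongr
    _ ≤ _ := by nlinarith [sq_nonneg (‖Eh s‖ - ‖Ssum N s‖)]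

end

section
open Set Filter Topology

lemma integrable_Ssum_sq (N : ℕ) {r : ℝ} (hr : 0 < r) :
    Integrable fun τ : ℝ => ‖Ssum N ((((r ^ 4)⁻¹ : ℝ) : ℂ) + τ * Complex.I)‖ ^ 2 := by
  have h : Integrable fun τ : ℝ => (N : ℝ) * ∑ n ∈ Finset.Icc 1 N,
      dd n ^ 2 * ‖Iker n ((((r ^ 4)⁻¹ : ℝ) : ℂ) + τ * Complex.I)‖ ^ 2 :=
    (integrable_finsetSum _ fun n _ => (integrable_Iker_sq n hr).const_mul _).const_mul _
  refine h.mono' ((continuous_Ssum N hr).norm.pow 2).aestronglyMeasurable (ae_of_all _ fun τ => ?_)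
  rw [Real.norm_of_nonneg (by positivity)]
  exact norm_sum_dd_sq_le N _

lemma integrable_sub_Ssum_sq (N : ℕ) {r : ℝ} (hr : 0 < r) :
    Integrable fun τ : ℝ => ‖Eh ((((r ^ 4)⁻¹ : ℝ) : ℂ) + τ * Complex.I) -
      Ssum N ((((r ^ 4)⁻¹ : ℝ) : ℂ) + τ * Complex.I)‖ ^ 2 := by
  have hσ : 0 < (r ^ 4)⁻¹ := by positivity
  refine (((Eh_plancherel hσ).const_mul 2).add ((integrable_Ssum_sq N hr).const_mul 2)).mono'
    (((continuous_Eh hσ).sub (continuous_Ssum N hr)).norm.pow 2).aestronglyMeasurable (ae_of_all _ fun τ => ?_)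
  rw [Real.norm_of_nonneg (by positivity)]
  simp only [Pi.add_apply]
  set a := Eh ((((r ^ 4)⁻¹ : ℝ) : ℂ) + τ * Complex.I)
  set b := Ssum N ((((r ^ 4)⁻¹ : ℝ) : ℂ) + τ * Complex.I)
  calc ‖a - b‖ ^ 2 ≤ (‖a‖ + ‖b‖) ^ 2 := by gcongr; exact norm_sub_le _ _
    _ ≤ _ := by nlinarith [sq_nonneg (‖a‖ - ‖b‖)]

lemma integral_sub_Ssum_le : ∃ K, 0 < K ∧ ∀ (N : ℕ) (r : ℝ), 3 ≤ r →
    (r ^ 6)⁻¹ * ∫ τ in Ioi (0:ℝ), ‖Eh ((((r ^ 4)⁻¹ : ℝ) : ℂ) + τ * Complex.I) -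
      Ssum N ((((r ^ 4)⁻¹ : ℝ) : ℂ) + τ * Complex.I)‖ ^ 2 ≤
    K * (r ^ (-(1 / 2) : ℝ) + tailSum N) + 3 * ((r ^ 6)⁻¹ * ∫ τ in Ioi (0:ℝ), Yerr N r τ) := by
  obtain ⟨C1, hC1, h1⟩ := near_pointwise
  obtain ⟨C2, hC2, h2⟩ := integral_Ttail_le
  obtain ⟨C3, hC3, h3⟩ := integral_Eh_far
  refine ⟨8 * C1 + 2 * C3 + C1 * C2, by positivity, fun N r hr => ?_⟩
  have hr0 : 0 < r := by linarith
  have hσ1 : (r ^ 4)⁻¹ ≤ 1 / 81 := by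
    rw [inv_le_comm₀ (by positivity) (by norm_num)]
    have : (3:ℝ) ^ 4 ≤ r ^ 4 := by gcongr
    norm_num at this ⊢; linarith
  have hσ0 : 0 < (r ^ 4)⁻¹ := by positivity
  have hX := integrable_sub_Ssum_sq N hr0
  have hY := integrable_Yerr N (r := r) (by linarith)
  have hYo : IntegrableOn (Yerr N r) (Ioo 0 (1 / 4)) := hY.mono_set Ioo_subset_Ioi_self
  have hYi : IntegrableOn (Yerr N r) (Ici (1 / 4)) := hY.mono_set (Ici_subset_Ioi.2 (by norm_num))
  have hsplit : ∀ F : ℝ → ℝ, IntegrableOn F (Ioi 0) → ∫ τ in Ioi (0:ℝ), F τ =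
      (∫ τ in Ioo (0:ℝ) (1 / 4), F τ) + ∫ τ in Ici (1 / 4 : ℝ), F τ := by
    intro F hF
    have hd : Disjoint (Ioo (0:ℝ) (1 / 4)) (Ici (1 / 4)) :=
      disjoint_left.2 fun x hx hx' => absurd hx.2 (not_lt.2 (mem_Ici.1 hx'))
    rw [← Ioo_union_Ici_eq_Ioi (by norm_num : (0:ℝ) < 1 / 4), setIntegral_union hd measurableSet_Ici
      (hF.mono_set Ioo_subset_Ioi_self) (hF.mono_set (Ici_subset_Ioi.2 (by norm_num)))]
  have hpi : IntegrableOn (fun τ : ℝ => τ ^ (-(7 / 8 : ℝ))) (Ioo 0 (1 / 4)) :=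
    (intervalIntegral.integrableOn_Ioo_rpow_iff (by norm_num)).2 (by norm_num)
  have hp : ∫ τ in Ioo (0:ℝ) (1 / 4), τ ^ (-(7 / 8 : ℝ)) ≤ 8 := by
    rw [← integral_Ioc_eq_integral_Ioo, ← intervalIntegral.integral_of_le (by norm_num),
      integral_rpow (Or.inl (by norm_num))]
    have : ((1:ℝ) / 4) ^ (1 / 8 : ℝ) ≤ 1 := Real.rpow_le_one (by norm_num) (by norm_num) (by norm_num)
    norm_num at this ⊢
    linarith
  have hT := continuous_Ttail (abs_ddTail_le N) hσ0 (by linarith)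
  have hTo : IntegrableOn (Ttail (ddTail N) (r ^ 4)⁻¹) (Ioo 0 (1 / 4)) :=
    (hT.integrableOn_Icc (a := 0) (b := 1 / 4)).mono_set Ioo_subset_Icc_self
  have hTi : ∫ τ in Ioo (0:ℝ) (1 / 4), Ttail (ddTail N) (r ^ 4)⁻¹ τ ≤ C2 * r ^ 6 * tailSum N := by
    have := h2 (ddTail N) (abs_ddTail_le N) (r ^ 4)⁻¹ hσ0 (by linarith)
    rw [intervalIntegral.integral_of_le (by norm_num), integral_Ioc_eq_integral_Ioo, inv_pow_four_rpow hr0] at this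
    refine this.trans_eq ?_
    rw [tailSum, show (4:ℝ) * (3 / 2) = ((6 : ℕ) : ℝ) by norm_num, Real.rpow_natCast]
  have hI1 : ∫ τ in Ioo (0:ℝ) (1 / 4), ‖Eh ((((r ^ 4)⁻¹ : ℝ) : ℂ) + τ * Complex.I) -
      Ssum N ((((r ^ 4)⁻¹ : ℝ) : ℂ) + τ * Complex.I)‖ ^ 2 ≤
      C1 * (r ^ (11 / 2 : ℝ) * 8) + C1 * (C2 * r ^ 6 * tailSum N) + 3 * ∫ τ in Ioo (0:ℝ) (1 / 4), Yerr N r τ := by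
    have hm := setIntegral_mono_on hX.integrableOn ((((hpi.const_mul (r ^ (11 / 2 : ℝ))).const_mul C1).add
      (hTo.const_mul C1)).add (hYo.const_mul 3)) measurableSet_Ioo fun τ hτ => h1 N r τ hr hτ.1 hτ.2
    refine hm.trans ?_
    simp only [Pi.add_apply]
    rw [integral_add (f := fun τ : ℝ => C1 * (r ^ (11 / 2 : ℝ) * τ ^ (-(7 / 8 : ℝ))) +
      C1 * Ttail (ddTail N) (r ^ 4)⁻¹ τ) (((hpi.const_mul (r ^ (11 / 2 : ℝ))).const_mul C1).add (hTo.const_mul C1)) (hYo.const_mul 3),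
      integral_add ((hpi.const_mul (r ^ (11 / 2 : ℝ))).const_mul C1) (hTo.const_mul C1),
      integral_const_mul, integral_const_mul, integral_const_mul, integral_const_mul]
    gcongr
  have hI2 : ∫ τ in Ici (1 / 4 : ℝ), ‖Eh ((((r ^ 4)⁻¹ : ℝ) : ℂ) + τ * Complex.I) -
      Ssum N ((((r ^ 4)⁻¹ : ℝ) : ℂ) + τ * Complex.I)‖ ^ 2 ≤
      2 * (C3 * r ^ (5 : ℝ)) + 3 * ∫ τ in Ici (1 / 4 : ℝ), Yerr N r τ := by
    have hE := Eh_plancherel hσ0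
    have hm := setIntegral_mono_on hX.integrableOn ((hE.integrableOn.const_mul 2).add (hYi.const_mul 2))
      measurableSet_Ici fun τ hτ => far_pointwise N hτ
    refine hm.trans ?_
    simp only [Pi.add_apply]
    rw [integral_add (hE.integrableOn.const_mul 2) (hYi.const_mul 2), integral_const_mul, integral_const_mul]
    have h4 := h3 _ hσ0 (by linarith)
    rw [inv_pow_four_rpow hr0, ← integral_Ici_eq_integral_Ioi, show (4:ℝ) * (5 / 4) = 5 by norm_num] at h4
    have h5 : 0 ≤ ∫ τ in Ici (1 / 4 : ℝ), Yerr N r τ := integral_nonneg fun τ => Yerr_nonneg N r τ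
    linarith
  rw [hsplit _ hX.integrableOn, hsplit _ hY]
  have e1 : (r ^ 6)⁻¹ * r ^ (11 / 2 : ℝ) = r ^ (-(1 / 2) : ℝ) := by
    rw [← Real.rpow_natCast r 6, ← Real.rpow_neg hr0.le, ← Real.rpow_add hr0]; norm_num
  have e2 : (r ^ 6)⁻¹ * r ^ (5 : ℝ) ≤ r ^ (-(1 / 2) : ℝ) := by
    rw [← Real.rpow_natCast r 6, ← Real.rpow_neg hr0.le, ← Real.rpow_add hr0]
    exact Real.rpow_le_rpow_of_exponent_le (by linarith) (by norm_num)
  have e3 : (r ^ 6)⁻¹ * r ^ 6 = 1 := inv_mul_cancel₀ (by positivity)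
  have ht := tailSum_nonneg N
  have hrp : 0 ≤ r ^ (-(1 / 2) : ℝ) := by positivity
  calc _ ≤ (r ^ 6)⁻¹ * ((C1 * (r ^ (11 / 2 : ℝ) * 8) + C1 * (C2 * r ^ 6 * tailSum N) +
        3 * ∫ τ in Ioo (0:ℝ) (1 / 4), Yerr N r τ) + (2 * (C3 * r ^ (5 : ℝ)) + 3 * ∫ τ in Ici (1 / 4 : ℝ), Yerr N r τ)) := by
        gcongr
    _ = 8 * C1 * ((r ^ 6)⁻¹ * r ^ (11 / 2 : ℝ)) + C1 * C2 * tailSum N * ((r ^ 6)⁻¹ * r ^ 6) +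
        2 * C3 * ((r ^ 6)⁻¹ * r ^ (5 : ℝ)) + 3 * ((r ^ 6)⁻¹ * ((∫ τ in Ioo (0:ℝ) (1 / 4), Yerr N r τ) +
        ∫ τ in Ici (1 / 4 : ℝ), Yerr N r τ)) := by ring
    _ ≤ 8 * C1 * r ^ (-(1 / 2) : ℝ) + C1 * C2 * tailSum N * 1 + 2 * C3 * r ^ (-(1 / 2) : ℝ) +
        3 * ((r ^ 6)⁻¹ * ((∫ τ in Ioo (0:ℝ) (1 / 4), Yerr N r τ) + ∫ τ in Ici (1 / 4 : ℝ), Yerr N r τ)) := by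
        rw [e1, e3]; gcongr
    _ ≤ _ := by nlinarith [mul_nonneg hC1.le ht, mul_nonneg hC3.le ht, mul_nonneg (mul_pos hC1 hC2).le hrp]

/-! ### The approximating sums in the time domain -/

/-- The `N`-th partial sum, in complex form. -/
noncomputable def hsum (N : ℕ) (t : ℝ) : ℂ :=
  ∑ n ∈ Finset.Icc 1 N, (dd n : ℂ) * (kap n * osc (Real.sqrt (2 * Real.pi * n)) t)

/-- The `N`-th approximation to `E`. -/
noncomputable def Gfun (N : ℕ) (t : ℝ) : ℝ := 2 * (hsum N t).re

lemma measurable_hsum (N : ℕ) : Measurable (hsum N) :=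
  Finset.measurable_fun_sum _ fun _ _ => ((measurable_osc _).const_mul _).const_mul _

lemma measurable_Gfun (N : ℕ) : Measurable (Gfun N) :=
  (Complex.measurable_re.comp (measurable_hsum N)).const_mul 2

lemma norm_hsum_le (N : ℕ) {t : ℝ} (ht : 0 ≤ t) :
    ‖hsum N t‖ ≤ (∑ n ∈ Finset.Icc 1 N, dd n * ‖kap n‖) * t ^ (1 / 4 : ℝ) := by
  rw [Finset.sum_mul]
  refine (norm_sum_le _ _).trans (Finset.sum_le_sum fun n _ => ?_)
  rw [norm_mul, norm_mul, norm_osc _ ht, Complex.norm_real, Real.norm_of_nonneg (dd_nonneg n), mul_assoc]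

lemma integrable_mul_exp {f : ℝ → ℂ} {s : ℂ} (hf : AEStronglyMeasurable f (volume.restrict (Ioi 0)))
    (h : IntegrableOn (fun t => ‖f t‖ * Real.exp (-(s.re * t))) (Ioi 0)) :
    IntegrableOn (fun t : ℝ => f t * Complex.exp (-(s * t))) (Ioi 0) := by
  refine h.mono' (hf.mul (Continuous.aestronglyMeasurable (by fun_prop))) (ae_of_all _ fun t => ?_)
  rw [norm_mul, norm_exp_neg_mul_ofReal]

lemma lapl_hsum (N : ℕ) {s : ℂ} (hs : 0 < s.re) : lapl (hsum N) s = Ssum N s ∧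
    IntegrableOn (fun t : ℝ => hsum N t * Complex.exp (-(s * t))) (Ioi 0) := by
  have hi : ∀ n ∈ Finset.Icc 1 N, IntegrableOn (fun t : ℝ => (dd n : ℂ) * (kap n *
      (osc (Real.sqrt (2 * Real.pi * n)) t * Complex.exp (-(s * t))))) (Ioi 0) := fun n _ =>
    ((integrable_mul_exp (measurable_osc _).aestronglyMeasurable (integrable_osc _ hs)).const_mul _).const_mul _
  have e : ∀ t : ℝ, hsum N t * Complex.exp (-(s * t)) = ∑ n ∈ Finset.Icc 1 N, (dd n : ℂ) * (kap n *
      (osc (Real.sqrt (2 * Real.pi * n)) t * Complex.exp (-(s * t)))) := fun t => by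
    rw [hsum, Finset.sum_mul]
    exact Finset.sum_congr rfl fun n _ => by ring
  constructor
  · rw [lapl]
    simp_rw [e]
    rw [integral_finsetSum _ hi, Ssum]
    refine Finset.sum_congr rfl fun n _ => ?_
    rw [integral_const_mul, integral_const_mul]; rfl
  · simp_rw [e]
    exact integrable_finsetSum _ hi

lemma lapl_conj (f : ℝ → ℂ) (s : ℂ) : lapl (fun t => (starRingEnd ℂ) (f t)) s =
    (starRingEnd ℂ) (lapl f ((starRingEnd ℂ) s)) := by
  rw [lapl, lapl, ← integral_conj]
  refine integral_congr_ae (ae_of_all _ fun t => ?_)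
  simp only [map_mul, ← Complex.exp_conj, map_neg, Complex.conj_conj, Complex.conj_ofReal]

lemma conj_add_mul_I (σ τ : ℝ) : (starRingEnd ℂ) ((σ : ℂ) + τ * Complex.I) = (σ : ℂ) + ((-τ : ℝ) : ℂ) * Complex.I := by
  simp

lemma lapl_sub_Gfun (N : ℕ) {σ : ℝ} (hσ : 0 < σ) (τ : ℝ) :
    lapl (fun t => ((Efun t - Gfun N t : ℝ) : ℂ)) (σ + τ * Complex.I) =
      Eh (σ + τ * Complex.I) - Ssum N (σ + τ * Complex.I) -
        (starRingEnd ℂ) (Ssum N (σ + ((-τ : ℝ) : ℂ) * Complex.I)) := by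
  set s : ℂ := σ + τ * Complex.I with hs
  have hre : s.re = σ := by simp [hs]
  have hs0 : 0 < s.re := by rw [hre]; exact hσ
  have hc0 : 0 < ((starRingEnd ℂ) s).re := by rw [Complex.conj_re]; exact hs0
  have hE : IntegrableOn (fun t : ℝ => (Efun t : ℂ) * Complex.exp (-(s * t))) (Ioi 0) := by
    refine integrable_mul_exp (Complex.continuous_ofReal.comp continuous_Efun).aestronglyMeasurable ?_
    simpa only [Complex.norm_real, Real.norm_eq_abs] using integrable_Efun_mul_exp hs0
  obtain ⟨h1, h2⟩ := lapl_hsum N hs0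
  obtain ⟨h3, h4⟩ := lapl_hsum N hc0
  have h5 : IntegrableOn (fun t : ℝ => (starRingEnd ℂ) (hsum N t) * Complex.exp (-(s * t))) (Ioi 0) := by
    have := Complex.conjCLE.toContinuousLinearMap.integrable_comp h4
    refine this.congr (ae_of_all _ fun t => ?_)
    simp only [ContinuousLinearEquiv.coe_coe, Complex.conjCLE_apply, map_mul, ← Complex.exp_conj, map_neg,
      Complex.conj_conj, Complex.conj_ofReal]
  rw [← conj_add_mul_I, ← hs, ← h3, ← lapl_conj, ← h1]
  simp only [lapl, Eh]
  rw [← integral_sub hE h2, ← integral_sub (f := fun t : ℝ => (Efun t : ℂ) * Complex.exp (-(s * t)) -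
      hsum N t * Complex.exp (-(s * t))) (hE.sub h2) h5]
  refine integral_congr_ae (ae_of_all _ fun t => ?_)
  simp only [Gfun]
  have : ((2 * (hsum N t).re : ℝ) : ℂ) = hsum N t + (starRingEnd ℂ) (hsum N t) := (Complex.add_conj _).symm
  push_cast at this ⊢
  rw [this]; ring

lemma tendsto_Ssum_neg (N : ℕ) : Tendsto (fun r : ℝ => (r ^ 6)⁻¹ * ∫ τ in Ioi (0:ℝ),
    ‖Ssum N ((((r ^ 4)⁻¹ : ℝ) : ℂ) + ((-τ : ℝ) : ℂ) * Complex.I)‖ ^ 2) atTop (𝓝 0) := by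
  have h : Tendsto (fun r : ℝ => (N : ℝ) * ∑ n ∈ Finset.Icc 1 N, dd n ^ 2 * ((r ^ 6)⁻¹ * ∫ τ in Ioi (0:ℝ),
      ‖Iker n ((((r ^ 4)⁻¹ : ℝ) : ℂ) + ((-τ : ℝ) : ℂ) * Complex.I)‖ ^ 2)) atTop
      (𝓝 ((N : ℝ) * ∑ n ∈ Finset.Icc 1 N, dd n ^ 2 * 0)) :=
    (tendsto_finsetSum _ fun n hn => (tendsto_Iker_neg (Finset.mem_Icc.1 hn).1).const_mul _).const_mul _
  simp only [mul_zero, Finset.sum_const_zero] at h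
  refine squeeze_zero' (Eventually.of_forall fun r => ?_) ?_ h
  · exact mul_nonneg (inv_nonneg.2 (by positivity)) (integral_nonneg fun τ => by positivity)
  filter_upwards [eventually_gt_atTop 0] with r hr
  have hi : ∀ n ∈ Finset.Icc 1 N, IntegrableOn (fun τ : ℝ => dd n ^ 2 *
      ‖Iker n ((((r ^ 4)⁻¹ : ℝ) : ℂ) + ((-τ : ℝ) : ℂ) * Complex.I)‖ ^ 2) (Ioi 0) := fun n _ =>
    ((integrable_Iker_sq n hr).comp_neg.const_mul _).integrableOn
  have := setIntegral_mono_on (s := Ioi 0) (integrable_Ssum_sq N hr).comp_neg.integrableOn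
    ((integrable_finsetSum _ hi).const_mul (N : ℝ)) measurableSet_Ioi
    fun τ _ => norm_sum_dd_sq_le N fun n => Iker n ((((r ^ 4)⁻¹ : ℝ) : ℂ) + ((-τ : ℝ) : ℂ) * Complex.I)
  rw [integral_const_mul, integral_finsetSum _ hi] at this
  calc _ ≤ (r ^ 6)⁻¹ * _ := mul_le_mul_of_nonneg_left this (by positivity)
    _ = _ := by
      simp_rw [integral_const_mul, Finset.mul_sum]
      exact Finset.sum_congr rfl fun n _ => by ring

end

section
open Set Filter Topology

lemma integral_eq_two_mul_Ioi_of_even {F : ℝ → ℝ} (hF : Integrable F) (he : ∀ x, F (-x) = F x) :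
    ∫ x, F x = 2 * ∫ x in Ioi (0:ℝ), F x := by
  have := integral_comp_neg_Ioi 0 F
  simp_rw [he, neg_zero] at this
  rw [← intervalIntegral.integral_Iic_add_Ioi hF.integrableOn hF.integrableOn (b := 0), ← this]
  ring

lemma norm_hsum_sq_le (N : ℕ) {t : ℝ} (ht : 0 < t) :
    ‖hsum N t‖ ^ 2 ≤ (∑ n ∈ Finset.Icc 1 N, dd n * ‖kap n‖) ^ 2 * ‖osc 0 t‖ ^ 2 := by
  rw [← mul_pow, norm_osc 0 ht.le]
  have := norm_hsum_le N ht.le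
  gcongr

lemma abs_Gfun_le (N : ℕ) (t : ℝ) : |Gfun N t| ≤ 2 * ‖hsum N t‖ := by
  rw [Gfun, abs_mul, abs_two]
  have := Complex.abs_re_le_norm (hsum N t)
  linarith

lemma integrable_sub_Gfun (N : ℕ) {σ : ℝ} (hσ : 0 < σ) :
    IntegrableOn (fun t => |Efun t - Gfun N t| * Real.exp (-(σ * t))) (Ioi 0) := by
  set H := ∑ n ∈ Finset.Icc 1 N, dd n * ‖kap n‖ with hH
  have h1 := (integrable_Efun_mul_exp hσ).add ((integrable_osc 0 hσ).const_mul (2 * H))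
  have hm : Measurable fun t => |Efun t - Gfun N t| * Real.exp (-(σ * t)) := by
    have := continuous_Efun.measurable
    have := measurable_Gfun N
    fun_prop
  refine h1.mono' hm.aestronglyMeasurable ?_
  refine (ae_restrict_iff' measurableSet_Ioi).2 (ae_of_all _ fun t ht => ?_)
  rw [Real.norm_of_nonneg (by positivity)]
  simp only [Pi.add_apply]
  have h2 := norm_hsum_le N (mem_Ioi.1 ht).le
  have h3 := abs_Gfun_le N t
  have h4 := abs_sub (Efun t) (Gfun N t)
  rw [norm_osc 0 (mem_Ioi.1 ht).le, ← mul_assoc, ← add_mul]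
  gcongr
  rw [hH]
  linarith

lemma integrable_sub_Gfun_sq (N : ℕ) {σ : ℝ} (hσ : 0 < σ) :
    IntegrableOn (fun t => |Efun t - Gfun N t| ^ 2 * Real.exp (-(σ * t))) (Ioi 0) := by
  set H := ∑ n ∈ Finset.Icc 1 N, dd n * ‖kap n‖ with hH
  have h1 := ((integrable_Efun_sq_mul_exp hσ).const_mul 2).add ((integrable_osc_sq 0 hσ).const_mul (8 * H ^ 2))
  have hm : Measurable fun t => |Efun t - Gfun N t| ^ 2 * Real.exp (-(σ * t)) := by
    have := continuous_Efun.measurable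
    have := measurable_Gfun N
    fun_prop
  refine h1.mono' hm.aestronglyMeasurable ?_
  refine (ae_restrict_iff' measurableSet_Ioi).2 (ae_of_all _ fun t ht => ?_)
  rw [Real.norm_of_nonneg (by positivity)]
  simp only [Pi.add_apply]
  have h2 := norm_hsum_sq_le N (mem_Ioi.1 ht)
  have h3 := abs_Gfun_le N t
  have h4 := abs_sub (Efun t) (Gfun N t)
  rw [← mul_assoc, ← mul_assoc, ← add_mul]
  gcongr
  have h5 : |Gfun N t| ^ 2 ≤ (2 * ‖hsum N t‖) ^ 2 := by gcongr
  calc |Efun t - Gfun N t| ^ 2 ≤ (|Efun t| + |Gfun N t|) ^ 2 := by gcongr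
    _ ≤ 2 * |Efun t| ^ 2 + 2 * |Gfun N t| ^ 2 := by nlinarith [sq_nonneg (|Efun t| - |Gfun N t|)]
    _ ≤ _ := by linarith

lemma integral_sub_Gfun_sq_le (N : ℕ) {r : ℝ} (hr : 0 < r) :
    ∫ t in Ioi (0:ℝ), |Efun t - Gfun N t| ^ 2 * Real.exp (-(2 * (r ^ 4)⁻¹ * t)) ≤
      2 * (∫ τ in Ioi (0:ℝ), ‖Eh ((((r ^ 4)⁻¹ : ℝ) : ℂ) + τ * Complex.I) -
        Ssum N ((((r ^ 4)⁻¹ : ℝ) : ℂ) + τ * Complex.I)‖ ^ 2) +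
      2 * ∫ τ in Ioi (0:ℝ), ‖Ssum N ((((r ^ 4)⁻¹ : ℝ) : ℂ) + ((-τ : ℝ) : ℂ) * Complex.I)‖ ^ 2 := by
  have hσ : 0 < (r ^ 4)⁻¹ := by positivity
  have hm : Measurable fun t => ((Efun t - Gfun N t : ℝ) : ℂ) :=
    Complex.measurable_ofReal.comp (continuous_Efun.measurable.sub (measurable_Gfun N))
  obtain ⟨h1, h2⟩ := plancherel_lapl (f := fun t => ((Efun t - Gfun N t : ℝ) : ℂ)) (σ := (r ^ 4)⁻¹)
    hm.aestronglyMeasurable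
    (by simpa only [Complex.norm_real, Real.norm_eq_abs] using integrable_sub_Gfun N hσ)
    (by simpa only [Complex.norm_real, Real.norm_eq_abs] using
      integrable_sub_Gfun_sq N (σ := 2 * (r ^ 4)⁻¹) (by positivity))
  simp only [Complex.norm_real, Real.norm_eq_abs] at h2
  rw [integral_eq_two_mul_Ioi_of_even h1] at h2
  · have h3 := setIntegral_mono_on (s := Ioi 0) h1.integrableOn
      (((integrable_sub_Ssum_sq N hr).const_mul 2).add
        ((integrable_Ssum_sq N hr).comp_neg.const_mul 2)).integrableOn measurableSet_Ioi (fun τ _ => by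
        rw [lapl_sub_Gfun N hσ]
        simp only [Pi.add_apply]
        set a := Eh ((((r ^ 4)⁻¹ : ℝ) : ℂ) + τ * Complex.I) - Ssum N ((((r ^ 4)⁻¹ : ℝ) : ℂ) + τ * Complex.I)
        set b := Ssum N ((((r ^ 4)⁻¹ : ℝ) : ℂ) + ((-τ : ℝ) : ℂ) * Complex.I)
        have := norm_sub_le a ((starRingEnd ℂ) b)
        rw [RCLike.norm_conj] at this
        calc ‖a - (starRingEnd ℂ) b‖ ^ 2 ≤ (‖a‖ + ‖b‖) ^ 2 := by gcongr
          _ ≤ 2 * ‖a‖ ^ 2 + 2 * ‖b‖ ^ 2 := by nlinarith [sq_nonneg (‖a‖ - ‖b‖)])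
    simp only [Pi.add_apply] at h3
    rw [integral_add ((integrable_sub_Ssum_sq N hr).const_mul 2).integrableOn
        ((integrable_Ssum_sq N hr).comp_neg.const_mul 2).integrableOn, integral_const_mul,
        integral_const_mul] at h3
    refine le_trans ?_ h3
    have h4 : 0 ≤ ∫ t in Ioi (0:ℝ), |Efun t - Gfun N t| ^ 2 * Real.exp (-(2 * (r ^ 4)⁻¹ * t)) :=
      integral_nonneg fun t => by positivity
    nlinarith [Real.pi_gt_three]
  · intro τ
    rw [← conj_add_mul_I, ← RCLike.norm_conj, ← lapl_conj]
    simp only [Complex.conj_ofReal]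

lemma sub_Gfun_mean_sq : ∃ K, 0 < K ∧ ∀ (N : ℕ) (ε : ℝ), 0 < ε → ∀ᶠ r : ℝ in atTop,
    (r ^ 6)⁻¹ * ∫ t in Ioi (0:ℝ), |Efun t - Gfun N t| ^ 2 * Real.exp (-(2 * (r ^ 4)⁻¹ * t)) ≤
      K * tailSum N + ε := by
  obtain ⟨K, hK, h⟩ := integral_sub_Ssum_le
  refine ⟨2 * K, by positivity, fun N ε hε => ?_⟩
  have ht : Tendsto (fun r : ℝ => 2 * K * r ^ (-(1 / 2) : ℝ) + 6 * ((r ^ 6)⁻¹ * ∫ τ in Ioi (0:ℝ), Yerr N r τ) +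
      2 * ((r ^ 6)⁻¹ * ∫ τ in Ioi (0:ℝ), ‖Ssum N ((((r ^ 4)⁻¹ : ℝ) : ℂ) + ((-τ : ℝ) : ℂ) * Complex.I)‖ ^ 2))
      atTop (𝓝 0) := by
    have := (((tendsto_rpow_neg_atTop (y := 1 / 2) (by norm_num)).const_mul (2 * K)).add
      ((tendsto_Yerr N).const_mul 6)).add ((tendsto_Ssum_neg N).const_mul 2)
    simpa using this
  filter_upwards [ht.eventually_lt_const hε, eventually_ge_atTop 3] with r h1 hr
  have hr0 : 0 < r := by linarith
  have h2 := mul_le_mul_of_nonneg_left (integral_sub_Gfun_sq_le N hr0) (by positivity : 0 ≤ (r ^ 6)⁻¹)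
  have h3 := h N r hr
  linarith

lemma continuous_Gfun (N : ℕ) : Continuous (Gfun N) := by
  have h : ∀ b, Continuous (osc b) := fun b => by
    have := Real.continuous_rpow_const (q := 1 / 4) (by norm_num)
    unfold osc
    fun_prop
  have : Continuous (hsum N) :=
    continuous_finsetSum _ fun n _ => ((h _).const_mul _).const_mul _
  unfold Gfun
  fun_prop

/-- `E` is approximated by the partial sums in mean on `[T, 2T]`. -/
lemma exists_delta : ∃ δ : ℕ → ℝ, Tendsto δ atTop (𝓝 0) ∧ ∀ N, ∀ᶠ T : ℝ in atTop,
    T ^ (-(5 / 4) : ℝ) * ∫ t in T..(2 * T), |Efun t - Gfun N t| ≤ δ N := by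
  obtain ⟨K, hK, h⟩ := sub_Gfun_mean_sq
  refine ⟨fun N => Real.sqrt (Real.exp 4 * (K * tailSum N + 1 / ((N : ℝ) + 1))), ?_, fun N => ?_⟩
  · have h1 := ((tendsto_tailSum.const_mul K).add tendsto_one_div_add_atTop_nhds_zero_nat).const_mul (Real.exp 4)
    have := h1.sqrt
    simpa using this
  · have hr : Tendsto (fun T : ℝ => T ^ (1 / 4 : ℝ)) atTop atTop := tendsto_rpow_atTop (by norm_num)
    filter_upwards [hr.eventually (h N (1 / ((N : ℝ) + 1)) (by positivity)), eventually_gt_atTop 0] with T h1 hT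
    have e4 : (T ^ (1 / 4 : ℝ)) ^ 4 = T := by
      rw [← Real.rpow_natCast, ← Real.rpow_mul hT.le]; norm_num
    have e6 : (T ^ (1 / 4 : ℝ)) ^ 6 = T ^ (3 / 2 : ℝ) := by
      rw [← Real.rpow_natCast, ← Real.rpow_mul hT.le]; norm_num
    rw [e4, e6] at h1
    set f : ℝ → ℝ := fun t => |Efun t - Gfun N t| with hf
    have hfc : Continuous f := (continuous_Efun.sub (continuous_Gfun N)).abs
    have hi : IntegrableOn (fun t => f t ^ 2 * Real.exp (-(2 * T⁻¹ * t))) (Ioi 0) :=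
      integrable_sub_Gfun_sq N (by positivity)
    have hsub : Ioc T (2 * T) ⊆ Ioi 0 := fun t ht => hT.trans ht.1
    have hle : ∀ t ∈ Ioc T (2 * T), f t ^ 2 ≤ Real.exp 4 * (f t ^ 2 * Real.exp (-(2 * T⁻¹ * t))) := by
      intro t ht
      have : 1 ≤ Real.exp 4 * Real.exp (-(2 * T⁻¹ * t)) := by
        rw [← Real.exp_add, Real.one_le_exp_iff]
        have : T⁻¹ * t ≤ 2 := by
          rw [inv_mul_le_iff₀ hT]; linarith [ht.2]
        linarith
      nlinarith [sq_nonneg (f t)]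
    have hfi : IntegrableOn (fun t => f t ^ 2) (Ioc T (2 * T)) := by
      refine ((hi.mono_set hsub).const_mul (Real.exp 4)).mono' (hfc.pow 2).aestronglyMeasurable ?_
      refine (ae_restrict_iff' measurableSet_Ioc).2 (ae_of_all _ fun t ht => ?_)
      rw [Real.norm_of_nonneg (by positivity)]
      exact hle t ht
    have hsq : ∫ t in T..(2 * T), f t ^ 2 ≤ Real.exp 4 * (T ^ (3 / 2 : ℝ) * (K * tailSum N + 1 / ((N : ℝ) + 1))) := by
      rw [intervalIntegral.integral_of_le (by linarith)]
      refine (setIntegral_mono_on hfi ((hi.mono_set hsub).const_mul _) measurableSet_Ioc hle).trans ?_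
      rw [integral_const_mul]
      refine mul_le_mul_of_nonneg_left ?_ (Real.exp_pos _).le
      refine (setIntegral_mono_set hi (ae_of_all _ fun t => by positivity) hsub.eventuallyLE).trans ?_
      rwa [inv_mul_le_iff₀ (by positivity)] at h1
    have hcs : (∫ t in T..(2 * T), f t) ^ 2 ≤ T * ∫ t in T..(2 * T), f t ^ 2 := by
      have := sq_integral_le (a := T) (b := 2 * T) hfc (by linarith)
      rwa [show 2 * T - T = T by ring] at this
    rw [← Real.sqrt_sq (show 0 ≤ T ^ (-(5 / 4) : ℝ) * ∫ t in T..(2 * T), f t from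
      mul_nonneg (by positivity) (intervalIntegral.integral_nonneg (by linarith) fun t _ => by positivity))]
    refine Real.sqrt_le_sqrt ?_
    have e5 : (T ^ (-(5 / 4) : ℝ)) ^ 2 * (T * T ^ (3 / 2 : ℝ)) = 1 := by
      rw [← Real.rpow_natCast, ← Real.rpow_mul hT.le, ← Real.rpow_one_add' hT.le (by norm_num), ← Real.rpow_add hT]
      norm_num
    calc (T ^ (-(5 / 4) : ℝ) * ∫ t in T..(2 * T), f t) ^ 2
        ≤ (T ^ (-(5 / 4) : ℝ)) ^ 2 * (T * (Real.exp 4 * (T ^ (3 / 2 : ℝ) * (K * tailSum N + 1 / ((N : ℝ) + 1))))) := by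
          rw [mul_pow]; gcongr; exact hcs.trans (by gcongr)
      _ = (T ^ (-(5 / 4) : ℝ)) ^ 2 * (T * T ^ (3 / 2 : ℝ)) * (Real.exp 4 * (K * tailSum N + 1 / ((N : ℝ) + 1))) := by ring
      _ = _ := by rw [e5, one_mul]

end

section
open Set Filter Topology

/-- The character `u ↦ exp (i l u)`. -/
noncomputable def chr (l u : ℝ) : ℂ := Complex.exp ((l * u : ℝ) * Complex.I)

@[simp] lemma chr_zero (u : ℝ) : chr 0 u = 1 := by simp [chr]

lemma chr_mul (l m u : ℝ) : chr l u * chr m u = chr (l + m) u := by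
  rw [chr, chr, chr, ← Complex.exp_add]; push_cast; ring_nf

lemma norm_chr (l u : ℝ) : ‖chr l u‖ = 1 := Complex.norm_exp_ofReal_mul_I _

lemma continuous_chr (l : ℝ) : Continuous (chr l) := by unfold chr; fun_prop

/-- The mean of `t ^ (1/4) * F (√t)` over `[T, 2T]`, normalised by `T ^ (5/4)`. -/
noncomputable def avg (F : ℝ → ℂ) (T : ℝ) : ℂ :=
  ((T ^ (-(5 / 4) : ℝ) : ℝ) : ℂ) * ∫ t in T..(2 * T), ((t ^ (1 / 4 : ℝ) : ℝ) : ℂ) * F (Real.sqrt t)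

lemma continuous_avg_integrand {F : ℝ → ℂ} (hF : Continuous F) :
    Continuous fun t : ℝ => ((t ^ (1 / 4 : ℝ) : ℝ) : ℂ) * F (Real.sqrt t) := by
  have := Real.continuous_rpow_const (q := 1 / 4) (by norm_num)
  fun_prop

lemma avg_add {F G : ℝ → ℂ} (hF : Continuous F) (hG : Continuous G) (T : ℝ) :
    avg (F + G) T = avg F T + avg G T := by
  simp only [avg, Pi.add_apply, mul_add]
  rw [intervalIntegral.integral_add ((continuous_avg_integrand hF).intervalIntegrable _ _)
    ((continuous_avg_integrand hG).intervalIntegrable _ _), mul_add]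

lemma avg_smul (c : ℂ) (F : ℝ → ℂ) (T : ℝ) : avg (c • F) T = c * avg F T := by
  simp only [avg, Pi.smul_apply, smul_eq_mul, mul_left_comm _ c]
  rw [intervalIntegral.integral_const_mul]
  ring

lemma avg_sub {F G : ℝ → ℂ} (hF : Continuous F) (hG : Continuous G) (T : ℝ) :
    avg (F - G) T = avg F T - avg G T := by
  have := avg_add (F := F) (G := (-1 : ℂ) • G) hF (hG.const_smul (-1 : ℂ)) T
  rw [avg_smul] at this
  rw [sub_eq_add_neg, ← neg_one_smul ℂ G, this]
  ring

lemma norm_avg_le {F : ℝ → ℂ} {C : ℝ} (hF : ∀ u, ‖F u‖ ≤ C) {T : ℝ} (hT : 0 < T) :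
    ‖avg F T‖ ≤ 2 * C := by
  have hC : 0 ≤ C := (norm_nonneg _).trans (hF 0)
  have h2 : (2:ℝ) ^ (1 / 4 : ℝ) ≤ 2 := by
    calc (2:ℝ) ^ (1 / 4 : ℝ) ≤ 2 ^ (1:ℝ) := Real.rpow_le_rpow_of_exponent_le (by norm_num) (by norm_num)
      _ = 2 := Real.rpow_one 2
  have h : ‖∫ t in T..(2 * T), ((t ^ (1 / 4 : ℝ) : ℝ) : ℂ) * F (Real.sqrt t)‖ ≤
      (2 * T ^ (1 / 4 : ℝ) * C) * |2 * T - T| := by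
    refine intervalIntegral.norm_integral_le_of_norm_le_const fun t ht => ?_
    rw [uIoc_of_le (by linarith)] at ht
    have ht0 : 0 < t := hT.trans ht.1
    rw [norm_mul, Complex.norm_real, Real.norm_of_nonneg (by positivity)]
    gcongr
    · calc t ^ (1 / 4 : ℝ) ≤ (2 * T) ^ (1 / 4 : ℝ) := Real.rpow_le_rpow ht0.le ht.2 (by norm_num)
        _ = 2 ^ (1 / 4 : ℝ) * T ^ (1 / 4 : ℝ) := Real.mul_rpow (by norm_num) hT.le
        _ ≤ _ := by gcongr
    · exact hF _
  rw [show 2 * T - T = T by ring, abs_of_pos hT] at h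
  rw [avg, norm_mul, Complex.norm_real, Real.norm_of_nonneg (by positivity)]
  have e : T ^ (-(5 / 4) : ℝ) * (T ^ (1 / 4 : ℝ) * T) = 1 := by
    rw [← Real.rpow_add_one hT.ne', ← Real.rpow_add hT]; norm_num
  calc _ ≤ T ^ (-(5 / 4) : ℝ) * ((2 * T ^ (1 / 4 : ℝ) * C) * T) := by gcongr
    _ = (T ^ (-(5 / 4) : ℝ) * (T ^ (1 / 4 : ℝ) * T)) * (2 * C) := by ring
    _ = _ := by rw [e, one_mul]

/-- The mean of the trivial character. -/
noncomputable def avgC : ℝ := 4 / 5 * (2 ^ (5 / 4 : ℝ) - 1)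

lemma avgC_pos : 0 < avgC := by
  have : (1:ℝ) < 2 ^ (5 / 4 : ℝ) := Real.one_lt_rpow (by norm_num) (by norm_num)
  unfold avgC
  linarith

lemma tendsto_avg_chr_zero : Tendsto (avg (chr 0)) atTop (𝓝 (avgC : ℂ)) := by
  refine tendsto_const_nhds.congr' ?_
  filter_upwards [eventually_gt_atTop 0] with T hT
  simp only [avg, chr_zero, mul_one]
  rw [intervalIntegral.integral_ofReal, ← Complex.ofReal_mul, integral_rpow (Or.inl (by norm_num)),
    Real.mul_rpow (by norm_num) hT.le, avgC]
  congr 1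
  have e : T ^ (-(5 / 4) : ℝ) * T ^ (5 / 4 : ℝ) = 1 := by
    rw [← Real.rpow_add hT]; norm_num
  rw [show (1 / 4 + 1 : ℝ) = 5 / 4 by norm_num]
  linear_combination (-(4 / 5) * ((2:ℝ) ^ (5 / 4 : ℝ) - 1)) * e

lemma integral_chr_eq {l T : ℝ} (hl : l ≠ 0) (hT : 0 < T) :
    ∫ t in T..(2 * T), ((t ^ (1 / 4 : ℝ) : ℝ) : ℂ) * chr l (Real.sqrt t) =
      2 / (Complex.I * l) * ((((2 * T) ^ (3 / 4 : ℝ) : ℝ) : ℂ) * chr l (Real.sqrt (2 * T)) -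
        ((T ^ (3 / 4 : ℝ) : ℝ) : ℂ) * chr l (Real.sqrt T)) -
      3 / (2 * Complex.I * l) * ∫ t in T..(2 * T), ((t ^ (-(1 / 4) : ℝ) : ℝ) : ℂ) * chr l (Real.sqrt t) := by
  have hlC : (l : ℂ) ≠ 0 := by exact_mod_cast hl
  have hpos : ∀ t ∈ uIcc T (2 * T), 0 < t := fun t ht => by
    rw [uIcc_of_le (by linarith)] at ht; exact hT.trans_le ht.1
  have hc : ContinuousOn (fun t : ℝ => ((t ^ (-(1 / 4) : ℝ) : ℝ) : ℂ) * chr l (Real.sqrt t)) (uIcc T (2 * T)) := by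
    refine ContinuousOn.mul ?_ ((continuous_chr l).comp Real.continuous_sqrt).continuousOn
    exact Complex.continuous_ofReal.comp_continuousOn
      (ContinuousOn.rpow_const continuousOn_id fun t ht => Or.inl (hpos t ht).ne')
  have hi := hc.intervalIntegrable (μ := volume)
  have hi2 := ((continuous_avg_integrand (continuous_chr l)).intervalIntegrable (μ := volume) T (2 * T))
  have hd : ∀ t ∈ uIcc T (2 * T), HasDerivAt
      (fun t : ℝ => 2 / (Complex.I * l) * (((t ^ (3 / 4 : ℝ) : ℝ) : ℂ) * chr l (Real.sqrt t)))
      (((t ^ (1 / 4 : ℝ) : ℝ) : ℂ) * chr l (Real.sqrt t) +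
        3 / (2 * Complex.I * l) * (((t ^ (-(1 / 4) : ℝ) : ℝ) : ℂ) * chr l (Real.sqrt t))) t := by
    intro t ht
    have ht0 := hpos t ht
    have h1 := (Real.hasDerivAt_rpow_const (p := 3 / 4) (Or.inl ht0.ne')).ofReal_comp
    have h2 : HasDerivAt (fun t : ℝ => chr l (Real.sqrt t))
        (chr l (Real.sqrt t) * (((l * (1 / (2 * Real.sqrt t)) : ℝ) : ℂ) * Complex.I)) t :=
      ((((Real.hasDerivAt_sqrt ht0.ne').const_mul l).ofReal_comp).mul_const Complex.I).cexp
    refine ((h1.fun_mul h2).const_mul (2 / (Complex.I * l))).congr_deriv ?_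
    have e1 : t ^ (3 / 4 - 1 : ℝ) = t ^ (-(1 / 4) : ℝ) := by norm_num
    have e2 : t ^ (3 / 4 : ℝ) = t ^ (1 / 4 : ℝ) * Real.sqrt t := by
      rw [Real.sqrt_eq_rpow, ← Real.rpow_add ht0]; norm_num
    have hs : ((Real.sqrt t : ℝ) : ℂ) ≠ 0 := by exact_mod_cast (Real.sqrt_pos.2 ht0).ne'
    rw [e1, e2]
    push_cast
    field_simp
    ring_nf
  have h := intervalIntegral.integral_eq_sub_of_hasDerivAt hd (hi2.add (hi.const_mul _))
  rw [intervalIntegral.integral_add hi2 (hi.const_mul _), intervalIntegral.integral_const_mul] at h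
  rw [mul_sub]
  exact eq_sub_of_add_eq h

lemma tendsto_avg_chr {l : ℝ} (hl : l ≠ 0) : Tendsto (avg (chr l)) atTop (𝓝 0) := by
  have h2 : (2:ℝ) ^ (3 / 4 : ℝ) ≤ 2 := by
    calc (2:ℝ) ^ (3 / 4 : ℝ) ≤ 2 ^ (1:ℝ) := Real.rpow_le_rpow_of_exponent_le (by norm_num) (by norm_num)
      _ = 2 := Real.rpow_one 2
  have hz : Tendsto (fun T : ℝ => (15 / 2 / |l|) * T ^ (-(1 / 2) : ℝ)) atTop (𝓝 0) := by
    simpa using (tendsto_rpow_neg_atTop (y := 1 / 2) (by norm_num)).const_mul (15 / 2 / |l|)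
  refine squeeze_zero_norm' ?_ hz
  filter_upwards [eventually_gt_atTop 0] with T hT
  have hl' : 0 < |l| := abs_pos.2 hl
  have hI : ‖∫ t in T..(2 * T), ((t ^ (-(1 / 4) : ℝ) : ℝ) : ℂ) * chr l (Real.sqrt t)‖ ≤ T ^ (3 / 4 : ℝ) := by
    have : ‖∫ t in T..(2 * T), ((t ^ (-(1 / 4) : ℝ) : ℝ) : ℂ) * chr l (Real.sqrt t)‖ ≤
        T ^ (-(1 / 4) : ℝ) * |2 * T - T| := by
      refine intervalIntegral.norm_integral_le_of_norm_le_const fun t ht => ?_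
      rw [uIoc_of_le (by linarith)] at ht
      have ht0 : 0 < t := hT.trans ht.1
      rw [norm_mul, Complex.norm_real, Real.norm_of_nonneg (by positivity), norm_chr, mul_one]
      exact Real.rpow_le_rpow_of_nonpos hT ht.1.le (by norm_num)
    rw [show 2 * T - T = T by ring, abs_of_pos hT, ← Real.rpow_add_one hT.ne'] at this
    norm_num at this ⊢
    exact this
  have hB : ‖(((2 * T) ^ (3 / 4 : ℝ) : ℝ) : ℂ) * chr l (Real.sqrt (2 * T)) -
      ((T ^ (3 / 4 : ℝ) : ℝ) : ℂ) * chr l (Real.sqrt T)‖ ≤ 3 * T ^ (3 / 4 : ℝ) := by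
    refine (norm_sub_le _ _).trans ?_
    rw [norm_mul, norm_mul, norm_chr, norm_chr, Complex.norm_real, Complex.norm_real,
      Real.norm_of_nonneg (by positivity), Real.norm_of_nonneg (by positivity),
      Real.mul_rpow (by norm_num) hT.le]
    nlinarith [Real.rpow_pos_of_pos hT (3 / 4)]
  rw [avg, integral_chr_eq hl hT, norm_mul, Complex.norm_real, Real.norm_of_nonneg (by positivity)]
  have e : T ^ (-(5 / 4) : ℝ) * T ^ (3 / 4 : ℝ) = T ^ (-(1 / 2) : ℝ) := by
    rw [← Real.rpow_add hT]; norm_num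
  have n1 : ‖2 / (Complex.I * (l : ℂ))‖ = 2 / |l| := by simp
  have n2 : ‖3 / (2 * Complex.I * (l : ℂ))‖ = 3 / (2 * |l|) := by simp
  calc _ ≤ T ^ (-(5 / 4) : ℝ) * (2 / |l| * (3 * T ^ (3 / 4 : ℝ)) + 3 / (2 * |l|) * T ^ (3 / 4 : ℝ)) := by
        gcongr
        refine (norm_sub_le _ _).trans ?_
        rw [norm_mul, norm_mul, n1, n2]
        gcongr
    _ = (15 / 2 / |l|) * (T ^ (-(5 / 4) : ℝ) * T ^ (3 / 4 : ℝ)) := by field_simp; ring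
    _ = _ := by rw [e]

/-- The mean of the character of frequency `l`. -/
noncomputable def avgChr (l : ℝ) : ℂ := if l = 0 then (avgC : ℂ) else 0

lemma tendsto_avg_chr_avgChr (l : ℝ) : Tendsto (avg (chr l)) atTop (𝓝 (avgChr l)) := by
  unfold avgChr
  split_ifs with h
  · rw [h]; exact tendsto_avg_chr_zero
  · exact tendsto_avg_chr h

/-- The algebra of trigonometric polynomials. -/
noncomputable def trigPoly : Subalgebra ℂ (ℝ → ℂ) := Algebra.adjoin ℂ (range chr)

lemma span_chr_eq : Subalgebra.toSubmodule trigPoly = Submodule.span ℂ (range chr) := by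
  let S : Submonoid (ℝ → ℂ) :=
    { carrier := range chr
      one_mem' := ⟨0, by ext u; simp⟩
      mul_mem' := by
        rintro _ _ ⟨l, rfl⟩ ⟨m, rfl⟩
        exact ⟨l + m, by ext u; simp [chr_mul]⟩ }
  rw [trigPoly, Algebra.adjoin_eq_span, show range chr = (S : Set (ℝ → ℂ)) from rfl, Submonoid.closure_eq]

lemma trigPoly_avg {F : ℝ → ℂ} (hF : F ∈ trigPoly) :
    Continuous F ∧ ∃ m, Tendsto (avg F) atTop (𝓝 m) := by
  have : F ∈ Submodule.span ℂ (range chr) := by rw [← span_chr_eq]; exact hF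
  induction this using Submodule.span_induction with
  | mem x h =>
    obtain ⟨l, rfl⟩ := h
    exact ⟨continuous_chr l, _, tendsto_avg_chr_avgChr l⟩
  | zero => exact ⟨continuous_zero, 0, tendsto_const_nhds.congr fun T => by simp [avg]⟩
  | add x y hx hy h1 h2 =>
    rw [← span_chr_eq] at hx hy
    obtain ⟨c1, m1, h1⟩ := h1 hx
    obtain ⟨c2, m2, h2⟩ := h2 hy
    exact ⟨c1.add c2, m1 + m2, (h1.add h2).congr fun T => (avg_add c1 c2 T).symm⟩
  | smul a x hx h1 =>
    rw [← span_chr_eq] at hx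
    obtain ⟨c1, m1, h1⟩ := h1 hx
    refine ⟨c1.const_smul a, a * m1, ?_⟩
    exact (h1.const_mul a).congr fun T => (avg_smul a x T).symm

/-- The absolute value of a bounded real trigonometric polynomial is a uniform limit of
trigonometric polynomials. -/
lemma exists_trigPoly_near_abs {F : ℝ → ℝ} (hF : (fun u => (F u : ℂ)) ∈ trigPoly) {H : ℝ}
    (hH : ∀ u, |F u| ≤ H) {ε : ℝ} (hε : 0 < ε) :
    ∃ Q ∈ trigPoly, ∀ u, ‖((|F u| : ℝ) : ℂ) - Q u‖ ≤ ε := by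
  obtain ⟨p, hp⟩ := exists_polynomial_near_of_continuousOn (-H) H (fun x => |x|)
    continuous_abs.continuousOn ε hε
  refine ⟨Polynomial.aeval (fun u => (F u : ℂ)) (p.map (algebraMap ℝ ℂ)), ?_, fun u => ?_⟩
  · have := (Polynomial.aeval (⟨_, hF⟩ : trigPoly) (p.map (algebraMap ℝ ℂ))).2
    rwa [Polynomial.aeval_subalgebra_coe] at this
  · have e : Polynomial.aeval (fun u => (F u : ℂ)) (p.map (algebraMap ℝ ℂ)) u = ((p.eval (F u) : ℝ) : ℂ) := by
      have := Polynomial.aeval_algHom_apply (Pi.evalAlgHom ℂ (fun _ : ℝ => ℂ) u) (fun u => (F u : ℂ))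
        (p.map (algebraMap ℝ ℂ))
      rw [Pi.evalAlgHom_apply] at this
      refine this.symm.trans ?_
      simp [Polynomial.aeval_def, Polynomial.eval_map]
      exact Polynomial.eval₂_at_apply (algebraMap ℝ ℂ) (F u)
    rw [e, ← Complex.ofReal_sub, Complex.norm_real, Real.norm_eq_abs, abs_sub_comm]
    exact (hp _ (abs_le.1 (hH u))).le

lemma exists_tendsto_of_approx {g : ℝ → ℂ}
    (h : ∀ ε > 0, ∃ (k : ℝ → ℂ) (m : ℂ), Tendsto k atTop (𝓝 m) ∧ ∀ᶠ T in atTop, ‖g T - k T‖ ≤ ε) :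
    ∃ L, Tendsto g atTop (𝓝 L) := by
  refine cauchy_map_iff_exists_tendsto.1 (Metric.cauchy_iff.2 ⟨inferInstance, fun ε hε => ?_⟩)
  obtain ⟨k, m, hk, hg⟩ := h (ε / 4) (by positivity)
  refine ⟨Metric.ball m (ε / 2), ?_, fun x hx y hy => ?_⟩
  · rw [mem_map]
    filter_upwards [hg, Metric.tendsto_nhds.1 hk (ε / 4) (by positivity)] with T h1 h2
    rw [mem_preimage, Metric.mem_ball]
    have := dist_triangle (g T) (k T) m
    rw [← dist_eq_norm] at h1
    linarith
  · have := dist_triangle_right x y m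
    rw [Metric.mem_ball] at hx hy
    linarith

end

section
open Set Filter Topology

/-- The frequencies of the limiting almost periodic function. -/
noncomputable def frq (n : ℕ) : ℝ := 2 * Real.sqrt (2 * Real.pi * n)

lemma frq_pos {n : ℕ} (hn : 1 ≤ n) : 0 < frq n := by
  have : (0:ℝ) < n := by exact_mod_cast hn
  unfold frq
  positivity

lemma frq_injective {m n : ℕ} (h : frq m = frq n) : m = n := by
  have h1 : Real.sqrt (2 * Real.pi * m) = Real.sqrt (2 * Real.pi * n) := by
    unfold frq at h; linarith
  rw [Real.sqrt_inj (by positivity) (by positivity)] at h1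
  exact_mod_cast mul_left_cancel₀ (by positivity) h1

/-- The trigonometric polynomial with `Gfun N t = t ^ (1/4) * Pfun N (√t)`. -/
noncomputable def Pfun (N : ℕ) (u : ℝ) : ℝ :=
  2 * (∑ n ∈ Finset.Icc 1 N, ((dd n : ℂ) * kap n) * chr (frq n) u).re

lemma Gfun_eq (N : ℕ) (t : ℝ) : Gfun N t = t ^ (1 / 4 : ℝ) * Pfun N (Real.sqrt t) := by
  have : hsum N t = ((t ^ (1 / 4 : ℝ) : ℝ) : ℂ) *
      ∑ n ∈ Finset.Icc 1 N, ((dd n : ℂ) * kap n) * chr (frq n) (Real.sqrt t) := by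
    rw [hsum, Finset.mul_sum]
    refine Finset.sum_congr rfl fun n _ => ?_
    rw [osc, chr, frq]
    ring
  rw [Gfun, this, Complex.re_ofReal_mul, Pfun]
  ring

lemma conj_chr (l u : ℝ) : (starRingEnd ℂ) (chr l u) = chr (-l) u := by
  rw [chr, chr, ← Complex.exp_conj, map_mul, Complex.conj_ofReal, Complex.conj_I]
  push_cast
  ring_nf

lemma Pfun_eq (N : ℕ) : (fun u => (Pfun N u : ℂ)) = ∑ n ∈ Finset.Icc 1 N,
    (((dd n : ℂ) * kap n) • chr (frq n) + (starRingEnd ℂ) ((dd n : ℂ) * kap n) • chr (-frq n)) := by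
  ext u
  rw [Pfun, Complex.ofReal_mul, Complex.re_eq_add_conj, map_sum, Finset.sum_apply, ← Finset.sum_add_distrib]
  push_cast
  rw [mul_div_cancel₀ _ (by norm_num : (2:ℂ) ≠ 0)]
  refine Finset.sum_congr rfl fun n _ => ?_
  rw [map_mul, conj_chr]
  rfl

lemma abs_Pfun_le (N : ℕ) (u : ℝ) : |Pfun N u| ≤ 2 * ∑ n ∈ Finset.Icc 1 N, ‖(dd n : ℂ) * kap n‖ := by
  rw [Pfun, abs_mul, abs_two]
  gcongr
  refine (Complex.abs_re_le_norm _).trans ((norm_sum_le _ _).trans (le_of_eq ?_))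
  refine Finset.sum_congr rfl fun n _ => ?_
  rw [norm_mul _ (chr _ _), norm_chr, mul_one]

lemma chr_mem (l : ℝ) : chr l ∈ trigPoly := Algebra.subset_adjoin ⟨l, rfl⟩

lemma Pfun_mem (N : ℕ) : (fun u => (Pfun N u : ℂ)) ∈ trigPoly := by
  rw [Pfun_eq]
  exact Subalgebra.sum_mem _ fun n _ =>
    add_mem (Subalgebra.smul_mem _ (chr_mem _) _) (Subalgebra.smul_mem _ (chr_mem _) _)

lemma continuous_Pfun (N : ℕ) : Continuous (Pfun N) := by
  have := Complex.continuous_re.comp (trigPoly_avg (Pfun_mem N)).1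
  exact this

lemma tendsto_avg_sum {ι : Type*} (s : Finset ι) {F : ι → ℝ → ℂ} {m : ι → ℂ}
    (hF : ∀ i ∈ s, F i ∈ trigPoly) (hm : ∀ i ∈ s, Tendsto (avg (F i)) atTop (𝓝 (m i))) :
    Tendsto (avg (∑ i ∈ s, F i)) atTop (𝓝 (∑ i ∈ s, m i)) := by
  classical
  induction s using Finset.induction_on with
  | empty => exact tendsto_const_nhds.congr fun T => by simp [avg]
  | insert a s ha ih =>
    rw [Finset.sum_insert ha, Finset.sum_insert ha]
    have hs : ∀ i ∈ s, F i ∈ trigPoly := fun i hi => hF i (Finset.mem_insert_of_mem hi)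
    have c1 := (trigPoly_avg (hF a (Finset.mem_insert_self a s))).1
    have c2 := (trigPoly_avg (Subalgebra.sum_mem _ hs)).1
    exact ((hm a (Finset.mem_insert_self a s)).add
      (ih hs fun i hi => hm i (Finset.mem_insert_of_mem hi))).congr fun T => (avg_add c1 c2 T).symm

lemma tendsto_avg_Pfun_mul_chr (N : ℕ) (l : ℝ) :
    Tendsto (avg ((fun u => (Pfun N u : ℂ)) * chr l)) atTop (𝓝 (∑ n ∈ Finset.Icc 1 N,
      (((dd n : ℂ) * kap n) * avgChr (frq n + l) +
        (starRingEnd ℂ) ((dd n : ℂ) * kap n) * avgChr (-frq n + l)))) := by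
  have e : (fun u => (Pfun N u : ℂ)) * chr l = ∑ n ∈ Finset.Icc 1 N,
      (((dd n : ℂ) * kap n) • chr (frq n + l) +
        (starRingEnd ℂ) ((dd n : ℂ) * kap n) • chr (-frq n + l)) := by
    rw [Pfun_eq, Finset.sum_mul]
    refine Finset.sum_congr rfl fun n _ => ?_
    ext u
    simp only [Pi.mul_apply, Pi.add_apply, Pi.smul_apply, smul_eq_mul, ← chr_mul]
    ring
  rw [e]
  refine tendsto_avg_sum _ (fun n _ => add_mem (Subalgebra.smul_mem _ (chr_mem _) _)
    (Subalgebra.smul_mem _ (chr_mem _) _)) fun n _ => ?_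
  refine (((tendsto_avg_chr_avgChr _).const_mul _).add
    ((tendsto_avg_chr_avgChr _).const_mul _)).congr fun T => ?_
  rw [avg_add ((continuous_chr _).const_smul _) ((continuous_chr _).const_smul _), avg_smul, avg_smul]

lemma tendsto_avg_Pfun (N : ℕ) : Tendsto (avg (fun u => (Pfun N u : ℂ))) atTop (𝓝 0) := by
  have h := tendsto_avg_Pfun_mul_chr N 0
  have e : (fun u => (Pfun N u : ℂ)) * chr 0 = fun u => (Pfun N u : ℂ) := by
    ext u; simp
  rw [e, Finset.sum_eq_zero] at h
  · exact h
  · intro n hn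
    have := frq_pos (Finset.mem_Icc.1 hn).1
    simp [avgChr, this.ne']

lemma dd_one : dd 1 = 1 := by simp [dd]

lemma tendsto_avg_Pfun_mul_chr_one {N : ℕ} (hN : 1 ≤ N) :
    Tendsto (avg ((fun u => (Pfun N u : ℂ)) * chr (-frq 1))) atTop (𝓝 (kap 1 * avgC)) := by
  have h := tendsto_avg_Pfun_mul_chr N (-frq 1)
  rw [Finset.sum_eq_single_of_mem 1 (Finset.mem_Icc.2 ⟨le_rfl, hN⟩)] at h
  · have := frq_pos (le_refl 1)
    have h2 : avgChr (-frq 1 + -frq 1) = 0 := if_neg (by linarith)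
    rw [h2, add_neg_cancel, dd_one] at h
    simpa [avgChr] using h
  · intro n hn h1
    have := frq_pos (le_refl 1)
    have := frq_pos (Finset.mem_Icc.1 hn).1
    have h2 : avgChr (-frq n + -frq 1) = 0 := if_neg (by linarith)
    have h3 : avgChr (frq n + -frq 1) = 0 :=
      if_neg fun h => h1 (frq_injective (by linarith))
    rw [h2, h3, mul_zero, mul_zero, add_zero]

/-- The normalised mean of `f` over `[T, 2T]`. -/
noncomputable def nmean (f : ℝ → ℝ) (T : ℝ) : ℝ := T ^ (-(5 / 4) : ℝ) * ∫ t in T..(2 * T), f t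

lemma avg_ofReal (F : ℝ → ℝ) (T : ℝ) : avg (fun u => (F u : ℂ)) T =
    ((T ^ (-(5 / 4) : ℝ) * ∫ t in T..(2 * T), t ^ (1 / 4 : ℝ) * F (Real.sqrt t) : ℝ) : ℂ) := by
  simp only [avg, ← Complex.ofReal_mul]
  rw [intervalIntegral.integral_ofReal, Complex.ofReal_mul]

lemma avg_Pfun (N : ℕ) (T : ℝ) : avg (fun u => (Pfun N u : ℂ)) T =
    (nmean (Gfun N) T : ℂ) := by
  simp only [avg_ofReal, nmean, Gfun_eq]

lemma avg_abs_Pfun (N : ℕ) {T : ℝ} (hT : 0 < T) : avg (fun u => ((|Pfun N u| : ℝ) : ℂ)) T =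
    (nmean (fun t => |Gfun N t|) T : ℂ) := by
  rw [avg_ofReal, nmean]
  congr 2
  refine intervalIntegral.integral_congr fun t ht => ?_
  rw [uIcc_of_le (by linarith)] at ht
  have : 0 < t := hT.trans_le ht.1
  rw [Gfun_eq, abs_mul, abs_of_nonneg (by positivity : 0 ≤ t ^ (1 / 4 : ℝ))]

lemma nmean_mono {f g : ℝ → ℝ} (hf : Continuous f) (hg : Continuous g) (h : ∀ t, f t ≤ g t)
    {T : ℝ} (hT : 0 < T) : nmean f T ≤ nmean g T := by
  unfold nmean
  gcongr
  exact intervalIntegral.integral_mono_on (by linarith) (hf.intervalIntegrable _ _)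
    (hg.intervalIntegrable _ _) fun t _ => h t

lemma nmean_add {f g : ℝ → ℝ} (hf : Continuous f) (hg : Continuous g) (T : ℝ) :
    nmean (fun t => f t + g t) T = nmean f T + nmean g T := by
  unfold nmean
  rw [intervalIntegral.integral_add (hf.intervalIntegrable _ _) (hg.intervalIntegrable _ _), mul_add]

lemma nmean_sub {f g : ℝ → ℝ} (hf : Continuous f) (hg : Continuous g) (T : ℝ) :
    nmean (fun t => f t - g t) T = nmean f T - nmean g T := by
  unfold nmean
  rw [intervalIntegral.integral_sub (hf.intervalIntegrable _ _) (hg.intervalIntegrable _ _), mul_sub]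

lemma abs_nmean_le (f : ℝ → ℝ) {T : ℝ} (hT : 0 < T) : |nmean f T| ≤ nmean (fun t => |f t|) T := by
  unfold nmean
  rw [abs_mul, abs_of_pos (by positivity)]
  gcongr
  exact intervalIntegral.abs_integral_le_integral_abs (by linarith)

lemma abs_nmean_sub_le {f g h : ℝ → ℝ} (hf : Continuous f) (hg : Continuous g) (hh : Continuous h)
    (hfg : ∀ t, |f t - g t| ≤ h t) {T : ℝ} (hT : 0 < T) : |nmean f T - nmean g T| ≤ nmean h T := by
  rw [← nmean_sub hf hg]
  exact (abs_nmean_le _ hT).trans (nmean_mono (hf.sub hg).abs hh hfg hT)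

lemma exists_nmean_sub_le : ∃ δ : ℕ → ℝ, Tendsto δ atTop (𝓝 0) ∧ ∀ N, ∀ᶠ T : ℝ in atTop,
    |nmean Efun T - nmean (Gfun N) T| ≤ δ N ∧
    |nmean (fun t => |Efun t|) T - nmean (fun t => |Gfun N t|) T| ≤ δ N := by
  obtain ⟨δ, hδ, h⟩ := exists_delta
  refine ⟨δ, hδ, fun N => ?_⟩
  filter_upwards [h N, eventually_gt_atTop 0] with T h1 hT
  have hc : Continuous fun t => |Efun t - Gfun N t| := (continuous_Efun.sub (continuous_Gfun N)).abs
  exact ⟨(abs_nmean_sub_le continuous_Efun (continuous_Gfun N) hc (fun t => le_rfl) hT).trans h1,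
    (abs_nmean_sub_le continuous_Efun.abs (continuous_Gfun N).abs hc
      (fun t => abs_abs_sub_abs_le _ _) hT).trans h1⟩

lemma exists_tendsto_nmean_abs : ∃ L, Tendsto (nmean fun t => |Efun t|) atTop (𝓝 L) := by
  obtain ⟨δ, hδ, h⟩ := exists_nmean_sub_le
  suffices H : ∃ L : ℂ, Tendsto (fun T => ((nmean (fun t => |Efun t|) T : ℝ) : ℂ)) atTop (𝓝 L) by
    obtain ⟨L, hL⟩ := H
    exact ⟨L.re, (Complex.continuous_re.tendsto L).comp hL⟩
  refine exists_tendsto_of_approx fun ε hε => ?_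
  obtain ⟨N, hN⟩ := (hδ.eventually_lt_const (half_pos hε)).exists
  obtain ⟨Q, hQ, hQn⟩ := exists_trigPoly_near_abs (Pfun_mem N) (abs_Pfun_le N) (ε := ε / 4) (by positivity)
  obtain ⟨cQ, m, hm⟩ := trigPoly_avg hQ
  refine ⟨avg Q, m, hm, ?_⟩
  filter_upwards [h N, eventually_gt_atTop 0] with T h1 hT
  have hP : Continuous fun u => ((|Pfun N u| : ℝ) : ℂ) := by
    have := continuous_Pfun N
    fun_prop
  have h2 := norm_avg_le hQn hT
  have h3 := avg_sub hP cQ T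
  have e : ((fun u => ((|Pfun N u| : ℝ) : ℂ)) - Q) = fun u => ((|Pfun N u| : ℝ) : ℂ) - Q u := rfl
  rw [e] at h3
  rw [h3, avg_abs_Pfun N hT] at h2
  have h4 := h1.2
  rw [← Real.norm_eq_abs, ← Complex.norm_real, Complex.ofReal_sub] at h4
  have h5 := norm_sub_le_norm_sub_add_norm_sub ((nmean (fun t => |Efun t|) T : ℝ) : ℂ)
    ((nmean (fun t => |Gfun N t|) T : ℝ) : ℂ) (avg Q T)
  linarith

lemma tendsto_nmean_Efun : Tendsto (nmean Efun) atTop (𝓝 0) := by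
  obtain ⟨δ, hδ, h⟩ := exists_nmean_sub_le
  rw [Metric.tendsto_nhds]
  intro ε hε
  obtain ⟨N, hN⟩ := (hδ.eventually_lt_const (half_pos hε)).exists
  filter_upwards [h N, eventually_gt_atTop 0, Metric.tendsto_nhds.1 (tendsto_avg_Pfun N) (ε / 2) (half_pos hε)]
    with T h1 hT h2
  rw [dist_zero_right, avg_Pfun, Complex.norm_real, Real.norm_eq_abs] at h2
  rw [dist_zero_right, Real.norm_eq_abs]
  have h5 := abs_sub_abs_le_abs_sub (nmean Efun T) (nmean (Gfun N) T)
  linarith [h1.1]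

lemma norm_avg_Pfun_mul_chr_le (N : ℕ) (l : ℝ) {T : ℝ} (hT : 0 < T) :
    ‖avg ((fun u => (Pfun N u : ℂ)) * chr l) T‖ ≤ nmean (fun t => |Gfun N t|) T := by
  rw [avg, norm_mul, Complex.norm_real, Real.norm_of_nonneg (by positivity), nmean]
  gcongr
  refine (intervalIntegral.norm_integral_le_integral_norm (by linarith)).trans (le_of_eq ?_)
  refine intervalIntegral.integral_congr fun t _ => ?_
  simp only [Pi.mul_apply]
  rw [← mul_assoc, norm_mul _ (chr _ _), norm_chr, mul_one, ← Complex.ofReal_mul, ← Gfun_eq,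
    Complex.norm_real, Real.norm_eq_abs]

lemma nmean_abs_limit_pos {L : ℝ} (hL : Tendsto (nmean fun t => |Efun t|) atTop (𝓝 L)) : 0 < L := by
  obtain ⟨δ, hδ, h⟩ := exists_nmean_sub_le
  have hk : 0 < ‖kap 1 * avgC‖ := by
    rw [norm_mul, Complex.norm_real, Real.norm_of_nonneg avgC_pos.le]
    exact mul_pos (norm_kap_pos le_rfl) avgC_pos
  refine hk.trans_le ?_
  have hl : Tendsto (fun N => L + δ N) atTop (𝓝 L) := by simpa using hδ.const_add L
  refine ge_of_tendsto hl ?_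
  filter_upwards [eventually_ge_atTop 1] with N hN
  refine le_of_tendsto_of_tendsto (tendsto_avg_Pfun_mul_chr_one hN).norm (hL.add_const (δ N)) ?_
  filter_upwards [h N, eventually_gt_atTop 0] with T h1 hT
  have h5 := norm_avg_Pfun_mul_chr_le N (-frq 1) hT
  have h6 := (abs_le.1 h1.2).1
  linarith

lemma nmean_const (c : ℝ) : Tendsto (nmean fun _ => c) atTop (𝓝 0) := by
  have := (tendsto_rpow_neg_atTop (y := 1 / 4) (by norm_num)).const_mul c
  rw [mul_zero] at this
  refine this.congr' ?_
  filter_upwards [eventually_gt_atTop 0] with T hT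
  have e : T ^ (-(1 / 4) : ℝ) = T ^ (-(5 / 4) : ℝ) * T := by
    rw [← Real.rpow_add_one hT.ne']; norm_num
  rw [nmean, intervalIntegral.integral_const, smul_eq_mul, e]
  ring

lemma tendsto_nmean_shift : Tendsto (nmean fun t => Efun t - Real.pi) atTop (𝓝 0) := by
  have := tendsto_nmean_Efun.sub (nmean_const Real.pi)
  rw [sub_zero] at this
  exact this.congr fun T => (nmean_sub continuous_Efun continuous_const T).symm

lemma tendsto_nmean_abs_shift {L : ℝ} (hL : Tendsto (nmean fun t => |Efun t|) atTop (𝓝 L)) :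
    Tendsto (nmean fun t => |Efun t - Real.pi|) atTop (𝓝 L) := by
  have h : Tendsto (fun T => nmean (fun t => |Efun t - Real.pi|) T - nmean (fun t => |Efun t|) T) atTop (𝓝 0) := by
    refine squeeze_zero_norm' ?_ (nmean_const Real.pi)
    filter_upwards [eventually_gt_atTop 0] with T hT
    refine abs_nmean_sub_le (continuous_Efun.sub continuous_const).abs continuous_Efun.abs
      continuous_const (fun t => ?_) hT
    have := abs_abs_sub_abs_le (Efun t - Real.pi) (Efun t)
    rwa [sub_sub_cancel_left, abs_neg, abs_of_pos Real.pi_pos] at this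
  simpa using h.add hL

lemma Jplus_eq {T : ℝ} (hT : 0 < T) : Jplus T / T ^ (5 / 4 : ℝ) =
    (nmean (fun t => |Efun t - Real.pi|) T + nmean (fun t => Efun t - Real.pi) T) / 2 := by
  have hc : Continuous fun t => Efun t - Real.pi := continuous_Efun.sub continuous_const
  have hm : MeasurableSet {t | Real.pi < Efun t} := (isOpen_lt continuous_const continuous_Efun).measurableSet
  rw [← nmean_add hc.abs hc, nmean, intervalIntegral.integral_of_le (by linarith), Jplus,
    show {t : ℝ | t ∈ Ioc T (2 * T) ∧ Real.pi < Efun t} = Ioc T (2 * T) ∩ {t | Real.pi < Efun t} from rfl,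
    ← setIntegral_indicator hm, Real.rpow_neg hT.le, div_eq_mul_inv, mul_comm, mul_div_assoc,
    ← integral_div]
  congr 2
  ext t
  by_cases h : Real.pi < Efun t
  · rw [indicator_of_mem (by exact h), abs_of_pos (sub_pos.2 h)]; ring
  · rw [indicator_of_notMem (by exact h), abs_of_nonpos (sub_nonpos.2 (not_lt.1 h))]; ring

lemma Jminus_eq {T : ℝ} (hT : 0 < T) : -Jminus T / T ^ (5 / 4 : ℝ) =
    (nmean (fun t => |Efun t - Real.pi|) T - nmean (fun t => Efun t - Real.pi) T) / 2 := by
  have hc : Continuous fun t => Efun t - Real.pi := continuous_Efun.sub continuous_const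
  have hm : MeasurableSet {t | Efun t < Real.pi} := (isOpen_lt continuous_Efun continuous_const).measurableSet
  rw [← nmean_sub hc.abs hc, nmean, intervalIntegral.integral_of_le (by linarith), Jminus,
    show {t : ℝ | t ∈ Ioc T (2 * T) ∧ Efun t < Real.pi} = Ioc T (2 * T) ∩ {t | Efun t < Real.pi} from rfl,
    ← setIntegral_indicator hm, Real.rpow_neg hT.le, div_eq_mul_inv, mul_comm, mul_div_assoc,
    ← integral_div, ← integral_neg]
  congr 2
  ext t
  by_cases h : Efun t < Real.pi
  · rw [indicator_of_mem (by exact h), abs_of_neg (sub_neg.2 h)]; ring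
  · rw [indicator_of_notMem (by exact h), abs_of_nonneg (sub_nonneg.2 (not_lt.1 h))]; ring

end

end JAsymp

theorem Jplus_Jminus_asymptotic :
    ∃ C > (0 : ℝ),
      Filter.Tendsto (fun T : ℝ => Jplus T / T ^ ((5 : ℝ) / 4)) Filter.atTop (nhds C) ∧
      Filter.Tendsto (fun T : ℝ => -Jminus T / T ^ ((5 : ℝ) / 4)) Filter.atTop (nhds C) := by
  obtain ⟨L, hL⟩ := JAsymp.exists_tendsto_nmean_abs
  have h1 := JAsymp.tendsto_nmean_abs_shift hL
  have h2 := JAsymp.tendsto_nmean_shift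
  refine ⟨L / 2, half_pos (JAsymp.nmean_abs_limit_pos hL), ?_, ?_⟩
  · have := (h1.add h2).div_const 2
    rw [add_zero] at this
    refine this.congr' ?_
    filter_upwards [Filter.eventually_gt_atTop 0] with T hT using (JAsymp.Jplus_eq hT).symm
  · have := (h1.sub h2).div_const 2
    rw [sub_zero] at this
    refine this.congr' ?_
    filter_upwards [Filter.eventually_gt_atTop 0] with T hT using (JAsymp.Jminus_eq hT).symm
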